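/- Every n-vertex planar graph (n ≥ 6) that is 2-connected, has minimum degree at least 3, and contains no Theta graph on 6 vertices (a 6-cycle plus a chord) as a subgraph, has at most (18/7)n - 48/7 edges. -/

import Mathlib

open SimpleGraph

/-- `H` is a minor of `G`: there is an assignment of disjoint connected branch sets
of `G` to the vertices of `H` realizing all edges of `H`. -/
def HasMinor {V : Type*} {W : Type*} (G : SimpleGraph V) (H : SimpleGraph W) : Prop :=
  ∃ f : V → Option W,
    (∀ w : W, ∃ v, f v = some w) ∧
    (∀ w : W, (G.induce {v | f v = some w}).Preconnected) ∧
    (∀ w₁ w₂ : W, H.Adj w₁ w₂ →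
      ∃ v₁ v₂, f v₁ = some w₁ ∧ f v₂ = some w₂ ∧ G.Adj v₁ v₂)

/-- Planarity, via Wagner's theorem: no `K₅` minor and no `K₃,₃` minor. -/
def IsPlanar {V : Type*} (G : SimpleGraph V) : Prop :=
  ¬ HasMinor G (completeGraph (Fin 5)) ∧
    ¬ HasMinor G (completeBipartiteGraph (Fin 3) (Fin 3))

/-- `G` contains a Theta graph on 6 vertices: a 6-cycle together with a chord
joining two non-consecutive vertices of the cycle. -/
def HasTheta6 {V : Type*} (G : SimpleGraph V) : Prop :=
  ∃ v : Fin 6 → V, Function.Injective v ∧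
    (∀ i : Fin 6, G.Adj (v i) (v (i + 1))) ∧
    ∃ i j : Fin 6, i ≠ j ∧ j ≠ i + 1 ∧ i ≠ j + 1 ∧ G.Adj (v i) (v j)

/-- A graph is 2-connected: at least 3 vertices, and removing any single
vertex leaves a connected graph. -/
def IsTwoConnected {V : Type*} [Fintype V] (G : SimpleGraph V) : Prop :=
  3 ≤ Fintype.card V ∧ G.Connected ∧
    ∀ v : V, (G.induce {u : V | u ≠ v}).Connected

section
open SimpleGraph Finset
open scoped Classical

set_option linter.unusedSectionVars false
set_option linter.unnecessarySeqFocus false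

namespace T6

lemma z2 (x : ZMod 2) : x = 0 ∨ x = 1 := by
  revert x; decide

lemma z2_ne {x : ZMod 2} (h : x ≠ 0) : x = 1 := (z2 x).resolve_left h

lemma z2_ne1 {x : ZMod 2} (h : x ≠ 1) : x = 0 := (z2 x).resolve_right h

lemma z2_add (x : ZMod 2) : x + x = 0 := by
  revert x; decide

lemma z2_eq {x y : ZMod 2} (h : x + y = 0) : x = y := by
  revert x y; decide

abbrev Ch (V : Type*) := Sym2 V → ZMod 2

lemma ch_add {α : Type*} (z : α → ZMod 2) : z + z = 0 := by
  funext e; exact z2_add _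

lemma ch_eq {α : Type*} {z w : α → ZMod 2} (h : z + w = 0) : z = w := by
  funext e; exact z2_eq (congrFun h e)

variable {V : Type*} [Fintype V]

/-- the boundary map mod 2 -/
noncomputable def bd : Ch V →ₗ[ZMod 2] (V → ZMod 2) where
  toFun z := fun v => ∑ w, z s(v, w)
  map_add' x y := by funext v; simp [Finset.sum_add_distrib]
  map_smul' c x := by funext v; simp [Finset.mul_sum]

lemma bd_apply (z : Ch V) (v : V) : bd z v = ∑ w, z s(v, w) := rfl

noncomputable def dl {α : Type*} (e : α) : α → ZMod 2 := fun e' => if e' = e then 1 else 0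

lemma dl_self {α : Type*} (e : α) : dl e e = 1 := by simp [dl]

lemma dl_ne {α : Type*} {e e' : α} (h : e' ≠ e) : dl e e' = 0 := by simp [dl, h]

lemma dl_ne_zero {α : Type*} {e e' : α} (h : dl e e' ≠ 0) : e' = e := by
  by_contra h'; exact h (dl_ne h')

lemma bd_dl {a b : V} (h : a ≠ b) : bd (dl s(a, b)) = dl a + dl b := by
  funext v
  rw [bd_apply]
  by_cases hva : v = a
  · subst hva
    rw [Finset.sum_eq_single b]
    · simp [dl, h]
    · intro w _ hw; apply dl_ne; simp [hw, h]
    · simp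
  · by_cases hvb : v = b
    · subst hvb
      rw [Finset.sum_eq_single a]
      · rw [Sym2.eq_swap]; simp [dl, hva]
      · intro w _ hw; apply dl_ne; rw [Sym2.eq_swap]; simp [hw, hva]
      · simp
    · rw [Finset.sum_eq_zero]
      · simp [dl, hva, hvb]
      · intro w _; apply dl_ne; simp [hva, hvb]

/-- restriction of a chain to a set of edges -/
noncomputable def res {α : Type*} (E : Set α) (z : α → ZMod 2) : α → ZMod 2 := fun e => if e ∈ E then z e else 0

/-- cycles on an edge set -/
def Cyc (E : Set (Sym2 V)) (z : Ch V) : Prop := (∀ e, z e ≠ 0 → e ∈ E) ∧ bd z = 0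

lemma Cyc.add {E : Set (Sym2 V)} {z w : Ch V} (hz : Cyc E z) (hw : Cyc E w) : Cyc E (z + w) := by
  refine ⟨fun e he => ?_, ?_⟩
  · by_cases h : z e = 0
    · apply hw.1; intro h2; apply he; simp [h, h2]
    · exact hz.1 e h
  · rw [map_add, hz.2, hw.2, add_zero]

lemma Cyc.mono {E E' : Set (Sym2 V)} {z : Ch V} (hz : Cyc E z) (h : E ⊆ E') : Cyc E' z :=
  ⟨fun e he => h (hz.1 e he), hz.2⟩

structure IsTB (E : Set (Sym2 V)) {ι : Type} [Fintype ι] (F : ι → Ch V) : Prop where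
  cyc : ∀ i, Cyc E (F i)
  ne : ∀ i, F i ≠ 0
  two : ∀ e ∈ E, ∃ i j, i ≠ j ∧ F i e = 1 ∧ F j e = 1 ∧ ∀ k, k ≠ i → k ≠ j → F k e = 0
  span : ∀ z, Cyc E z → ∃ c : ι → ZMod 2, z = ∑ i, c i • F i

def HasTB (E : Set (Sym2 V)) : Prop := ∃ (ι : Type) (_ : Fintype ι) (F : ι → Ch V), IsTB E F

section conn

/-- cut-based connectivity of a set of vertices -/
def CC (G : SimpleGraph V) (s : Set V) : Prop :=
  ∀ D ⊆ s, D.Nonempty → (∀ x ∈ D, ∀ y ∈ s, G.Adj x y → y ∈ D) → D = s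

def TwoConn (G : SimpleGraph V) (U : Set V) : Prop :=
  3 ≤ U.ncard ∧ (∀ x y, G.Adj x y → x ∈ U) ∧ ∀ v, CC G (U \ {v})

lemma TwoConn.cc {G : SimpleGraph V} {U : Set V} (h : TwoConn G U) : CC G U := by
  intro D hD hne hcl
  have hU := h.1
  by_contra hcon
  obtain ⟨x, hx⟩ := hne
  obtain ⟨y, hyU, hy⟩ : ∃ y ∈ U, y ∉ D := by
    by_contra hh; push Not at hh
    exact hcon (Set.Subset.antisymm hD hh)
  -- a third vertex
  obtain ⟨w, hwU, hwx, hwy⟩ : ∃ w ∈ U, w ≠ x ∧ w ≠ y := by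
    by_contra hh; push Not at hh
    have : U ⊆ {x, y} := by
      intro w hw
      by_cases hwx : w = x
      · simp [hwx]
      · simp [hh w hw hwx]
    have h2 := Set.ncard_le_ncard this (Set.toFinite _)
    have h3 := Set.ncard_pair (a := x) (b := y) (by rintro rfl; exact hy hx)
    omega
  have := h.2.2 w (D \ {w}) (Set.sdiff_subset_sdiff_left hD) ⟨x, hx, by simpa using hwx.symm⟩
    (fun a ha b hb hab => ⟨hcl a ha.1 b hb.1 hab, hb.2⟩)
  have hy2 : y ∈ U \ {w} := ⟨hyU, by simpa using hwy.symm⟩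
  rw [← this] at hy2
  exact hy hy2.1

lemma CC.chain {G : SimpleGraph V} {s : Set V} (h : CC G s) {a b : V} (ha : a ∈ s) (hb : b ∈ s) :
    ∃ p : Ch V, (∀ e, p e ≠ 0 → e ∈ G.edgeSet ∧ ∀ x ∈ e, x ∈ s) ∧ bd p = dl a + dl b := by
  have := h {b | b ∈ s ∧ ∃ p : Ch V, (∀ e, p e ≠ 0 → e ∈ G.edgeSet ∧ ∀ x ∈ e, x ∈ s) ∧ bd p = dl a + dl b}
    (fun x hx => hx.1) ⟨a, ha, 0, by simp, by rw [map_zero, ch_add]⟩ (by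
      rintro x ⟨hx, p, hp, hpb⟩ y hy hxy
      refine ⟨hy, p + dl s(x, y), ?_, ?_⟩
      · intro e he
        by_cases h0 : p e = 0
        · have : dl s(x,y) e ≠ 0 := by simpa [h0] using he
          rw [dl_ne_zero this]
          refine ⟨hxy, ?_⟩
          intro z hz
          rcases Sym2.mem_iff.1 hz with rfl | rfl <;> assumption
        · exact hp e h0
      · rw [map_add, hpb, bd_dl hxy.ne]
        rw [add_assoc, ← add_assoc (dl x), ch_add, zero_add])
  have hb2 : b ∈ {b | b ∈ s ∧ ∃ p : Ch V, (∀ e, p e ≠ 0 → e ∈ G.edgeSet ∧ ∀ x ∈ e, x ∈ s) ∧ bd p = dl a + dl b} := by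
    rw [this]; exact hb
  exact hb2.2

/-- cycle through two given edges at v, and no others at v -/
lemma TwoConn.cyc2 {G : SimpleGraph V} {U : Set V} (h : TwoConn G U) {v a b : V} (ha : G.Adj v a)
    (hb : G.Adj v b) (hab : a ≠ b) :
    ∃ z, Cyc G.edgeSet z ∧ ∀ w, z s(v, w) = if w = a ∨ w = b then 1 else 0 := by
  have haU : a ∈ U \ {v} := ⟨h.2.1 _ _ ha.symm, by simpa using ha.ne'⟩
  have hbU : b ∈ U \ {v} := ⟨h.2.1 _ _ hb.symm, by simpa using hb.ne'⟩
  obtain ⟨p, hp, hpb⟩ := (h.2.2 v).chain haU hbU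
  have hpv : ∀ w, p s(v, w) = 0 := by
    intro w
    by_contra h0
    have := (hp _ h0).2 v (by simp)
    simp at this
  refine ⟨p + dl s(v,a) + dl s(v,b), ⟨?_, ?_⟩, ?_⟩
  · intro e he
    by_cases h0 : p e = 0
    · by_cases h1 : dl s(v,a) e = 0
      · have : dl s(v,b) e ≠ 0 := by simpa [h0, h1] using he
        rw [dl_ne_zero this]; exact hb
      · rw [dl_ne_zero h1]; exact ha
    · exact (hp e h0).1
  · rw [map_add, map_add, hpb, bd_dl ha.ne, bd_dl hb.ne]
    have h1 := ch_add (dl a : V → ZMod 2)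
    have h2 := ch_add (dl b : V → ZMod 2)
    have h3 := ch_add (dl v : V → ZMod 2)
    calc _ = (dl a + dl a) + (dl b + dl b) + (dl v + dl v) := by abel
      _ = 0 := by rw [h1, h2, h3]; simp
  · intro w
    simp only [Pi.add_apply, hpv, dl, Sym2.congr_right, zero_add]
    by_cases hwa : w = a
    · subst hwa; simp [hab]
    · by_cases hwb : w = b
      · subst hwb; simp [hab.symm]
      · simp [hwa, hwb]

lemma TwoConn.deg2 {G : SimpleGraph V} {U : Set V} (h : TwoConn G U) {v a : V} (ha : G.Adj v a) :
    ∃ b, G.Adj v b ∧ b ≠ a := by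
  by_contra hh; push Not at hh
  have hvU := h.2.1 _ _ ha
  have hv := h.2.2 a {v} (by intro x hx; rw [Set.mem_singleton_iff] at hx; subst hx; exact ⟨hvU, by simpa using ha.ne⟩)
    ⟨v, rfl⟩ (by
      intro x hx y hy hxy
      rw [Set.mem_singleton_iff] at hx; subst hx
      exact absurd (hh y hxy) (by simpa using hy.2))
  have h3 := h.1
  have : U ⊆ {a, v} := by
    intro x hx
    by_cases hxa : x = a
    · simp [hxa]
    · have : x ∈ U \ {a} := ⟨hx, by simpa using hxa⟩
      rw [← hv] at this
      simp at this; simp [this]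
  have h2 := Set.ncard_le_ncard this (Set.toFinite _)
  have h4 := Set.ncard_pair (a := a) (b := v) ha.ne'
  omega

lemma TwoConn.edge_cyc {G : SimpleGraph V} {U : Set V} (h : TwoConn G U) {e : Sym2 V} (he : e ∈ G.edgeSet) :
    ∃ z, Cyc G.edgeSet z ∧ z e = 1 := by
  induction e using Sym2.ind with
  | _ v a =>
    obtain ⟨b, hb, hba⟩ := h.deg2 he
    obtain ⟨z, hz, hz2⟩ := h.cyc2 he hb hba.symm
    exact ⟨z, hz, by simp [hz2]⟩

/-- Lemma A -/
lemma TwoConn.split {G : SimpleGraph V} {U : Set V} (h : TwoConn G U) (E1 : Set (Sym2 V))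
    (hz : ∀ z, Cyc G.edgeSet z → bd (res E1 z) = 0) :
    (∀ e ∈ G.edgeSet, e ∉ E1) ∨ (∀ e ∈ G.edgeSet, e ∈ E1) := by
  by_contra hcon
  push Not at hcon
  obtain ⟨⟨e1, he1, h1⟩, e0, he0, h0⟩ := hcon
  -- no mixed vertices
  have hmix : ∀ v a b, G.Adj v a → G.Adj v b → s(v,a) ∈ E1 → s(v,b) ∈ E1 := by
    intro v a b ha hb hva
    by_contra hvb
    have hab : a ≠ b := by rintro rfl; exact hvb hva
    obtain ⟨z, hzc, hzv⟩ := h.cyc2 ha hb hab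
    have := congrFun (hz z hzc) v
    rw [bd_apply, Finset.sum_eq_single a] at this
    · simp [res, hva, hzv] at this
    · intro w _ hwa
      by_cases hwb : w = b
      · subst hwb; simp [res, hvb]
      · simp [res, hzv, hwa, hwb]
    · simp
  have hD := h.cc {v | ∃ a, G.Adj v a ∧ s(v,a) ∈ E1} (by rintro x ⟨a, ha, _⟩; exact h.2.1 _ _ ha)
    (by
      induction e1 using Sym2.ind with
      | _ x y => exact ⟨x, y, he1, h1⟩)
    (by
      rintro x ⟨a, ha, hxa⟩ y hy hxy
      refine ⟨x, hxy.symm, ?_⟩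
      rw [Sym2.eq_swap]
      exact hmix x a y ha hxy hxa)
  induction e0 using Sym2.ind with
  | _ x y =>
    have hx : x ∈ U := h.2.1 _ _ he0
    rw [← hD] at hx
    obtain ⟨a, ha, hxa⟩ := hx
    exact h0 (hmix x a y ha he0 hxa)

end conn

section TB
variable {ι : Type} [Fintype ι] {E : Set (Sym2 V)} {F : ι → Ch V}

lemma sum_apply (c : ι → ZMod 2) (e : Sym2 V) : (∑ i, c i • F i) e = ∑ i, c i * F i e := by
  simp [Finset.sum_apply]

lemma eval2 {c : ι → ZMod 2} {e : Sym2 V} {i j : ι} (hij : i ≠ j) (hi : F i e = 1) (hj : F j e = 1)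
    (hk : ∀ k, k ≠ i → k ≠ j → F k e = 0) : (∑ i, c i • F i) e = c i + c j := by
  rw [sum_apply, Finset.sum_eq_add i j hij]
  · simp [hi, hj]
  · intro k _ hk2; rw [hk k hk2.1 hk2.2, mul_zero]
  · simp
  · simp

lemma IsTB.eval (h : IsTB E F) {e : Sym2 V} {i j : ι} (hij : i ≠ j) (hi : F i e = 1) (hj : F j e = 1)
    (c : ι → ZMod 2) : (∑ i, c i • F i) e = c i + c j := by
  have he : e ∈ E := (h.cyc i).1 e (by rw [hi]; decide)
  obtain ⟨i', j', hij', hi', hj', hk⟩ := h.two e he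
  have h1 : i = i' ∨ i = j' := by
    by_contra hh; push Not at hh
    rw [hk i hh.1 hh.2] at hi; exact absurd hi (by decide)
  have h2 : j = i' ∨ j = j' := by
    by_contra hh; push Not at hh
    rw [hk j hh.1 hh.2] at hj; exact absurd hj (by decide)
  apply eval2 hij hi hj
  intro k h3 h4
  rcases h1 with rfl | rfl <;> rcases h2 with rfl | rfl
  · exact absurd rfl hij
  · exact hk k h3 h4
  · exact hk k h4 h3
  · exact absurd rfl hij

lemma IsTB.third (h : IsTB E F) {e : Sym2 V} {i j : ι} (hij : i ≠ j) (hi : F i e = 1) (hj : F j e = 1)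
    {k : ι} (hk : F k e = 1) : k = i ∨ k = j := by
  by_contra hh; push Not at hh
  have he : e ∈ E := (h.cyc i).1 e (by rw [hi]; decide)
  obtain ⟨i', j', hij', hi', hj', hk'⟩ := h.two e he
  have key : ∀ l, F l e = 1 → l = i' ∨ l = j' := by
    intro l hl
    by_contra h2; push Not at h2
    rw [hk' l h2.1 h2.2] at hl; exact absurd hl (by decide)
  have := key i hi; have := key j hj; have := key k hk
  grind

lemma IsTB.other (h : IsTB E F) {e : Sym2 V} {i : ι} (hi : F i e = 1) :
    ∃ j, j ≠ i ∧ F j e = 1 := by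
  have he : e ∈ E := (h.cyc i).1 e (by rw [hi]; decide)
  obtain ⟨i', j', hij', hi', hj', hk'⟩ := h.two e he
  by_cases h1 : i = i'
  · subst h1; exact ⟨j', hij'.symm, hj'⟩
  · exact ⟨i', fun hh => h1 hh.symm, hi'⟩

lemma IsTB.zero_out (h : IsTB E F) {e : Sym2 V} (he : e ∉ E) (i : ι) : F i e = 0 := by
  by_contra h0; exact he ((h.cyc i).1 e h0)

lemma IsTB.sum_cyc (h : IsTB E F) (c : ι → ZMod 2) : Cyc E (∑ i, c i • F i) := by
  refine ⟨fun e he => ?_, ?_⟩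
  · by_contra h0
    apply he; rw [sum_apply]
    exact Finset.sum_eq_zero fun i _ => by rw [h.zero_out h0, mul_zero]
  · rw [map_sum]
    exact Finset.sum_eq_zero fun i _ => by rw [map_smul, (h.cyc i).2, smul_zero]

lemma IsTB.all (h : IsTB E F) : ∑ i, F i = 0 := by
  have h1 : ∑ i, F i = ∑ i, (1 : ι → ZMod 2) i • F i := by simp
  rw [h1]
  funext e
  by_cases he : e ∈ E
  · obtain ⟨i, j, hij, hi, hj, hk⟩ := h.two e he
    rw [eval2 hij hi hj hk]; simp; decide
  · rw [sum_apply]; exact Finset.sum_eq_zero fun i _ => by rw [h.zero_out he, mul_zero]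

lemma IsTB.shift (h : IsTB E F) (c : ι → ZMod 2) : ∑ i, (c i + 1) • F i = ∑ i, c i • F i := by
  simp [add_smul, Finset.sum_add_distrib, h.all]

/-- span with a prescribed coefficient -/
lemma IsTB.span' (h : IsTB E F) {z : Ch V} (hz : Cyc E z) (i : ι) (t : ZMod 2) :
    ∃ c : ι → ZMod 2, z = ∑ i, c i • F i ∧ c i = t := by
  obtain ⟨c, hc⟩ := h.span z hz
  by_cases hi : c i = t
  · exact ⟨c, hc, hi⟩
  · refine ⟨fun i => c i + 1, by rw [h.shift]; exact hc, ?_⟩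
    rcases z2 (c i) with h0 | h0 <;> rcases z2 t with h1 | h1 <;> simp_all <;> decide

lemma IsTB.has_edge (h : IsTB E F) (i : ι) : ∃ e ∈ E, F i e = 1 := by
  by_contra hh; push Not at hh
  apply h.ne i
  funext e
  by_cases he : e ∈ E
  · exact z2_ne1 (hh e he)
  · exact h.zero_out he i

lemma IsTB.gen {G : SimpleGraph V} {U : Set V} (h : IsTB G.edgeSet F) (hG : TwoConn G U)
    (i : ι) (c : ι → ZMod 2) (hci : c i = 0)
    (hc : ∀ e j k, F j e = 1 → F k e = 1 → j ≠ i → k ≠ i → c j = c k) :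
    (∀ j, c j = 0) ∨ (∀ j, j ≠ i → c j = 1) := by
  have key := hG.split {e | ∃ j, c j = 1 ∧ F j e = 1} (by
    intro z hz
    obtain ⟨b, hb, hbi⟩ := h.span' hz i 0
    have : res {e | ∃ j, c j = 1 ∧ F j e = 1} z = ∑ j, (b j * c j) • F j := by
      funext e
      by_cases he : e ∈ G.edgeSet
      · obtain ⟨j, k, hjk, hj, hk, hl⟩ := h.two e he
        rw [eval2 hjk hj hk hl, res, hb, eval2 hjk hj hk hl]
        have hmem : e ∈ {e | ∃ j, c j = 1 ∧ F j e = 1} ↔ c j = 1 ∨ c k = 1 := by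
          constructor
          · rintro ⟨l, hl1, hl2⟩
            rcases h.third hjk hj hk hl2 with rfl | rfl
            · exact Or.inl hl1
            · exact Or.inr hl1
          · rintro (h1 | h1)
            · exact ⟨j, h1, hj⟩
            · exact ⟨k, h1, hk⟩
        by_cases hji : j = i
        · subst hji
          rcases z2 (c k) with h0 | h0 <;> simp [hmem, h0, hci, hbi]
        · by_cases hki : k = i
          · subst hki
            rcases z2 (c j) with h0 | h0 <;> simp [hmem, h0, hci, hbi]
          · have := hc e j k hj hk hji hki
            rcases z2 (c k) with h0 | h0 <;> simp [hmem, h0, this]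
      · have h1 : z e = 0 := by by_contra h1; exact he (hz.1 e h1)
        rw [res, h1, sum_apply]
        rw [Finset.sum_eq_zero fun i _ => by rw [h.zero_out he, mul_zero]]
        simp
    rw [this]
    exact (h.sum_cyc _).2)
  rcases key with h1 | h1
  · left
    intro j
    obtain ⟨e, he, hje⟩ := h.has_edge j
    apply z2_ne1
    intro hj
    exact h1 e he ⟨j, hj, hje⟩
  · right
    intro j hj
    obtain ⟨e, he, hje⟩ := h.has_edge j
    obtain ⟨k, hk, hke⟩ := h1 e he
    have hki : k ≠ i := by rintro rfl; rw [hci] at hk; exact absurd hk (by decide)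
    rw [hc e j k hje hke hj hki, hk]

lemma IsTB.F3 {G : SimpleGraph V} {U : Set V} (h : IsTB G.edgeSet F) (hG : TwoConn G U)
    (c : ι → ZMod 2) (hc : ∑ i, c i • F i = 0) (i j : ι) : c i = c j := by
  have main : ∀ c : ι → ZMod 2, ∑ i, c i • F i = 0 → c i = 0 → ∀ j, c j = 0 := by
    intro c hc hci
    have hc2 : ∀ e j k, F j e = 1 → F k e = 1 → c j = c k := by
      intro e j k hj hk
      by_cases hjk : j = k
      · rw [hjk]
      · have := h.eval hjk hj hk c
        rw [hc] at this
        exact z2_eq this.symm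
    rcases h.gen hG i c hci (fun e j k hj hk _ _ => hc2 e j k hj hk) with h1 | h1
    · exact h1
    · obtain ⟨e, he, hie⟩ := h.has_edge i
      obtain ⟨k, hki, hke⟩ := h.other hie
      have := hc2 e i k hie hke
      rw [hci, h1 k hki] at this
      exact absurd this (by decide)
  rcases z2 (c i) with h0 | h0
  · rw [h0, main c hc h0 j]
  · have := main (fun i => c i + 1) (by rw [h.shift]; exact hc) (by simp [h0]; decide) j
    rw [h0]; exact (z2_eq this).symm

lemma IsTB.min {G : SimpleGraph V} {U : Set V} (h : IsTB G.edgeSet F) (hG : TwoConn G U)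
    (i : ι) (d : Ch V) (hd : bd d = 0) (hd0 : d ≠ 0) (hs : ∀ e, d e = 1 → F i e = 1) : d = F i := by
  have hcyc : Cyc G.edgeSet d := ⟨fun e he => (h.cyc i).1 e (by rw [hs e (z2_ne he)]; decide), hd⟩
  obtain ⟨c, hc, hci⟩ := h.span' hcyc i 0
  rcases h.gen hG i c hci (by
    intro e j k hj hk hji hki
    by_cases hjk : j = k
    · rw [hjk]
    · have h1 := h.eval hjk hj hk c
      rw [← hc] at h1
      have : d e = 0 := by
        apply z2_ne1; intro h2
        rcases h.third hjk hj hk (hs e h2) with rfl | rfl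
        · exact hji rfl
        · exact hki rfl
      rw [this] at h1
      exact z2_eq h1.symm) with h1 | h1
  · exfalso; apply hd0; rw [hc]; simp [h1]
  · have : d + F i = 0 := by
      rw [hc, ← h.all, ← Finset.sum_erase_add _ _ (Finset.mem_univ i), hci, zero_smul, add_zero,
        ← Finset.sum_erase_add _ _ (Finset.mem_univ i)]
      congr 1
      apply Finset.sum_congr rfl
      intro j hj
      rw [h1 j (Finset.ne_of_mem_erase hj), one_smul]
    exact ch_eq this

/-- link lemma -/
lemma IsTB.link {G : SimpleGraph V} {U : Set V} (h : IsTB G.edgeSet F) (hG : TwoConn G U)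
    (v : V) (c : ι → ZMod 2) (hc : ∀ w j k, F j s(v,w) = 1 → F k s(v,w) = 1 → c j = c k)
    {i j : ι} {a b : V} (hi : F i s(v,a) = 1) (hj : F j s(v,b) = 1) : c i = c j := by
  by_contra hij
  have hab : a ≠ b := by rintro rfl; exact hij (hc _ _ _ hi hj)
  have ha : G.Adj v a := (h.cyc i).1 _ (by rw [hi]; decide)
  have hb : G.Adj v b := (h.cyc j).1 _ (by rw [hj]; decide)
  obtain ⟨z, hz, hzv⟩ := hG.cyc2 ha hb hab
  obtain ⟨x, hx⟩ := h.span z hz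
  have hy := (h.sum_cyc (fun k => x k * c k)).2
  have hy2 := congrFun hy v
  rw [bd_apply] at hy2
  have ev : ∀ w, ∀ k, F k s(v,w) = 1 → (∑ k, (x k * c k) • F k) s(v,w) = c k * z s(v,w) := by
    intro w k hk
    obtain ⟨l, hl, hlw⟩ := h.other hk
    rw [h.eval hl.symm hk hlw, hx, h.eval hl.symm hk hlw, hc w k l hk hlw]; ring
  have hsum : ∑ w, (∑ k, (x k * c k) • F k) s(v,w) = c i + c j := by
    rw [Finset.sum_eq_add a b hab]
    · rw [ev a i hi, ev b j hj, hzv, hzv]; simp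
    · intro w _ hw
      by_cases hvw : G.Adj v w
      · obtain ⟨k, _, _, hk, _⟩ := h.two s(v,w) hvw
        rw [ev w k hk, hzv]; simp [hw.1, hw.2]
      · rw [sum_apply]; exact Finset.sum_eq_zero fun i _ => by rw [h.zero_out hvw, mul_zero]
    · simp
    · simp
  rw [hsum] at hy2
  exact hij (z2_eq hy2)

end TB
end T6

end

section
open SimpleGraph Finset
open scoped Classical
set_option linter.unusedSectionVars false
set_option linter.unusedSimpArgs false
set_option linter.unnecessarySeqFocus false

namespace T6
variable {V : Type*} [Fintype V]

section minors

/-- minors given by branch sets -/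
def Mn {W : Type*} (G : SimpleGraph V) (H : SimpleGraph W) : Prop :=
  ∃ B : W → Set V, (∀ w, (B w).Nonempty) ∧ (∀ w, CC G (B w)) ∧
    (∀ w w', w ≠ w' → ∀ x, x ∈ B w → x ∉ B w') ∧
    (∀ w w', H.Adj w w' → ∃ x ∈ B w, ∃ y ∈ B w', G.Adj x y)

lemma CC.preconn {G : SimpleGraph V} {s : Set V} (h : CC G s) : (G.induce s).Preconnected := by
  rintro ⟨a, ha⟩ ⟨b, hb⟩
  have := h {x | ∃ hx : x ∈ s, (G.induce s).Reachable ⟨a, ha⟩ ⟨x, hx⟩} (fun x hx => hx.1)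
    ⟨a, ha, SimpleGraph.Reachable.refl _⟩ (by
      rintro x ⟨hx, hr⟩ y hy hxy
      refine ⟨hy, hr.trans ?_⟩
      exact SimpleGraph.Adj.reachable (by simpa using hxy))
  rw [← this] at hb
  exact hb.2

lemma Mn.hasMinor {W : Type*} {G : SimpleGraph V} {H : SimpleGraph W} (h : Mn G H) : HasMinor G H := by
  obtain ⟨B, hne, hcc, hdis, hadj⟩ := h
  let f : V → Option W := fun v => if hv : ∃ w, v ∈ B w then some hv.choose else none
  have hf : ∀ v w, f v = some w ↔ v ∈ B w := by
    intro v w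
    by_cases hv : ∃ w, v ∈ B w
    · simp only [f, hv, dif_pos, Option.some.injEq]
      constructor
      · rintro rfl; exact hv.choose_spec
      · intro hw
        by_contra hne
        exact hdis _ _ hne v hv.choose_spec hw
    · simp only [f, hv, dif_neg, not_false_eq_true]
      constructor
      · intro h; simp at h
      · intro h; exact absurd ⟨w, h⟩ hv
  have hset : ∀ w, {v | f v = some w} = B w := by
    intro w; ext v; exact hf v w
  refine ⟨f, ?_, ?_, ?_⟩
  · intro w; obtain ⟨x, hx⟩ := hne w; exact ⟨x, (hf x w).2 hx⟩
  · intro w; rw [hset]; exact (hcc w).preconn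
  · intro w w' hw
    obtain ⟨x, hx, y, hy, hxy⟩ := hadj w w' hw
    exact ⟨x, y, (hf x w).2 hx, (hf y w').2 hy, hxy⟩

lemma Mn.trans {W : Type*} {G G' : SimpleGraph V} {H : SimpleGraph W} (U : Set V)
    (hU : ∀ x y, G'.Adj x y → x ∈ U) (ψ : V → Set V) (hne : ∀ x ∈ U, (ψ x).Nonempty)
    (hcc : ∀ x ∈ U, CC G (ψ x)) (hdis : ∀ x ∈ U, ∀ y ∈ U, x ≠ y → ∀ a, a ∈ ψ x → a ∉ ψ y)
    (hadj : ∀ x y, G'.Adj x y → ∃ a ∈ ψ x, ∃ b ∈ ψ y, G.Adj a b)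
    (hH : ∀ w, ∃ w', H.Adj w w') (h : Mn G' H) : Mn G H := by
  obtain ⟨B, hBne, hBcc, hBdis, hBadj⟩ := h
  have hBU : ∀ w, ∀ x ∈ B w, x ∈ U := by
    intro w
    have := hBcc w (B w ∩ U) Set.inter_subset_left (by
      obtain ⟨w', hw'⟩ := hH w
      obtain ⟨x, hx, y, hy, hxy⟩ := hBadj w w' hw'
      exact ⟨x, hx, hU _ _ hxy⟩) (fun x hx y hy hxy => ⟨hy, hU _ _ hxy.symm⟩)
    intro x hx; rw [← this] at hx; exact hx.2
  refine ⟨fun w => {a | ∃ x ∈ B w, a ∈ ψ x}, ?_, ?_, ?_, ?_⟩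
  · intro w
    obtain ⟨x, hx⟩ := hBne w
    obtain ⟨a, ha⟩ := hne x (hBU w x hx)
    exact ⟨a, x, hx, ha⟩
  · intro w D hD hDne hcl
    have h1 : ∀ x ∈ B w, (∃ a ∈ D, a ∈ ψ x) → ψ x ⊆ D := by
      rintro x hx ⟨a, haD, hax⟩
      have := hcc x (hBU w x hx) (D ∩ ψ x) Set.inter_subset_right ⟨a, haD, hax⟩
        (fun p hp q hq hpq => ⟨hcl p hp.1 q ⟨x, hx, hq⟩ hpq, hq⟩)
      intro y hy; rw [← this] at hy; exact hy.1
    have h2 := hBcc w {x | x ∈ B w ∧ ψ x ⊆ D} (fun x hx => hx.1) (by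
      obtain ⟨a, ha⟩ := hDne
      obtain ⟨x, hx, hax⟩ := hD ha
      exact ⟨x, hx, h1 x hx ⟨a, ha, hax⟩⟩) (by
      rintro x ⟨hx, hxD⟩ y hy hxy
      refine ⟨hy, h1 y hy ?_⟩
      obtain ⟨a, ha, b, hb, hab⟩ := hadj x y hxy
      exact ⟨b, hcl a (hxD ha) b ⟨y, hy, hb⟩ hab, hb⟩)
    apply Set.Subset.antisymm hD
    rintro a ⟨x, hx, hax⟩
    rw [← h2] at hx
    exact hx.2 hax
  · rintro w w' hww' a ⟨x, hx, hax⟩ ⟨y, hy, hay⟩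
    by_cases hxy : x = y
    · subst hxy; exact hBdis w w' hww' x hx hy
    · exact hdis x (hBU w x hx) y (hBU w' y hy) hxy a hax hay
  · intro w w' hww'
    obtain ⟨x, hx, y, hy, hxy⟩ := hBadj w w' hww'
    obtain ⟨a, ha, b, hb, hab⟩ := hadj x y hxy
    exact ⟨a, ⟨x, hx, ha⟩, b, ⟨y, hy, hb⟩, hab⟩

lemma CC.singleton (G : SimpleGraph V) (x : V) : CC G {x} := by
  intro D hD hne _
  obtain ⟨y, hy⟩ := hne
  apply Set.Subset.antisymm hD
  intro z hz
  have := hD hy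
  simp only [Set.mem_singleton_iff] at hz this
  rw [hz, ← this]; exact hy

lemma CC.pair {G : SimpleGraph V} {x y : V} (h : G.Adj x y) : CC G {x, y} := by
  intro D hD hne hcl
  have hxy : x ∈ D ↔ y ∈ D := ⟨fun hx => hcl x hx y (by simp) h, fun hy => hcl y hy x (by simp) h.symm⟩
  obtain ⟨z, hz⟩ := hne
  have hx : x ∈ D := by
    rcases hD hz with rfl | h2
    · exact hz
    · rw [Set.mem_singleton_iff] at h2; subst h2; exact hxy.2 hz
  apply Set.Subset.antisymm hD
  rintro w (rfl | hw)
  · exact hx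
  · rw [Set.mem_singleton_iff] at hw; subst hw; exact hxy.1 hx

/-- no K5 and no K33 minor -/
def Good (G : SimpleGraph V) : Prop :=
  ¬ Mn G (completeGraph (Fin 5)) ∧ ¬ Mn G (completeBipartiteGraph (Fin 3) (Fin 3))

lemma Good.of {G G' : SimpleGraph V} (h : Good G) (U : Set V)
    (hU : ∀ x y, G'.Adj x y → x ∈ U) (ψ : V → Set V) (hne : ∀ x ∈ U, (ψ x).Nonempty)
    (hcc : ∀ x ∈ U, CC G (ψ x)) (hdis : ∀ x ∈ U, ∀ y ∈ U, x ≠ y → ∀ a, a ∈ ψ x → a ∉ ψ y)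
    (hadj : ∀ x y, G'.Adj x y → ∃ a ∈ ψ x, ∃ b ∈ ψ y, G.Adj a b) : Good G' := by
  constructor
  · intro hm
    exact h.1 (hm.trans U hU ψ hne hcc hdis hadj (by
      intro w; exact ⟨w + 1, by fin_cases w <;> simp [completeGraph]⟩))
  · intro hm
    exact h.2 (hm.trans U hU ψ hne hcc hdis hadj (by
      rintro (w | w)
      · exact ⟨Sum.inr 0, by simp⟩
      · exact ⟨Sum.inl 0, by simp⟩))

end minors

section ops
variable {ι : Type} [Fintype ι] {E : Set (Sym2 V)} {F : ι → Ch V}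

lemma bd_single {z : Ch V} {e : Sym2 V} (hz : bd z = 0) (h1 : ∀ e', z e' = 1 → e' = e) (he : z e = 1) :
    e.IsDiag := by
  induction e using Sym2.ind with
  | _ x y =>
    by_contra hxy
    have hxy : x ≠ y := hxy
    have : z = dl s(x,y) := by
      funext e'
      by_cases h : e' = s(x,y)
      · subst h; rw [dl_self, he]
      · rw [dl_ne h]; exact z2_ne1 fun h2 => h (h1 _ h2)
    rw [this, bd_dl hxy] at hz
    have := congrFun hz x
    simp [dl, hxy] at this

lemma IsTB.remove (h : IsTB E F) {i j : ι} {e : Sym2 V} (hij : i ≠ j) (hi : F i e = 1) (hj : F j e = 1)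
    (hcom : ∀ e', F i e' = 1 → F j e' = 1 → e' = e) (hne : F i ≠ F j) :
    IsTB (E \ {e}) (fun k : {k // k ≠ j} => if k.1 = i then F i + F j else F k.1) := by
  have hFe : ∀ k, k ≠ i → k ≠ j → F k e = 0 := by
    intro k h1 h2; apply z2_ne1; intro h3
    rcases h.third hij hi hj h3 with rfl | rfl <;> simp_all
  have hcyc : ∀ k : {k // k ≠ j}, Cyc E (if k.1 = i then F i + F j else F k.1) := by
    intro k; split_ifs
    · exact (h.cyc i).add (h.cyc j)
    · exact h.cyc k
  refine ⟨?_, ?_, ?_, ?_⟩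
  · intro k
    refine ⟨?_, (hcyc k).2⟩
    intro e' he'
    refine ⟨(hcyc k).1 e' he', ?_⟩
    rintro rfl
    split_ifs at he' with hk
    · apply he'; rw [Pi.add_apply, hi, hj]; decide
    · exact he' (hFe k hk k.2)
  · intro k
    split_ifs with hk
    · intro h0; exact hne (ch_eq h0)
    · exact h.ne _
  · rintro e' ⟨he', hee⟩
    have hee : e' ≠ e := hee
    obtain ⟨p, q, hpq, hp, hq, hr⟩ := h.two e' he'
    -- helper
    have aux : ∀ p q, p ≠ q → F p e' = 1 → F q e' = 1 → (∀ k, k ≠ p → k ≠ q → F k e' = 0) → q ≠ j →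
        ∃ i' j' : {k // k ≠ j}, i' ≠ j' ∧ (if i'.1 = i then F i + F j else F i'.1) e' = 1 ∧
          (if j'.1 = i then F i + F j else F j'.1) e' = 1 ∧
          ∀ k : {k // k ≠ j}, k ≠ i' → k ≠ j' → (if k.1 = i then F i + F j else F k.1) e' = 0 := by
      intro p q hpq hp hq hr hqj
      by_cases hpj : p = j
      · subst hpj
        have hqi : q ≠ i := by rintro rfl; exact hee (hcom _ hq hp)
        have hFi : F i e' = 0 := hr i hij (Ne.symm hqi)
        refine ⟨⟨i, hij⟩, ⟨q, hqj⟩, by simpa using hqi.symm, by simp [hp, hFi], by simp [hqi, hq], ?_⟩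
        rintro ⟨k, hk⟩ h1 h2
        simp only [ne_eq, Subtype.mk.injEq] at h1 h2
        simp [h1, hr k hk h2]
      · have hFj : F j e' = 0 := hr j (Ne.symm hpj) (Ne.symm hqj)
        refine ⟨⟨p, hpj⟩, ⟨q, hqj⟩, by simpa using hpq, ?_, ?_, ?_⟩
        · by_cases hpi : p = i
          · subst hpi; simp [hFj, hp]
          · simp [hpi, hp]
        · by_cases hqi : q = i
          · subst hqi; simp [hFj, hq]
          · simp [hqi, hq]
        · rintro ⟨k, hk⟩ h1 h2
          simp only [ne_eq, Subtype.mk.injEq] at h1 h2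
          by_cases hki : k = i
          · subst hki; simp [hFj, hr k h1 h2]
          · simp [hki, hr k h1 h2]
    by_cases hqj : q = j
    · exact aux q p hpq.symm hq hp (fun k h1 h2 => hr k h2 h1) (by rw [← hqj]; exact hpq)
    · exact aux p q hpq hp hq hr hqj
  · intro z hz
    obtain ⟨c, hc⟩ := h.span z (hz.mono Set.sdiff_subset)
    have hze : z e = 0 := by by_contra h0; exact (hz.1 e h0).2 rfl
    have hcij : c i = c j := by
      have := h.eval hij hi hj c
      rw [← hc, hze] at this; exact z2_eq this.symm
    refine ⟨fun k => c k.1, ?_⟩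
    rw [hc, ← Finset.sum_erase_add _ _ (Finset.mem_univ j),
      ← Finset.sum_erase_add (Finset.univ.erase j) _ (Finset.mem_erase.2 ⟨hij, Finset.mem_univ i⟩)]
    rw [← Finset.sum_erase_add _ _ (Finset.mem_univ (⟨i, hij⟩ : {k // k ≠ j}))]
    simp only [if_true]
    rw [smul_add, ← hcij, add_assoc]
    congr 1
    symm
    apply Finset.sum_bij (fun (k : {k // k ≠ j}) _ => k.1)
    · intro k hk
      simp only [Finset.mem_erase, Finset.mem_univ, and_true] at hk ⊢
      exact ⟨fun h => hk (Subtype.ext h), k.2⟩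
    · intro a _ b _ hab; exact Subtype.ext hab
    · intro b hb
      simp only [Finset.mem_erase, Finset.mem_univ, and_true] at hb
      exact ⟨⟨b, hb.2⟩, by simpa using hb.1, rfl⟩
    · intro k hk
      simp only [Finset.mem_erase, Finset.mem_univ, and_true] at hk
      have : k.1 ≠ i := fun h => hk (Subtype.ext h)
      simp [this]

lemma IsTB.ear (h : IsTB E F) (i0 : ι) (P : Ch V) (hP : ∀ e, P e = 1 → F i0 e = 1) (N : Set (Sym2 V))
    (hN : ∀ e ∈ N, e ∉ E) (hNne : N.Nonempty) (hbd : bd (P + res N 1) = 0)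
    (hconst : ∀ z, Cyc (E ∪ N) z → ∀ e ∈ N, ∀ e' ∈ N, z e = z e') :
    IsTB (E ∪ N) (fun k : Option ι => k.elim (P + res N 1)
      (fun i => if i = i0 then F i0 + (P + res N 1) else F i)) := by
  have hPE : ∀ e, e ∉ E → P e = 0 := fun e he => z2_ne1 fun h1 => by
    have := hP e h1; rw [h.zero_out he] at this; exact absurd this (by decide)
  have hPR : Cyc (E ∪ N) (P + res N 1) := by
    refine ⟨fun e he => ?_, hbd⟩
    by_contra hh
    simp only [Set.mem_union, not_or] at hh
    apply he; simp [hPE e hh.1, res, hh.2]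
  have hR0 : ∀ e ∈ E, res N 1 e = 0 := by
    intro e he
    have : e ∉ N := fun h2 => hN e h2 he
    simp [res, this]
  have hR1 : ∀ e ∈ N, res N 1 e = 1 := by
    intro e he; simp [res, he]
  obtain ⟨eN, heN⟩ := hNne
  refine ⟨?_, ?_, ?_, ?_⟩
  · rintro (_ | i)
    · exact hPR
    · simp only [Option.elim_some]
      split_ifs
      · exact ((h.cyc i0).mono Set.subset_union_left).add hPR
      · exact (h.cyc i).mono Set.subset_union_left
  · rintro (_ | i)
    · intro h0
      have := congrFun h0 eN
      simp [hPE eN (hN _ heN), hR1 _ heN] at this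
    · simp only [Option.elim_some]
      split_ifs
      · intro h0
        have := congrFun h0 eN
        simp [hPE eN (hN _ heN), hR1 _ heN, h.zero_out (hN _ heN)] at this
      · exact h.ne i
  · rintro e (he | he)
    · obtain ⟨p, q, hpq, hp, hq, hr⟩ := h.two e he
      have aux : ∀ p q, p ≠ q → F p e = 1 → F q e = 1 → (∀ k, k ≠ p → k ≠ q → F k e = 0) → q ≠ i0 →
        ∃ i j : Option ι, i ≠ j ∧ (i.elim (P + res N 1)
          (fun i => if i = i0 then F i0 + (P + res N 1) else F i)) e = 1 ∧ (j.elim (P + res N 1)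
          (fun i => if i = i0 then F i0 + (P + res N 1) else F i)) e = 1 ∧
          ∀ k : Option ι, k ≠ i → k ≠ j → (k.elim (P + res N 1)
          (fun i => if i = i0 then F i0 + (P + res N 1) else F i)) e = 0 := by
        intro p q hpq hp hq hr hqi
        rcases z2 (P e) with h0 | h1
        · refine ⟨some p, some q, by simpa using hpq, ?_, ?_, ?_⟩
          · by_cases hpi : p = i0
            · subst hpi; simp [hp, h0, hR0 e he]
            · simp [hpi, hp]
          · simp [hqi, hq]
          · rintro (_ | k) h1 h2
            · simp [h0, hR0 e he]
            · simp only [ne_eq, Option.some.injEq] at h1 h2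
              by_cases hki : k = i0
              · subst hki; simp [hr k h1 h2, h0, hR0 e he]
              · simp [hki, hr k h1 h2]
        · have hpi : i0 = p := by
            by_contra hh
            have := hP e h1
            rw [hr i0 hh (Ne.symm hqi)] at this; exact absurd this (by decide)
          subst hpi
          refine ⟨none, some q, by simp, by simp [h1, hR0 e he], by simp [hqi, hq], ?_⟩
          rintro (_ | k) h2 h3
          · exact absurd rfl h2
          · simp only [ne_eq, Option.some.injEq] at h3
            by_cases hki : k = i0
            · subst hki; simp [hp, h1, hR0 e he]; decide
            · simp [hki, hr k hki h3]
      by_cases hqi : q = i0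
      · exact aux q p hpq.symm hq hp (fun k h1 h2 => hr k h2 h1) (by rw [← hqi]; exact hpq)
      · exact aux p q hpq hp hq hr hqi
    · refine ⟨none, some i0, by simp, ?_, ?_, ?_⟩
      · simp [hPE e (hN e he), hR1 e he]
      · simp [hPE e (hN e he), hR1 e he, h.zero_out (hN e he)]
      · rintro (_ | k) h1 h2
        · exact absurd rfl h1
        · simp only [ne_eq, Option.some.injEq] at h2
          simp [h2, h.zero_out (hN e he)]
  · intro z hz
    have hz' : Cyc E (z + z eN • (P + res N 1)) := by
      refine ⟨fun e he => ?_, ?_⟩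
      · by_contra hE
        apply he
        by_cases heN' : e ∈ N
        · simp [hPE e hE, hR1 e heN', hconst z hz e heN' eN heN, z2_add]
        · have : z e = 0 := by
            by_contra h0
            rcases hz.1 e h0 with h1 | h1
            · exact hE h1
            · exact heN' h1
          simp [this, hPE e hE, res, heN']
      · rw [map_add, map_smul, hz.2, hbd]; simp
    obtain ⟨c, hc⟩ := h.span _ hz'
    refine ⟨fun k => k.elim (c i0 + z eN) c, ?_⟩
    rw [Fintype.sum_option]
    simp only [Option.elim_none, Option.elim_some]
    have h1 : ∑ i, c i • (if i = i0 then F i0 + (P + res N 1) else F i)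
        = (∑ i, c i • F i) + c i0 • (P + res N 1) := by
      rw [← Finset.sum_erase_add _ _ (Finset.mem_univ i0), ← Finset.sum_erase_add (f := fun i => c i • F i) _ (Finset.mem_univ i0)]
      simp only [if_true]
      rw [smul_add, ← add_assoc]
      congr 2
      apply Finset.sum_congr rfl
      intro k hk
      rw [if_neg (Finset.ne_of_mem_erase hk)]
    rw [h1, ← hc, add_smul]
    have h2 := ch_add (c i0 • (P + res N 1))
    have h3 := ch_add (z eN • (P + res N 1))
    calc z = z + 0 + 0 := by simp
      _ = z + (c i0 • (P + res N 1) + c i0 • (P + res N 1)) + (z eN • (P + res N 1) + z eN • (P + res N 1)) := by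
          rw [h2, h3]
      _ = _ := by abel

lemma IsTB.sum2 {ι' : Type} [Fintype ι'] {E' : Set (Sym2 V)} {F' : ι' → Ch V} (h : IsTB E F) (h' : IsTB E' F')
    {e0 : Sym2 V} (hd : ¬ e0.IsDiag) (hE : ∀ e, e ∈ E → e ∈ E' → e = e0) {b : ι} {a' : ι'}
    (hb : F b e0 = 1) (ha' : F' a' e0 = 1)
    (hsplit : ∀ z, Cyc (E ∪ E') z → ∃ z1 z2, Cyc E z1 ∧ Cyc E' z2 ∧ z = z1 + z2) :
    IsTB (E ∪ E') (Sum.elim (fun i => if i = b then F b + F' a' else F i) (fun j : {j // j ≠ a'} => F' j.1)) := by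
  have hE' : ∀ e, e ∈ E' → e ≠ e0 → ∀ i, F i e = 0 := fun e he hne i => h.zero_out (fun h1 => hne (hE e h1 he)) i
  have hE1 : ∀ e, e ∈ E → e ≠ e0 → ∀ i, F' i e = 0 := fun e he hne i => h'.zero_out (fun h1 => hne (hE e he h1)) i
  obtain ⟨a, hab, ha⟩ := h.other hb
  obtain ⟨b', hab', hb'⟩ := h'.other ha'
  refine ⟨?_, ?_, ?_, ?_⟩
  · rintro (i | j)
    · simp only [Sum.elim_inl]
      split_ifs
      · exact ((h.cyc b).mono Set.subset_union_left).add ((h'.cyc a').mono Set.subset_union_right)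
      · exact (h.cyc i).mono Set.subset_union_left
    · exact (h'.cyc j).mono Set.subset_union_right
  · rintro (i | j)
    · simp only [Sum.elim_inl]
      split_ifs
      · intro h0
        have h1 := ch_eq h0
        refine hd (bd_single (h.cyc b).2 (fun e he => ?_) hb)
        refine hE e ((h.cyc b).1 e (by rw [he]; decide)) ((h'.cyc a').1 e ?_)
        rw [← h1, he]; decide
      · exact h.ne i
    · exact h'.ne j
  · intro e he
    by_cases hee : e = e0
    · subst hee
      refine ⟨Sum.inl a, Sum.inr ⟨b', hab'⟩, by simp, by simp [hab, ha], by simp [hb'], ?_⟩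
      rintro (k | ⟨k, hk⟩) h1 h2
      · simp only [ne_eq, Sum.inl.injEq] at h1
        simp only [Sum.elim_inl]
        split_ifs with hkb
        · rw [Pi.add_apply, hb, ha']; decide
        · apply z2_ne1; intro h3
          rcases h.third hab ha hb h3 with h4 | h4
          · exact h1 h4
          · exact hkb h4
      · simp only [ne_eq, Sum.inr.injEq, Subtype.mk.injEq] at h2
        simp only [Sum.elim_inr]
        apply z2_ne1; intro h3
        rcases h'.third hab' hb' ha' h3 with h4 | h4
        · exact h2 h4
        · exact hk h4
    · rcases he with he | he
      · obtain ⟨p, q, hpq, hp, hq, hr⟩ := h.two e he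
        have hz := hE1 e he hee
        have key : ∀ k, (if k = b then F b + F' a' else F k) e = F k e := by
          intro k; split_ifs with hk
          · rw [Pi.add_apply, hz, hk, add_zero]
          · rfl
        refine ⟨Sum.inl p, Sum.inl q, by simpa using hpq, by simp [key, hp], by simp [key, hq], ?_⟩
        rintro (k | k) h1 h2
        · simp only [ne_eq, Sum.inl.injEq] at h1 h2
          simp [key, hr k h1 h2]
        · simp [hz]
      · obtain ⟨p, q, hpq, hp, hq, hr⟩ := h'.two e he
        have hz := hE' e he hee
        have key : ∀ k, (if k = b then F b + F' a' else F k) e = if k = b then F' a' e else 0 := by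
          intro k; split_ifs with hk
          · rw [Pi.add_apply, hz, zero_add]
          · exact hz k
        have aux : ∀ p q, p ≠ q → F' p e = 1 → F' q e = 1 → (∀ k, k ≠ p → k ≠ q → F' k e = 0) → q ≠ a' →
          ∃ i j : ι ⊕ {j // j ≠ a'}, i ≠ j ∧ (Sum.elim (fun i => if i = b then F b + F' a' else F i) (fun j : {j // j ≠ a'} => F' j.1) i) e = 1 ∧
           (Sum.elim (fun i => if i = b then F b + F' a' else F i) (fun j : {j // j ≠ a'} => F' j.1) j) e = 1 ∧
           ∀ k, k ≠ i → k ≠ j → (Sum.elim (fun i => if i = b then F b + F' a' else F i) (fun j : {j // j ≠ a'} => F' j.1) k) e = 0 := by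
          intro p q hpq hp hq hr hqa
          by_cases hpa : p = a'
          · subst hpa
            refine ⟨Sum.inl b, Sum.inr ⟨q, hqa⟩, by simp, by simp [hz, hp], by simp [hq], ?_⟩
            rintro (k | ⟨k, hk⟩) h1 h2
            · simp only [ne_eq, Sum.inl.injEq] at h1
              simp [h1, hz]
            · simp only [ne_eq, Sum.inr.injEq, Subtype.mk.injEq] at h2
              simp [hr k hk h2]
          · refine ⟨Sum.inr ⟨p, hpa⟩, Sum.inr ⟨q, hqa⟩, by simpa using hpq, by simp [hp], by simp [hq], ?_⟩
            rintro (k | ⟨k, hk⟩) h1 h2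
            · simp [key, hr a' (Ne.symm hpa) (Ne.symm hqa)]
            · simp only [ne_eq, Sum.inr.injEq, Subtype.mk.injEq] at h1 h2
              simp [hr k h1 h2]
        by_cases hqi : q = a'
        · exact aux q p hpq.symm hq hp (fun k h1 h2 => hr k h2 h1) (by rw [← hqi]; exact hpq)
        · exact aux p q hpq hp hq hr hqi
  · intro z hz
    obtain ⟨z1, z2, h1, h2, rfl⟩ := hsplit z hz
    obtain ⟨c, hc⟩ := h.span z1 h1
    obtain ⟨c', hc', hca⟩ := h'.span' h2 a' (c b)
    refine ⟨Sum.elim c (fun j => c' j.1), ?_⟩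
    rw [Fintype.sum_sum_type]
    simp only [Sum.elim_inl, Sum.elim_inr]
    have h3 : ∑ i, c i • (if i = b then F b + F' a' else F i) = (∑ i, c i • F i) + c b • F' a' := by
      rw [← Finset.sum_erase_add _ _ (Finset.mem_univ b), ← Finset.sum_erase_add (f := fun i => c i • F i) _ (Finset.mem_univ b)]
      simp only [if_true]
      rw [smul_add, ← add_assoc]
      congr 2
      apply Finset.sum_congr rfl
      intro k hk
      rw [if_neg (Finset.ne_of_mem_erase hk)]
    have h4 : ∑ j : {j // j ≠ a'}, c' j.1 • F' j.1 + c' a' • F' a' = ∑ j, c' j • F' j := by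
      rw [← Finset.sum_erase_add _ _ (Finset.mem_univ a')]
      congr 1
      rw [← Finset.sum_subtype_of_mem (p := fun j => j ≠ a') (fun j => c' j • F' j) (by intro j hj; exact Finset.ne_of_mem_erase hj)]
      apply Finset.sum_congr _ (fun _ _ => rfl)
      ext j; simp [j.2]
    rw [h3, ← hc, hc', ← h4, hca]; abel
end ops
end T6

end

section
open SimpleGraph Finset
open scoped Classical
set_option linter.unusedSectionVars false
set_option linter.unusedSimpArgs false
set_option linter.unnecessarySeqFocus false

namespace T6
variable {V : Type*} [Fintype V]

lemma ch_sum (z : Ch V) : z = ∑ e, z e • dl e := by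
  funext e
  rw [Finset.sum_apply, Finset.sum_eq_single e]
  · simp [dl]
  · intro b _ hb; simp [dl, hb.symm]
  · simp

lemma sum_bd {z : Ch V} (hz : ∀ e, z e ≠ 0 → ¬ e.IsDiag) : ∑ v, bd z v = 0 := by
  have h1 : bd z = ∑ e, z e • bd (dl e) := by
    conv_lhs => rw [ch_sum z]
    rw [map_sum]; simp
  have h2 : ∀ e : Sym2 V, ¬ e.IsDiag → ∑ v, bd (dl e) v = 0 := by
    intro e he
    induction e using Sym2.ind with
    | _ x y =>
      have hxy : x ≠ y := he
      rw [bd_dl hxy]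
      simp only [Pi.add_apply, Finset.sum_add_distrib, dl, Finset.sum_ite_eq', Finset.mem_univ, if_true]
      decide
  rw [h1]
  simp only [Finset.sum_apply, Pi.smul_apply]
  rw [Finset.sum_comm]
  apply Finset.sum_eq_zero
  intro e _
  rw [← Finset.smul_sum]
  by_cases h0 : z e = 0
  · simp [h0]
  · rw [h2 e (hz e h0), smul_zero]

lemma exists_comp (G : SimpleGraph V) (T : Set V) {u : V} (hu : u ∈ T) :
    ∃ R ⊆ T, u ∈ R ∧ CC G R ∧ ∀ x ∈ R, ∀ y ∈ T, G.Adj x y → y ∈ R := by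
  let R : Set V := {x | x ∈ T ∧ ∀ D : Set V, u ∈ D → (∀ a ∈ D, ∀ b ∈ T, G.Adj a b → b ∈ D) → x ∈ D}
  have huR : u ∈ R := ⟨hu, fun D h _ => h⟩
  have hcl : ∀ x ∈ R, ∀ y ∈ T, G.Adj x y → y ∈ R := by
    intro x hx y hy hxy
    exact ⟨hy, fun D h1 h2 => h2 x (hx.2 D h1 h2) y hy hxy⟩
  have key : ∀ D ⊆ R, u ∈ D → (∀ x ∈ D, ∀ y ∈ R, G.Adj x y → y ∈ D) → D = R := by
    intro D hD huD hc
    apply Set.Subset.antisymm hD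
    intro x hx
    exact hx.2 D huD (fun a ha b hb hab => hc a ha b (hcl a (hD ha) b hb hab) hab)
  refine ⟨R, fun x hx => hx.1, huR, ?_, hcl⟩
  intro D hD hne hc
  by_cases huD : u ∈ D
  · exact key D hD huD hc
  · have := key (R \ D) Set.sdiff_subset ⟨huR, huD⟩ (by
      intro x hx y hy hxy
      exact ⟨hy, fun hyD => hx.2 (hc y hyD x hx.1 hxy.symm)⟩)
    obtain ⟨a, ha⟩ := hne
    have h2 := hD ha
    rw [← this] at h2
    exact absurd ha h2.2

/-- one side of a 2-separation, with the virtual edge added -/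
def side (G : SimpleGraph V) (S : Set V) (u v : V) : SimpleGraph V where
  Adj x y := x ≠ y ∧ x ∈ S ∧ y ∈ S ∧ (G.Adj x y ∨ s(x,y) = s(u,v))
  symm := ⟨fun x y h => ⟨h.1.symm, h.2.2.1, h.2.1, h.2.2.2.imp (fun h => h.symm) (fun h => by rw [Sym2.eq_swap]; exact h)⟩⟩
  loopless := ⟨fun x h => h.1 rfl⟩

structure Sep (G : SimpleGraph V) (U D D2 : Set V) (u v : V) : Prop where
  hu : u ∈ U
  hv : v ∈ U
  huv : u ≠ v
  mem : ∀ x, x ∈ U ↔ x ∈ D ∨ x ∈ D2 ∨ x = u ∨ x = v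
  dis : ∀ x ∈ D, x ∉ D2
  huD : u ∉ D
  hvD : v ∉ D
  huD2 : u ∉ D2
  hvD2 : v ∉ D2
  neD : D.Nonempty
  neD2 : D2.Nonempty
  nadj : ∀ x ∈ D, ∀ y ∈ D2, ¬ G.Adj x y

lemma Sep.symm {G : SimpleGraph V} {U D D2 : Set V} {u v : V} (h : Sep G U D D2 u v) : Sep G U D2 D u v :=
  ⟨h.hu, h.hv, h.huv, fun x => by rw [h.mem]; tauto, fun x hx h2 => h.dis x h2 hx, h.huD2, h.hvD2, h.huD, h.hvD,
    h.neD2, h.neD, fun x hx y hy hxy => h.nadj y hy x hx hxy.symm⟩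

lemma Sep.two {G : SimpleGraph V} {U D D2 : Set V} {u v : V} (h : Sep G U D D2 u v) (hG : TwoConn G U) :
    TwoConn (side G (D ∪ {u, v}) u v) (D ∪ {u, v}) := by
  have hm : ∀ x, x ∈ D ∪ {u, v} ↔ x ∈ D ∨ x = u ∨ x = v := by intro x; simp; tauto
  refine ⟨?_, fun x y hxy => hxy.2.1, ?_⟩
  · obtain ⟨a, ha⟩ := h.neD
    have hau : a ≠ u := by rintro rfl; exact h.huD ha
    have hav : a ≠ v := by rintro rfl; exact h.hvD ha
    have h3 : ({a, u, v} : Set V).ncard = 3 := by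
      rw [Set.ncard_eq_three]; exact ⟨a, u, v, hau, hav, h.huv, rfl⟩
    rw [← h3]
    apply Set.ncard_le_ncard _ (Set.toFinite _)
    intro x hx
    rw [hm]
    rcases hx with rfl | rfl | hx
    · exact Or.inl ha
    · simp
    · simp at hx; simp [hx]
  · intro s D' hD' hne hcl
    have hcl' : ∀ x ∈ D', ∀ y ∈ (D ∪ {u, v}), y ≠ s → (G.Adj x y ∨ s(x,y) = s(u,v)) → y ∈ D' := by
      intro x hx y hy hys hxy
      by_cases hxy2 : x = y
      · rw [← hxy2]; exact hx
      · exact hcl x hx y ⟨hy, hys⟩ ⟨hxy2, (hD' hx).1, hy, hxy⟩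
    have huv' : u ∈ D' → v ≠ s → v ∈ D' := fun h1 h2 => hcl' u h1 v (by simp) h2 (Or.inr rfl)
    have hvu' : v ∈ D' → u ≠ s → u ∈ D' := fun h1 h2 => hcl' v h1 u (by simp) h2 (Or.inr Sym2.eq_swap)
    have hDU : ∀ x ∈ D', x ∈ U ∧ x ≠ s := by
      intro x hx
      have := hD' hx
      refine ⟨?_, this.2⟩
      rw [h.mem]
      rcases (hm x).1 this.1 with h1 | h1 | h1 <;> simp [h1]
    by_cases hc : u ∈ D' ∨ v ∈ D'
    · -- extend by D2
      have key := hG.2.2 s (D' ∪ (D2 \ {s})) (by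
        rintro x (hx | hx)
        · exact ⟨(hDU x hx).1, (hDU x hx).2⟩
        · exact ⟨(h.mem x).2 (Or.inr (Or.inl hx.1)), hx.2⟩) (by
        obtain ⟨a, ha⟩ := hne; exact ⟨a, Or.inl ha⟩) (by
        rintro x hx y ⟨hyU, hys⟩ hxy
        have hys : y ≠ s := hys
        rcases (h.mem y).1 hyU with h1 | h1 | h1 | h1
        · rcases hx with hx | hx
          · exact Or.inl (hcl' x hx y ((hm y).2 (Or.inl h1)) hys (Or.inl hxy))
          · exact absurd hxy.symm (h.nadj y h1 x hx.1)
        · exact Or.inr ⟨h1, hys⟩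
        · subst h1
          rcases hc with hc | hc
          · exact Or.inl hc
          · exact Or.inl (hvu' hc hys)
        · subst h1
          rcases hc with hc | hc
          · exact Or.inl (huv' hc hys)
          · exact Or.inl hc)
      apply Set.Subset.antisymm hD'
      rintro x ⟨hx, hxs⟩
      have hxU : x ∈ U \ {s} := ⟨by rw [h.mem]; rcases (hm x).1 hx with h1 | h1 | h1 <;> simp [h1], hxs⟩
      rw [← key] at hxU
      rcases hxU with h1 | h1
      · exact h1
      · exfalso
        rcases (hm x).1 hx with h2 | h2 | h2
        · exact h.dis x h2 h1.1
        · subst h2; exact h.huD2 h1.1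
        · subst h2; exact h.hvD2 h1.1
    · push Not at hc
      have hD'D : ∀ x ∈ D', x ∈ D := by
        intro x hx
        rcases (hm x).1 (hD' hx).1 with h1 | h1 | h1
        · exact h1
        · subst h1; exact absurd hx hc.1
        · subst h1; exact absurd hx hc.2
      have key := hG.2.2 s D' (fun x hx => ⟨(hDU x hx).1, (hDU x hx).2⟩) hne (by
        rintro x hx y ⟨hyU, hys⟩ hxy
        apply hcl' x hx y _ hys (Or.inl hxy)
        rw [hm]
        rcases (h.mem y).1 hyU with h1 | h1 | h1
        · exact Or.inl h1
        · exact absurd hxy (h.nadj x (hD'D x hx) y h1)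
        · exact Or.inr h1)
      exfalso
      by_cases hus : u = s
      · have : v ∈ U \ {s} := ⟨h.hv, by subst hus; simpa using h.huv.symm⟩
        rw [← key] at this; exact hc.2 this
      · have : u ∈ U \ {s} := ⟨h.hu, hus⟩
        rw [← key] at this; exact hc.1 this

lemma Sep.good {G : SimpleGraph V} {U D D2 : Set V} {u v : V} (h : Sep G U D D2 u v) (hG : TwoConn G U) (hg : Good G) :
    Good (side G (D ∪ {u, v}) u v) := by
  obtain ⟨R, hRT, huR, hRc, hRcl⟩ := exists_comp G (D2 ∪ {u}) (u := u) (by simp)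
  have hm : ∀ x, x ∈ D ∪ {u, v} ↔ x ∈ D ∨ x = u ∨ x = v := by intro x; simp; tauto
  have hvR : v ∉ R := fun hv => by
    rcases hRT hv with h1 | h1
    · exact h.hvD2 h1
    · exact h.huv (by simpa using h1.symm)
  have hDR : ∀ x ∈ D, x ∉ R := fun x hx hxR => by
    rcases hRT hxR with h1 | h1
    · exact h.dis x hx h1
    · rw [Set.mem_singleton_iff] at h1; subst h1; exact h.huD hx
  have hadj : ∃ a ∈ R, G.Adj a v := by
    by_contra hcon; push Not at hcon
    by_cases hR1 : (R \ {u}).Nonempty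
    · have := hG.2.2 u (R \ {u}) (by
        rintro x ⟨hx, hxu⟩
        refine ⟨?_, hxu⟩
        rw [h.mem]
        rcases hRT hx with h1 | h1
        · simp [h1]
        · exact absurd h1 hxu) hR1 (by
        rintro x ⟨hx, hxu⟩ y ⟨hy, hyu⟩ hxy
        have hxD2 : x ∈ D2 := by
          rcases hRT hx with h1 | h1
          · exact h1
          · exact absurd h1 hxu
        refine ⟨?_, hyu⟩
        rcases (h.mem y).1 hy with h1 | h1 | h1 | h1
        · exact absurd hxy.symm (h.nadj y h1 x hxD2)
        · exact hRcl x hx y (Or.inl h1) hxy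
        · exact absurd h1 hyu
        · subst h1; exact absurd hxy (hcon x hx))
      have hv : v ∈ U \ {u} := ⟨h.hv, by simpa using h.huv.symm⟩
      rw [← this] at hv; exact hvR hv.1
    · have hR2 : ∀ x ∈ R, x = u := by
        intro x hx; by_contra hxu; exact hR1 ⟨x, hx, hxu⟩
      have := hG.2.2 v D2 (by
        intro x hx
        refine ⟨(h.mem x).2 (by simp [hx]), ?_⟩
        rintro rfl; exact h.hvD2 hx) h.neD2 (by
        rintro x hx y ⟨hy, hyv⟩ hxy
        rcases (h.mem y).1 hy with h1 | h1 | h1 | h1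
        · exact absurd hxy.symm (h.nadj y h1 x hx)
        · exact h1
        · subst h1
          have := hR2 x (hRcl y huR x (Or.inl hx) hxy.symm)
          subst this; exact absurd rfl hxy.ne
        · exact absurd h1 hyv)
      have hu : u ∈ U \ {v} := ⟨h.hu, by simpa using h.huv⟩
      rw [← this] at hu; exact h.huD2 hu
  refine hg.of (D ∪ {u, v}) (fun x y hxy => hxy.2.1) (fun x => if x = u then R else {x}) ?_ ?_ ?_ ?_
  · intro x _; split_ifs
    · exact ⟨u, huR⟩
    · exact ⟨x, rfl⟩
  · intro x _; split_ifs
    · exact hRc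
    · exact CC.singleton G x
  · intro x hx y hy hxy a hax hay
    have notR : ∀ w, w ∈ D ∪ {u, v} → w ≠ u → w ∉ R := by
      intro w hw hwu
      rcases (hm w).1 hw with h1 | h1 | h1
      · exact hDR w h1
      · exact absurd h1 hwu
      · subst h1; exact hvR
    split_ifs at hax hay with h1 h2 h2
    · exact hxy (h1.trans h2.symm)
    · rw [Set.mem_singleton_iff] at hay; subst hay; exact notR a hy h2 hax
    · rw [Set.mem_singleton_iff] at hax; subst hax; exact notR a hx h1 hay
    · rw [Set.mem_singleton_iff] at hax hay; exact hxy (hax.symm.trans hay)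
  · intro x y hxy
    have self : ∀ w, w ∈ (fun x => if x = u then R else {x}) w := by
      intro w; simp only; split_ifs with h1
      · subst h1; exact huR
      · rfl
    rcases hxy.2.2.2 with h1 | h1
    · exact ⟨x, self x, y, self y, h1⟩
    · obtain ⟨a, ha, hav⟩ := hadj
      rcases Sym2.eq_iff.1 h1 with ⟨rfl, rfl⟩ | ⟨rfl, rfl⟩
      · exact ⟨a, by simpa using ha, y, self y, hav⟩
      · exact ⟨x, self x, a, by simpa using ha, hav.symm⟩

lemma Sep.card_lt {G : SimpleGraph V} {U D D2 : Set V} {u v : V} (h : Sep G U D D2 u v) :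
    (D ∪ {u, v} : Set V).ncard < U.ncard := by
  apply Set.ncard_lt_ncard _ (Set.toFinite _)
  constructor
  · intro x hx
    rw [h.mem]
    rcases hx with h1 | h1
    · simp [h1]
    · simp at h1; tauto
  · intro hsub
    obtain ⟨a, ha⟩ := h.neD2
    rcases hsub ((h.mem a).2 (by simp [ha])) with h1 | h1 | h1
    · exact h.dis a h1 ha
    · subst h1; exact h.huD2 ha
    · rw [Set.mem_singleton_iff] at h1; subst h1; exact h.hvD2 ha

lemma Sep.tb {G : SimpleGraph V} {U D D2 : Set V} {u v : V} (h : Sep G U D D2 u v) (hG : TwoConn G U)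
    (h1 : HasTB (side G (D ∪ {u, v}) u v).edgeSet) (h2 : HasTB (side G (D2 ∪ {u, v}) u v).edgeSet) :
    HasTB G.edgeSet := by
  obtain ⟨ι, _, F, hF⟩ := h1
  obtain ⟨ι', _, F', hF'⟩ := h2
  set E1 := (side G (D ∪ {u, v}) u v).edgeSet with hE1
  set E2 := (side G (D2 ∪ {u, v}) u v).edgeSet with hE2
  have hm : ∀ x, x ∈ D ∪ {u, v} ↔ x ∈ D ∨ x = u ∨ x = v := by intro x; simp; tauto
  have hm2 : ∀ x, x ∈ D2 ∪ {u, v} ↔ x ∈ D2 ∨ x = u ∨ x = v := by intro x; simp; tauto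
  have e01 : s(u,v) ∈ E1 := ⟨h.huv, by simp, by simp, Or.inr rfl⟩
  have e02 : s(u,v) ∈ E2 := ⟨h.huv, by simp, by simp, Or.inr rfl⟩
  have hEsub : ∀ e, e ∈ E1 → e ∈ E2 → e = s(u,v) := by
    intro e
    induction e using Sym2.ind with
    | _ x y =>
      rintro ⟨hxy, hx, hy, _⟩ ⟨_, hx', hy', _⟩
      rw [hm] at hx hy; rw [hm2] at hx' hy'
      have aux : ∀ x, (x ∈ D ∨ x = u ∨ x = v) → (x ∈ D2 ∨ x = u ∨ x = v) → x = u ∨ x = v := by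
        intro x h1 h2
        rcases h1 with h1 | h1
        · rcases h2 with h2 | h2
          · exact absurd h2 (h.dis x h1)
          · exact h2
        · exact h1
      rcases aux x hx hx' with rfl | rfl <;> rcases aux y hy hy' with rfl | rfl
      · exact absurd rfl hxy
      · rfl
      · exact Sym2.eq_swap
      · exact absurd rfl hxy
  have hEG : E1 ∪ E2 = G.edgeSet ∪ {s(u,v)} := by
    ext e
    induction e using Sym2.ind with
    | _ x y =>
      constructor
      · rintro (⟨_, _, _, h1⟩ | ⟨_, _, _, h1⟩)
        · rcases h1 with h1 | h1
          · exact Or.inl h1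
          · exact Or.inr h1
        · rcases h1 with h1 | h1
          · exact Or.inl h1
          · exact Or.inr h1
      · rintro (h1 | h1)
        · have h1 : G.Adj x y := h1
          have hx := (h.mem x).1 (hG.2.1 _ _ h1)
          have hy := (h.mem y).1 (hG.2.1 _ _ h1.symm)
          by_cases hc : x ∈ D2 ∨ y ∈ D2
          · right
            refine ⟨h1.ne, (hm2 x).2 ?_, (hm2 y).2 ?_, Or.inl h1⟩
            · rcases hx with hx | hx
              · rcases hc with hc | hc
                · exact Or.inl hc
                · exact absurd h1 (h.nadj x hx y hc)
              · exact hx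
            · rcases hy with hy | hy
              · rcases hc with hc | hc
                · exact absurd h1.symm (h.nadj y hy x hc)
                · exact Or.inl hc
              · exact hy
          · push Not at hc
            left
            refine ⟨h1.ne, (hm x).2 ?_, (hm y).2 ?_, Or.inl h1⟩ <;> tauto
        · rw [Set.mem_singleton_iff] at h1
          rw [h1]; exact Or.inl e01
  have hsplit : ∀ z, Cyc (E1 ∪ E2) z → ∃ z1 z2, Cyc E1 z1 ∧ Cyc E2 z2 ∧ z = z1 + z2 := by
    intro z hz
    have hb0 : ∀ w, w ≠ u → w ≠ v → bd (res E1 z) w = 0 := by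
      intro w hwu hwv
      by_cases hwD : w ∈ D
      · have : bd (res E1 z) w = bd z w := by
          rw [bd_apply, bd_apply]
          apply Finset.sum_congr rfl
          intro x _
          rw [res]
          split_ifs with h1
          · rfl
          · by_contra h0
            rcases hz.1 _ (Ne.symm h0) with h2 | h2
            · exact h1 h2
            · have := (hm2 w).1 h2.2.1
              rcases this with h3 | h3 | h3
              · exact h.dis w hwD h3
              · exact hwu h3
              · exact hwv h3
        rw [this, hz.2]; rfl
      · rw [bd_apply]
        apply Finset.sum_eq_zero
        intro x _
        rw [res, if_neg]
        rintro ⟨_, h1, _⟩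
        rcases (hm w).1 h1 with h3 | h3 | h3
        · exact hwD h3
        · exact hwu h3
        · exact hwv h3
    have hsum : ∑ w, bd (res E1 z) w = 0 := by
      apply sum_bd
      intro e he
      have : e ∈ E1 := by
        by_contra h1; apply he; simp [res, h1]
      exact SimpleGraph.not_isDiag_of_mem_edgeSet _ this
    rw [Finset.sum_eq_add u v h.huv (fun w _ hw => hb0 w hw.1 hw.2) (by simp) (by simp)] at hsum
    have huv := z2_eq hsum
    set t := bd (res E1 z) u with ht
    have hc1 : Cyc E1 (res E1 z + t • dl s(u,v)) := by
      constructor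
      · intro e he
        by_contra h1
        apply he
        have : e ≠ s(u,v) := by rintro rfl; exact h1 e01
        simp [res, h1, dl, this]
      · rw [map_add, map_smul, bd_dl h.huv]
        funext w
        by_cases hwu : w = u
        · subst hwu
          simp [dl, h.huv, ← ht, z2_add]
        · by_cases hwv : w = v
          · subst hwv; simp [dl, h.huv.symm, ← huv, z2_add]
          · simp [dl, hwu, hwv, hb0 w hwu hwv]
    refine ⟨res E1 z + t • dl s(u,v), z + (res E1 z + t • dl s(u,v)), hc1, ⟨?_, ?_⟩, ?_⟩
    · intro e he
      by_contra h1
      apply he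
      have hne : e ≠ s(u,v) := by rintro rfl; exact h1 e02
      by_cases h2 : e ∈ E1
      · simp [res, h2, dl, hne, z2_add]
      · have : z e = 0 := by
          by_contra h0
          rcases hz.1 e h0 with h3 | h3
          · exact h2 h3
          · exact h1 h3
        simp [res, h2, dl, hne, this]
    · rw [map_add, hc1.2, hz.2, add_zero]
    · rw [add_comm z, ← add_assoc, ch_add, zero_add]
  obtain ⟨a, b, hab, ha, hb, _⟩ := hF.two _ e01
  obtain ⟨a', b', hab', ha', hb', _⟩ := hF'.two _ e02
  have hd : ¬ (s(u,v)).IsDiag := by simpa using h.huv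
  have hT := hF.sum2 hF' hd hEsub hb ha' hsplit
  by_cases huvG : G.Adj u v
  · rw [hEG, Set.union_eq_self_of_subset_right (by simpa using huvG)] at hT
    exact ⟨_, _, _, hT⟩
  · have hcom : ∀ e', F a e' = 1 → F' b' e' = 1 → e' = s(u,v) := by
      intro e' h1 h2
      exact hEsub e' ((hF.cyc a).1 e' (by rw [h1]; decide)) ((hF'.cyc b').1 e' (by rw [h2]; decide))
    have hT2 := hT.remove (i := Sum.inl a) (j := Sum.inr ⟨b', hab'.symm⟩) (e := s(u,v)) (by simp) (by simp [hab, ha])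
      (by simp [hb']) (by
        intro e'
        simp only [Sum.elim_inl, Sum.elim_inr, if_neg hab]
        exact hcom e') (by
        simp only [Sum.elim_inl, Sum.elim_inr, if_neg hab]
        intro heq
        exact hd (bd_single (hF.cyc a).2 (fun e he => hcom e he (by rw [← heq]; exact he)) ha))
    have : (E1 ∪ E2) \ {s(u,v)} = G.edgeSet := by
      rw [hEG, Set.union_sdiff_right, Set.sdiff_singleton_eq_self]
      exact huvG
    rw [this] at hT2
    exact ⟨_, _, _, hT2⟩

lemma sep_of_not {G : SimpleGraph V} {U : Set V} (hG : TwoConn G U) {u v : V} (h : ¬ CC G (U \ {u, v})) :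
    ∃ D D2, Sep G U D D2 u v := by
  have aux : ∀ u v : V, ¬ CC G (U \ {u, v}) → u ∈ U := by
    intro u v h
    by_contra hu
    apply h
    have : U \ {u, v} = U \ {v} := by
      ext x; simp only [Set.mem_sdiff, Set.mem_insert_iff, Set.mem_singleton_iff]
      constructor
      · tauto
      · rintro ⟨h1, h2⟩
        refine ⟨h1, ?_⟩
        rintro (rfl | rfl)
        · exact hu h1
        · exact h2 rfl
    rw [this]; exact hG.2.2 v
  have huv : u ≠ v := by
    rintro rfl; apply h; simpa using hG.2.2 u
  have hu := aux u v h
  have hv := aux v u (by rw [Set.pair_comm]; exact h)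
  unfold CC at h; push Not at h
  obtain ⟨D, hD, hne, hcl, hneq⟩ := h
  refine ⟨D, (U \ {u, v}) \ D, hu, hv, huv, ?_, ?_, ?_, ?_, ?_, ?_, hne, ?_, ?_⟩
  · intro x
    constructor
    · intro hx
      by_cases hxu : x = u
      · simp [hxu]
      · by_cases hxv : x = v
        · simp [hxv]
        · by_cases hxD : x ∈ D
          · simp [hxD]
          · right; left; exact ⟨⟨hx, by simp [hxu, hxv]⟩, hxD⟩
    · rintro (h1 | h1 | rfl | rfl)
      · exact (hD h1).1
      · exact h1.1.1
      · exact hu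
      · exact hv
  · intro x hx h2; exact h2.2 hx
  · intro h1; simpa using (hD h1).2
  · intro h1; simpa using (hD h1).2
  · intro h1; simpa using h1.1.2
  · intro h1; simpa using h1.1.2
  · by_contra h0
    rw [Set.not_nonempty_iff_eq_empty, Set.sdiff_eq_empty] at h0
    exact hneq (Set.Subset.antisymm hD h0)
  · intro x hx y hy hxy
    exact hy.2 (hcl x hx y hy.1 hxy)

end T6

end

section
open SimpleGraph Finset
open scoped Classical
set_option linter.unusedSectionVars false
set_option linter.unusedVariables false
set_option linter.unusedSimpArgs false
set_option linter.unnecessarySeqFocus false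

namespace T6
variable {V : Type*} [Fintype V]

structure Frag (G : SimpleGraph V) (U : Set V) (a b c : V) (D : Set V) : Prop where
  ne : D.Nonempty
  sub : ∀ p ∈ D, p ∈ U ∧ p ≠ a ∧ p ≠ b ∧ p ≠ c
  cl : ∀ p ∈ D, ∀ q ∈ U, q ≠ a → q ≠ b → q ≠ c → G.Adj p q → q ∈ D
  out : ∃ q ∈ U, q ≠ a ∧ q ≠ b ∧ q ≠ c ∧ q ∉ D

lemma Frag.perm {G : SimpleGraph V} {U : Set V} {a b c : V} {D : Set V} (h : Frag G U a b c D) :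
    Frag G U b c a D :=
  ⟨h.ne, fun p hp => by have := h.sub p hp; tauto, fun p hp q hq h1 h2 h3 => h.cl p hp q hq h3 h1 h2, by
    obtain ⟨q, hq⟩ := h.out; exact ⟨q, by tauto⟩⟩

lemma Frag.nb {G : SimpleGraph V} {U : Set V} {a b c : V} {D : Set V} (h : Frag G U a b c D)
    (h3 : ∀ u v, CC G (U \ {u, v})) : (∃ v ∈ D, G.Adj c v) ∧ c ≠ a ∧ c ≠ b := by
  have key : ¬ (∀ p ∈ D, ∀ q ∈ U, q ≠ a → q ≠ b → G.Adj p q → q ∈ D) := by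
    intro hcl
    have := h3 a b D (fun p hp => ⟨(h.sub p hp).1, by have := h.sub p hp; simp; tauto⟩) h.ne
      (fun p hp q hq hpq => hcl p hp q hq.1 (by have := hq.2; simp at this; tauto) (by have := hq.2; simp at this; tauto) hpq)
    obtain ⟨q, hq, h1, h2, h3, h4⟩ := h.out
    apply h4; rw [this]; exact ⟨hq, by simp [h1, h2]⟩
  push Not at key
  obtain ⟨p, hp, q, hq, hqa, hqb, hpq, hqD⟩ := key
  have : q = c := by
    by_contra hqc
    exact hqD (h.cl p hp q hq hqa hqb hqc hpq)
  subst this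
  exact ⟨⟨p, hp, hpq.symm⟩, hqa, hqb⟩

lemma frag_of_not {G : SimpleGraph V} {U : Set V} {a b c : V} (h : ¬ CC G (U \ {a, b, c})) :
    ∃ D, Frag G U a b c D := by
  unfold CC at h; push Not at h
  obtain ⟨D, hD, hne, hcl, hneq⟩ := h
  refine ⟨D, hne, ?_, ?_, ?_⟩
  · intro p hp; have := hD hp; simp at this; tauto
  · intro p hp q hq h1 h2 h3 hpq
    exact hcl p hp q ⟨hq, by simp [h1, h2, h3]⟩ hpq
  · by_contra hh; push Not at hh
    apply hneq
    apply Set.Subset.antisymm hD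
    intro q hq
    have h2 := hq.2
    simp only [Set.mem_insert_iff, Set.mem_singleton_iff, not_or] at h2
    exact hh q hq.1 h2.1 h2.2.1 h2.2.2

lemma exists_contractible {G : SimpleGraph V} {U : Set V} (hne : ∃ x y, G.Adj x y)
    (h3 : ∀ u v, CC G (U \ {u, v})) :
    ∃ x y, G.Adj x y ∧ ∀ z, CC G (U \ {x, y, z}) := by
  by_contra hcon; push Not at hcon
  have main : ∀ n, ∀ x y z D, G.Adj x y → Frag G U x y z D → D.ncard = n → False := by
    intro n
    induction n using Nat.strong_induction_on with
    | _ n ih =>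
      intro x y z D hxy hD hn
      obtain ⟨⟨v, hv, hzv⟩, hzx, hzy⟩ := hD.nb h3
      obtain ⟨w, hw⟩ := hcon z v hzv
      obtain ⟨D', hD'⟩ := frag_of_not hw
      -- choose a side avoiding x and y
      have hvs := hD.sub v hv
      obtain ⟨D1, hD1, hx1, hy1⟩ : ∃ D1, Frag G U z v w D1 ∧ x ∉ D1 ∧ y ∉ D1 := by
        by_cases hc : x ∈ D' ∨ y ∈ D'
        · refine ⟨{q | q ∈ U ∧ q ≠ z ∧ q ≠ v ∧ q ≠ w ∧ q ∉ D'}, ⟨?_, ?_, ?_, ?_⟩, ?_, ?_⟩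
          · exact hD'.out
          · intro p hp; exact ⟨hp.1, hp.2.1, hp.2.2.1, hp.2.2.2.1⟩
          · intro p hp q hq h1 h2 h3' hpq
            exact ⟨hq, h1, h2, h3', fun hqD => hp.2.2.2.2 (hD'.cl q hqD p hp.1 hp.2.1 hp.2.2.1 hp.2.2.2.1 hpq.symm)⟩
          · obtain ⟨q, hq⟩ := hD'.ne
            have := hD'.sub q hq
            exact ⟨q, this.1, this.2.1, this.2.2.1, this.2.2.2, fun h => h.2.2.2.2 hq⟩
          · rintro ⟨h1, h2, h3', h4, h5⟩
            rcases hc with hc | hc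
            · exact h5 hc
            · exact h5 (hD'.cl y hc x h1 h2 h3' h4 hxy.symm)
          · rintro ⟨h1, h2, h3', h4, h5⟩
            rcases hc with hc | hc
            · exact h5 (hD'.cl x hc y h1 h2 h3' h4 hxy)
            · exact h5 hc
        · push Not at hc
          exact ⟨D', hD', hc.1, hc.2⟩
      obtain ⟨⟨q, hq, hvq⟩, _⟩ := hD1.perm.perm.nb h3
      have hqs := hD1.sub q hq
      have hqD : q ∈ D := hD.cl v hv q hqs.1 (by rintro rfl; exact hx1 hq) (by rintro rfl; exact hy1 hq) hqs.2.1 hvq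
      have hf : Frag G U z v w (D ∩ D1) := by
        refine ⟨⟨q, hqD, hq⟩, fun p hp => hD1.sub p hp.2, ?_, ?_⟩
        · intro p hp r hr h1 h2 h3' hpr
          have hr1 := hD1.cl p hp.2 r hr h1 h2 h3' hpr
          exact ⟨hD.cl p hp.1 r hr (by rintro rfl; exact hx1 hr1) (by rintro rfl; exact hy1 hr1) h1 hpr, hr1⟩
        · obtain ⟨r, hr⟩ := hD1.out
          exact ⟨r, hr.1, hr.2.1, hr.2.2.1, hr.2.2.2.1, fun h => hr.2.2.2.2 h.2⟩
      refine ih _ ?_ z v w (D ∩ D1) hzv hf rfl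
      rw [← hn]
      apply Set.ncard_lt_ncard _ (Set.toFinite _)
      refine ⟨Set.inter_subset_left, fun h => ?_⟩
      exact (hD1.sub v (h hv).2).2.2.1 rfl
  obtain ⟨x, y, hxy⟩ := hne
  obtain ⟨z, hz⟩ := hcon x y hxy
  obtain ⟨D, hD⟩ := frag_of_not hz
  exact main _ x y z D hxy hD rfl

/-- contraction of y into x -/
def ctr (G : SimpleGraph V) (x y : V) : SimpleGraph V where
  Adj a b := a ≠ b ∧ a ≠ y ∧ b ≠ y ∧ (G.Adj a b ∨ (a = x ∧ G.Adj y b) ∨ (b = x ∧ G.Adj a y))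
  symm := ⟨fun a b h => ⟨h.1.symm, h.2.2.1, h.2.1, by
    rcases h.2.2.2 with h | h | h
    · exact Or.inl h.symm
    · exact Or.inr (Or.inr ⟨h.1, h.2.symm⟩)
    · exact Or.inr (Or.inl ⟨h.1, h.2.symm⟩)⟩⟩
  loopless := ⟨fun x h => h.1 rfl⟩

def dv (G : SimpleGraph V) (v : V) : SimpleGraph V where
  Adj a b := G.Adj a b ∧ a ≠ v ∧ b ≠ v
  symm := ⟨fun a b h => ⟨h.1.symm, h.2.2, h.2.1⟩⟩
  loopless := ⟨fun x h => h.1.ne rfl⟩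

lemma dv_ctr {G : SimpleGraph V} {x y a b : V} :
    (dv (ctr G x y) x).Adj a b ↔ G.Adj a b ∧ a ≠ x ∧ a ≠ y ∧ b ≠ x ∧ b ≠ y := by
  simp only [dv, ctr]
  constructor
  · rintro ⟨⟨h1, h2, h3, h4⟩, h5, h6⟩
    rcases h4 with h4 | h4 | h4
    · tauto
    · exact absurd h4.1 h5
    · exact absurd h4.1 h6
  · rintro ⟨h1, h2, h3, h4, h5⟩
    exact ⟨⟨h1.ne, h3, h5, Or.inl h1⟩, h2, h4⟩

lemma ctr_two {G : SimpleGraph V} {U : Set V} (hG : TwoConn G U) {x y : V} (hxy : G.Adj x y)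
    (h3 : ∀ u v, CC G (U \ {u, v})) (hc : 4 ≤ U.ncard) : TwoConn (ctr G x y) (U \ {y}) := by
  have hyU := hG.2.1 _ _ hxy.symm
  have hxU := hG.2.1 _ _ hxy
  refine ⟨?_, ?_, ?_⟩
  · rw [Set.ncard_sdiff_singleton_of_mem hyU]; omega
  · rintro a b ⟨h1, h2, h3, h4⟩
    refine ⟨?_, h2⟩
    rcases h4 with h4 | h4 | h4
    · exact hG.2.1 _ _ h4
    · rw [h4.1]; exact hxU
    · exact hG.2.1 _ _ h4.2
  · intro s D hD hne hcl
    have hDs : ∀ a ∈ D, a ∈ U ∧ a ≠ y ∧ a ≠ s := fun a ha => ⟨(hD ha).1.1, (hD ha).1.2, (hD ha).2⟩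
    have hcl' : ∀ a ∈ D, ∀ b ∈ U, b ≠ y → b ≠ s → G.Adj a b → b ∈ D := fun a ha b hb h1 h2 hab =>
      hcl a ha b ⟨⟨hb, h1⟩, h2⟩ ⟨hab.ne, (hDs a ha).2.1, h1, Or.inl hab⟩
    by_cases hsx : s = x
    · subst hsx
      have := h3 s y D (fun a ha => ⟨(hDs a ha).1, by have := hDs a ha; simp; tauto⟩) hne
        (fun a ha b hb hab => hcl' a ha b hb.1 (fun h => hb.2 (by simp [h])) (fun h => hb.2 (by simp [h])) hab)
      rw [this]; ext a; simp; tauto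
    · have hccs : ∃ S : Set V, (∀ a, a ∈ S ↔ a = s ∧ s ≠ y) ∧ CC G (U \ S) := by
        by_cases hsy : s = y
        · exact ⟨∅, by simp [hsy], by simpa using hG.cc⟩
        · exact ⟨{s}, by simp [hsy], hG.2.2 s⟩
      obtain ⟨S, hS, hcc⟩ := hccs
      have := hcc {a | a ∈ D ∨ (a = y ∧ x ∈ D ∧ s ≠ y) ∨ (a = y ∧ x ∈ D)} (by
        rintro a (ha | ha | ha)
        · exact ⟨(hDs a ha).1, fun h => (hDs a ha).2.2 ((hS a).1 h).1⟩
        · exact ⟨by rw [ha.1]; exact hyU, fun h => ((hS a).1 h).2 (((hS a).1 h).1.symm.trans ha.1)⟩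
        · exact ⟨by rw [ha.1]; exact hyU, fun h => ((hS a).1 h).2 (((hS a).1 h).1.symm.trans ha.1)⟩)
        (by obtain ⟨a, ha⟩ := hne; exact ⟨a, Or.inl ha⟩) (by
        intro a ha b hb hab
        have hbs : b ≠ y → b ≠ s := by
          rintro h1 rfl; exact hb.2 ((hS b).2 ⟨rfl, h1⟩)
        by_cases hby : b = y
        · subst hby
          right; right
          refine ⟨rfl, ?_⟩
          rcases ha with ha | ha | ha
          · by_cases hax : a = x
            · rw [← hax]; exact ha
            · refine hcl a ha x ⟨⟨hxU, by simpa using hxy.ne⟩, by simpa using Ne.symm hsx⟩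
                ⟨hax, (hDs a ha).2.1, hxy.ne, Or.inr (Or.inr ⟨rfl, hab⟩)⟩
          · exact ha.2.1
          · exact ha.2
        · left
          have aux : x ∈ D → G.Adj y b → b ∈ D := by
            intro hx hyb
            by_cases hbx : b = x
            · rw [hbx]; exact hx
            · exact hcl x hx b ⟨⟨hb.1, hby⟩, hbs hby⟩ ⟨Ne.symm hbx, hxy.ne, hby, Or.inr (Or.inl ⟨rfl, hyb⟩)⟩
          rcases ha with ha | ha | ha
          · exact hcl' a ha b hb.1 hby (hbs hby) hab
          · exact aux ha.2.1 (ha.1 ▸ hab)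
          · exact aux ha.2 (ha.1 ▸ hab))
      apply Set.Subset.antisymm hD
      rintro a ⟨⟨ha, hay⟩, has⟩
      have h1 : a ∈ U \ S := ⟨ha, fun h => has ((hS a).1 h).1⟩
      rw [← this] at h1
      rcases h1 with h1 | h1 | h1
      · exact h1
      · exact absurd h1.1 hay
      · exact absurd h1.1 hay

lemma ctr_good {G : SimpleGraph V} {x y : V} (hxy : G.Adj x y) (hg : Good G) : Good (ctr G x y) := by
  refine hg.of {y}ᶜ (fun a b h => h.2.1) (fun a => if a = x then {x, y} else {a}) ?_ ?_ ?_ ?_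
  · intro a _; split_ifs
    · exact ⟨x, by simp⟩
    · exact ⟨a, rfl⟩
  · intro a _; split_ifs
    · exact CC.pair hxy
    · exact CC.singleton G a
  · intro a ha b hb hab c hca hcb
    have ha : a ≠ y := ha
    have hb : b ≠ y := hb
    split_ifs at hca hcb <;> simp_all
  · have self : ∀ w, w ∈ (fun a => if a = x then ({x, y} : Set V) else {a}) w := by
      intro w; simp only; split_ifs with h1
      · simp [h1]
      · rfl
    rintro a b ⟨h1, h2, h3, h4⟩
    rcases h4 with h4 | h4 | h4
    · exact ⟨a, self a, b, self b, h4⟩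
    · exact ⟨y, by simp [h4.1], b, self b, h4.2⟩
    · exact ⟨a, self a, y, by simp [h4.1], h4.2⟩

lemma del_two {G : SimpleGraph V} {U : Set V} (hG : TwoConn G U) {x y : V} (hxy : G.Adj x y)
    (hc : ∀ z, CC G (U \ {x, y, z})) (h5 : 5 ≤ U.ncard) : TwoConn (dv (ctr G x y) x) (U \ {x, y}) := by
  have hyU := hG.2.1 _ _ hxy.symm
  have hxU := hG.2.1 _ _ hxy
  refine ⟨?_, ?_, ?_⟩
  · have h1 := Set.ncard_sdiff (s := {x, y}) (t := U) (by
      rintro a (rfl | h)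
      · exact hxU
      · rw [Set.mem_singleton_iff] at h; rw [h]; exact hyU) (Set.toFinite _)
    have h2 := Set.ncard_pair hxy.ne
    omega
  · intro a b hab
    rw [dv_ctr] at hab
    exact ⟨hG.2.1 _ _ hab.1, by simp; tauto⟩
  · intro z
    have h1 : (U \ {x, y}) \ {z} = U \ {x, y, z} := by ext a; simp; tauto
    rw [h1]
    intro D hD hne hcl
    refine hc z D hD hne ?_
    intro a ha b hb hab
    refine hcl a ha b hb (dv_ctr.2 ⟨hab, ?_⟩)
    have h1 := (hD ha).2
    have h2 := hb.2
    simp at h1 h2; tauto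

lemma tb_dv {H : SimpleGraph V} {U : Set V} (hH : TwoConn H U) {v : V} {U' : Set V} (hK : TwoConn (dv H v) U')
    (hv : ∃ a, H.Adj v a) (hT : HasTB H.edgeSet) :
    ∃ (ι : Type) (_ : Fintype ι) (F : ι → Ch V) (i0 : ι), IsTB (dv H v).edgeSet F ∧
      ∀ a, H.Adj v a → ∃ b, F i0 s(a,b) = 1 := by
  obtain ⟨ι, _, F, hF⟩ := hT
  set t : ι → Prop := fun i => ∃ w, F i s(v,w) = 1 with ht
  have hsub : (dv H v).edgeSet ⊆ H.edgeSet := by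
    intro e; induction e using Sym2.ind with
    | _ a b => exact fun h => h.1
  have hmemK : ∀ e, e ∈ H.edgeSet → (∀ w, e ≠ s(v,w)) → e ∈ (dv H v).edgeSet := by
    intro e; induction e using Sym2.ind with
    | _ a b =>
      intro h h2
      refine ⟨h, ?_, ?_⟩
      · rintro rfl; exact h2 b rfl
      · rintro rfl; exact h2 a Sym2.eq_swap
  have hKv : ∀ e ∈ (dv H v).edgeSet, ∀ w, e ≠ s(v,w) := by
    rintro e he w rfl
    exact he.2.1 rfl
  -- coefficients of cycles of K are constant on touching faces
  have hconst : ∀ c : ι → ZMod 2, (∀ w, (∑ i, c i • F i) s(v,w) = 0) → ∀ i j, t i → t j → c i = c j := by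
    rintro c hc i j ⟨a, ha⟩ ⟨b, hb⟩
    refine hF.link hH v c ?_ ha hb
    intro w j k hj hk
    by_cases hjk : j = k
    · rw [hjk]
    · have := hF.eval hjk hj hk c
      rw [hc] at this; exact z2_eq this.symm
  -- each K-edge has at most one touching face
  have hone : ∀ e ∈ (dv H v).edgeSet, ∀ i j, F i e = 1 → F j e = 1 → t i → t j → i = j := by
    intro e he i j hi hj hti htj
    by_contra hij
    obtain ⟨z, hz, hze⟩ := hK.edge_cyc he
    obtain ⟨c, hc⟩ := hF.span z (hz.mono hsub)
    have h1 := hconst c (by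
      intro w; rw [← hc]; by_contra h0; exact hKv _ (hz.1 _ h0) w rfl) i j hti htj
    have h2 := hF.eval hij hi hj c
    rw [← hc, hze, h1, z2_add] at h2
    exact absurd h2 (by decide)
  have htv : ∀ w i, F i s(v,w) = 1 → t i := fun w i h => ⟨w, h⟩
  set C : Ch V := ∑ i, (if t i then 1 else 0 : ZMod 2) • F i with hC
  have hCe : ∀ e, ∀ i j, i ≠ j → F i e = 1 → F j e = 1 → C e = (if t i then 1 else 0) + (if t j then 1 else 0) := by
    intro e i j hij hi hj
    rw [hC, hF.eval hij hi hj]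
  have hCcyc : Cyc (dv H v).edgeSet C := by
    have h1 := hF.sum_cyc (fun i => if t i then 1 else 0)
    refine ⟨fun e he => hmemK e (h1.1 e he) ?_, h1.2⟩
    rintro w rfl
    obtain ⟨i, j, hij, hi, hj, _⟩ := hF.two _ (h1.1 _ he)
    rw [hCe _ i j hij hi hj, if_pos (htv w i hi), if_pos (htv w j hj)] at he
    exact he (by decide)
  have hCt : ∀ e ∈ (dv H v).edgeSet, ∀ i, F i e = 1 → t i → C e = 1 := by
    intro e he i hi hti
    obtain ⟨j, hji, hj⟩ := hF.other hi
    have : ¬ t j := fun htj => hji (hone e he j i hj hi htj hti)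
    rw [hCe e i j hji.symm hi hj, if_pos hti, if_neg this, add_zero]
  have hmeet : ∀ a, H.Adj v a → ∃ b, C s(a,b) = 1 := by
    intro a ha
    obtain ⟨i, j, hij, hi, hj, _⟩ := hF.two s(v,a) ha
    have hb := congrFun (hF.cyc i).2 a
    rw [bd_apply] at hb
    have hav : F i s(a,v) = 1 := by rw [Sym2.eq_swap]; exact hi
    obtain ⟨b, hbv, hb1⟩ : ∃ b, b ≠ v ∧ F i s(a,b) = 1 := by
      by_contra hh; push Not at hh
      rw [Finset.sum_eq_single v (fun b _ hbv => z2_ne1 (hh b hbv)) (by simp), hav] at hb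
      exact absurd hb (by simp)
    refine ⟨b, hCt _ (hmemK _ ((hF.cyc i).1 _ (by rw [hb1]; decide)) ?_) i hb1 (htv a i hi)⟩
    intro w hw
    rcases Sym2.eq_iff.1 hw with h | h
    · exact ha.ne h.1.symm
    · exact hbv h.2
  refine ⟨Option {i // ¬ t i}, inferInstance, fun k => k.elim C (fun i => F i.1), none, ⟨?_, ?_, ?_, ?_⟩, hmeet⟩
  · rintro (_ | ⟨i, hi⟩)
    · exact hCcyc
    · refine ⟨fun e he => hmemK e ((hF.cyc i).1 e he) ?_, (hF.cyc i).2⟩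
      rintro w rfl
      exact hi ⟨w, z2_ne he⟩
  · rintro (_ | ⟨i, hi⟩)
    · intro h0
      obtain ⟨a, ha⟩ := hv
      obtain ⟨b, hb⟩ := hmeet a ha
      have h0 : C = 0 := h0
      rw [h0] at hb; exact absurd hb (by simp)
    · exact hF.ne i
  · intro e he
    obtain ⟨i, j, hij, hi, hj, hk⟩ := hF.two e (hsub he)
    by_cases hti : t i
    · have htj : ¬ t j := fun htj => hij (hone e he i j hi hj hti htj)
      refine ⟨none, some ⟨j, htj⟩, by simp, hCt e he i hi hti, hj, ?_⟩
      rintro (_ | ⟨k, hkt⟩) h1 h2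
      · exact absurd rfl h1
      · exact hk k (by rintro rfl; exact hkt hti) (by rintro rfl; exact h2 rfl)
    · by_cases htj : t j
      · refine ⟨none, some ⟨i, hti⟩, by simp, hCt e he j hj htj, hi, ?_⟩
        rintro (_ | ⟨k, hkt⟩) h1 h2
        · exact absurd rfl h1
        · exact hk k (by rintro rfl; exact h2 rfl) (by rintro rfl; exact hkt htj)
      · refine ⟨some ⟨i, hti⟩, some ⟨j, htj⟩, by simpa using hij, hi, hj, ?_⟩
        rintro (_ | ⟨k, hkt⟩) h1 h2
        · show C e = 0
          rw [hCe e i j hij hi hj, if_neg hti, if_neg htj, add_zero]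
        · exact hk k (by rintro rfl; exact h1 rfl) (by rintro rfl; exact h2 rfl)
  · intro z hz
    obtain ⟨c, hc⟩ := hF.span z (hz.mono hsub)
    have h1 := hconst c (by
      intro w; rw [← hc]; by_contra h0; exact hKv _ (hz.1 _ h0) w rfl)
    obtain ⟨a, ha⟩ := hv
    obtain ⟨i0, _, _, hi0, _⟩ := hF.two s(v,a) ha
    refine ⟨fun k => k.elim (c i0) (fun i => c i.1), ?_⟩
    rw [Fintype.sum_option]
    simp only [Option.elim_none, Option.elim_some]
    rw [hc, hC, Finset.smul_sum, ← Finset.sum_filter_add_sum_filter_not Finset.univ t]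
    congr 1
    · rw [← Finset.sum_filter_add_sum_filter_not (s := Finset.univ) (f := fun i => c i0 • ((if t i then (1:ZMod 2) else 0) • F i)) t]
      rw [Finset.sum_eq_zero (s := Finset.univ.filter fun x => ¬ t x), add_zero]
      · apply Finset.sum_congr rfl
        intro i hi
        have hi : t i := (Finset.mem_filter.1 hi).2
        rw [if_pos hi, one_smul, h1 i i0 hi (htv a i0 hi0)]
      · intro i hi
        have hi : ¬ t i := (Finset.mem_filter.1 hi).2
        simp [hi]
    · rw [Finset.sum_subtype (p := fun i => ¬ t i)]
      intro x; simp
end T6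

end

section
open SimpleGraph Finset
open scoped Classical
set_option linter.unusedSectionVars false
set_option linter.unusedVariables false
set_option linter.unusedSimpArgs false
set_option linter.unnecessarySeqFocus false

namespace T6
variable {V : Type*} [Fintype V]

/-- cyclic sequences of vertices -/
structure IsCy (c : ℕ → V) (k : ℕ) : Prop where
  k3 : 3 ≤ k
  per : ∀ n, c (n + k) = c n
  inj : ∀ m n, m < k → n < k → c m = c n → m = n

lemma IsCy.modk {c : ℕ → V} {k : ℕ} (h : IsCy c k) (n : ℕ) : c (n % k) = c n :=
  Function.Periodic.map_mod_nat (f := c) h.per n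

lemma IsCy.inj' {c : ℕ → V} {k : ℕ} (h : IsCy c k) {m n : ℕ} (hc : c m = c n) : m % k = n % k := by
  have := h.k3
  apply h.inj _ _ (Nat.mod_lt _ (by omega)) (Nat.mod_lt _ (by omega))
  rw [h.modk, h.modk, hc]

lemma IsCy.rot {c : ℕ → V} {k : ℕ} (h : IsCy c k) (s : ℕ) : IsCy (fun n => c (n + s)) k := by
  refine ⟨h.k3, fun n => ?_, fun m n hm hn hc => ?_⟩
  · show c (n + k + s) = c (n + s)
    rw [show n + k + s = n + s + k by ring, h.per]
  · have h1 : (m + s) ≡ (n + s) [MOD k] := h.inj' hc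
    have h2 : m ≡ n [MOD k] := Nat.ModEq.add_right_cancel' s h1
    rwa [Nat.ModEq, Nat.mod_eq_of_lt hm, Nat.mod_eq_of_lt hn] at h2

lemma IsCy.ne1 {c : ℕ → V} {k : ℕ} (h : IsCy c k) (n : ℕ) : c n ≠ c (n+1) := by
  intro hc
  have hr := (h.rot n).inj 0 1 (by have := h.k3; omega) (by have := h.k3; omega) (by simpa [add_comm] using hc)
  omega

lemma IsCy.ne2 {c : ℕ → V} {k : ℕ} (h : IsCy c k) (n : ℕ) : c n ≠ c (n+2) := by
  intro hc
  have hr := (h.rot n).inj 0 2 (by have := h.k3; omega) (by have := h.k3; omega) (by simpa [add_comm] using hc)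
  omega

lemma IsCy.edge {c : ℕ → V} {k : ℕ} (h : IsCy c k) {m n : ℕ} (hm : m < k) (hn : n < k)
    (he : s(c m, c (m+1)) = s(c n, c (n+1))) : m = n := by
  rw [Sym2.eq_iff] at he
  rcases he with he | he
  · exact h.inj m n hm hn he.1
  · exfalso
    have h3 := h.k3
    have h1 : m ≡ n + 1 [MOD k] := h.inj' he.1
    have h2 : m + 1 ≡ n [MOD k] := h.inj' he.2
    have h4 : n + 2 ≡ n + 0 [MOD k] := ((h1.add_right 1).symm.trans h2)
    have h5 : 2 ≡ 0 [MOD k] := Nat.ModEq.add_left_cancel' n h4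
    rw [Nat.ModEq, Nat.mod_eq_of_lt (by omega), Nat.mod_eq_of_lt (by omega)] at h5
    omega

noncomputable def seg (c : ℕ → V) (i j : ℕ) : Ch V := ∑ t ∈ Finset.Ico i j, dl s(c t, c (t+1))

lemma seg_app (c : ℕ → V) (i j : ℕ) (e : Sym2 V) :
    seg c i j e = ∑ t ∈ Finset.Ico i j, dl s(c t, c (t+1)) e := by
  simp [seg, Finset.sum_apply]

lemma seg_cons (c : ℕ → V) {i j l : ℕ} (h1 : i ≤ j) (h2 : j ≤ l) : seg c i j + seg c j l = seg c i l :=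
  Finset.sum_Ico_consecutive _ h1 h2

lemma seg_nz {c : ℕ → V} {i j : ℕ} {e : Sym2 V} (h : seg c i j e ≠ 0) :
    ∃ t, i ≤ t ∧ t < j ∧ e = s(c t, c (t+1)) := by
  by_contra hh; push Not at hh
  apply h; rw [seg_app]
  apply Finset.sum_eq_zero
  intro t ht
  rw [Finset.mem_Ico] at ht
  exact dl_ne (hh t ht.1 ht.2)

lemma IsCy.seg_eval {c : ℕ → V} {k : ℕ} (h : IsCy c k) {i j t : ℕ} (hj : j ≤ k) (ht : t < k) :
    seg c i j s(c t, c (t+1)) = if i ≤ t ∧ t < j then 1 else 0 := by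
  split_ifs with hc
  · rw [seg_app, Finset.sum_eq_single t]
    · exact dl_self _
    · intro b hb hbt
      rw [Finset.mem_Ico] at hb
      exact dl_ne fun he => hbt (h.edge ht (by omega) he).symm
    · intro hn; exact absurd (Finset.mem_Ico.2 hc) hn
  · by_contra h0
    obtain ⟨t', h1, h2, h3⟩ := seg_nz h0
    have := h.edge ht (by omega) h3
    subst this; exact hc ⟨h1, h2⟩

lemma IsCy.bd_seg {c : ℕ → V} {k : ℕ} (h : IsCy c k) {i j : ℕ} (hij : i ≤ j) :
    bd (seg c i j) = dl (c i) + dl (c j) := by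
  induction j, hij using Nat.le_induction with
  | base => simp [seg, ch_add]
  | succ j hj ih =>
    have : seg c i (j+1) = seg c i j + dl s(c j, c (j+1)) := by
      rw [seg, Finset.sum_Ico_succ_top hj]; rfl
    rw [this, map_add, ih, bd_dl (h.ne1 j)]
    have := ch_add (dl (c j))
    calc dl (c i) + dl (c j) + (dl (c j) + dl (c (j+1))) = dl (c i) + (dl (c j) + dl (c j)) + dl (c (j+1)) := by abel
      _ = _ := by rw [this]; simp

lemma IsCy.seg_rot {c : ℕ → V} {k : ℕ} (h : IsCy c k) (s : ℕ) : seg (fun n => c (n + s)) 0 k = seg c 0 k := by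
  induction s with
  | zero => simp
  | succ s ih =>
    rw [← ih]
    have h3 := h.k3
    set g : ℕ → Ch V := fun t => dl s(c (t + s), c (t + s + 1)) with hg
    have e1 : seg (fun n => c (n + (s+1))) 0 k = ∑ t ∈ Finset.range k, g (t+1) := by
      rw [seg, ← Finset.range_eq_Ico]
      apply Finset.sum_congr rfl
      intro t _
      simp only [hg]
      congr 2 <;> ring_nf
    have e2 : seg (fun n => c (n + s)) 0 k = ∑ t ∈ Finset.range k, g t := by
      rw [seg, ← Finset.range_eq_Ico]
      apply Finset.sum_congr rfl
      intro t _
      simp only [hg]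
      congr 2; ring_nf
    have e3 : g k = g 0 := by
      simp only [hg]
      have a1 : c (k + s) = c (0 + s) := by rw [add_comm k s, h.per]; simp
      have a2 : c (k + s + 1) = c (0 + s + 1) := by rw [show k + s + 1 = (s + 1) + k by ring, h.per]; simp
      rw [a1, a2]
    rw [e1, e2]
    have := Finset.sum_range_succ g k
    rw [Finset.sum_range_succ', e3] at this
    exact add_right_cancel this

/-- extraction of a cycle from a nonzero even chain -/
lemma cyc_extract {z : Ch V} (hb : bd z = 0) (hz : z ≠ 0) (hl : ∀ v, z s(v,v) = 0) :
    ∃ k c, IsCy c k ∧ ∀ n, z s(c n, c (n+1)) = 1 := by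
  have nb : ∀ a b : V, z s(a,b) = 1 → ∃ d, d ≠ a ∧ z s(b,d) = 1 := by
    intro a b hab
    by_contra hh; push Not at hh
    have := congrFun hb b
    rw [bd_apply, Finset.sum_eq_single a] at this
    · rw [Sym2.eq_swap, hab] at this; simp at this
    · intro d _ hd; exact z2_ne1 (hh d hd)
    · simp
  choose! f hf1 hf2 using nb
  obtain ⟨e, he⟩ : ∃ e, z e ≠ 0 := by
    by_contra hh; push Not at hh; exact hz (funext hh)
  induction e using Sym2.ind with
  | _ a b =>
    have hab := z2_ne he
    let p : ℕ → V × V := fun n => Nat.rec (a, b) (fun _ q => (q.2, f q.1 q.2)) n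
    have hp : ∀ n, z s((p n).1, (p n).2) = 1 := by
      intro n
      induction n with
      | zero => exact hab
      | succ n ih => exact hf2 _ _ ih
    set s : ℕ → V := fun n => (p n).1 with hs
    have hs1 : ∀ n, z s(s n, s (n+1)) = 1 := hp
    have hs2 : ∀ n, s (n+2) ≠ s n := fun n => hf1 _ _ (hp n)
    have hrep : ∃ j, ∃ i, i < j ∧ s i = s j := by
      obtain ⟨i, j, hij, h⟩ := Finite.exists_ne_map_eq_of_infinite s
      rcases lt_or_gt_of_ne hij with h1 | h1
      · exact ⟨j, i, h1, h⟩
      · exact ⟨i, j, h1, h.symm⟩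
    obtain ⟨i, hij, hsij⟩ := Nat.find_spec hrep
    set j := Nat.find hrep with hj
    have hmin : ∀ m n, m < n → n < j → s m ≠ s n := by
      intro m n hmn hn h
      exact Nat.find_min hrep hn ⟨m, hmn, h⟩
    have hk3 : 3 ≤ j - i := by
      by_contra hk
      have : j = i + 1 ∨ j = i + 2 := by omega
      rcases this with h | h
      · have h1 := hs1 i; rw [← h, ← hsij, hl] at h1; exact absurd h1 (by decide)
      · have h1 := hs2 i; rw [← h] at h1; exact h1 hsij.symm
    refine ⟨j - i, fun n => s (i + n % (j - i)), ⟨hk3, ?_, ?_⟩, ?_⟩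
    · intro n; simp
    · intro m n hm hn h
      simp only [Nat.mod_eq_of_lt hm, Nat.mod_eq_of_lt hn] at h
      rcases lt_trichotomy m n with h1 | h1 | h1
      · exact absurd h (hmin _ _ (by omega) (by omega))
      · exact h1
      · exact absurd h.symm (hmin _ _ (by omega) (by omega))
    · intro n
      simp only
      have hlt : n % (j - i) < j - i := Nat.mod_lt _ (by omega)
      rw [Nat.add_mod, Nat.mod_eq_of_lt (show 1 < j - i by omega)]
      by_cases h1 : n % (j-i) + 1 = j - i
      · rw [h1, Nat.mod_self, add_zero, hsij]
        have := hs1 (i + n % (j-i))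
        rwa [show i + n % (j-i) + 1 = j by omega] at this
      · rw [Nat.mod_eq_of_lt (show n % (j - i) + 1 < j - i by omega), ← add_assoc]
        exact hs1 _

lemma IsTB.loopless {G : SimpleGraph V} {ι : Type} [Fintype ι] {F : ι → Ch V} (h : IsTB G.edgeSet F) (i : ι)
    (v : V) : F i s(v,v) = 0 :=
  h.zero_out (by simp) i

/-- faces are cycles -/
lemma IsTB.face_cycle {G : SimpleGraph V} {U : Set V} {ι : Type} [Fintype ι] {F : ι → Ch V}
    (h : IsTB G.edgeSet F) (hG : TwoConn G U) (i : ι) :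
    ∃ k c, IsCy c k ∧ F i = seg c 0 k := by
  obtain ⟨k, c, hc, hz⟩ := cyc_extract (h.cyc i).2 (h.ne i) (h.loopless i)
  refine ⟨k, c, hc, ?_⟩
  have h3 := hc.k3
  symm
  apply h.min hG i
  · rw [hc.bd_seg (by omega)]
    have := hc.per 0
    rw [zero_add] at this
    rw [this, ch_add]
  · intro h0
    have := hc.seg_eval (i := 0) (j := k) (t := 0) le_rfl (by omega)
    rw [h0] at this
    simp at this; omega
  · intro e he
    obtain ⟨t, _, _, rfl⟩ := seg_nz (by rw [he]; decide : seg c 0 k e ≠ 0)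
    exact hz t

lemma bd_two {z : Ch V} {v a b : V} (hz : bd z v = 0) (hab : a ≠ b)
    (h0 : ∀ w, w ≠ a → w ≠ b → z s(v,w) = 0) : z s(v,a) = z s(v,b) := by
  rw [bd_apply, Finset.sum_eq_add a b hab] at hz
  · exact z2_eq hz
  · intro w _ hw; exact h0 w hw.1 hw.2
  · simp
  · simp

lemma res_single {α : Type*} (e : α) : res {e} (1 : α → ZMod 2) = dl e := by
  funext e'; simp [res, dl]

lemma res_pair {α : Type*} {e f : α} (h : e ≠ f) : res {e, f} (1 : α → ZMod 2) = dl e + dl f := by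
  funext e'
  by_cases h1 : e' = e
  · subst h1; simp [res, dl, h]
  · by_cases h2 : e' = f
    · subst h2; simp [res, dl, h.symm]
    · simp [res, dl, h1, h2]

/-- add a fan of edges at `w` inside a face -/
lemma fan {c : ℕ → V} {k : ℕ} (hc : IsCy c k) {w : V} (hw : ∀ n, c n ≠ w) {r : ℕ} (hr : r ≤ k) (T : Finset ℕ) :
    ∀ (E : Set (Sym2 V)) (ι : Type) (_ : Fintype ι) (F : ι → Ch V) (iA iB : ι) (m : ℕ), IsTB E F → iA ≠ iB →
      F iB s(w, c m) = 1 → (∀ t, m ≤ t → t < r → F iB s(c t, c (t+1)) = 1) → m < k →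
      (∀ q ∈ T, m < q ∧ q ≤ r ∧ q < k ∧ s(w, c q) ∉ E) →
      ∃ (ι' : Type) (_ : Fintype ι') (F' : ι' → Ch V), IsTB (E ∪ {e | ∃ q ∈ T, e = s(w, c q)}) F' ∧
        ∃ i', F' i' = F iA := by
  induction T using Finset.induction_on_min with
  | empty =>
    intro E ι _ F iA iB m hF _ _ _ _ _
    refine ⟨ι, inferInstance, F, ?_, iA, rfl⟩
    simpa using hF
  | insert q T hq ih =>
    intro E ι _ F iA iB m hF hAB hwm hseg hmk hT
    obtain ⟨hmq, hqr, hqk, hqE⟩ := hT q (by simp)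
    have hsw : ∀ t u, s(w, c u) ≠ s(c t, c (t+1)) := by
      intro t u h
      rw [Sym2.eq_iff] at h
      rcases h with h | h
      · exact hw _ h.1.symm
      · exact hw _ h.1.symm
    have hear := hF.ear iB (dl s(w, c m) + seg c m q) (by
      intro e he
      by_cases h1 : e = s(w, c m)
      · rw [h1]; exact hwm
      · have : seg c m q e ≠ 0 := by
          intro h0
          simp [h0, dl_ne h1] at he
        obtain ⟨t, h3, h2, rfl⟩ := seg_nz this
        exact hseg t h3 (by omega)) {s(w, c q)} (by
      intro e he; rw [Set.mem_singleton_iff] at he; rw [he]; exact hqE) ⟨_, rfl⟩ (by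
      rw [res_single, map_add, map_add, bd_dl (hw m).symm, bd_dl (hw q).symm, hc.bd_seg hmq.le]
      funext v
      simp only [Pi.add_apply, Pi.zero_apply]
      generalize dl w v = a
      generalize dl (c m) v = b
      generalize dl (c q) v = d
      revert a b d; decide) (by
      intro z hz e he e' he'
      rw [Set.mem_singleton_iff] at he he'; rw [he, he'])
    have := ih _ (Option ι) _ _ (some iA) (some iB) q hear (by simpa using hAB) (by
      simp only [Option.elim, if_true, Pi.add_apply, res_single, dl_self]
      have h1 : F iB s(w, c q) = 0 := hF.zero_out hqE _
      have h2 : dl s(w, c m) s(w, c q) = 0 := by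
        apply dl_ne; intro h
        rw [Sym2.congr_right] at h
        have := hc.inj _ _ hqk hmk h; omega
      have h3 : seg c m q s(w, c q) = 0 := by
        by_contra h0
        obtain ⟨t, _, _, h⟩ := seg_nz h0
        exact hsw t q h
      rw [h1, h2, h3]; decide) (by
      intro t ht1 ht2
      simp only [Option.elim, if_true, Pi.add_apply, res_single]
      rw [hseg t (by omega) ht2, dl_ne (hsw t m).symm, dl_ne (hsw t q).symm, hc.seg_eval (by omega) (by omega), if_neg (by omega)]
      decide) hqk (by
      intro q' hq'
      obtain ⟨h1, h2, h3, h4⟩ := hT q' (by simp [hq'])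
      refine ⟨hq q' hq', h2, h3, ?_⟩
      rintro (h | h)
      · exact h4 h
      · rw [Set.mem_singleton_iff, Sym2.congr_right] at h
        have := hc.inj _ _ h3 hqk h
        have := hq q' hq'; omega)
    obtain ⟨ι', hι, F', hF', i', hi'⟩ := this
    refine ⟨ι', hι, F', ?_, i', ?_⟩
    · convert hF' using 1
      ext e
      simp only [Set.mem_union, Set.mem_ofPred_eq, Finset.mem_insert, Set.mem_singleton_iff, exists_eq_or_imp, or_assoc]
    · rw [hi']
      simp [hAB]

/-- attach a vertex inside a face -/
lemma attach {c : ℕ → V} {k : ℕ} (hc : IsCy c k) {x : V} (hx : ∀ n, c n ≠ x) {t : ℕ} (h0t : 0 < t) (htk : t < k)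
    {E : Set (Sym2 V)} {ι : Type} [Fintype ι] {F : ι → Ch V} (hF : IsTB E F) {i0 : ι} (hi0 : F i0 = seg c 0 k)
    (hxE : ∀ v, s(x, v) ∉ E) (X : ℕ → Prop) (hX0 : X 0) (hXt : X t) (hX : ∀ n < k, X n → n = 0 ∨ t ≤ n) :
    ∃ (ι' : Type) (_ : Fintype ι') (F' : ι' → Ch V), IsTB (E ∪ {e | ∃ q < k, X q ∧ e = s(x, c q)}) F' ∧
        ∃ i', F' i' = seg c 0 t + (dl s(x, c 0) + dl s(x, c t)) := by
  have hne : c 0 ≠ c t := fun h => by have := hc.inj 0 t (by omega) htk h; omega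
  have hne' : s(x, c 0) ≠ s(x, c t) := by rw [Ne, Sym2.congr_right]; exact hne
  have hsw : ∀ t u, s(x, c u) ≠ s(c t, c (t+1)) := by
    intro t u h
    rw [Sym2.eq_iff] at h
    rcases h with h | h
    · exact hx _ h.1.symm
    · exact hx _ h.1.symm
  have hear := hF.ear i0 (seg c 0 t) (by
    intro e he
    obtain ⟨u, h1, h2, rfl⟩ := seg_nz (by rw [he]; decide : seg c 0 t e ≠ 0)
    rw [hi0, hc.seg_eval le_rfl (by omega), if_pos (by omega)]) {s(x, c 0), s(x, c t)} (by
    rintro e (rfl | h)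
    · exact hxE _
    · rw [Set.mem_singleton_iff] at h; rw [h]; exact hxE _) ⟨_, Or.inl rfl⟩ (by
    rw [res_pair hne', map_add, map_add, bd_dl (hx _).symm, bd_dl (hx _).symm, hc.bd_seg (by omega)]
    funext v
    simp only [Pi.add_apply, Pi.zero_apply]
    generalize dl x v = a
    generalize dl (c 0) v = b
    generalize dl (c t) v = d
    revert a b d; decide) (by
    intro z hz
    have : z s(x, c 0) = z s(x, c t) := by
      apply bd_two (congrFun hz.2 x) hne
      intro w h1 h2
      by_contra h0
      rcases hz.1 _ h0 with h | h | h
      · exact hxE _ h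
      · rw [Sym2.congr_right] at h; exact h1 h
      · rw [Set.mem_singleton_iff, Sym2.congr_right] at h; exact h2 h
    rintro e (rfl | he) e' (rfl | he')
    · rfl
    · rw [Set.mem_singleton_iff] at he'; rw [he', this]
    · rw [Set.mem_singleton_iff] at he; rw [he, this]
    · rw [Set.mem_singleton_iff] at he he'; rw [he, he'])
  obtain ⟨ι', hι, F', hF', i', hi'⟩ := fan hc hx (r := k) le_rfl ((Finset.range k).filter fun q => X q ∧ t < q)
    _ _ _ _ none (some i0) t hear (by simp) (by
      simp only [Option.elim, if_true, Pi.add_apply, res_pair hne', dl_self]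
      rw [hF.zero_out (hxE _), dl_ne hne'.symm]
      have h3 : seg c 0 t s(x, c t) = 0 := by
        by_contra h0
        obtain ⟨t', _, _, h⟩ := seg_nz h0
        exact hsw _ _ h
      rw [h3]; decide) (by
      intro u h1 h2
      simp only [Option.elim, if_true, Pi.add_apply, res_pair hne', hi0]
      rw [hc.seg_eval le_rfl h2, hc.seg_eval htk.le h2, if_pos (by omega), if_neg (by omega), dl_ne (hsw _ _).symm, dl_ne (hsw _ _).symm]
      decide) htk (by
      intro q hq
      simp only [Finset.mem_filter, Finset.mem_range] at hq
      refine ⟨hq.2.2, hq.1.le, hq.1, ?_⟩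
      rintro (h | h | h)
      · exact hxE _ h
      · rw [Sym2.congr_right] at h
        have := hc.inj _ _ hq.1 (by omega) h; omega
      · rw [Set.mem_singleton_iff, Sym2.congr_right] at h
        have := hc.inj _ _ hq.1 htk h; omega)
  refine ⟨ι', hι, F', ?_, i', ?_⟩
  · convert hF' using 1
    ext e
    simp only [Set.mem_union, Set.mem_ofPred_eq, Finset.mem_filter, Finset.mem_range, Set.mem_insert_iff, Set.mem_singleton_iff, or_assoc]
    apply or_congr_right
    constructor
    · rintro ⟨q, hq, hXq, rfl⟩
      rcases hX q hq hXq with h | h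
      · left; rw [h]
      · rcases h.eq_or_lt with h | h
        · right; left; rw [h]
        · right; right; exact ⟨q, ⟨hq, hXq, h⟩, rfl⟩
    · rintro (rfl | rfl | ⟨q, ⟨hq, hXq, _⟩, rfl⟩)
      · exact ⟨0, by omega, hX0, rfl⟩
      · exact ⟨t, htk, hXt, rfl⟩
      · exact ⟨q, hq, hXq, rfl⟩
  · rw [hi', res_pair hne']; rfl

end T6

end

section
open SimpleGraph Finset
open scoped Classical
set_option linter.unusedSectionVars false
set_option linter.unusedVariables false
set_option linter.unusedSimpArgs false
set_option linter.unnecessarySeqFocus false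

namespace T6
variable {V : Type*} [Fintype V]

def arc (c : ℕ → V) (a b : ℕ) : Set V := {v | ∃ t, a ≤ t ∧ t < b ∧ v = c t}

lemma arc_cc {G : SimpleGraph V} {c : ℕ → V} (hadj : ∀ n, G.Adj (c n) (c (n+1))) (a b : ℕ) :
    CC G (arc c a b) := by
  intro D hD hne hcl
  obtain ⟨v, hv⟩ := hne
  obtain ⟨t0, h1, h2, rfl⟩ := hD hv
  apply Set.Subset.antisymm hD
  have up : ∀ n, t0 + n < b → c (t0 + n) ∈ D := by
    intro n
    induction n with
    | zero => intro _; exact hv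
    | succ n ih =>
      intro h
      exact hcl _ (ih (by omega)) _ ⟨t0 + (n+1), by omega, h, rfl⟩ (hadj _)
  have down : ∀ n, n ≤ t0 → a ≤ t0 - n → c (t0 - n) ∈ D := by
    intro n
    induction n with
    | zero => intro _ _; exact hv
    | succ n ih =>
      intro h h'
      refine hcl _ (ih (by omega) (by omega)) _ ⟨t0 - (n+1), by omega, by omega, rfl⟩ ?_
      have := hadj (t0 - (n+1))
      rw [show t0 - (n+1) + 1 = t0 - n by omega] at this
      exact this.symm
  rintro v ⟨t, ht1, ht2, rfl⟩
  by_cases h : t0 ≤ t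
  · have := up (t - t0) (by omega); rwa [show t0 + (t - t0) = t by omega] at this
  · have := down (t0 - t) (by omega) (by omega); rwa [show t0 - (t0 - t) = t by omega] at this

section
variable {G : SimpleGraph V} {c : ℕ → V} {k : ℕ} {x y : V}

lemma no_alt (hg : Good G) (hc : IsCy c k) (hadj : ∀ n, G.Adj (c n) (c (n+1))) (hx : ∀ n, c n ≠ x) (hy : ∀ n, c n ≠ y)
    (hxy : G.Adj x y) {i b j : ℕ} (h0i : 0 < i) (hib : i < b) (hbj : b < j) (hjk : j < k)
    (h0 : G.Adj y (c 0)) (h1 : G.Adj x (c i)) (h2 : G.Adj y (c b)) (h3 : G.Adj x (c j)) : False := by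
  apply hg.2
  have dis : ∀ a b a' b', b ≤ k → b' ≤ k → (b ≤ a' ∨ b' ≤ a) → ∀ v, v ∈ arc c a b → v ∉ arc c a' b' := by
    rintro a b a' b' hb hb' h v ⟨t, ht1, ht2, rfl⟩ ⟨t', ht1', ht2', h'⟩
    have := hc.inj t t' (by omega) (by omega) h'
    omega
  have hxa : ∀ a b, x ∉ arc c a b := by rintro a b ⟨t, _, _, h⟩; exact hx _ h.symm
  have hya : ∀ a b, y ∉ arc c a b := by rintro a b ⟨t, _, _, h⟩; exact hy _ h.symm
  have hk := hadj (k-1)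
  rw [show k - 1 + 1 = 0 + k by omega, hc.per] at hk
  have hi := hadj (i-1)
  rw [show i - 1 + 1 = i by omega] at hi
  have hb := hadj (b-1)
  rw [show b - 1 + 1 = b by omega] at hb
  have hj := hadj (j-1)
  rw [show j - 1 + 1 = j by omega] at hj
  have m1 : ∀ a b, a < b → c a ∈ arc c a b := fun a b h => ⟨a, le_rfl, h, rfl⟩
  have m2 : ∀ a b, a < b → c (b-1) ∈ arc c a b := fun a b h => ⟨b-1, by omega, by omega, rfl⟩
  let A : Fin 3 → Set V := ![{x}, arc c 0 i, arc c b j]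
  let B : Fin 3 → Set V := ![{y}, arc c i b, arc c j k]
  have hA : ∀ w w', w ≠ w' → ∀ v, v ∈ A w → v ∉ A w' := by
    intro w w' hw v hv hv'
    fin_cases w <;> fin_cases w' <;> simp [A] at hw hv hv'
    · subst hv; exact hxa _ _ hv'
    · subst hv; exact hxa _ _ hv'
    · subst hv'; exact hxa _ _ hv
    · exact dis _ _ _ _ (by omega) (by omega) (by omega) v hv hv'
    · subst hv'; exact hxa _ _ hv
    · exact dis _ _ _ _ (by omega) (by omega) (by omega) v hv hv'
  have hB : ∀ w w', w ≠ w' → ∀ v, v ∈ B w → v ∉ B w' := by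
    intro w w' hw v hv hv'
    fin_cases w <;> fin_cases w' <;> simp [B] at hw hv hv'
    · subst hv; exact hya _ _ hv'
    · subst hv; exact hya _ _ hv'
    · subst hv'; exact hya _ _ hv
    · exact dis _ _ _ _ (by omega) (by omega) (by omega) v hv hv'
    · subst hv'; exact hya _ _ hv
    · exact dis _ _ _ _ (by omega) (by omega) (by omega) v hv hv'
  have hAB : ∀ w w', ∀ v, v ∈ A w → v ∉ B w' := by
    intro w w' v hv hv'
    fin_cases w <;> fin_cases w' <;> simp [A, B] at hv hv'
    · subst hv; exact hxy.ne hv'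
    · subst hv; exact hxa _ _ hv'
    · subst hv; exact hxa _ _ hv'
    · subst hv'; exact hya _ _ hv
    · exact dis _ _ _ _ (by omega) (by omega) (by omega) v hv hv'
    · exact dis _ _ _ _ (by omega) (by omega) (by omega) v hv hv'
    · subst hv'; exact hya _ _ hv
    · exact dis _ _ _ _ (by omega) (by omega) (by omega) v hv hv'
    · exact dis _ _ _ _ (by omega) (by omega) (by omega) v hv hv'
  have hadjAB : ∀ w w', ∃ a ∈ A w, ∃ b ∈ B w', G.Adj a b := by
    intro w w'
    fin_cases w <;> fin_cases w' <;> simp only [A, B, Fin.zero_eta, Fin.mk_one, Fin.reduceFinMk, Matrix.cons_val]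
    · exact ⟨x, rfl, y, rfl, hxy⟩
    · exact ⟨x, rfl, c i, m1 _ _ hib, h1⟩
    · exact ⟨x, rfl, c j, m1 _ _ hjk, h3⟩
    · exact ⟨c 0, m1 _ _ h0i, y, rfl, h0.symm⟩
    · exact ⟨_, m2 _ _ h0i, _, m1 _ _ hib, hi⟩
    · exact ⟨_, m1 _ _ h0i, _, m2 _ _ hjk, hk.symm⟩
    · exact ⟨_, m1 _ _ hbj, y, rfl, h2.symm⟩
    · exact ⟨_, m1 _ _ hbj, _, m2 _ _ hib, hb.symm⟩
    · exact ⟨_, m2 _ _ hbj, _, m1 _ _ hjk, hj⟩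
  refine ⟨Sum.elim A B, ?_, ?_, ?_, ?_⟩
  · rintro (w | w)
    · obtain ⟨a, ha, _⟩ := hadjAB w 0; exact ⟨a, ha⟩
    · obtain ⟨a, _, b, hb, _⟩ := hadjAB 0 w; exact ⟨b, hb⟩
  · rintro (w | w)
    · fin_cases w <;> simp only [Sum.elim_inl, A, Fin.zero_eta, Fin.mk_one, Fin.reduceFinMk, Matrix.cons_val]
      · exact CC.singleton _ _
      · exact arc_cc hadj _ _
      · exact arc_cc hadj _ _
    · fin_cases w <;> simp only [Sum.elim_inr, B, Fin.zero_eta, Fin.mk_one, Fin.reduceFinMk, Matrix.cons_val]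
      · exact CC.singleton _ _
      · exact arc_cc hadj _ _
      · exact arc_cc hadj _ _
  · rintro (w | w) (w' | w') hw v hv hv'
    · exact hA w w' (fun h => hw (by rw [h])) v hv hv'
    · exact hAB _ _ v hv hv'
    · exact hAB _ _ v hv' hv
    · exact hB w w' (fun h => hw (by rw [h])) v hv hv'
  · rintro (w | w) (w' | w') hw
    · simp at hw
    · exact hadjAB w w'
    · obtain ⟨a, ha, b, hb, h⟩ := hadjAB w' w
      exact ⟨b, hb, a, ha, h.symm⟩
    · simp at hw

lemma no_three (hg : Good G) (hc : IsCy c k) (hadj : ∀ n, G.Adj (c n) (c (n+1))) (hx : ∀ n, c n ≠ x) (hy : ∀ n, c n ≠ y)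
    (hxy : G.Adj x y) {p q : ℕ} (h0p : 0 < p) (hpq : p < q) (hqk : q < k)
    (h0 : G.Adj y (c 0)) (h1 : G.Adj x (c 0)) (h2 : G.Adj y (c p)) (h3 : G.Adj x (c p))
    (h4 : G.Adj y (c q)) (h5 : G.Adj x (c q)) : False := by
  apply hg.1
  have dis : ∀ a b a' b', b ≤ k → b' ≤ k → (b ≤ a' ∨ b' ≤ a) → ∀ v, v ∈ arc c a b → v ∉ arc c a' b' := by
    rintro a b a' b' hb hb' h v ⟨t, ht1, ht2, rfl⟩ ⟨t', ht1', ht2', h'⟩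
    have := hc.inj t t' (by omega) (by omega) h'
    omega
  have hxa : ∀ a b, x ∉ arc c a b := by rintro a b ⟨t, _, _, h⟩; exact hx _ h.symm
  have hya : ∀ a b, y ∉ arc c a b := by rintro a b ⟨t, _, _, h⟩; exact hy _ h.symm
  have hk := hadj (k-1)
  rw [show k - 1 + 1 = 0 + k by omega, hc.per] at hk
  have hp := hadj (p-1)
  rw [show p - 1 + 1 = p by omega] at hp
  have hq := hadj (q-1)
  rw [show q - 1 + 1 = q by omega] at hq
  have m1 : ∀ a b, a < b → c a ∈ arc c a b := fun a b h => ⟨a, le_rfl, h, rfl⟩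
  have m2 : ∀ a b, a < b → c (b-1) ∈ arc c a b := fun a b h => ⟨b-1, by omega, by omega, rfl⟩
  let A : Fin 5 → Set V := ![{x}, {y}, arc c 0 p, arc c p q, arc c q k]
  have hlt : ∀ w w', w < w' → (∀ v, v ∈ A w → v ∉ A w') ∧ ∃ a ∈ A w, ∃ b ∈ A w', G.Adj a b := by
    intro w w' hw
    fin_cases w <;> fin_cases w' <;> first | (exfalso; revert hw; decide) | skip
    · exact ⟨fun v hv hv' => hxy.ne (hv.symm.trans hv'), x, rfl, y, rfl, hxy⟩
    · exact ⟨fun v hv hv' => hxa _ _ (hv ▸ hv'), x, rfl, c 0, m1 _ _ h0p, h1⟩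
    · exact ⟨fun v hv hv' => hxa _ _ (hv ▸ hv'), x, rfl, c p, m1 _ _ hpq, h3⟩
    · exact ⟨fun v hv hv' => hxa _ _ (hv ▸ hv'), x, rfl, c q, m1 _ _ hqk, h5⟩
    · exact ⟨fun v hv hv' => hya _ _ (hv ▸ hv'), y, rfl, c 0, m1 _ _ h0p, h0⟩
    · exact ⟨fun v hv hv' => hya _ _ (hv ▸ hv'), y, rfl, c p, m1 _ _ hpq, h2⟩
    · exact ⟨fun v hv hv' => hya _ _ (hv ▸ hv'), y, rfl, c q, m1 _ _ hqk, h4⟩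
    · exact ⟨dis _ _ _ _ (by omega) (by omega) (by omega), _, m2 _ _ h0p, _, m1 _ _ hpq, hp⟩
    · exact ⟨dis _ _ _ _ (by omega) (by omega) (by omega), _, m1 _ _ h0p, _, m2 _ _ hqk, hk.symm⟩
    · exact ⟨dis _ _ _ _ (by omega) (by omega) (by omega), _, m2 _ _ hpq, _, m1 _ _ hqk, hq⟩
  refine ⟨A, ?_, ?_, ?_, ?_⟩
  · intro w
    fin_cases w
    · exact ⟨x, rfl⟩
    · exact ⟨y, rfl⟩
    · exact ⟨_, m1 _ _ h0p⟩
    · exact ⟨_, m1 _ _ hpq⟩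
    · exact ⟨_, m1 _ _ hqk⟩
  · intro w
    fin_cases w
    · exact CC.singleton _ _
    · exact CC.singleton _ _
    · exact arc_cc hadj _ _
    · exact arc_cc hadj _ _
    · exact arc_cc hadj _ _
  · intro w w' hw v hv hv'
    rcases lt_or_gt_of_ne hw with h | h
    · exact (hlt _ _ h).1 v hv hv'
    · exact (hlt _ _ h).1 v hv' hv
  · intro w w' hw
    rcases lt_or_gt_of_ne hw.ne with h | h
    · exact (hlt _ _ h).2
    · obtain ⟨a, ha, b, hb, hab⟩ := (hlt _ _ h).2
      exact ⟨b, hb, a, ha, hab.symm⟩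

def GoodCfg (G : SimpleGraph V) (c : ℕ → V) (k : ℕ) (x y : V) (t : ℕ) : Prop :=
  0 < t ∧ t < k ∧ G.Adj x (c 0) ∧ G.Adj x (c t) ∧ (∀ n < k, G.Adj x (c n) → n = 0 ∨ t ≤ n) ∧
    ∀ n < k, G.Adj y (c n) → n ≤ t

lemma two_pos (hc : IsCy c k) (P : V → Prop) (h : ∃ p q, c p ≠ c q ∧ P (c p) ∧ P (c q)) :
    ∃ i j, i < j ∧ j < k ∧ P (c i) ∧ P (c j) ∧ ∀ n < k, P (c n) → i ≤ n ∧ n ≤ j := by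
  have h3 := hc.k3
  set S := (Finset.range k).filter fun n => P (c n) with hS
  have hm : ∀ n, n ∈ S ↔ n < k ∧ P (c n) := by intro n; simp [hS]
  obtain ⟨p, q, hpq, hp, hq⟩ := h
  have hp' : p % k ∈ S := (hm _).2 ⟨Nat.mod_lt _ (by omega), by rwa [hc.modk]⟩
  have hq' : q % k ∈ S := (hm _).2 ⟨Nat.mod_lt _ (by omega), by rwa [hc.modk]⟩
  have hne : p % k ≠ q % k := by
    intro h; apply hpq; rw [← hc.modk p, ← hc.modk q, h]
  have hSn : S.Nonempty := ⟨_, hp'⟩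
  refine ⟨S.min' hSn, S.max' hSn, ?_, ?_, ?_, ?_, ?_⟩
  · have h1 := S.min'_le _ hp'
    have h2 := S.min'_le _ hq'
    have h3 := S.le_max' _ hp'
    have h4 := S.le_max' _ hq'
    omega
  · exact ((hm _).1 (S.max'_mem hSn)).1
  · exact ((hm _).1 (S.min'_mem hSn)).2
  · exact ((hm _).1 (S.max'_mem hSn)).2
  · intro n hn hP
    have := (hm n).2 ⟨hn, hP⟩
    exact ⟨S.min'_le _ this, S.le_max' _ this⟩

lemma exists_cfg (hg : Good G) (hc0 : IsCy c k) (hadj0 : ∀ n, G.Adj (c n) (c (n+1))) (hx0 : ∀ n, c n ≠ x) (hy0 : ∀ n, c n ≠ y)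
    (hxy : G.Adj x y) (hX : ∃ p q, c p ≠ c q ∧ G.Adj x (c p) ∧ G.Adj x (c q))
    (hY : ∃ p q, c p ≠ c q ∧ G.Adj y (c p) ∧ G.Adj y (c q)) :
    ∃ s t, GoodCfg G (fun n => c (n + s)) k x y t := by
  -- generic rotation
  have hk3 := hc0.k3
  have rotX : ∀ (z : V) s, (∃ p q, c p ≠ c q ∧ G.Adj z (c p) ∧ G.Adj z (c q)) →
      ∃ p q, c (p + s) ≠ c (q + s) ∧ G.Adj z (c (p + s)) ∧ G.Adj z (c (q + s)) := by
    rintro z s ⟨p, q, h1, h2, h3⟩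
    have key : ∀ p, ∃ p', c (p' + s) = c p := by
      intro p
      refine ⟨p + (s * (k - 1)), ?_⟩
      have : p + s * (k-1) + s = p + s * k := by
        obtain ⟨m, rfl⟩ : ∃ m, k = m + 1 := ⟨k-1, by omega⟩
        simp; ring
      rw [this, ← hc0.modk (p + s * k), Nat.add_mul_mod_self_right, hc0.modk]
    obtain ⟨p', hp'⟩ := key p
    obtain ⟨q', hq'⟩ := key q
    exact ⟨p', q', by rw [hp', hq']; exact h1, by rwa [hp'], by rwa [hq']⟩
  have addk : ∀ n, k ≤ n → c n = c (n - k) := by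
    intro n hn
    have := hc0.per (n - k)
    rwa [Nat.sub_add_cancel hn] at this
  by_cases hA : ∃ b, G.Adj y (c b) ∧ ¬ G.Adj x (c b)
  · obtain ⟨b, hyb, hxb⟩ := hA
    have hc := hc0.rot b
    set d : ℕ → V := fun n => c (n + b) with hd
    obtain ⟨i, j, hij, hjk, hi, hj, hall⟩ := two_pos hc (fun v => G.Adj x v) (rotX x b hX)
    have hi0 : 0 < i := by
      rcases Nat.eq_zero_or_pos i with h | h
      · rw [h] at hi; simp [hd] at hi; exact absurd hi hxb
      · exact h
    have hadj : ∀ n, G.Adj (d n) (d (n+1)) := fun n => by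
      have := hadj0 (n + b); simp only [hd]; rwa [show n + 1 + b = n + b + 1 by ring]
    have hnob : ∀ β, i < β → β < j → ¬ G.Adj y (d β) := fun β h1 h2 h3 =>
      no_alt hg hc hadj (fun n => hx0 _) (fun n => hy0 _) hxy hi0 h1 h2 hjk (by simpa [hd] using hyb) hi h3 hj
    refine ⟨j + b, i + k - j, by omega, by omega, ?_, ?_, ?_, ?_⟩
    · simpa [hd] using hj
    · have : i + k - j + (j + b) = i + b + k := by omega
      simp only [this, hc0.per]; exact hi
    · intro n hn hxn
      by_cases h1 : n + j < k
      · have := hall (n + j) h1 (by simpa [hd, add_assoc] using hxn)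
        omega
      · have := hall (n + j - k) (by omega) (by
          simp only [hd]
          beta_reduce at hxn; rw [addk _ (by omega)] at hxn
          rwa [show n + j - k + b = n + (j + b) - k by omega])
        omega
    · intro n hn hyn
      by_cases h1 : n + j < k
      · omega
      · by_contra hlt
        exact hnob (n + j - k) (by omega) (by omega) (by
          simp only [hd]
          beta_reduce at hyn; rw [addk _ (by omega)] at hyn
          rwa [show n + j - k + b = n + (j + b) - k by omega])
  · push Not at hA
    obtain ⟨b, b', hbb, hyb, hyb'⟩ := hY
    have hc := hc0.rot b
    set d : ℕ → V := fun n => c (n + b) with hd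
    have hadj : ∀ n, G.Adj (d n) (d (n+1)) := fun n => by
      have := hadj0 (n + b); simp only [hd]; rwa [show n + 1 + b = n + b + 1 by ring]
    have hA' : ∀ n, G.Adj y (d n) → G.Adj x (d n) := fun n => hA _
    have hy0' : G.Adj y (d 0) := by simpa [hd] using hyb
    obtain ⟨i, u, hiu, huk, hi, hu, hall⟩ := two_pos hc (fun v => G.Adj y v) (rotX y b ⟨b, b', hbb, hyb, hyb'⟩)
    have hi0 : i = 0 := by have := (hall 0 (by omega) hy0').1; omega
    subst hi0
    have honly : ∀ n < k, G.Adj y (d n) → n = 0 ∨ n = u := by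
      intro n hn hyn
      by_contra hh; push Not at hh
      have := hall n hn hyn
      exact no_three hg hc hadj (fun n => hx0 _) (fun n => hy0 _) hxy (p := n) (q := u) (by omega) (by omega) huk
        hi (hA' _ hi) hyn (hA' _ hyn) hu (hA' _ hu)
    by_cases hL : ∃ p, 0 < p ∧ p < u ∧ G.Adj x (d p)
    · obtain ⟨p, hp0, hpu, hxp⟩ := hL
      have hR : ∀ q, u < q → q < k → ¬ G.Adj x (d q) := fun q h1 h2 h3 =>
        no_alt hg hc hadj (fun n => hx0 _) (fun n => hy0 _) hxy hp0 hpu h1 h2 hi hxp hu h3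
      refine ⟨u + b, k - u, by omega, by omega, ?_, ?_, ?_, ?_⟩
      · simpa [hd] using hA' _ hu
      · have : k - u + (u + b) = b + k := by omega
        simp only [this, hc0.per]; exact hA _ hyb
      · intro n hn hxn
        by_cases h1 : n + u < k
        · by_contra hh; push Not at hh
          exact hR (n + u) (by omega) h1 (by simpa [hd, add_assoc] using hxn)
        · omega
      · intro n hn hyn
        by_cases h1 : n + u < k
        · omega
        · have := honly (n + u - k) (by omega) (by
            simp only [hd]
            beta_reduce at hyn; rw [addk _ (by omega)] at hyn
            rwa [show n + u - k + b = n + (u + b) - k by omega])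
          omega
    · push Not at hL
      refine ⟨b, u, by omega, huk, hA' _ hi, hA' _ hu, ?_, ?_⟩
      · intro n hn hxn
        by_contra hh; push Not at hh
        exact hL n (by omega) (by omega) hxn
      · intro n hn hyn
        exact (hall n hn hyn).2

end

end T6

end

section
open SimpleGraph Finset
open scoped Classical
set_option linter.unusedSectionVars false
set_option linter.unusedVariables false
set_option linter.unusedSimpArgs false
set_option linter.unnecessarySeqFocus false

namespace T6
variable {V : Type*} [Fintype V]

lemma extend {G : SimpleGraph V} {c : ℕ → V} {k : ℕ} {x y : V} (hc : IsCy c k) (hx : ∀ n, c n ≠ x) (hy : ∀ n, c n ≠ y)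
    (hxy : G.Adj x y) {t : ℕ} (hcfg : GoodCfg G c k x y t)
    {E : Set (Sym2 V)} {ι : Type} [Fintype ι] {F : ι → Ch V} (hF : IsTB E F) {i0 : ι} (hi0 : F i0 = seg c 0 k)
    (hxE : ∀ v, s(x, v) ∉ E) (hyE : ∀ v, s(y, v) ∉ E)
    (hE : ∀ e, e ∈ G.edgeSet ↔ e ∈ E ∨ e = s(x,y) ∨ (∃ q < k, G.Adj x (c q) ∧ e = s(x, c q)) ∨
      (∃ q < k, G.Adj y (c q) ∧ e = s(y, c q)))
    (hY : ∃ p q, c p ≠ c q ∧ G.Adj y (c p) ∧ G.Adj y (c q)) : HasTB G.edgeSet := by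
  obtain ⟨h0t, htk, hX0, hXt, hX, hYt⟩ := hcfg
  obtain ⟨j, l, hjl, hlk, hyj, hyl, hall⟩ := two_pos hc (fun v => G.Adj y v) hY
  have hlt := hYt l hlk hyl
  obtain ⟨ι1, _, F1, hF1, i1, hi1⟩ := attach hc hx h0t htk hF hi0 hxE (fun n => G.Adj x (c n)) hX0 hXt hX
  set E1 := E ∪ {e | ∃ q < k, G.Adj x (c q) ∧ e = s(x, c q)} with hE1
  have hyE1 : ∀ v, s(y, v) ∉ E1 := by
    rintro v (h | ⟨q, _, _, h⟩)
    · exact hyE _ h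
    · rw [Sym2.eq_iff] at h
      rcases h with h | h
      · exact hxy.ne h.1.symm
      · exact hy _ h.1.symm
  have hsx : ∀ t u, s(x, c u) ≠ s(c t, c (t+1)) := by
    intro t u h
    rw [Sym2.eq_iff] at h
    rcases h with h | h
    · exact hx _ h.1.symm
    · exact hx _ h.1.symm
  have hsy : ∀ t u, s(y, c u) ≠ s(c t, c (t+1)) := by
    intro t u h
    rw [Sym2.eq_iff] at h
    rcases h with h | h
    · exact hy _ h.1.symm
    · exact hy _ h.1.symm
  have hyx : ∀ t, s(y, x) ≠ s(c t, c (t+1)) := by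
    intro t h
    rw [Sym2.eq_iff] at h
    rcases h with h | h
    · exact hy _ h.1.symm
    · exact hy _ h.1.symm
  have hne' : s(x, c 0) ≠ s(x, c t) := by
    rw [Ne, Sym2.congr_right]; intro h; have := hc.inj 0 t (by omega) htk h; omega
  have hN : s(y, x) ≠ s(y, c j) := by rw [Ne, Sym2.congr_right]; exact (hx j).symm
  have hyxx : ∀ u, s(y, x) ≠ s(x, c u) := by
    intro u h; rw [Sym2.eq_iff] at h
    rcases h with h | h
    · exact hxy.ne h.1.symm
    · exact hy _ h.1.symm
  have hyjx : ∀ u v, s(y, c u) ≠ s(x, c v) := by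
    intro u v h; rw [Sym2.eq_iff] at h
    rcases h with h | h
    · exact hxy.ne h.1.symm
    · exact hx _ h.2
  have hear := hF1.ear i1 (dl s(x, c 0) + seg c 0 j) (by
    intro e he
    rw [hi1]
    by_cases h1 : e = s(x, c 0)
    · subst h1
      have h3 : seg c 0 t s(x, c 0) = 0 := by
        by_contra h0
        obtain ⟨t', _, _, h⟩ := seg_nz h0
        exact hsx _ _ h
      simp only [Pi.add_apply, dl_self, h3, dl_ne hne']
      decide
    · have : seg c 0 j e ≠ 0 := by
        intro h0
        simp [h0, dl_ne h1] at he
      obtain ⟨u, h1, h2, rfl⟩ := seg_nz this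
      simp only [Pi.add_apply, dl_ne (hsx _ _).symm]
      rw [hc.seg_eval htk.le (by omega), if_pos (by omega)]; decide) {s(y, x), s(y, c j)} (by
    rintro e (rfl | h)
    · exact hyE1 _
    · rw [Set.mem_singleton_iff] at h; rw [h]; exact hyE1 _) ⟨_, Or.inl rfl⟩ (by
    rw [res_pair hN, map_add, map_add, map_add, bd_dl (hx _).symm, bd_dl (hy _).symm, bd_dl hxy.ne', hc.bd_seg (by omega)]
    funext v
    simp only [Pi.add_apply, Pi.zero_apply]
    generalize dl x v = a
    generalize dl y v = f
    generalize dl (c 0) v = b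
    generalize dl (c j) v = d
    revert a b d f; decide) (by
    intro z hz
    have : z s(y, x) = z s(y, c j) := by
      apply bd_two (congrFun hz.2 y) (hx j).symm
      intro w h1 h2
      by_contra h0
      rcases hz.1 _ h0 with h | h | h
      · exact hyE1 _ h
      · rw [Sym2.congr_right] at h; exact h1 h
      · rw [Set.mem_singleton_iff, Sym2.congr_right] at h; exact h2 h
    rintro e (rfl | he) e' (rfl | he')
    · rfl
    · rw [Set.mem_singleton_iff] at he'; rw [he', this]
    · rw [Set.mem_singleton_iff] at he; rw [he, this]
    · rw [Set.mem_singleton_iff] at he he'; rw [he, he'])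
  have hsegy : ∀ a b u, seg c a b s(y, c u) = 0 := by
    intro a b u
    by_contra h0
    obtain ⟨t', _, _, h⟩ := seg_nz h0
    exact hsy _ _ h
  obtain ⟨ι', hι, F', hF', i', hi'⟩ := fan hc hy (r := t) htk.le ((Finset.range k).filter fun q => G.Adj y (c q) ∧ j < q)
    _ _ _ _ none (some i1) j hear (by simp) (by
      simp only [Option.elim, if_true, Pi.add_apply, res_pair hN, dl_self]
      rw [hF1.zero_out (hyE1 _), dl_ne hN.symm, dl_ne (hyjx _ _), hsegy]
      decide) (by
      intro u h1 h2
      simp only [Option.elim, if_true, Pi.add_apply, res_pair hN, hi1]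
      rw [hc.seg_eval htk.le (by omega), hc.seg_eval (by omega) (by omega), if_pos (by omega), if_neg (by omega),
        dl_ne (hsx _ _).symm, dl_ne (hsx _ _).symm, dl_ne (hsy _ _).symm, dl_ne (hyx _).symm]
      decide) (by omega) (by
      intro q hq
      simp only [Finset.mem_filter, Finset.mem_range] at hq
      refine ⟨hq.2.2, hYt q hq.1 hq.2.1, hq.1, ?_⟩
      rintro (h | h | h)
      · exact hyE1 _ h
      · rw [Sym2.congr_right] at h
        exact hx _ h
      · rw [Set.mem_singleton_iff, Sym2.congr_right] at h
        have := hc.inj _ _ hq.1 (by omega) h; omega)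
  refine ⟨ι', hι, F', ?_⟩
  convert hF' using 1
  ext e
  rw [hE]
  simp only [hE1, Set.mem_union, Set.mem_ofPred_eq, Finset.mem_filter, Finset.mem_range, Set.mem_insert_iff, Set.mem_singleton_iff]
  constructor
  · rintro (h | rfl | h | ⟨q, hq, hyq, rfl⟩)
    · exact Or.inl (Or.inl (Or.inl h))
    · exact Or.inl (Or.inr (Or.inl Sym2.eq_swap))
    · exact Or.inl (Or.inl (Or.inr h))
    · rcases (hall q hq hyq).1.eq_or_lt with h | h
      · left; right; right; rw [h]
      · right; exact ⟨q, ⟨hq, hyq, h⟩, rfl⟩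
  · rintro (((h | h) | rfl | rfl) | ⟨q, ⟨hq, hyq, _⟩, rfl⟩)
    · exact Or.inl h
    · exact Or.inr (Or.inr (Or.inl h))
    · exact Or.inr (Or.inl Sym2.eq_swap)
    · exact Or.inr (Or.inr (Or.inr ⟨j, by omega, hyj, rfl⟩))
    · exact Or.inr (Or.inr (Or.inr ⟨q, hq, hyq, rfl⟩))

/-- a cycle has a two-basis -/
lemma tb_cycle {c : ℕ → V} {k : ℕ} (hc : IsCy c k) :
    IsTB {e | ∃ t, e = s(c t, c (t+1))} (fun _ : Bool => seg c 0 k) := by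
  have h3 := hc.k3
  have hk : ∀ t, ∃ u < k, s(c t, c (t+1)) = s(c u, c (u+1)) := by
    intro t
    refine ⟨t % k, Nat.mod_lt _ (by omega), ?_⟩
    rw [hc.modk, ← hc.modk (t % k + 1), Nat.mod_add_mod, hc.modk]
  have h1 : ∀ t, seg c 0 k s(c t, c (t+1)) = 1 := by
    intro t
    obtain ⟨u, hu, he⟩ := hk t
    rw [he, hc.seg_eval le_rfl hu, if_pos (by omega)]
  have hbd : bd (seg c 0 k) = 0 := by
    rw [hc.bd_seg (by omega)]
    have := hc.per 0
    rw [zero_add] at this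
    rw [this, ch_add]
  refine ⟨fun _ => ⟨?_, hbd⟩, ?_, ?_, ?_⟩
  · intro e he
    obtain ⟨t, _, _, rfl⟩ := seg_nz he
    exact ⟨t, rfl⟩
  · intro _ h0
    have := h1 0
    rw [h0] at this; simp at this
  · rintro e ⟨t, rfl⟩
    refine ⟨true, false, by simp, h1 t, h1 t, ?_⟩
    intro k h1 h2; cases k <;> simp at h1 h2
  · intro z hz
    have hstep : ∀ t, z s(c t, c (t+1)) = z s(c 0, c 1) := by
      intro t
      induction t with
      | zero => rfl
      | succ t ih =>
        rw [← ih, Sym2.eq_swap (a := c t)]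
        symm
        apply bd_two (congrFun hz.2 _) (hc.ne2 t)
        intro w hw1 hw2
        by_contra h0
        obtain ⟨u, hu⟩ := hz.1 _ h0
        rw [Sym2.eq_iff] at hu
        rcases hu with hu | hu
        · apply hw2; rw [hu.2]
          have : (t + 1) ≡ u [MOD k] := hc.inj' hu.1
          have := this.add_right 1
          rw [← hc.modk (u+1), ← hc.modk (t+2)]
          exact congrArg c this.symm
        · apply hw1; rw [hu.2]
          have : (t + 1) ≡ u + 1 [MOD k] := hc.inj' hu.1
          have := Nat.ModEq.add_right_cancel' 1 this
          rw [← hc.modk u, ← hc.modk t]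
          exact congrArg c this.symm
    refine ⟨fun b => if b then z s(c 0, c 1) else 0, ?_⟩
    rw [Fintype.sum_bool]
    simp only [if_true, Bool.false_eq_true, if_false, zero_smul, add_zero]
    funext e
    by_cases he : ∃ t, e = s(c t, c (t+1))
    · obtain ⟨t, rfl⟩ := he
      simp [hstep t, h1 t]
    · have e1 : z e = 0 := by by_contra h0; exact he (hz.1 _ h0)
      have e2 : seg c 0 k e = 0 := by
        by_contra h0; obtain ⟨t, _, _, rfl⟩ := seg_nz h0; exact he ⟨t, rfl⟩
      simp [e1, e2]

lemma cy3 {a b d : V} (hab : a ≠ b) (hbd : b ≠ d) (had : a ≠ d) : IsCy (fun n => if n % 3 = 0 then a else if n % 3 = 1 then b else d) 3 := by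
  refine ⟨le_rfl, ?_, ?_⟩
  · intro n; simp
  · intro m n hm hn h
    interval_cases m <;> interval_cases n <;> simp_all

lemma TwoConn.exists_adj {G : SimpleGraph V} {U : Set V} (hG : TwoConn G U) {a : V} (ha : a ∈ U) :
    ∃ b, G.Adj a b := by
  by_contra hh; push Not at hh
  have := hG.cc {a} (by simpa using ha) ⟨a, rfl⟩ (by
    intro x hx y hy hxy; rw [Set.mem_singleton_iff] at hx; subst hx; exact absurd hxy (hh y))
  have h1 := hG.1
  rw [← this, Set.ncard_singleton] at h1; omega

end T6

end

section
open SimpleGraph Finset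
open scoped Classical
set_option linter.unusedSectionVars false
set_option linter.unusedVariables false
set_option linter.unusedSimpArgs false
set_option linter.unnecessarySeqFocus false

namespace T6
variable {V : Type*} [Fintype V]

lemma CC.adj_of {G : SimpleGraph V} {s : Set V} {a b : V} (h : CC G s) (hs : ∀ x, x ∈ s ↔ x = a ∨ x = b) (hab : a ≠ b) :
    G.Adj a b := by
  by_contra hn
  have := h {a} (by intro x hx; rw [Set.mem_singleton_iff] at hx; rw [hs]; exact Or.inl hx) ⟨a, rfl⟩ (by
    intro x hx y hy hxy
    rw [Set.mem_singleton_iff] at hx; subst hx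
    rcases (hs y).1 hy with h | h
    · exact h
    · subst h; exact absurd hxy hn)
  have hb : b ∈ ({a} : Set V) := by rw [this, hs]; exact Or.inr rfl
  exact hab hb.symm

lemma cy3_edges {a b d : V} (e : Sym2 V) : (∃ t, e = s((fun n : ℕ => if n % 3 = 0 then a else if n % 3 = 1 then b else d) t,
    (fun n : ℕ => if n % 3 = 0 then a else if n % 3 = 1 then b else d) (t+1))) ↔ e = s(a,b) ∨ e = s(b,d) ∨ e = s(d,a) := by
  constructor
  · rintro ⟨t, rfl⟩
    have : t % 3 = 0 ∨ t % 3 = 1 ∨ t % 3 = 2 := by omega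
    rcases this with h | h | h
    · have : (t+1) % 3 = 1 := by omega
      simp [h, this]
    · have : (t+1) % 3 = 2 := by omega
      simp [h, this]
    · have : (t+1) % 3 = 0 := by omega
      simp [h, this]
  · rintro (rfl | rfl | rfl)
    · exact ⟨0, by simp⟩
    · exact ⟨1, by simp⟩
    · exact ⟨2, by simp⟩

lemma tb3 {G : SimpleGraph V} {U : Set V} (hG : TwoConn G U) (hU : U.ncard = 3) : HasTB G.edgeSet := by
  obtain ⟨a, b, d, hab, had, hbd, rfl⟩ := Set.ncard_eq_three.1 hU
  have h1 : G.Adj a b := (hG.2.2 d).adj_of (by intro x; simp only [Set.mem_sdiff, Set.mem_insert_iff, Set.mem_singleton_iff]; constructor <;> [tauto; (rintro (rfl | rfl) <;> tauto)]) hab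
  have h2 : G.Adj b d := (hG.2.2 a).adj_of (by intro x; simp only [Set.mem_sdiff, Set.mem_insert_iff, Set.mem_singleton_iff]; constructor <;> [tauto; (rintro (rfl | rfl) <;> tauto)]) hbd
  have h3 : G.Adj d a := (hG.2.2 b).adj_of (by intro x; simp only [Set.mem_sdiff, Set.mem_insert_iff, Set.mem_singleton_iff]; constructor <;> [tauto; (rintro (rfl | rfl) <;> tauto)]) had.symm
  refine ⟨Bool, inferInstance, (fun _ : Bool => seg (fun n : ℕ => if n % 3 = 0 then a else if n % 3 = 1 then b else d) 0 3), ?_⟩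
  · convert tb_cycle (cy3 hab hbd had) using 1
    ext e
    rw [Set.mem_ofPred_eq, cy3_edges]
    constructor
    · induction e using Sym2.ind with
      | _ p q =>
        intro h
        have hp : p ∈ _ := hG.2.1 _ _ h
        have hq : q ∈ _ := hG.2.1 _ _ (SimpleGraph.Adj.symm h)
        have hpq : p ≠ q := SimpleGraph.Adj.ne h
        simp only [Set.mem_insert_iff, Set.mem_singleton_iff] at hp hq
        rcases hp with rfl | rfl | rfl <;> rcases hq with rfl | rfl | rfl <;> simp_all
    · rintro (rfl | rfl | rfl) <;> assumption

lemma tb4 {G : SimpleGraph V} {U : Set V} (hG : TwoConn G U) (hU : U.ncard = 4) (h3 : ∀ u v, CC G (U \ {u, v})) :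
    HasTB G.edgeSet := by
  obtain ⟨x, hx⟩ : U.Nonempty := by
    rw [← Set.ncard_pos]; omega
  have hU3 : (U \ {x}).ncard = 3 := by rw [Set.ncard_sdiff_singleton_of_mem hx]; omega
  obtain ⟨a, b, d, hab, had, hbd, hs⟩ := Set.ncard_eq_three.1 hU3
  have hm : ∀ p, p ∈ U ↔ p = x ∨ p = a ∨ p = b ∨ p = d := by
    intro p
    by_cases hp : p = x
    · subst hp; simp [hx]
    · have : p ∈ U \ {x} ↔ p ∈ ({a, b, d} : Set V) := by rw [hs]
      simp only [Set.mem_sdiff, Set.mem_singleton_iff, Set.mem_insert_iff] at this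
      tauto
  have hxs : x ∉ ({a, b, d} : Set V) := by rw [← hs]; simp
  simp only [Set.mem_singleton_iff, Set.mem_insert_iff, not_or] at hxs
  obtain ⟨hxa, hxb, hxd⟩ := hxs
  have mk : ∀ p q r s, p ≠ q → p ≠ r → p ≠ s → q ≠ r → q ≠ s → (∀ w, w ∈ U ↔ w = p ∨ w = q ∨ w = r ∨ w = s) → G.Adj p q := by
    intro p q r s h1 h2 h3' h4 h5 hw
    apply (h3 r s).adj_of _ h1
    intro w
    rw [Set.mem_sdiff, hw]
    simp only [Set.mem_insert_iff, Set.mem_singleton_iff]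
    constructor
    · tauto
    · rintro (rfl | rfl) <;> tauto
  have e1 := mk a b d x hab had (Ne.symm hxa) hbd (Ne.symm hxb) (fun w => by rw [hm]; tauto)
  have e2 := mk b d a x hbd hab.symm (Ne.symm hxb) had.symm (Ne.symm hxd) (fun w => by rw [hm]; tauto)
  have e3 := mk d a b x had.symm hbd.symm (Ne.symm hxd) hab (Ne.symm hxa) (fun w => by rw [hm]; tauto)
  have f1 := mk x a b d hxa hxb hxd hab had (fun w => by rw [hm])
  have f2 := mk x b a d hxb hxa hxd hab.symm hbd (fun w => by rw [hm]; tauto)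
  have f3 := mk x d a b hxd hxa hxb had.symm hbd.symm (fun w => by rw [hm]; tauto)
  have hcy := cy3 hab hbd had
  have hxc : ∀ n : ℕ, (fun n : ℕ => if n % 3 = 0 then a else if n % 3 = 1 then b else d) n ≠ x := by
    intro n; simp only; split_ifs
    · exact Ne.symm hxa
    · exact Ne.symm hxb
    · exact Ne.symm hxd
  obtain ⟨ι', hι, F', hF', _⟩ := attach hcy hxc (t := 1) (by omega) (by omega) (tb_cycle hcy) (i0 := true) rfl (by
    intro v hv
    rw [Set.mem_ofPred_eq, cy3_edges] at hv
    simp only [Sym2.eq_iff] at hv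
    tauto) (fun _ => True) trivial trivial (by intro n _ _; omega)
  refine ⟨ι', hι, F', ?_⟩
  convert hF' using 1
  ext e
  have hq : (∃ q < 3, True ∧ e = s(x, (fun n : ℕ => if n % 3 = 0 then a else if n % 3 = 1 then b else d) q)) ↔ e = s(x,a) ∨ e = s(x,b) ∨ e = s(x,d) := by
    constructor
    · rintro ⟨q, hq, _, rfl⟩
      interval_cases q <;> simp
    · rintro (rfl | rfl | rfl)
      · exact ⟨0, by omega, trivial, by simp⟩
      · exact ⟨1, by omega, trivial, by simp⟩
      · exact ⟨2, by omega, trivial, by simp⟩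
  rw [Set.mem_union, Set.mem_ofPred_eq, cy3_edges, Set.mem_ofPred_eq, hq]
  constructor
  · induction e using Sym2.ind with
    | _ p q =>
      intro h
      have hp : p ∈ U := hG.2.1 _ _ h
      have hq : q ∈ U := hG.2.1 _ _ (SimpleGraph.Adj.symm h)
      have hpq : p ≠ q := SimpleGraph.Adj.ne h
      rw [hm] at hp hq
      simp only [Sym2.eq_iff]
      rcases hp with rfl | rfl | rfl | rfl <;> rcases hq with rfl | rfl | rfl | rfl <;> first | (exact absurd rfl hpq) | simp
  · rintro ((rfl | rfl | rfl) | (rfl | rfl | rfl)) <;> assumption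

lemma two_nbrs {G : SimpleGraph V} {U : Set V} (hG : TwoConn G U) (h3 : ∀ u v, CC G (U \ {u, v})) (hU : 4 ≤ U.ncard)
    {x y : V} (hxy : G.Adj x y) : ∃ a b, a ≠ b ∧ a ≠ y ∧ b ≠ y ∧ G.Adj x a ∧ G.Adj x b := by
  obtain ⟨a, ha, hay⟩ := hG.deg2 hxy
  by_contra hh; push Not at hh
  have hxU := hG.2.1 _ _ hxy
  have := h3 y a {x} (by
    intro p hp; rw [Set.mem_singleton_iff] at hp; subst hp
    exact ⟨hxU, by simp [hxy.ne, ha.ne]⟩) ⟨x, rfl⟩ (by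
    intro p hp q hq hpq
    rw [Set.mem_singleton_iff] at hp; subst hp
    have h2 := hq.2
    simp only [Set.mem_insert_iff, Set.mem_singleton_iff, not_or] at h2
    exact absurd hpq (hh a q (Ne.symm h2.2) hay h2.1 ha))
  have hsub : U ⊆ {x, y, a} := by
    intro p hp
    by_cases h : p = y ∨ p = a
    · simp; tauto
    · have : p ∈ ({x} : Set V) := by rw [this]; exact ⟨hp, by simpa using h⟩
      simp at this; simp [this]
  have h1 := Set.ncard_le_ncard hsub (Set.toFinite _)
  have h2 : ({x, y, a} : Set V).ncard ≤ 3 := by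
    have := Set.ncard_insert_le x {y, a}
    have := Set.ncard_insert_le y {a}
    have := Set.ncard_singleton a
    omega
  omega

theorem tb_exists : ∀ (n : ℕ) (G : SimpleGraph V) (U : Set V), U.ncard = n → TwoConn G U → Good G → HasTB G.edgeSet := by
  intro n
  induction n using Nat.strong_induction_on with
  | _ n ih =>
    intro G U hn hG hg
    by_cases h3 : ∀ u v, CC G (U \ {u, v})
    swap
    · push Not at h3
      obtain ⟨u, v, h⟩ := h3
      obtain ⟨D, D2, hs⟩ := sep_of_not hG h
      exact hs.tb hG (ih _ (hn ▸ hs.card_lt) _ _ rfl (hs.two hG) (hs.good hG hg))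
        (ih _ (hn ▸ hs.symm.card_lt) _ _ rfl (hs.symm.two hG) (hs.symm.good hG hg))
    have hU3 := hG.1
    by_cases hc3 : U.ncard = 3
    · exact tb3 hG hc3
    by_cases hc4 : U.ncard = 4
    · exact tb4 hG hc4 h3
    have h5 : 5 ≤ U.ncard := by omega
    obtain ⟨a0, ha0⟩ : U.Nonempty := by
      rw [← Set.ncard_pos]; omega
    obtain ⟨b0, hab0⟩ := hG.exists_adj ha0
    obtain ⟨x, y, hxy, hcon⟩ := exists_contractible ⟨a0, b0, hab0⟩ h3
    have hyU := hG.2.1 _ _ hxy.symm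
    have hH := ctr_two hG hxy h3 (by omega)
    have hK := del_two hG hxy hcon h5
    have hT := ih _ (by rw [← hn, Set.ncard_sdiff_singleton_of_mem hyU]; omega) _ _ rfl hH (ctr_good hxy hg)
    obtain ⟨a1, b1, hab1, ha1y, hb1y, ha1, hb1⟩ := two_nbrs hG h3 (by omega) hxy
    obtain ⟨a2, b2, hab2, ha2x, hb2x, ha2, hb2⟩ := two_nbrs hG h3 (by omega) hxy.symm
    obtain ⟨ι, _, F, i0, hF, hnb⟩ := tb_dv hH hK ⟨a1, ha1.ne, hxy.ne, ha1y, Or.inl ha1⟩ hT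
    obtain ⟨k, c, hc, hi0⟩ := hF.face_cycle hK i0
    have hk3 := hc.k3
    have hcK : ∀ n, (dv (ctr G x y) x).Adj (c n) (c (n+1)) := by
      intro n
      have h1 : s(c n, c (n+1)) ∈ (dv (ctr G x y) x).edgeSet := by
        apply (hF.cyc i0).1
        rw [hi0]
        have : s(c n, c (n+1)) = s(c (n % k), c (n % k + 1)) := by
          rw [hc.modk, ← hc.modk (n % k + 1), Nat.mod_add_mod, hc.modk]
        rw [this, hc.seg_eval le_rfl (Nat.mod_lt _ (by omega)), if_pos ⟨by omega, Nat.mod_lt _ (by omega)⟩]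
        decide
      exact h1
    have hadj : ∀ n, G.Adj (c n) (c (n+1)) := fun n => (dv_ctr.1 (hcK n)).1
    have hcx : ∀ n, c n ≠ x := fun n => (dv_ctr.1 (hcK n)).2.1
    have hcy : ∀ n, c n ≠ y := fun n => (dv_ctr.1 (hcK n)).2.2.1
    have hon : ∀ a, a ≠ x → a ≠ y → (G.Adj x a ∨ G.Adj y a) → ∃ q, a = c q := by
      intro a hax hay h
      obtain ⟨b, hb⟩ := hnb a ⟨hax.symm, hxy.ne, hay, by tauto⟩
      rw [hi0] at hb
      obtain ⟨t, _, _, h⟩ := seg_nz (by rw [hb]; decide : seg c 0 k s(a,b) ≠ 0)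
      rw [Sym2.eq_iff] at h
      rcases h with h | h
      · exact ⟨_, h.1⟩
      · exact ⟨_, h.1⟩
    have hX : ∃ p q, c p ≠ c q ∧ G.Adj x (c p) ∧ G.Adj x (c q) := by
      obtain ⟨p, hp⟩ := hon a1 ha1.ne' ha1y (Or.inl ha1)
      obtain ⟨q, hq⟩ := hon b1 hb1.ne' hb1y (Or.inl hb1)
      subst hp hq
      exact ⟨p, q, hab1, ha1, hb1⟩
    have hY : ∃ p q, c p ≠ c q ∧ G.Adj y (c p) ∧ G.Adj y (c q) := by
      obtain ⟨p, hp⟩ := hon a2 ha2x ha2.ne' (Or.inr ha2)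
      obtain ⟨q, hq⟩ := hon b2 hb2x hb2.ne' (Or.inr hb2)
      subst hp hq
      exact ⟨p, q, hab2, ha2, hb2⟩
    obtain ⟨s, t, hcfg⟩ := exists_cfg hg hc hadj hcx hcy hxy hX hY
    have hrot : ∀ p, ∃ p' < k, c (p' + s) = c p := by
      intro p
      refine ⟨(p + (s * (k - 1))) % k, Nat.mod_lt _ (by omega), ?_⟩
      have : p + s * (k-1) + s = p + s * k := by
        obtain ⟨m, rfl⟩ : ∃ m, k = m + 1 := ⟨k-1, by omega⟩
        simp; ring
      rw [← hc.modk, Nat.mod_add_mod, this, Nat.add_mul_mod_self_right, hc.modk]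
    refine extend (hc.rot s) (fun n => hcx _) (fun n => hcy _) hxy hcfg hF (i0 := i0) (by rw [hi0, hc.seg_rot]) ?_ ?_ ?_ ?_
    · intro v hv
      exact (dv_ctr.1 hv).2.1 rfl
    · intro v hv
      exact (dv_ctr.1 hv).2.2.1 rfl
    · intro e
      induction e using Sym2.ind with
      | _ p q =>
        have side : ∀ p q, G.Adj p q → (p = x ∨ p = y) → s(p,q) = s(x,y) ∨ (∃ q' < k, G.Adj x (c (q' + s)) ∧ s(p,q) = s(x, c (q' + s))) ∨
            (∃ q' < k, G.Adj y (c (q' + s)) ∧ s(p,q) = s(y, c (q' + s))) := by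
          rintro p q hpq (rfl | rfl)
          · by_cases hq : q = y
            · left; rw [hq]
            · right; left
              obtain ⟨u, rfl⟩ := hon q hpq.ne' hq (Or.inl hpq)
              obtain ⟨u', hu', he⟩ := hrot u
              exact ⟨u', hu', by rwa [he], by rw [he]⟩
          · by_cases hq : q = x
            · left; rw [hq]; exact Sym2.eq_swap
            · right; right
              obtain ⟨u, rfl⟩ := hon q hq hpq.ne' (Or.inr hpq)
              obtain ⟨u', hu', he⟩ := hrot u
              exact ⟨u', hu', by rwa [he], by rw [he]⟩
        constructor
        · intro h
          have h : G.Adj p q := h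
          by_cases hp : p = x ∨ p = y
          · exact Or.inr (side p q h hp)
          · by_cases hq : q = x ∨ q = y
            · have := side q p h.symm hq
              rw [Sym2.eq_swap] at this
              exact Or.inr this
            · left
              push Not at hp hq
              exact dv_ctr.2 ⟨h, hp.1, hp.2, hq.1, hq.2⟩
        · rintro (h | h | ⟨u, _, hu, h⟩ | ⟨u, _, hu, h⟩)
          · exact (dv_ctr.1 h).1
          · rw [h]; exact hxy
          · rw [h]; exact hu
          · rw [h]; exact hu
    · obtain ⟨p, q, h1, h2, h4⟩ := hY
      obtain ⟨p', _, hp⟩ := hrot p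
      obtain ⟨q', _, hq⟩ := hrot q
      exact ⟨p', q', by simp only [hp, hq]; exact h1, by simp only [hp]; exact h2, by simp only [hq]; exact h4⟩

end T6

end

section
open SimpleGraph Finset
open scoped Classical
set_option linter.unusedSectionVars false
set_option linter.unusedVariables false
set_option linter.unusedSimpArgs false
set_option linter.unnecessarySeqFocus false

namespace T6
variable {V : Type*} [Fintype V]

/-- number of edges of a chain -/
noncomputable def sz (z : Ch V) : ℕ := (univ.filter (fun e => z e = 1)).card

lemma IsCy.seg_one {c : ℕ → V} {k : ℕ} (h : IsCy c k) (e : Sym2 V) :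
    seg c 0 k e = 1 ↔ ∃ t < k, e = s(c t, c (t+1)) := by
  constructor
  · intro he
    obtain ⟨t, _, ht, rfl⟩ := seg_nz (by rw [he]; decide : seg c 0 k e ≠ 0)
    exact ⟨t, ht, rfl⟩
  · rintro ⟨t, ht, rfl⟩
    rw [h.seg_eval le_rfl ht]; simp [ht]

lemma IsCy.sz_seg {c : ℕ → V} {k : ℕ} (h : IsCy c k) : sz (seg c 0 k) = k := by
  have : univ.filter (fun e => seg c 0 k e = 1) = (range k).image (fun t => s(c t, c (t+1))) := by
    ext e
    simp only [mem_filter, mem_univ, true_and, mem_image, mem_range, h.seg_one]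
    constructor
    · rintro ⟨t, h1, h2⟩; exact ⟨t, h1, h2.symm⟩
    · rintro ⟨t, h1, h2⟩; exact ⟨t, h1, h2.symm⟩
  rw [sz, this, card_image_of_injOn, card_range]
  intro m hm n hn he
  simp only [coe_range, Set.mem_Iio] at hm hn
  exact h.edge hm hn he

lemma IsCy.bd_cyc {c : ℕ → V} {k : ℕ} (h : IsCy c k) : bd (seg c 0 k) = 0 := by
  rw [h.bd_seg (Nat.zero_le _)]
  have : c k = c 0 := by simpa using h.per 0
  rw [this]; exact funext fun v => z2_add _

lemma IsCy.loop {c : ℕ → V} {k : ℕ} (h : IsCy c k) (v : V) : seg c 0 k s(v,v) = 0 := by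
  apply z2_ne1; intro h1
  obtain ⟨t, _, ht⟩ := (h.seg_one _).1 h1
  rw [Sym2.eq_iff] at ht
  rcases ht with ⟨h2, h3⟩ | ⟨h2, h3⟩ <;> exact h.ne1 t (by rw [← h2, ← h3])

lemma sz_mono {z w : Ch V} (h : ∀ e, w e = 1 → z e = 1) : sz w ≤ sz z := by
  apply card_le_card
  intro e he
  simp only [mem_filter, mem_univ, true_and] at *
  exact h e he

lemma sz_sub {z w : Ch V} (h : ∀ e, w e = 1 → z e = 1) : sz (z + w) + sz w = sz z := by
  unfold sz
  rw [← card_union_of_disjoint]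
  · congr 1
    ext e
    simp only [mem_filter, mem_univ, true_and, mem_union, Pi.add_apply]
    constructor
    · rintro (h1 | h1)
      · by_cases h2 : w e = 1
        · exact h e h2
        · rw [z2_ne1 h2] at h1; simpa using h1
      · exact h e h1
    · intro h1
      by_cases h2 : w e = 1
      · exact Or.inr h2
      · left; rw [z2_ne1 h2, h1]; rfl
  · rw [Finset.disjoint_left]
    intro e he he'
    simp only [mem_filter, mem_univ, true_and, Pi.add_apply] at *
    rw [he', h e he'] at he
    exact absurd he (by decide)

lemma even_ge3 {z : Ch V} (hb : bd z = 0) (hz : z ≠ 0) (hl : ∀ v, z s(v,v) = 0) :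
    ∃ k c, IsCy c k ∧ (∀ e, seg c 0 k e = 1 → z e = 1) ∧ k ≤ sz z := by
  obtain ⟨k, c, hc, h1⟩ := cyc_extract hb hz hl
  have h2 : ∀ e, seg c 0 k e = 1 → z e = 1 := by
    intro e he
    obtain ⟨t, _, rfl⟩ := (hc.seg_one _).1 he
    exact h1 t
  refine ⟨k, c, hc, h2, ?_⟩
  have := sz_mono h2
  rwa [hc.sz_seg] at this

lemma even_small {z : Ch V} (hb : bd z = 0) (hz : z ≠ 0) (hl : ∀ v, z s(v,v) = 0) (h5 : sz z ≤ 5) :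
    ∃ c, IsCy c (sz z) ∧ z = seg c 0 (sz z) := by
  obtain ⟨k, c, hc, h1, h2⟩ := even_ge3 hb hz hl
  have h3 := sz_sub h1
  rw [hc.sz_seg] at h3
  have hk := hc.k3
  have h0 : z + seg c 0 k = 0 := by
    by_contra hne
    obtain ⟨k', c', hc', _, h4⟩ := even_ge3 (z := z + seg c 0 k) (by rw [map_add, hb, hc.bd_cyc]; rfl) hne (by
      intro v; rw [Pi.add_apply, hl, hc.loop]; rfl)
    have := hc'.k3
    omega
  have hzz := ch_eq h0
  have : sz z = k := by rw [hzz, hc.sz_seg]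
  rw [this]
  exact ⟨c, hc, hzz⟩

def Is3 (z : Ch V) (a b c : V) : Prop :=
  (a ≠ b ∧ a ≠ c ∧ b ≠ c) ∧ ∀ e, z e = 1 ↔ e = s(a,b) ∨ e = s(b,c) ∨ e = s(c,a)
def Is4 (z : Ch V) (a b c d : V) : Prop :=
  (a ≠ b ∧ a ≠ c ∧ a ≠ d ∧ b ≠ c ∧ b ≠ d ∧ c ≠ d) ∧ ∀ e, z e = 1 ↔ e = s(a,b) ∨ e = s(b,c) ∨ e = s(c,d) ∨ e = s(d,a)
def Is5 (z : Ch V) (a b c d f : V) : Prop :=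
  (a ≠ b ∧ a ≠ c ∧ a ≠ d ∧ a ≠ f ∧ b ≠ c ∧ b ≠ d ∧ b ≠ f ∧ c ≠ d ∧ c ≠ f ∧ d ≠ f) ∧
    ∀ e, z e = 1 ↔ e = s(a,b) ∨ e = s(b,c) ∨ e = s(c,d) ∨ e = s(d,f) ∨ e = s(f,a)

lemma Is3.rot {z : Ch V} {a b c : V} (h : Is3 z a b c) : Is3 z b c a :=
  ⟨⟨h.1.2.2, h.1.1.symm, h.1.2.1.symm⟩, fun e => by rw [h.2]; tauto⟩
lemma Is3.rev {z : Ch V} {a b c : V} (h : Is3 z a b c) : Is3 z b a c :=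
  ⟨⟨h.1.1.symm, h.1.2.2, h.1.2.1⟩, fun e => by rw [h.2, Sym2.eq_swap (a := b) (b := a), Sym2.eq_swap (a := a) (b := c), Sym2.eq_swap (a := c) (b := b)]; tauto⟩
lemma Is4.rot {z : Ch V} {a b c d : V} (h : Is4 z a b c d) : Is4 z b c d a := by
  obtain ⟨⟨h1, h2, h3, h4, h5, h6⟩, h⟩ := h
  exact ⟨⟨h4, h5, h1.symm, h6, h2.symm, h3.symm⟩, fun e => by rw [h]; tauto⟩
lemma Is4.rev {z : Ch V} {a b c d : V} (h : Is4 z a b c d) : Is4 z b a d c := by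
  obtain ⟨⟨h1, h2, h3, h4, h5, h6⟩, h⟩ := h
  exact ⟨⟨h1.symm, h5, h4, h3, h2, h6.symm⟩, fun e => by
    rw [h, Sym2.eq_swap (a := b) (b := a), Sym2.eq_swap (a := a) (b := d), Sym2.eq_swap (a := d) (b := c), Sym2.eq_swap (a := c) (b := b)]; tauto⟩
lemma Is5.rot {z : Ch V} {a b c d f : V} (h : Is5 z a b c d f) : Is5 z b c d f a := by
  obtain ⟨⟨h1, h2, h3, h4, h5, h6, h7, h8, h9, h10⟩, h⟩ := h
  exact ⟨⟨h5, h6, h7, h1.symm, h8, h9, h2.symm, h10, h3.symm, h4.symm⟩, fun e => by rw [h]; tauto⟩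
lemma Is5.rev {z : Ch V} {a b c d f : V} (h : Is5 z a b c d f) : Is5 z b a f d c := by
  obtain ⟨⟨h1, h2, h3, h4, h5, h6, h7, h8, h9, h10⟩, h⟩ := h
  exact ⟨⟨h1.symm, h7, h6, h5, h4, h3, h2, h10.symm, h9.symm, h8.symm⟩, fun e => by
    rw [h, Sym2.eq_swap (a := b) (b := a), Sym2.eq_swap (a := a) (b := f), Sym2.eq_swap (a := f) (b := d), Sym2.eq_swap (a := d) (b := c), Sym2.eq_swap (a := c) (b := b)]; tauto⟩

lemma is3_ex {z : Ch V} (hb : bd z = 0) (hl : ∀ v, z s(v,v) = 0) (h : sz z = 3) : ∃ a b c, Is3 z a b c := by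
  obtain ⟨c, hc, hz⟩ := even_small hb (by rintro rfl; simp [sz] at h) hl (by omega)
  rw [h] at hc hz
  refine ⟨c 0, c 1, c 2, ⟨hc.ne1 0, hc.ne2 0, hc.ne1 1⟩, fun e => ?_⟩
  have h0 : c 3 = c 0 := by simpa using hc.per 0
  rw [hz, hc.seg_one]
  constructor
  · rintro ⟨t, ht, rfl⟩
    interval_cases t <;> simp [h0]
  · rintro (rfl | rfl | rfl)
    exacts [⟨0, by omega, rfl⟩, ⟨1, by omega, rfl⟩, ⟨2, by omega, by rw [h0]⟩]

lemma is4_ex {z : Ch V} (hb : bd z = 0) (hl : ∀ v, z s(v,v) = 0) (h : sz z = 4) : ∃ a b c d, Is4 z a b c d := by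
  obtain ⟨c, hc, hz⟩ := even_small hb (by rintro rfl; simp [sz] at h) hl (by omega)
  rw [h] at hc hz
  have hne : ∀ m n, m < 4 → n < 4 → m ≠ n → c m ≠ c n := fun m n h1 h2 h3 h4 => h3 (hc.inj m n h1 h2 h4)
  refine ⟨c 0, c 1, c 2, c 3, ⟨?_, ?_, ?_, ?_, ?_, ?_⟩, fun e => ?_⟩
  iterate 6 exact hne _ _ (by omega) (by omega) (by omega)
  have h0 : c 4 = c 0 := by simpa using hc.per 0
  rw [hz, hc.seg_one]
  constructor
  · rintro ⟨t, ht, rfl⟩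
    interval_cases t <;> simp [h0]
  · rintro (rfl | rfl | rfl | rfl)
    exacts [⟨0, by omega, rfl⟩, ⟨1, by omega, rfl⟩, ⟨2, by omega, rfl⟩, ⟨3, by omega, by rw [h0]⟩]

lemma is5_ex {z : Ch V} (hb : bd z = 0) (hl : ∀ v, z s(v,v) = 0) (h : sz z = 5) : ∃ a b c d f, Is5 z a b c d f := by
  obtain ⟨c, hc, hz⟩ := even_small hb (by rintro rfl; simp [sz] at h) hl (by omega)
  rw [h] at hc hz
  have hne : ∀ m n, m < 5 → n < 5 → m ≠ n → c m ≠ c n := fun m n h1 h2 h3 h4 => h3 (hc.inj m n h1 h2 h4)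
  refine ⟨c 0, c 1, c 2, c 3, c 4, ⟨?_, ?_, ?_, ?_, ?_, ?_, ?_, ?_, ?_, ?_⟩, fun e => ?_⟩
  iterate 10 exact hne _ _ (by omega) (by omega) (by omega)
  have h0 : c 5 = c 0 := by simpa using hc.per 0
  rw [hz, hc.seg_one]
  constructor
  · rintro ⟨t, ht, rfl⟩
    interval_cases t <;> simp [h0]
  · rintro (rfl | rfl | rfl | rfl | rfl)
    exacts [⟨0, by omega, rfl⟩, ⟨1, by omega, rfl⟩, ⟨2, by omega, rfl⟩, ⟨3, by omega, rfl⟩, ⟨4, by omega, by rw [h0]⟩]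

lemma Is3.at {z : Ch V} {a b c u v : V} (h : Is3 z a b c) (he : z s(u,v) = 1) : ∃ w, Is3 z u v w := by
  have := (h.2 _).1 he
  simp only [Sym2.eq_iff] at this
  rcases this with (⟨rfl, rfl⟩ | ⟨rfl, rfl⟩) | (⟨rfl, rfl⟩ | ⟨rfl, rfl⟩) | (⟨rfl, rfl⟩ | ⟨rfl, rfl⟩)
  exacts [⟨_, h⟩, ⟨_, h.rev⟩, ⟨_, h.rot⟩, ⟨_, h.rot.rev⟩, ⟨_, h.rot.rot⟩, ⟨_, h.rot.rot.rev⟩]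
lemma Is4.at {z : Ch V} {a b c d u v : V} (h : Is4 z a b c d) (he : z s(u,v) = 1) : ∃ w x, Is4 z u v w x := by
  have := (h.2 _).1 he
  simp only [Sym2.eq_iff] at this
  rcases this with (⟨rfl, rfl⟩ | ⟨rfl, rfl⟩) | (⟨rfl, rfl⟩ | ⟨rfl, rfl⟩) | (⟨rfl, rfl⟩ | ⟨rfl, rfl⟩) | (⟨rfl, rfl⟩ | ⟨rfl, rfl⟩)
  exacts [⟨_, _, h⟩, ⟨_, _, h.rev⟩, ⟨_, _, h.rot⟩, ⟨_, _, h.rot.rev⟩, ⟨_, _, h.rot.rot⟩, ⟨_, _, h.rot.rot.rev⟩,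
    ⟨_, _, h.rot.rot.rot⟩, ⟨_, _, h.rot.rot.rot.rev⟩]
lemma Is5.at {z : Ch V} {a b c d f u v : V} (h : Is5 z a b c d f) (he : z s(u,v) = 1) : ∃ w x y, Is5 z u v w x y := by
  have := (h.2 _).1 he
  simp only [Sym2.eq_iff] at this
  rcases this with (⟨rfl, rfl⟩ | ⟨rfl, rfl⟩) | (⟨rfl, rfl⟩ | ⟨rfl, rfl⟩) | (⟨rfl, rfl⟩ | ⟨rfl, rfl⟩) | (⟨rfl, rfl⟩ | ⟨rfl, rfl⟩) | (⟨rfl, rfl⟩ | ⟨rfl, rfl⟩)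
  exacts [⟨_, _, _, h⟩, ⟨_, _, _, h.rev⟩, ⟨_, _, _, h.rot⟩, ⟨_, _, _, h.rot.rev⟩, ⟨_, _, _, h.rot.rot⟩, ⟨_, _, _, h.rot.rot.rev⟩,
    ⟨_, _, _, h.rot.rot.rot⟩, ⟨_, _, _, h.rot.rot.rot.rev⟩, ⟨_, _, _, h.rot.rot.rot.rot⟩, ⟨_, _, _, h.rot.rot.rot.rot.rev⟩]

section faces
variable {ι : Type} [Fintype ι] {F : ι → Ch V} {G : SimpleGraph V} {U : Set V}

lemma IsTB.sz3 (h : IsTB G.edgeSet F) (i : ι) : 3 ≤ sz (F i) := by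
  obtain ⟨k, c, hc, _, h2⟩ := even_ge3 (h.cyc i).2 (h.ne i) (h.loopless i)
  have := hc.k3
  omega

lemma IsTB.face2 (h : IsTB G.edgeSet F) (hG : TwoConn G U) {i : ι} {v a b w : V} (hab : a ≠ b)
    (ha : F i s(v,a) = 1) (hb : F i s(v,b) = 1) (hw : F i s(v,w) = 1) : w = a ∨ w = b := by
  obtain ⟨k, c, hc, hF⟩ := h.face_cycle hG i
  have hk := hc.k3
  rw [hF] at ha hb hw
  obtain ⟨m, hm⟩ : ∃ m, v = c (m + 1) := by
    obtain ⟨t, _, ht⟩ := (hc.seg_one _).1 ha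
    rw [Sym2.eq_iff] at ht
    rcases ht with ht | ht
    · refine ⟨t + (k - 1), ?_⟩
      rw [show t + (k-1) + 1 = t + k by omega, hc.per]; exact ht.1
    · exact ⟨t, ht.1⟩
  have key : ∀ w, seg c 0 k s(v,w) = 1 → w = c m ∨ w = c (m+2) := by
    intro w hw
    obtain ⟨t, ht1, ht⟩ := (hc.seg_one _).1 hw
    rw [Sym2.eq_iff] at ht
    rcases ht with ht | ht
    · right
      rw [ht.2, ← hc.modk (t+1), ← hc.modk (m+2)]
      congr 1
      have := hc.inj' (hm.symm.trans ht.1)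
      exact (Nat.ModEq.add_right 1 this).symm
    · left
      rw [ht.2, ← hc.modk t, ← hc.modk m]
      congr 1
      have := hc.inj' (hm.symm.trans ht.1)
      exact (Nat.ModEq.add_right_cancel' 1 this).symm
  rcases key a ha with h1 | h1 <;> rcases key b hb with h2 | h2 <;> rcases key w hw with h3 | h3 <;> simp_all

lemma IsTB.face_ex2 (h : IsTB G.edgeSet F) {i : ι} {v a : V}
    (ha : F i s(v,a) = 1) : ∃ b, b ≠ a ∧ F i s(v,b) = 1 := by
  by_contra hh; push Not at hh
  have := congrFun (h.cyc i).2 v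
  rw [bd_apply, Finset.sum_eq_single a] at this
  · rw [ha] at this; exact one_ne_zero this
  · intro b _ hb; exact z2_ne1 (hh b hb)
  · simp

lemma IsTB.adj (h : IsTB G.edgeSet F) {i : ι} {v a : V} (ha : F i s(v,a) = 1) : G.Adj v a :=
  (h.cyc i).1 _ (by rw [ha]; decide)

/-- a set of edges at `v` closed under sharing faces contains all edges at `v` -/
lemma IsTB.sat (h : IsTB G.edgeSet F) (hG : TwoConn G U) {v : V} (S : Set V) {a : V} (ha : a ∈ S) (hva : G.Adj v a)
    (hcl : ∀ w ∈ S, ∀ k, F k s(v,w) = 1 → ∀ w', F k s(v,w') = 1 → w' ∈ S) : ∀ w, G.Adj v w → w ∈ S := by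
  intro w hw
  by_contra hwS
  obtain ⟨i, _, _, hi, _⟩ := h.two s(v,a) hva
  obtain ⟨j, _, _, hj, _⟩ := h.two s(v,w) hw
  have := h.link hG v (fun k => if ∃ w ∈ S, F k s(v,w) = 1 then 1 else 0) (by
    intro u j k hj hk
    by_cases hu : u ∈ S
    · rw [if_pos ⟨u, hu, hj⟩, if_pos ⟨u, hu, hk⟩]
    · rw [if_neg, if_neg]
      · rintro ⟨w', h1, h2⟩; exact hu (hcl w' h1 k h2 u hk)
      · rintro ⟨w', h1, h2⟩; exact hu (hcl w' h1 j h2 u hj)) hi hj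
  rw [if_pos ⟨a, ha, hi⟩, if_neg] at this
  · exact absurd this (by decide)
  · rintro ⟨w', h1, h2⟩; exact hwS (hcl w' h1 j h2 w hj)

lemma IsTB.sat2 (h : IsTB G.edgeSet F) (hG : TwoConn G U) (hd : ∀ v a b : V, ∃ w, G.Adj v w ∧ w ≠ a ∧ w ≠ b)
    {i j : ι} {v a b : V} (hab : a ≠ b) (hia : F i s(v,a) = 1) (hib : F i s(v,b) = 1) (hja : F j s(v,a) = 1)
    (hjb : F j s(v,b) = 1) : i = j := by
  by_contra hij
  obtain ⟨w, h1, h2, h3⟩ := hd v a b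
  have := h.sat hG ({a, b} : Set V) (by simp) (h.adj hia) (by
    intro w hw k hk w' hw'
    have : k = i ∨ k = j := by
      rcases hw with rfl | hw
      · exact h.third hij hia hja hk
      · rw [Set.mem_singleton_iff] at hw; subst hw
        exact h.third hij hib hjb hk
    rcases this with rfl | rfl
    · exact h.face2 hG hab hia hib hw'
    · exact h.face2 hG hab hja hjb hw') w h1
  rcases this with h4 | h4
  · exact h2 h4
  · exact h3 h4

end faces

/-- six-cycle with short chord -/
lemma th_short {G : SimpleGraph V} (hth : ¬ HasTheta6 G) {a b c d e f : V} (h1 : G.Adj a b) (h2 : G.Adj b c) (h3 : G.Adj c d)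
    (h4 : G.Adj d e) (h5 : G.Adj e f) (h6 : G.Adj f a) (h7 : G.Adj a c)
    (n2 : a ≠ d) (n3 : a ≠ e) (n4 : b ≠ d) (n5 : b ≠ e) (n6 : b ≠ f) (n7 : c ≠ e) (n8 : c ≠ f) (n9 : d ≠ f) : False := by
  apply hth
  refine ⟨![a,b,c,d,e,f], ?_, ?_, 0, 2, by decide, by decide, by decide, h7⟩
  · have m1 := h1.ne
    have m2 := h2.ne
    have m3 := h3.ne
    have m4 := h4.ne
    have m5 := h5.ne
    have m6 := h6.ne
    have m7 := h7.ne
    intro i j hij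
    fin_cases i <;> fin_cases j <;> simp_all
  · intro i; fin_cases i <;> simpa

/-- six-cycle with long chord -/
lemma th_long {G : SimpleGraph V} (hth : ¬ HasTheta6 G) {a b c d e f : V} (h1 : G.Adj a b) (h2 : G.Adj b c) (h3 : G.Adj c d)
    (h4 : G.Adj d e) (h5 : G.Adj e f) (h6 : G.Adj f a) (h7 : G.Adj a d)
    (n2 : a ≠ c) (n3 : a ≠ e) (n4 : b ≠ d) (n5 : b ≠ e) (n6 : b ≠ f) (n7 : c ≠ e) (n8 : c ≠ f) (n9 : d ≠ f) : False := by
  apply hth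
  refine ⟨![a,b,c,d,e,f], ?_, ?_, 0, 3, by decide, by decide, by decide, h7⟩
  · have m1 := h1.ne
    have m2 := h2.ne
    have m3 := h3.ne
    have m4 := h4.ne
    have m5 := h5.ne
    have m6 := h6.ne
    have m7 := h7.ne
    intro i j hij
    fin_cases i <;> fin_cases j <;> simp_all
  · intro i; fin_cases i <;> simpa

end T6

end

section
open SimpleGraph Finset
open scoped Classical
set_option linter.unusedSectionVars false
set_option linter.unusedVariables false
set_option linter.unusedSimpArgs false
set_option linter.unnecessarySeqFocus false

namespace T6
variable {V : Type*} [Fintype V]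

lemma Is3.sz {z : Ch V} {a b c : V} (h : Is3 z a b c) : sz z = 3 := by
  have : univ.filter (fun e => z e = 1) = {s(a,b), s(b,c), s(c,a)} := by
    ext e; simp [h.2]
  obtain ⟨⟨h1, h2, h3⟩, _⟩ := h
  rw [T6.sz, this, card_insert_of_notMem, card_insert_of_notMem, card_singleton]
  · simp [Sym2.eq_iff]; tauto
  · simp [Sym2.eq_iff]; tauto

lemma Is4.sz {z : Ch V} {a b c d : V} (h : Is4 z a b c d) : sz z = 4 := by
  have : univ.filter (fun e => z e = 1) = {s(a,b), s(b,c), s(c,d), s(d,a)} := by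
    ext e; simp [h.2]
  obtain ⟨⟨h1, h2, h3, h4, h5, h6⟩, _⟩ := h
  rw [T6.sz, this, card_insert_of_notMem, card_insert_of_notMem, card_insert_of_notMem, card_singleton]
  · simp [Sym2.eq_iff]; tauto
  · simp [Sym2.eq_iff]; tauto
  · simp [Sym2.eq_iff]; tauto

lemma Is5.sz {z : Ch V} {a b c d f : V} (h : Is5 z a b c d f) : sz z = 5 := by
  have : univ.filter (fun e => z e = 1) = {s(a,b), s(b,c), s(c,d), s(d,f), s(f,a)} := by
    ext e; simp [h.2]
  obtain ⟨⟨h1, h2, h3, h4, h5, h6, h7, h8, h9, h10⟩, _⟩ := h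
  rw [T6.sz, this, card_insert_of_notMem, card_insert_of_notMem, card_insert_of_notMem, card_insert_of_notMem, card_singleton]
  · simp [Sym2.eq_iff]; tauto
  · simp [Sym2.eq_iff]; tauto
  · simp [Sym2.eq_iff]; tauto
  · simp [Sym2.eq_iff]; tauto

lemma z2_three (P Q R : Prop) (h1 : ¬ (P ∧ Q)) (h2 : ¬ (P ∧ R)) (h3 : ¬ (Q ∧ R)) :
    ((if P then (1 : ZMod 2) else 0) + (if Q then 1 else 0) + (if R then 1 else 0) = 1) ↔ P ∨ Q ∨ R := by
  by_cases hP : P <;> by_cases hQ : Q <;> by_cases hR : R <;> simp_all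

lemma is3_mk {a b c : V} (h1 : a ≠ b) (h2 : a ≠ c) (h3 : b ≠ c) :
    Is3 (dl s(a,b) + dl s(b,c) + dl s(c,a) : Ch V) a b c := by
  refine ⟨⟨h1, h2, h3⟩, fun e => ?_⟩
  simp only [Pi.add_apply, dl]
  apply z2_three
  · rintro ⟨rfl, h⟩; simp [Sym2.eq_iff] at h; tauto
  · rintro ⟨rfl, h⟩; simp [Sym2.eq_iff] at h; tauto
  · rintro ⟨rfl, h⟩; simp [Sym2.eq_iff] at h; tauto

noncomputable def ntri {ι : Type} [Fintype ι] (F : ι → Ch V) : ℕ := (univ.filter (fun i => sz (F i) = 3)).card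

variable {ι : Type} [Fintype ι] {F : ι → Ch V} {G : SimpleGraph V} {U : Set V}

lemma bd_tri {a b c : V} (h1 : a ≠ b) (h2 : a ≠ c) (h3 : b ≠ c) :
    bd (dl s(a,b) + dl s(b,c) + dl s(c,a) : Ch V) = 0 := by
  rw [map_add, map_add, bd_dl h1, bd_dl h3, bd_dl h2.symm]
  funext v
  simp only [Pi.add_apply, Pi.zero_apply]
  have : ∀ x y w : ZMod 2, x + y + (y + w) + (w + x) = 0 := by decide
  apply this

lemma cyc_tri {a b c : V} (h1 : G.Adj a b) (h2 : G.Adj a c) (h3 : G.Adj b c) :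
    Cyc G.edgeSet (dl s(a,b) + dl s(b,c) + dl s(c,a) : Ch V) := by
  refine ⟨fun e he => ?_, bd_tri h1.ne h2.ne h3.ne⟩
  rcases ((is3_mk h1.ne h2.ne h3.ne).2 e).1 (z2_ne he) with rfl | rfl | rfl
  exacts [h1, h3, h2.symm]

lemma is3_compl {z : Ch V} {p s q t : V} (hI : Is4 z p s q t) :
    Is3 (z + (dl s(p,s) + dl s(s,q) + dl s(q,p)) : Ch V) q t p := by
  obtain ⟨⟨n1, n2, n3, n4, n5, n6⟩, hI⟩ := hI
  refine ⟨⟨n6, n2.symm, n3.symm⟩, fun e => ?_⟩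
  have h1 := hI e
  have h2 := (is3_mk n1 n2 n4).2 e
  rw [Pi.add_apply, Sym2.eq_swap (a := p) (b := q)]
  have d1 : e = s(p,s) → ¬ (e = s(q,t) ∨ e = s(t,p) ∨ e = s(q,p)) := by
    rintro rfl h; simp only [Sym2.eq_iff] at h; grind
  have d2 : e = s(s,q) → ¬ (e = s(q,t) ∨ e = s(t,p) ∨ e = s(q,p)) := by
    rintro rfl h; simp only [Sym2.eq_iff] at h; grind
  have d3 : e = s(q,p) → ¬ (e = s(q,t) ∨ e = s(t,p)) := by
    rintro rfl h; simp only [Sym2.eq_iff] at h; grind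
  generalize (e = s(p,s)) = X1 at *
  generalize (e = s(s,q)) = X2 at *
  generalize (e = s(q,t)) = X3 at *
  generalize (e = s(t,p)) = X4 at *
  generalize (e = s(q,p)) = X5 at *
  by_cases a1 : z e = 1
  · by_cases a2 : (dl s(p,s) + dl s(s,q) + dl s(q,p) : Ch V) e = 1
    · rw [a1, a2]
      have b1 := h1.1 a1
      have b2 := h2.1 a2
      constructor
      · intro h; exact absurd h (by decide)
      · grind
    · rw [a1, z2_ne1 a2]
      have b1 := h1.1 a1
      have b2 := (not_congr h2).1 a2
      simp only [add_zero, true_iff]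
      grind
  · have b1 := (not_congr h1).1 a1
    rw [z2_ne1 a1, zero_add, h2]
    grind

set_option maxHeartbeats 1000000 in
lemma switch (h : IsTB G.edgeSet F) (hG : TwoConn G U) {I A B : ι} {p s q t : V} (hI : Is4 (F I) p s q t) (hpq : G.Adj p q)
    (hAB : A ≠ B) (hA : F A s(p,q) = 1) (hB : F B s(p,q) = 1) (hno : ¬ (sz (F A) = 3 ∧ sz (F B) = 3)) :
    ∃ (ι' : Type) (_ : Fintype ι') (F' : ι' → Ch V), IsTB G.edgeSet F' ∧ ntri F < ntri F' := by
  have hIn := hI.1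
  obtain ⟨n1, n2, n3, n4, n5, n6⟩ := hIn
  have hps : G.Adj p s := h.adj ((hI.2 _).2 (by simp))
  have hsq : G.Adj s q := h.adj ((hI.2 _).2 (by simp))
  have hqt : G.Adj q t := h.adj ((hI.2 _).2 (by simp))
  have htp : G.Adj t p := h.adj ((hI.2 _).2 (by simp))
  have hIA : I ≠ A := by
    rintro rfl
    have := (hI.2 _).1 hA
    simp [Sym2.eq_iff] at this; tauto
  have hIB : I ≠ B := by
    rintro rfl
    have := (hI.2 _).1 hB
    simp [Sym2.eq_iff] at this; tauto
  have com1 : ∀ x, G.Adj p x → G.Adj x q → ∀ e, F A e = 1 → F B e = 1 → e = s(p,x) ∨ e = s(x,q) ∨ e = s(q,p) := by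
    intro x hpx hxq e hAe hBe
    obtain ⟨c, hc⟩ := h.span _ (cyc_tri hpx hpq hxq)
    have e1 := h.eval hAB hA hB c
    have e2 := h.eval hAB hAe hBe c
    rw [← hc] at e1 e2
    have h3 := is3_mk hpx.ne hpq.ne hxq.ne
    rw [← (h3.2 e), e2, ← e1, h3.2]
    simp [Sym2.eq_iff]
  have hcom : ∀ e, F A e = 1 → F B e = 1 → e = s(p,q) := by
    intro e h1 h2
    rcases com1 s hps hsq e h1 h2 with rfl | rfl | rfl <;> rcases com1 t htp.symm hqt.symm _ h1 h2 with h3 | h3 | h3 <;>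
      simp [Sym2.eq_iff] at h3 ⊢ <;> tauto
  have hne : F A ≠ F B := by
    intro he
    have h1 := h.sz3 A
    have : sz (F A) ≤ ({s(p,q)} : Finset (Sym2 V)).card := by
      apply card_le_card
      intro e he'
      simp only [mem_filter, mem_univ, true_and] at he'
      simp [hcom e he' (by rw [← he]; exact he')]
    simp at this; omega
  have hR := h.remove hAB hA hB hcom hne
  have hz : (dl s(p,s) + dl s(s,q) : Ch V) + res {s(p,q)} 1 = dl s(p,s) + dl s(s,q) + dl s(q,p) := by
    rw [res_single, Sym2.eq_swap (a := p) (b := q)]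
  have hE := hR.ear ⟨I, hIB⟩ (dl s(p,s) + dl s(s,q)) (by
    intro e he
    simp only [hIA, if_false]
    rw [hI.2]
    simp only [Pi.add_apply, dl] at he
    by_contra hh; push Not at hh
    rw [if_neg hh.1, if_neg hh.2.1] at he
    simp at he) {s(p,q)} (by simp) ⟨_, rfl⟩ (by rw [hz]; exact bd_tri n1 n2 n4) (by
    intro z _ e he e' he'
    rw [Set.mem_singleton_iff] at he he'
    rw [he, he'])
  have hEE : G.edgeSet \ {s(p,q)} ∪ {s(p,q)} = G.edgeSet := by
    apply Set.sdiff_union_of_subset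
    rintro e rfl; exact hpq
  rw [hEE] at hE
  refine ⟨_, _, _, hE, ?_⟩
  rw [hz]
  set K : Option {k // k ≠ B} → Ch V := fun k => k.elim (dl s(p,s) + dl s(s,q) + dl s(q,p))
      (fun i => if i = ⟨I, hIB⟩ then (if I = A then F A + F B else F I) + (dl s(p,s) + dl s(s,q) + dl s(q,p))
        else (if i.1 = A then F A + F B else F i.1)) with hK
  suffices hs : ntri F < ntri K by convert hs
  have k1 : sz (K none) = 3 := (is3_mk n1 n2 n4).sz
  have k2 : sz (K (some ⟨I, hIB⟩)) = 3 := by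
    have h3 : K (some ⟨I, hIB⟩) = F I + (dl s(p,s) + dl s(s,q) + dl s(q,p)) := by
      simp only [hK, hIA, Option.elim, if_true, if_false]
    rw [h3]
    exact (is3_compl hI).sz
  have hcard : ntri F < (univ.filter (fun i => sz (F i) = 3 ∧ i ≠ A ∧ i ≠ B)).card + 2 := by
    have hsub : univ.filter (fun i => sz (F i) = 3) ⊆ univ.filter (fun i => sz (F i) = 3 ∧ i ≠ A ∧ i ≠ B) ∪
        (if sz (F A) = 3 then {A} else {B}) := by
      intro i hi
      simp only [mem_filter, mem_univ, true_and, mem_union] at hi ⊢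
      by_cases h1 : i = A
      · subst h1; right; rw [if_pos hi]; simp
      · by_cases h2 : i = B
        · subst h2; right; rw [if_neg (fun hh => hno ⟨hh, hi⟩)]; simp
        · left; exact ⟨hi, h1, h2⟩
    have h1 := card_le_card hsub
    have h2 := card_union_le (univ.filter (fun i => sz (F i) = 3 ∧ i ≠ A ∧ i ≠ B)) (if sz (F A) = 3 then {A} else {B})
    have h3 : (if sz (F A) = 3 then ({A} : Finset ι) else {B}).card = 1 := by split_ifs <;> simp
    unfold ntri; omega
  refine lt_of_lt_of_le hcard ?_
  have hinj : ((univ.filter (fun i => sz (F i) = 3 ∧ i ≠ A ∧ i ≠ B)).image (fun i => if hi : i ≠ B then some (⟨i, hi⟩ : {k // k ≠ B}) else none)).card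
      = (univ.filter (fun i => sz (F i) = 3 ∧ i ≠ A ∧ i ≠ B)).card := by
    apply card_image_of_injOn
    intro i hi j hj hij
    simp only [coe_filter, mem_univ, true_and, Set.mem_ofPred_eq] at hi hj
    simp only [hi.2.2, hj.2.2, dif_pos, ne_eq, not_false_eq_true, Option.some.injEq, Subtype.mk.injEq] at hij
    exact hij
  rw [← hinj]
  have hI4 := hI.sz
  rw [show ∀ n : ℕ, n + 2 = n + 1 + 1 from fun n => rfl, ← card_insert_of_notMem (a := (none : Option {k // k ≠ B})),
    ← card_insert_of_notMem (a := some (⟨I, hIB⟩ : {k // k ≠ B}))]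
  · apply card_le_card
    intro x hx
    simp only [mem_insert, mem_image, mem_filter, mem_univ, true_and] at hx ⊢
    rcases hx with rfl | rfl | ⟨i, ⟨h1, h2, h3⟩, rfl⟩
    · exact k2
    · exact k1
    · rw [dif_pos h3]
      have hiI : i ≠ I := by rintro rfl; omega
      simpa [hK, hiI, h2] using h1
  · simp only [mem_insert, mem_image, mem_filter, mem_univ, true_and, not_or]
    refine ⟨by simp, ?_⟩
    rintro ⟨i, ⟨h1, h2, h3⟩, h4⟩
    rw [dif_pos h3] at h4
    simp at h4; subst h4; omega
  · simp only [mem_image, mem_filter, mem_univ, true_and]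
    rintro ⟨i, ⟨h1, h2, h3⟩, h4⟩
    rw [dif_pos h3] at h4
    simp at h4

end T6

end

section
open SimpleGraph Finset
open scoped Classical
set_option linter.unusedSectionVars false
set_option linter.unusedVariables false
set_option linter.unusedSimpArgs false
set_option linter.unnecessarySeqFocus false

namespace T6
variable {V : Type*} [Fintype V]

lemma cc_of_preconn {G : SimpleGraph V} {s : Set V} (h : (G.induce s).Preconnected) : CC G s := by
  intro D hD ⟨x, hx⟩ hcl
  apply Set.Subset.antisymm hD
  intro y hy
  obtain ⟨w⟩ := h ⟨x, hD hx⟩ ⟨y, hy⟩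
  have : ∀ (a b : s), (G.induce s).Walk a b → a.1 ∈ D → b.1 ∈ D := by
    intro a b w
    induction w with
    | nil => exact id
    | cons hab _ ih => intro ha; exact ih (hcl _ ha _ (Subtype.property _) hab)
  exact this _ _ w hx

lemma twoConn_of {G : SimpleGraph V} (h : IsTwoConnected G) : TwoConn G Set.univ := by
  refine ⟨?_, fun _ _ _ => Set.mem_univ _, fun v => ?_⟩
  · rw [Set.ncard_univ, Nat.card_eq_fintype_card]; exact h.1
  · have h1 := cc_of_preconn (h.2.2 v).preconnected
    have : (Set.univ \ {v} : Set V) = {u | u ≠ v} := by ext; simp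
    rw [this]; exact h1

structure Cfg (G : SimpleGraph V) {ι : Type} [Fintype ι] (F : ι → Ch V) : Prop where
  tb : IsTB G.edgeSet F
  tc : TwoConn G Set.univ
  deg : ∀ v a b : V, ∃ w, G.Adj v w ∧ w ≠ a ∧ w ≠ b
  th : ¬ HasTheta6 G
  sw : ∀ I p s q t, Is4 (F I) p s q t → G.Adj p q → ∀ j, F j s(p,q) = 1 → sz (F j) = 3
  n6 : 6 ≤ Fintype.card V
  k5 : ¬ Mn G (completeGraph (Fin 5))

lemma IsTB.card_le {G : SimpleGraph V} {ι : Type} [Fintype ι] {F : ι → Ch V} (h : IsTB G.edgeSet F) :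
    Fintype.card ι ≤ 2 * Fintype.card (Sym2 V) := by
  choose e he hF using h.has_edge
  have := card_le_mul_card_image (f := e) (univ : Finset ι) 2 (by
    intro b hb
    obtain ⟨i, _, rfl⟩ := mem_image.1 hb
    obtain ⟨j, k, hjk, hj, hk, h0⟩ := h.two _ (he i)
    have hs : univ.filter (fun a => e a = e i) ⊆ {j, k} := by
      intro a ha
      simp only [mem_filter, mem_univ, true_and] at ha
      rcases h.third hjk hj hk (k := a) (by rw [← ha]; exact hF a) with rfl | rfl <;> simp
    exact (card_le_card hs).trans card_le_two)
  calc Fintype.card ι = (univ : Finset ι).card := rfl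
    _ ≤ _ := this
    _ ≤ _ := Nat.mul_le_mul_left _ (card_le_univ _)

lemma cfg_exists {G : SimpleGraph V} (hn : 6 ≤ Fintype.card V)
    (hplanar : IsPlanar G) (h2conn : IsTwoConnected G)
    (hdeg : ∀ v : V, 3 ≤ (G.neighborSet v).ncard)
    (hfree : ¬ HasTheta6 G) : ∃ (ι : Type) (_ : Fintype ι) (F : ι → Ch V), Cfg G F := by
  have tc := twoConn_of h2conn
  have good : Good G := ⟨fun h => hplanar.1 h.hasMinor, fun h => hplanar.2 h.hasMinor⟩
  obtain ⟨ι0, hι0, F0, h0⟩ := tb_exists _ G Set.univ rfl tc good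
  let P : ℕ → Prop := fun t => ∃ (ι : Type) (_ : Fintype ι) (F : ι → Ch V), IsTB G.edgeSet F ∧ ntri F = t
  have hbound : ∀ t, P t → t ≤ 2 * Fintype.card (Sym2 V) := by
    rintro t ⟨ι, _, F, hF, rfl⟩
    exact (card_le_univ _).trans hF.card_le
  have hP0 : P (ntri F0) := ⟨ι0, hι0, F0, h0, rfl⟩
  obtain ⟨ι, hι, F, hF, hmax⟩ := Nat.findGreatest_spec (P := P) (hbound _ hP0) hP0
  refine ⟨ι, hι, F, hF, tc, ?_, hfree, ?_, hn, good.1⟩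
  · intro v a b
    by_contra hh; push Not at hh
    have hs : G.neighborSet v ⊆ {a, b} := by
      intro w hw
      by_cases h1 : w = a
      · simp [h1]
      · simp [hh w hw h1]
    have h1 := Set.ncard_le_ncard hs (Set.toFinite _)
    have h2 := Set.ncard_insert_le a {b}
    rw [Set.ncard_singleton] at h2
    have := hdeg v
    omega
  · intro I p s q t hI hpq j hj
    by_contra h3
    obtain ⟨k, hk, hkF⟩ := hF.other hj
    obtain ⟨ι', hι', F', hF', hlt⟩ := switch hF tc hI hpq hk.symm hj hkF (fun hh => h3 hh.1)
    have hP' : P (ntri F') := ⟨ι', hι', F', hF', rfl⟩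
    have := Nat.le_findGreatest (P := P) (hbound _ hP') hP'
    omega

/-- Euler-type inequality -/
lemma IsTB.euler {G : SimpleGraph V} {ι : Type} [Fintype ι] {F : ι → Ch V} (h : IsTB G.edgeSet F) (i0 : ι) :
    G.edgeFinset.card + 2 ≤ Fintype.card ι + Fintype.card V := by
  obtain ⟨e0, he0, _⟩ := h.has_edge i0
  obtain ⟨v0, _⟩ : ∃ v : V, True := by
    induction e0 using Sym2.ind with
    | _ a b => exact ⟨a, trivial⟩
  -- extension by zero of functions on the edges
  let ext : ({e // e ∈ G.edgeSet} → ZMod 2) →ₗ[ZMod 2] Ch V :=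
    { toFun := fun z e => if he : e ∈ G.edgeSet then z ⟨e, he⟩ else 0
      map_add' := by
        intro x y; funext e
        by_cases he : e ∈ G.edgeSet
        · simp only [dif_pos he, Pi.add_apply]
        · simp only [dif_neg he, Pi.add_apply, add_zero]
      map_smul' := by
        intro m x; funext e
        by_cases he : e ∈ G.edgeSet
        · simp only [dif_pos he, Pi.smul_apply, RingHom.id_apply]
        · simp only [dif_neg he, Pi.smul_apply, RingHom.id_apply, smul_zero] }
  let L : ({e // e ∈ G.edgeSet} → ZMod 2) →ₗ[ZMod 2] ({v : V // v ≠ v0} → ZMod 2) :=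
    (LinearMap.funLeft (ZMod 2) (ZMod 2) (fun v : {v : V // v ≠ v0} => v.1)) ∘ₗ bd ∘ₗ ext
  let M : ({i : ι // i ≠ i0} → ZMod 2) →ₗ[ZMod 2] ({e // e ∈ G.edgeSet} → ZMod 2) :=
    { toFun := fun c e => ∑ i : {i : ι // i ≠ i0}, c i * F i.1 e.1
      map_add' := by intro x y; funext e; simp [add_mul, sum_add_distrib]
      map_smul' := by intro m x; funext e; simp [mul_assoc, mul_sum] }
  have hker : LinearMap.ker L ≤ LinearMap.range M := by
    intro z hz
    rw [LinearMap.mem_ker] at hz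
    have hsup : ∀ e, ext z e ≠ 0 → e ∈ G.edgeSet := by
      intro e he
      by_contra hh
      apply he
      show (if he : e ∈ G.edgeSet then z ⟨e, he⟩ else 0) = 0
      rw [dif_neg hh]
    have hb : ∀ v, v ≠ v0 → bd (ext z) v = 0 := fun v hv => congrFun hz ⟨v, hv⟩
    have hs := sum_bd (z := ext z) (fun e he => G.not_isDiag_of_mem_edgeSet (hsup e he))
    rw [Finset.sum_eq_single v0 (fun v _ hv => hb v hv) (by simp)] at hs
    have hcyc : Cyc G.edgeSet (ext z) := by
      refine ⟨hsup, funext fun v => ?_⟩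
      by_cases hv : v = v0
      · rw [hv]; exact hs
      · exact hb v hv
    obtain ⟨c, hc, hc0⟩ := h.span' hcyc i0 0
    refine ⟨fun i => c i.1, ?_⟩
    funext e
    have h1 : ext z e.1 = z e := by
      show (if he : e.1 ∈ G.edgeSet then z ⟨e.1, he⟩ else 0) = z e
      rw [dif_pos e.2]
    rw [← h1]
    have h2 : ext z e.1 = ∑ i, c i * F i e.1 := by
      rw [hc]; simp [Finset.sum_apply]
    rw [h2]
    show ∑ i : {i : ι // i ≠ i0}, c i * F i.1 e.1 = _
    rw [← Finset.sum_subtype (univ.filter (fun i => i ≠ i0)) (by simp) (fun i => c i * F i e.1)]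
    rw [Finset.sum_filter]
    apply Finset.sum_congr rfl
    intro i _
    split_ifs with hi
    · rfl
    · rw [not_not.1 hi, hc0, zero_mul]
  have r1 := LinearMap.finrank_range_add_finrank_ker L
  have r2 := Submodule.finrank_mono hker
  have r3 := LinearMap.finrank_range_le M
  have r4 := Submodule.finrank_le (LinearMap.range L)
  rw [Module.finrank_fintype_fun_eq_card] at r1 r3 r4
  rw [Fintype.card_subtype_compl, Fintype.card_subtype_eq] at r3 r4
  have c1 : Fintype.card {e // e ∈ G.edgeSet} = G.edgeFinset.card := by
    rw [SimpleGraph.edgeFinset, Set.toFinset_card]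
  have p1 : 0 < Fintype.card ι := Fintype.card_pos_iff.2 ⟨i0⟩
  have p2 : 0 < Fintype.card V := Fintype.card_pos_iff.2 ⟨v0⟩
  omega

end T6

end

section
open SimpleGraph Finset
open scoped Classical
set_option linter.unusedSectionVars false
set_option linter.unusedVariables false
set_option linter.unusedSimpArgs false
set_option linter.unnecessarySeqFocus false

namespace T6
variable {V : Type*} [Fintype V] {G : SimpleGraph V}

/-- the graph structure of a fan with centre `o` -/
structure FanG (G : SimpleGraph V) (o a b c d : V) : Prop where
  oa : G.Adj o a
  ob : G.Adj o b
  oc : G.Adj o c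
  od : G.Adj o d
  ab : G.Adj a b
  bc : G.Adj b c
  cd : G.Adj c d
  nac : a ≠ c
  nad : a ≠ d
  nbd : b ≠ d

lemma FanG.rev {o a b c d : V} (h : FanG G o a b c d) : FanG G o d c b a :=
  ⟨h.od, h.oc, h.ob, h.oa, h.cd.symm, h.bc.symm, h.ab.symm, h.nbd.symm, h.nad.symm, h.nac.symm⟩

section ears
variable {o a b c d : V} (h : FanG G o a b c d) (hth : ¬ HasTheta6 G)
include h hth

lemma FanG.ear3 {p q z z' : V} (hp : p ∈ ({o,a,b,c,d} : Finset V)) (hq : q ∈ ({o,a,b,c,d} : Finset V)) (hpq : p ≠ q)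
    (hz : z ∉ ({o,a,b,c,d} : Finset V)) (hz' : z' ∉ ({o,a,b,c,d} : Finset V)) (h1 : G.Adj p z) (h2 : G.Adj z z') (h3 : G.Adj z' q) : False := by
  obtain ⟨oa, ob, oc, od, ab, bc, cd, nac, nad, nbd⟩ := h
  have K : ∀ p x y q : V, p ∈ ({o,a,b,c,d} : Finset V) → x ∈ ({o,a,b,c,d} : Finset V) → y ∈ ({o,a,b,c,d} : Finset V) →
      q ∈ ({o,a,b,c,d} : Finset V) → G.Adj p x → G.Adj x y → G.Adj y q → G.Adj p y → p ≠ q → x ≠ q →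
      ∀ z z', z ∉ ({o,a,b,c,d} : Finset V) → z' ∉ ({o,a,b,c,d} : Finset V) → G.Adj p z → G.Adj z z' → G.Adj z' q → False := by
    intro p x y q hp hx hy hq h1 h2 h3 h4 n1 n2 z z' hz hz' h5 h6 h7
    exact th_short hth h1 h2 h3 h7.symm h6.symm h5.symm h4 n1 (ne_of_mem_of_not_mem hp hz') n2
      (ne_of_mem_of_not_mem hx hz') (ne_of_mem_of_not_mem hx hz) (ne_of_mem_of_not_mem hy hz')
      (ne_of_mem_of_not_mem hy hz) (ne_of_mem_of_not_mem hq hz)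
  have K' := fun p x y q m1 m2 m3 m4 e1 e2 e3 e4 n1 n2 =>
    K p x y q m1 m2 m3 m4 e1 e2 e3 e4 n1 n2 z' z hz' hz
  replace K := fun p x y q m1 m2 m3 m4 e1 e2 e3 e4 n1 n2 =>
    K p x y q m1 m2 m3 m4 e1 e2 e3 e4 n1 n2 z z' hz hz'
  simp only [Finset.mem_insert, Finset.mem_singleton] at hp hq
  rcases hp with rfl | rfl | rfl | rfl | rfl
  · rcases hq with rfl | rfl | rfl | rfl | rfl
    · exact hpq rfl
    · exact K p c b q (by simp) (by simp) (by simp) (by simp) oc bc.symm ab.symm ob oa.ne nac.symm h1 h2 h3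
    · exact K p d c q (by simp) (by simp) (by simp) (by simp) od cd.symm bc.symm oc ob.ne nbd.symm h1 h2 h3
    · exact K p a b q (by simp) (by simp) (by simp) (by simp) oa ab bc ob oc.ne nac h1 h2 h3
    · exact K p b c q (by simp) (by simp) (by simp) (by simp) ob bc cd oc od.ne nbd h1 h2 h3
  · rcases hq with rfl | rfl | rfl | rfl | rfl
    · exact K' q c b p (by simp) (by simp) (by simp) (by simp) oc bc.symm ab.symm ob oa.ne nac.symm h3.symm h2.symm h1.symm
    · exact hpq rfl
    · exact K' q c o p (by simp) (by simp) (by simp) (by simp) bc oc.symm oa ob.symm ab.ne.symm nac.symm h3.symm h2.symm h1.symm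
    · exact K p b o q (by simp) (by simp) (by simp) (by simp) ab ob.symm oc oa.symm nac bc.ne h1 h2 h3
    · exact K p b o q (by simp) (by simp) (by simp) (by simp) ab ob.symm od oa.symm nad nbd h1 h2 h3
  · rcases hq with rfl | rfl | rfl | rfl | rfl
    · exact K' q d c p (by simp) (by simp) (by simp) (by simp) od cd.symm bc.symm oc ob.ne nbd.symm h3.symm h2.symm h1.symm
    · exact K p c o q (by simp) (by simp) (by simp) (by simp) bc oc.symm oa ob.symm ab.ne.symm nac.symm h1 h2 h3
    · exact hpq rfl
    · exact K p a o q (by simp) (by simp) (by simp) (by simp) ab.symm oa.symm oc ob.symm bc.ne nac h1 h2 h3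
    · exact K p c o q (by simp) (by simp) (by simp) (by simp) bc oc.symm od ob.symm nbd cd.ne h1 h2 h3
  · rcases hq with rfl | rfl | rfl | rfl | rfl
    · exact K' q a b p (by simp) (by simp) (by simp) (by simp) oa ab bc ob oc.ne nac h3.symm h2.symm h1.symm
    · exact K' q b o p (by simp) (by simp) (by simp) (by simp) ab ob.symm oc oa.symm nac bc.ne h3.symm h2.symm h1.symm
    · exact K' q a o p (by simp) (by simp) (by simp) (by simp) ab.symm oa.symm oc ob.symm bc.ne nac h3.symm h2.symm h1.symm
    · exact hpq rfl
    · exact K p b o q (by simp) (by simp) (by simp) (by simp) bc.symm ob.symm od oc.symm cd.ne nbd h1 h2 h3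
  · rcases hq with rfl | rfl | rfl | rfl | rfl
    · exact K' q b c p (by simp) (by simp) (by simp) (by simp) ob bc cd oc od.ne nbd h3.symm h2.symm h1.symm
    · exact K' q b o p (by simp) (by simp) (by simp) (by simp) ab ob.symm od oa.symm nad nbd h3.symm h2.symm h1.symm
    · exact K' q c o p (by simp) (by simp) (by simp) (by simp) bc oc.symm od ob.symm nbd cd.ne h3.symm h2.symm h1.symm
    · exact K' q b o p (by simp) (by simp) (by simp) (by simp) bc.symm ob.symm od oc.symm cd.ne nbd h3.symm h2.symm h1.symm
    · exact hpq rfl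

lemma FanG.ear4 {p q z z' z'' : V} (hp : p ∈ ({o,a,b,c,d} : Finset V)) (hq : q ∈ ({o,a,b,c,d} : Finset V)) (hpq : G.Adj p q)
    (hz : z ∉ ({o,a,b,c,d} : Finset V)) (hz' : z' ∉ ({o,a,b,c,d} : Finset V)) (hz'' : z'' ∉ ({o,a,b,c,d} : Finset V))
    (h1 : G.Adj p z) (h2 : G.Adj z z') (h3 : G.Adj z' z'') (h4 : G.Adj z'' q) (hn : z ≠ z'') : False := by
  obtain ⟨oa, ob, oc, od, ab, bc, cd, nac, nad, nbd⟩ := h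
  have : ∃ r ∈ ({o,a,b,c,d} : Finset V), G.Adj p r ∧ G.Adj r q := by
    have hne := hpq.ne
    simp only [Finset.mem_insert, Finset.mem_singleton] at hp hq
    rcases hp with rfl | rfl | rfl | rfl | rfl
    · rcases hq with rfl | rfl | rfl | rfl | rfl
      · exact absurd rfl hne
      · exact ⟨b, by simp, ob, ab.symm⟩
      · exact ⟨a, by simp, oa, ab⟩
      · exact ⟨b, by simp, ob, bc⟩
      · exact ⟨c, by simp, oc, cd⟩
    · by_cases hqo : q = o
      · subst hqo; exact ⟨b, by simp, ab, ob.symm⟩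
      · refine ⟨o, by simp, oa.symm, ?_⟩
        rcases hq with rfl | rfl | rfl | rfl | rfl <;> first | assumption | exact absurd rfl hqo
    · by_cases hqo : q = o
      · subst hqo; exact ⟨a, by simp, ab.symm, oa.symm⟩
      · refine ⟨o, by simp, ob.symm, ?_⟩
        rcases hq with rfl | rfl | rfl | rfl | rfl <;> first | assumption | exact absurd rfl hqo
    · by_cases hqo : q = o
      · subst hqo; exact ⟨b, by simp, bc.symm, ob.symm⟩
      · refine ⟨o, by simp, oc.symm, ?_⟩
        rcases hq with rfl | rfl | rfl | rfl | rfl <;> first | assumption | exact absurd rfl hqo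
    · by_cases hqo : q = o
      · subst hqo; exact ⟨c, by simp, cd.symm, oc.symm⟩
      · refine ⟨o, by simp, od.symm, ?_⟩
        rcases hq with rfl | rfl | rfl | rfl | rfl <;> first | assumption | exact absurd rfl hqo
  obtain ⟨r, hr, e1, e2⟩ := this
  exact th_short hth e1 e2 h4.symm h3.symm h2.symm h1.symm hpq (ne_of_mem_of_not_mem hp hz'') (ne_of_mem_of_not_mem hp hz')
    (ne_of_mem_of_not_mem hr hz'') (ne_of_mem_of_not_mem hr hz') (ne_of_mem_of_not_mem hr hz)
    (ne_of_mem_of_not_mem hq hz') (ne_of_mem_of_not_mem hq hz) hn.symm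

lemma FanG.ear2 {p q z : V} (hp : p ∈ ({o,a,b,c,d} : Finset V)) (hq : q ∈ ({o,a,b,c,d} : Finset V)) (hpq : p ≠ q)
    (hz : z ∉ ({o,a,b,c,d} : Finset V)) (h1 : G.Adj p z) (h2 : G.Adj z q) :
    (((p = o ∧ q = b) ∨ (p = b ∧ q = o)) ∧ ¬ G.Adj a c ∧ ¬ G.Adj a d) ∨
    (((p = o ∧ q = c) ∨ (p = c ∧ q = o)) ∧ ¬ G.Adj b d ∧ ¬ G.Adj a d) := by
  obtain ⟨oa, ob, oc, od, ab, bc, cd, nac, nad, nbd⟩ := h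
  have K : ∀ p x y w q : V, p ∈ ({o,a,b,c,d} : Finset V) → x ∈ ({o,a,b,c,d} : Finset V) → y ∈ ({o,a,b,c,d} : Finset V) →
      w ∈ ({o,a,b,c,d} : Finset V) → 
      q ∈ ({o,a,b,c,d} : Finset V) → G.Adj p x → G.Adj x y → G.Adj y w → G.Adj w q → G.Adj p y → p ≠ w → p ≠ q → x ≠ w → x ≠ q → y ≠ q →
      G.Adj p z → G.Adj z q → False := by
    intro p x y w q hp hx hy hw hq h1 h2 h3 h4 h5 n1 n2 n3 n4 n5 h6 h7
    exact th_short hth h1 h2 h3 h4 h7.symm h6.symm h5 n1 n2 n3 n4 (ne_of_mem_of_not_mem hx hz) n5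
      (ne_of_mem_of_not_mem hy hz) (ne_of_mem_of_not_mem hw hz)
  have Kab : G.Adj a z → G.Adj z b → False := fun e1 e2 =>
    th_short hth e1 e2 bc cd od.symm oa ab nac nad (by rintro rfl; simp at hz) (by rintro rfl; simp at hz)
      (by rintro rfl; simp at hz) nbd ob.ne.symm oc.ne.symm
  have Kcd : G.Adj c z → G.Adj z d → False := fun e1 e2 =>
    th_short hth e2.symm e1.symm bc.symm ab.symm oa.symm od cd.symm nbd.symm nad.symm (by rintro rfl; simp at hz) (by rintro rfl; simp at hz)
      (by rintro rfl; simp at hz) nac.symm oc.ne.symm ob.ne.symm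
  have Koa : G.Adj o z → G.Adj z a → False :=
    K o d c b a (by simp) (by simp) (by simp) (by simp) (by simp) od cd.symm bc.symm ab.symm oc ob.ne oa.ne nbd.symm nad.symm nac.symm
  have Kod : G.Adj o z → G.Adj z d → False :=
    K o a b c d (by simp) (by simp) (by simp) (by simp) (by simp) oa ab bc cd ob oc.ne od.ne nac nad nbd
  have Kbc : G.Adj b z → G.Adj z c → False :=
    K b a o d c (by simp) (by simp) (by simp) (by simp) (by simp) ab.symm oa.symm od cd.symm ob.symm nbd bc.ne nad nac oc.ne
  have Kad : G.Adj a z → G.Adj z d → False :=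
    K a b o c d (by simp) (by simp) (by simp) (by simp) (by simp) ab ob.symm oc cd oa.symm nac nad bc.ne nbd od.ne
  have Kac : G.Adj a z → G.Adj z c → False :=
    K a b o d c (by simp) (by simp) (by simp) (by simp) (by simp) ab ob.symm od cd.symm oa.symm nad nac nbd bc.ne oc.ne
  have Kbd : G.Adj b z → G.Adj z d → False :=
    K b a o c d (by simp) (by simp) (by simp) (by simp) (by simp) ab.symm oa.symm oc cd ob.symm bc.ne nbd nac nad od.ne
  have Kob1 : G.Adj a c → G.Adj o z → G.Adj z b → False := fun ac =>
    K o d c a b (by simp) (by simp) (by simp) (by simp) (by simp) od cd.symm ac.symm ab oc oa.ne ob.ne nad.symm nbd.symm bc.ne.symm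
  have Kob2 : G.Adj a d → G.Adj o z → G.Adj z b → False := fun ad =>
    K o c d a b (by simp) (by simp) (by simp) (by simp) (by simp) oc cd ad.symm ab od oa.ne ob.ne nac.symm bc.ne.symm nbd.symm
  have Koc1 : G.Adj b d → G.Adj o z → G.Adj z c → False := fun bd =>
    K o a b d c (by simp) (by simp) (by simp) (by simp) (by simp) oa ab bd cd.symm ob od.ne oc.ne nad nac bc.ne
  have Koc2 : G.Adj a d → G.Adj o z → G.Adj z c → False := fun ad =>
    K o b a d c (by simp) (by simp) (by simp) (by simp) (by simp) ob ab.symm ad cd.symm oa od.ne oc.ne nbd bc.ne nac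
  have h1' := h1.symm
  have h2' := h2.symm
  simp only [Finset.mem_insert, Finset.mem_singleton] at hp hq
  rcases hp with rfl | rfl | rfl | rfl | rfl <;> rcases hq with rfl | rfl | rfl | rfl | rfl <;>
    first
    | exact absurd rfl hpq
    | exact (Kab ‹_› ‹_›).elim
    | exact (Kcd ‹_› ‹_›).elim
    | exact (Koa ‹_› ‹_›).elim
    | exact (Kod ‹_› ‹_›).elim
    | exact (Kbc ‹_› ‹_›).elim
    | exact (Kad ‹_› ‹_›).elim
    | exact (Kac ‹_› ‹_›).elim
    | exact (Kbd ‹_› ‹_›).elim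
    | exact Or.inl ⟨Or.inl ⟨rfl, rfl⟩, fun e => Kob1 e ‹_› ‹_›, fun e => Kob2 e ‹_› ‹_›⟩
    | exact Or.inl ⟨Or.inr ⟨rfl, rfl⟩, fun e => Kob1 e ‹_› ‹_›, fun e => Kob2 e ‹_› ‹_›⟩
    | exact Or.inr ⟨Or.inl ⟨rfl, rfl⟩, fun e => Koc1 e ‹_› ‹_›, fun e => Koc2 e ‹_› ‹_›⟩
    | exact Or.inr ⟨Or.inr ⟨rfl, rfl⟩, fun e => Koc1 e ‹_› ‹_›, fun e => Koc2 e ‹_› ‹_›⟩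

end ears
end T6

end

section
open SimpleGraph Finset
open scoped Classical
set_option linter.unusedSectionVars false
set_option linter.unusedVariables false
set_option linter.unusedSimpArgs false
set_option linter.unnecessarySeqFocus false

namespace T6
variable {V : Type*} [Fintype V] {G : SimpleGraph V} {ι : Type} [Fintype ι] {F : ι → Ch V}

/-- facial triangle -/
def Tri (F : ι → Ch V) (a b c : V) : Prop := ∃ i, Is3 (F i) a b c

lemma Tri.rot {a b c : V} (h : Tri F a b c) : Tri F b c a := let ⟨i, h⟩ := h; ⟨i, h.rot⟩
lemma Tri.rev {a b c : V} (h : Tri F a b c) : Tri F b a c := let ⟨i, h⟩ := h; ⟨i, h.rev⟩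

lemma Is3.e1 {z : Ch V} {a b c : V} (h : Is3 z a b c) : z s(a,b) = 1 := (h.2 _).2 (Or.inl rfl)
lemma Is3.e2 {z : Ch V} {a b c : V} (h : Is3 z a b c) : z s(b,c) = 1 := h.rot.e1
lemma Is3.e3 {z : Ch V} {a b c : V} (h : Is3 z a b c) : z s(a,c) = 1 := by rw [Sym2.eq_swap]; exact h.rot.rot.e1
lemma Is4.e1 {z : Ch V} {a b c d : V} (h : Is4 z a b c d) : z s(a,b) = 1 := (h.2 _).2 (Or.inl rfl)
lemma Is4.e2 {z : Ch V} {a b c d : V} (h : Is4 z a b c d) : z s(b,c) = 1 := h.rot.e1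
lemma Is4.e3 {z : Ch V} {a b c d : V} (h : Is4 z a b c d) : z s(c,d) = 1 := h.rot.rot.e1
lemma Is4.e4 {z : Ch V} {a b c d : V} (h : Is4 z a b c d) : z s(d,a) = 1 := h.rot.rot.rot.e1
lemma Is5.e1 {z : Ch V} {a b c d f : V} (h : Is5 z a b c d f) : z s(a,b) = 1 := (h.2 _).2 (Or.inl rfl)
lemma Is5.e2 {z : Ch V} {a b c d f : V} (h : Is5 z a b c d f) : z s(b,c) = 1 := h.rot.e1
lemma Is5.e3 {z : Ch V} {a b c d f : V} (h : Is5 z a b c d f) : z s(c,d) = 1 := h.rot.rot.e1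
lemma Is5.e4 {z : Ch V} {a b c d f : V} (h : Is5 z a b c d f) : z s(d,f) = 1 := h.rot.rot.rot.e1
lemma Is5.e5 {z : Ch V} {a b c d f : V} (h : Is5 z a b c d f) : z s(f,a) = 1 := h.rot.rot.rot.rot.e1

section cfg
variable (h : Cfg G F)
include h

lemma Cfg.s2 {i j : ι} {v a b : V} (hab : a ≠ b) (hia : F i s(v,a) = 1) (hib : F i s(v,b) = 1) (hja : F j s(v,a) = 1)
    (hjb : F j s(v,b) = 1) : i = j := h.tb.sat2 h.tc h.deg hab hia hib hja hjb

lemma Cfg.f2 {i : ι} {v a b w : V} (hab : a ≠ b)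
    (ha : F i s(v,a) = 1) (hb : F i s(v,b) = 1) (hw : F i s(v,w) = 1) : w = a ∨ w = b := h.tb.face2 h.tc hab ha hb hw

lemma Cfg.adj {i : ι} {v a : V} (ha : F i s(v,a) = 1) : G.Adj v a := h.tb.adj ha

lemma Cfg.loop {i : ι} {v : V} : F i s(v,v) = 0 := h.tb.loopless i v

lemma Cfg.ex3 {i : ι} {u v : V} (hi : F i s(u,v) = 1) (h3 : sz (F i) = 3) : ∃ w, Is3 (F i) u v w := by
  obtain ⟨_, _, _, h'⟩ := is3_ex (h.tb.cyc i).2 (h.tb.loopless i) h3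
  exact h'.at hi
lemma Cfg.ex4 {i : ι} {u v : V} (hi : F i s(u,v) = 1) (h3 : sz (F i) = 4) : ∃ w x, Is4 (F i) u v w x := by
  obtain ⟨_, _, _, _, h'⟩ := is4_ex (h.tb.cyc i).2 (h.tb.loopless i) h3
  exact h'.at hi
lemma Cfg.ex5 {i : ι} {u v : V} (hi : F i s(u,v) = 1) (h3 : sz (F i) = 5) : ∃ w x y, Is5 (F i) u v w x y := by
  obtain ⟨_, _, _, _, _, h'⟩ := is5_ex (h.tb.cyc i).2 (h.tb.loopless i) h3
  exact h'.at hi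

/-- a face through two consecutive edges of a facial triangle is this triangle -/
lemma Cfg.corner {k i : ι} {a b c : V} (hi : Is3 (F i) a b c) (h1 : F k s(a,b) = 1) (h2 : F k s(a,c) = 1) : k = i :=
  h.s2 hi.1.2.2 h1 h2 hi.e1 hi.e3

lemma Cfg.tri_adj {a b c : V} (ht : Tri F a b c) : G.Adj a b := by
  obtain ⟨i, hi⟩ := ht; exact h.adj hi.e1

end cfg

/-- facial fan -/
structure Fan (F : ι → Ch V) (o a b c d : V) : Prop where
  t1 : Tri F o a b
  t2 : Tri F o b c
  t3 : Tri F o c d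
  nac : a ≠ c
  nad : a ≠ d
  nbd : b ≠ d

lemma Fan.rev {o a b c d : V} (h : Fan F o a b c d) : Fan F o d c b a :=
  ⟨h.t3.rev.rot, h.t2.rev.rot, h.t1.rev.rot, h.nbd.symm, h.nad.symm, h.nac.symm⟩

noncomputable def fs (o a b c d : V) : Finset V := {o,a,b,c,d}
lemma mem_fs {o a b c d v : V} : v ∈ fs o a b c d ↔ v = o ∨ v = a ∨ v = b ∨ v = c ∨ v = d := by simp [fs]
lemma fs_rev {o a b c d : V} : fs o d c b a = fs o a b c d := by
  ext v; simp only [mem_fs]; tauto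

/-- edges inside a set -/
noncomputable def ES (G : SimpleGraph V) (X : Finset V) : Finset (Sym2 V) := univ.filter (fun e => e ∈ G.edgeSet ∧ ∀ v ∈ e, v ∈ X)
lemma mem_ES {X : Finset V} {u v : V} : s(u,v) ∈ ES G X ↔ G.Adj u v ∧ u ∈ X ∧ v ∈ X := by
  simp [ES]

section fan
variable (h : Cfg G F) {o a b c d : V} (f : Fan F o a b c d)
include h f

lemma Fan.g : FanG G o a b c d :=
  ⟨h.tri_adj f.t1, h.tri_adj f.t2, h.tri_adj f.t3, h.tri_adj f.t3.rot.rot.rev, h.tri_adj f.t1.rot, h.tri_adj f.t2.rot, h.tri_adj f.t3.rot,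
    f.nac, f.nad, f.nbd⟩

lemma Fan.ear2 {p q z : V} (hp : p ∈ fs o a b c d) (hq : q ∈ fs o a b c d) (hpq : p ≠ q)
    (hz : z ∉ fs o a b c d) (h1 : G.Adj p z) (h2 : G.Adj z q) :
    (((p = o ∧ q = b) ∨ (p = b ∧ q = o)) ∧ ¬ G.Adj a c ∧ ¬ G.Adj a d) ∨
    (((p = o ∧ q = c) ∨ (p = c ∧ q = o)) ∧ ¬ G.Adj b d ∧ ¬ G.Adj a d) := (f.g h).ear2 h.th hp hq hpq hz h1 h2

lemma Fan.ear3 {p q z z' : V} (hp : p ∈ fs o a b c d) (hq : q ∈ fs o a b c d) (hpq : p ≠ q)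
    (hz : z ∉ fs o a b c d) (hz' : z' ∉ fs o a b c d) (h1 : G.Adj p z) (h2 : G.Adj z z') (h3 : G.Adj z' q) : False :=
  (f.g h).ear3 h.th hp hq hpq hz hz' h1 h2 h3

lemma Fan.ear4 {p q z z' z'' : V} (hp : p ∈ fs o a b c d) (hq : q ∈ fs o a b c d) (hpq : G.Adj p q)
    (hz : z ∉ fs o a b c d) (hz' : z' ∉ fs o a b c d) (hz'' : z'' ∉ fs o a b c d)
    (h1 : G.Adj p z) (h2 : G.Adj z z') (h3 : G.Adj z' z'') (h4 : G.Adj z'' q) (hn : z ≠ z'') : False :=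
  (f.g h).ear4 h.th hp hq hpq hz hz' hz'' h1 h2 h3 h4 hn

/-- the faces at `ob` -/
lemma Fan.at_ob {k : ι} (hk : F k s(o,b) = 1) : Is3 (F k) o a b ∨ Is3 (F k) o b c := by
  obtain ⟨i, hi⟩ := f.t1
  obtain ⟨j, hj⟩ := f.t2
  have hij : i ≠ j := by
    rintro rfl
    rcases h.f2 hi.1.2.2 hi.e1 hi.e3 hj.e3 with h1 | h1
    · exact f.nac h1.symm
    · exact hj.1.2.2 h1.symm
  rcases h.tb.third hij hi.e3 hj.e1 hk with rfl | rfl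
  · exact Or.inl hi
  · exact Or.inr hj

lemma Fan.closed {u v w : V} (hu : u ∈ fs o a b c d) (hv : v ∈ fs o a b c d) (ht : Tri F u v w) : w ∈ fs o a b c d := by
  by_contra hw
  have key : ∀ {o a b c d : V}, Fan F o a b c d → ∀ {w}, Tri F o b w → w ∈ fs o a b c d := by
    intro o a b c d f w ht
    obtain ⟨k, hk⟩ := ht
    rcases f.at_ob h hk.e1 with h1 | h1
    · rcases h.f2 h1.1.2.2 h1.e1 h1.e3 hk.e3 with rfl | rfl <;> simp [fs]
    · rcases h.f2 h1.1.2.2 h1.e1 h1.e3 hk.e3 with rfl | rfl <;> simp [fs]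
  have hne : u ≠ v := let ⟨i, hi⟩ := ht; hi.1.1
  rcases f.ear2 h hu hv hne hw (h.tri_adj ht.rot.rot.rev) (h.tri_adj ht.rot).symm with ⟨⟨rfl, rfl⟩ | ⟨rfl, rfl⟩, _⟩ | ⟨⟨rfl, rfl⟩ | ⟨rfl, rfl⟩, _⟩
  · exact hw (key f ht)
  · exact hw (key f ht.rev)
  · rw [← fs_rev] at hw; exact hw (key f.rev ht)
  · rw [← fs_rev] at hw; exact hw (key f.rev ht.rev)

lemma Fan.card : (fs o a b c d).card = 5 := by
  have g := f.g h
  have := g.oa.ne; have := g.ob.ne; have := g.oc.ne; have := g.od.ne; have := g.ab.ne; have := g.bc.ne; have := g.cd.ne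
  have := f.nac; have := f.nad; have := f.nbd
  simp [fs, *]

lemma Fan.inter {o' a' b' c' d' : V} (f' : Fan F o' a' b' c' d') {u v : V} (huv : u ≠ v) (hu : u ∈ fs o a b c d) (hv : v ∈ fs o a b c d)
    (hu' : u ∈ fs o' a' b' c' d') (hv' : v ∈ fs o' a' b' c' d') : fs o' a' b' c' d' = fs o a b c d := by
  have key : ∀ {o a b c d o' a' b' c' d' : V}, Fan F o a b c d → Fan F o' a' b' c' d' → o' ∈ fs o a b c d →
      (a' ∈ fs o a b c d ∨ b' ∈ fs o a b c d ∨ c' ∈ fs o a b c d ∨ d' ∈ fs o a b c d) → fs o' a' b' c' d' = fs o a b c d := by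
    intro o a b c d o' a' b' c' d' f f' ho hh
    have c1 : a' ∈ fs o a b c d → b' ∈ fs o a b c d := fun hx => f.closed h ho hx f'.t1
    have c2 : d' ∈ fs o a b c d → c' ∈ fs o a b c d := fun hx => f.closed h ho hx f'.rev.t1
    have c3 : c' ∈ fs o a b c d → b' ∈ fs o a b c d := fun hx => f.closed h ho hx f'.rev.t2
    have hb : b' ∈ fs o a b c d := hh.elim c1 (fun hh => hh.elim id (fun hh => hh.elim c3 (fun hh => c3 (c2 hh))))
    have hc : c' ∈ fs o a b c d := f.closed h ho hb f'.t2
    have ha : a' ∈ fs o a b c d := f.closed h ho hb f'.rev.t3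
    have hd : d' ∈ fs o a b c d := f.closed h ho hc f'.t3
    apply Finset.eq_of_subset_of_card_le
    · intro x hx
      rcases mem_fs.1 hx with rfl | rfl | rfl | rfl | rfl <;> assumption
    · rw [f.card h, f'.card h]
  by_cases ho : o' ∈ fs o a b c d
  · apply key f f' ho
    rw [mem_fs] at hu' hv'
    by_cases huo : u = o'
    · have hvo : v ≠ o' := fun e => huv (huo.trans e.symm)
      rcases hv' with e | e | e | e | e
      exacts [absurd e hvo, Or.inl (e ▸ hv), Or.inr (Or.inl (e ▸ hv)), Or.inr (Or.inr (Or.inl (e ▸ hv))), Or.inr (Or.inr (Or.inr (e ▸ hv)))]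
    · rcases hu' with e | e | e | e | e
      exacts [absurd e huo, Or.inl (e ▸ hu), Or.inr (Or.inl (e ▸ hu)), Or.inr (Or.inr (Or.inl (e ▸ hu))), Or.inr (Or.inr (Or.inr (e ▸ hu)))]
  · have g := f'.g h
    have adj : ∀ x ∈ fs o' a' b' c' d', x ∈ fs o a b c d → G.Adj o' x := by
      intro x hx hx'
      rcases mem_fs.1 hx with rfl | rfl | rfl | rfl | rfl
      exacts [absurd hx' ho, g.oa, g.ob, g.oc, g.od]
    symm
    rcases f.ear2 h hu hv huv ho (adj u hu' hu).symm (adj v hv' hv) with ⟨⟨rfl, rfl⟩ | ⟨rfl, rfl⟩, _⟩ | ⟨⟨rfl, rfl⟩ | ⟨rfl, rfl⟩, _⟩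
    · exact key f' f hu' (Or.inr (Or.inl hv'))
    · exact key f' f hv' (Or.inr (Or.inl hu'))
    · exact key f' f hu' (Or.inr (Or.inr (Or.inl hv')))
    · exact key f' f hv' (Or.inr (Or.inr (Or.inl hu')))

lemma Fan.out4 {k : ι} {u v w x : V} (hk : Is4 (F k) u v w x) (hu : u ∈ fs o a b c d) (hv : v ∈ fs o a b c d)
    (hw : w ∉ fs o a b c d) (hx : x ∈ fs o a b c d) :
    (G.Adj b d ∧ ¬ G.Adj a c ∧ ¬ G.Adj a d ∧ ∃ z, z ∉ fs o a b c d ∧ Is4 (F k) o z b d) ∨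
    (G.Adj a c ∧ ¬ G.Adj b d ∧ ¬ G.Adj a d ∧ ∃ z, z ∉ fs o a b c d ∧ Is4 (F k) o z c a) := by
  have core : ∀ {o a b c d : V}, Fan F o a b c d → ∀ {u w}, Is4 (F k) u o w b → u ∈ fs o a b c d → u = d := by
    intro o a b c d f u w hk hu
    have s4 := hk.sz
    have e1 := hk.e1
    have e4 := hk.e4
    rw [Sym2.eq_swap] at e4
    rcases mem_fs.1 hu with rfl | rfl | rfl | rfl | rfl
    · exact absurd rfl hk.1.1
    · obtain ⟨i, hi⟩ := f.t1
      have := h.corner hi.rev e1 e4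
      subst this
      rw [hi.sz] at s4; omega
    · exact absurd rfl hk.1.2.2.1
    · obtain ⟨i, hi⟩ := f.t2
      have := h.corner hi.rot.rot e1 e4
      subst this
      rw [hi.sz] at s4; omega
    · rfl
  have hr : Is4 (F k) u x w v := hk.rev.rot
  have hvx : v ≠ x := hk.1.2.2.2.2.1
  have ad1 := h.adj hk.e2
  have ad2 := h.adj hk.e3
  have ad3 := h.adj hk.e4
  have ad4 := h.adj hk.e1
  rcases f.ear2 h hv hx hvx hw ad1 ad2 with ⟨⟨rfl, rfl⟩ | ⟨rfl, rfl⟩, n1, n2⟩ | ⟨⟨rfl, rfl⟩ | ⟨rfl, rfl⟩, n1, n2⟩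
  · have := core f hk hu; subst this
    exact Or.inl ⟨ad3, n1, n2, w, hw, hk.rot⟩
  · have := core f hr hu; subst this
    exact Or.inl ⟨ad4.symm, n1, n2, w, hw, hr.rot⟩
  · rw [← fs_rev] at hu
    have := core f.rev hk hu; subst this
    exact Or.inr ⟨ad3.symm, n1, n2, w, hw, hk.rot⟩
  · rw [← fs_rev] at hu
    have := core f.rev hr hu; subst this
    exact Or.inr ⟨ad4, n1, n2, w, hw, hr.rot⟩

lemma Fan.out5 {k : ι} {u v w x y : V} (hk : Is5 (F k) u v w x y) (hu : u ∈ fs o a b c d) (hv : v ∈ fs o a b c d)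
    (hw : w ∉ fs o a b c d) (hx : x ∈ fs o a b c d) (hy : y ∈ fs o a b c d) : False := by
  have core : ∀ {o a b c d : V}, Fan F o a b c d → ∀ {u w y}, Is5 (F k) u o w b y → u ∈ fs o a b c d → y ∈ fs o a b c d →
      ¬ G.Adj a c → ¬ G.Adj a d → False := by
    intro o a b c d f u w y hk hu hy n1 n2
    have s5 := hk.sz
    have e1 := hk.e1
    have e4 := hk.e4
    have e5 := hk.e5
    have ad := h.adj e5
    obtain ⟨i, hi⟩ := f.t3
    have s3 := hi.sz
    rcases mem_fs.1 hu with rfl | rfl | rfl | rfl | rfl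
    · exact hk.1.1 rfl
    · rcases mem_fs.1 hy with rfl | rfl | rfl | rfl | rfl
      · exact hk.1.2.2.2.2.2.2.1 rfl
      · exact hk.1.2.2.2.1 rfl
      · exact hk.1.2.2.2.2.2.2.2.2.2 rfl
      · exact n1 ad.symm
      · exact n2 ad.symm
    · exact hk.1.2.2.1 rfl
    · rcases mem_fs.1 hy with rfl | rfl | rfl | rfl | rfl
      · exact hk.1.2.2.2.2.2.2.1 rfl
      · exact n1 ad
      · exact hk.1.2.2.2.2.2.2.2.2.2 rfl
      · exact hk.1.2.2.2.1 rfl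
      · rw [Sym2.eq_swap] at e5
        have := h.corner hi.rev e1 e5
        subst this; omega
    · rcases mem_fs.1 hy with rfl | rfl | rfl | rfl | rfl
      · exact hk.1.2.2.2.2.2.2.1 rfl
      · exact n2 ad
      · exact hk.1.2.2.2.2.2.2.2.2.2 rfl
      · rw [Sym2.eq_swap] at e5
        have := h.corner hi.rot.rot e1 e5
        subst this; omega
      · exact hk.1.2.2.2.1 rfl
  have hr : Is5 (F k) y x w v u := hk.rot.rot.rot.rev.rot.rot.rot.rot.rot
  have hvx : v ≠ x := hk.1.2.2.2.2.2.1
  have ad1 := h.adj hk.e2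
  have ad2 := h.adj hk.e3
  rcases f.ear2 h hv hx hvx hw ad1 ad2 with ⟨⟨rfl, rfl⟩ | ⟨rfl, rfl⟩, n1, n2⟩ | ⟨⟨rfl, rfl⟩ | ⟨rfl, rfl⟩, n1, n2⟩
  · exact core f hk hu hy n1 n2
  · exact core f hr hy hu n1 n2
  · rw [← fs_rev] at hu hy
    exact core f.rev hk hu hy (fun e => n1 e.symm) (fun e => n2 e.symm)
  · rw [← fs_rev] at hu hy
    exact core f.rev hr hy hu (fun e => n1 e.symm) (fun e => n2 e.symm)

/-- small faces that are neither inside the fan set nor share no edge with it -/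
lemma Fan.out {k : ι} (h5 : sz (F k) ≤ 5) {e e' : Sym2 V} (he : F k e = 1) (heX : e ∈ ES G (fs o a b c d))
    (he' : F k e' = 1) (heX' : e' ∉ ES G (fs o a b c d)) :
    (¬ G.Adj a c ∧ ¬ G.Adj b d ∧ ¬ G.Adj a d ∧ sz (F k) = 5 ∧ F k s(b,c) = 1 ∧
      ∀ e, F k e = 1 → e ∈ ES G (fs o a b c d) → e = s(b,c)) ∨
    (G.Adj b d ∧ ¬ G.Adj a c ∧ ¬ G.Adj a d ∧ ∃ z, z ∉ fs o a b c d ∧ Is4 (F k) o z b d) ∨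
    (G.Adj a c ∧ ¬ G.Adj b d ∧ ¬ G.Adj a d ∧ ∃ z, z ∉ fs o a b c d ∧ Is4 (F k) o z c a) := by
  have h3 := h.tb.sz3 k
  induction e using Sym2.ind with
  | _ u v =>
  induction e' using Sym2.ind with
  | _ u' v' =>
  rw [mem_ES] at heX heX'
  obtain ⟨huv, hu, hv⟩ := heX
  have ad' := h.adj he'
  have hout : ¬ (u' ∈ fs o a b c d ∧ v' ∈ fs o a b c d) := fun hh => heX' ⟨ad', hh⟩
  have h345 : sz (F k) = 3 ∨ sz (F k) = 4 ∨ sz (F k) = 5 := by omega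
  rcases h345 with hs | hs | hs
  · obtain ⟨w, hk⟩ := h.ex3 he hs
    have hw := f.closed h hu hv ⟨k, hk⟩
    exfalso; apply hout
    have := (hk.2 _).1 he'
    simp only [Sym2.eq_iff] at this
    rcases this with (⟨rfl, rfl⟩ | ⟨rfl, rfl⟩) | (⟨rfl, rfl⟩ | ⟨rfl, rfl⟩) | (⟨rfl, rfl⟩ | ⟨rfl, rfl⟩) <;> constructor <;> assumption
  · obtain ⟨w, x, hk⟩ := h.ex4 he hs
    right
    by_cases hw : w ∈ fs o a b c d <;> by_cases hx : x ∈ fs o a b c d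
    · exfalso; apply hout
      have := (hk.2 _).1 he'
      simp only [Sym2.eq_iff] at this
      rcases this with (⟨rfl, rfl⟩ | ⟨rfl, rfl⟩) | (⟨rfl, rfl⟩ | ⟨rfl, rfl⟩) | (⟨rfl, rfl⟩ | ⟨rfl, rfl⟩) | (⟨rfl, rfl⟩ | ⟨rfl, rfl⟩) <;> constructor <;> assumption
    · exact f.out4 h hk.rev hv hu hx hw
    · exact f.out4 h hk hu hv hw hx
    · exact (f.ear3 h hv hu huv.ne.symm hw hx (h.adj hk.e2) (h.adj hk.e3) (h.adj hk.e4)).elim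
  · obtain ⟨w, x, y, hk⟩ := h.ex5 he hs
    by_cases hw : w ∈ fs o a b c d <;> by_cases hx : x ∈ fs o a b c d <;> by_cases hy : y ∈ fs o a b c d
    · exfalso; apply hout
      have := (hk.2 _).1 he'
      simp only [Sym2.eq_iff] at this
      rcases this with (⟨rfl, rfl⟩ | ⟨rfl, rfl⟩) | (⟨rfl, rfl⟩ | ⟨rfl, rfl⟩) | (⟨rfl, rfl⟩ | ⟨rfl, rfl⟩) | (⟨rfl, rfl⟩ | ⟨rfl, rfl⟩) | (⟨rfl, rfl⟩ | ⟨rfl, rfl⟩) <;> constructor <;> assumption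
    · exact (f.out5 h hk.rev hv hu hy hx hw).elim
    · exact (f.out5 h hk.rot hv hw hx hy hu).elim
    · exact (f.ear3 h hw hu hk.1.2.1.symm hx hy (h.adj hk.e3) (h.adj hk.e4) (h.adj hk.e5)).elim
    · exact (f.out5 h hk hu hv hw hx hy).elim
    · left
      have r1 := f.ear2 h hv hx hk.1.2.2.2.2.2.1 hw (h.adj hk.e2) (h.adj hk.e3)
      have r2 := f.ear2 h hx hu hk.1.2.2.1.symm hy (h.adj hk.e4) (h.adj hk.e5)
      have nbc := (f.g h).bc.ne
      have nob := (f.g h).ob.ne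
      have noc := (f.g h).oc.ne
      have huvbc : s(u,v) = s(b,c) ∧ ¬ G.Adj a c ∧ ¬ G.Adj b d ∧ ¬ G.Adj a d := by
        have := huv.ne
        rw [Sym2.eq_iff]
        rcases r1 with ⟨r1 | r1, n1, n2⟩ | ⟨r1 | r1, n1, n2⟩ <;> rcases r2 with ⟨r2 | r2, n3, n4⟩ | ⟨r2 | r2, n3, n4⟩ <;> grind
      refine ⟨huvbc.2.1, huvbc.2.2.1, huvbc.2.2.2, hs, huvbc.1 ▸ he, ?_⟩
      intro e he1 he2
      rw [← huvbc.1]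
      induction e using Sym2.ind with
      | _ p q =>
      rw [mem_ES] at he2
      have := (hk.2 _).1 he1
      rcases this with h1 | h1 | h1 | h1 | h1
      · exact h1
      all_goals
        exfalso
        rw [Sym2.eq_iff] at h1
        obtain ⟨_, m1, m2⟩ := he2
        rcases h1 with ⟨rfl, rfl⟩ | ⟨rfl, rfl⟩ <;> contradiction
    · exact (f.ear3 h hv hy hk.1.2.2.2.2.2.2.1 hw hx (h.adj hk.e2) (h.adj hk.e3) (h.adj hk.e4)).elim
    · exact (f.ear4 h hv hu huv.symm hw hx hy (h.adj hk.e2) (h.adj hk.e3) (h.adj hk.e4) (h.adj hk.e5) hk.1.2.2.2.2.2.2.2.2.1).elim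

end fan
end T6

end

section
open SimpleGraph Finset
open scoped Classical
set_option linter.unusedSectionVars false
set_option linter.unusedVariables false
set_option linter.unusedSimpArgs false
set_option linter.unnecessarySeqFocus false

namespace T6
variable {V : Type*} [Fintype V] {G : SimpleGraph V} {ι : Type} [Fintype ι] {F : ι → Ch V}

/-- elementary relation between edges -/
def R (G : SimpleGraph V) (F : ι → Ch V) (e e' : Sym2 V) : Prop :=
  (∃ i, sz (F i) = 3 ∧ F i e = 1 ∧ F i e' = 1) ∨
  (∃ o a b c d, Fan F o a b c d ∧ e ∈ ES G (fs o a b c d) ∧ e' ∈ ES G (fs o a b c d))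

lemma R.symm {e e' : Sym2 V} (h : R G F e e') : R G F e' e := by
  rcases h with ⟨i, h1, h2, h3⟩ | ⟨o, a, b, c, d, f, h2, h3⟩
  · exact Or.inl ⟨i, h1, h3, h2⟩
  · exact Or.inr ⟨o, a, b, c, d, f, h3, h2⟩

noncomputable def cls (G : SimpleGraph V) (F : ι → Ch V) (e : Sym2 V) : Finset (Sym2 V) :=
  univ.filter (fun e' => Relation.ReflTransGen (R G F) e e')

lemma mem_cls {e e' : Sym2 V} : e' ∈ cls G F e ↔ Relation.ReflTransGen (R G F) e e' := by simp [cls]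
lemma self_cls (e : Sym2 V) : e ∈ cls G F e := mem_cls.2 .refl
lemma cls_symm {e e' : Sym2 V} (h : e' ∈ cls G F e) : e ∈ cls G F e' := by
  rw [mem_cls] at *
  have : Std.Symm (R G F) := ⟨fun _ _ h => h.symm⟩
  exact Std.Symm.symm _ _ h
lemma cls_eq {e e' : Sym2 V} (h : e' ∈ cls G F e) : cls G F e' = cls G F e := by
  ext x
  have h' := mem_cls.1 (cls_symm h)
  rw [mem_cls] at h
  rw [mem_cls, mem_cls]
  exact ⟨fun h1 => h.trans h1, fun h1 => h'.trans h1⟩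
lemma R.mem {e e' : Sym2 V} (h : R G F e e') : e' ∈ cls G F e := mem_cls.2 (.single h)

lemma cls_sub {S : Finset (Sym2 V)} (hS : ∀ x ∈ S, ∀ y, R G F x y → y ∈ S) {e : Sym2 V} (he : e ∈ S) : cls G F e ⊆ S := by
  intro x hx
  rw [mem_cls] at hx
  induction hx with
  | refl => exact he
  | tail _ h2 ih => exact hS _ ih _ h2

lemma cls_edge (h : Cfg G F) {e : Sym2 V} (he : e ∈ G.edgeSet) {x : Sym2 V} (hx : x ∈ cls G F e) : x ∈ G.edgeSet := by
  rw [mem_cls] at hx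
  induction hx with
  | refl => exact he
  | tail _ h2 ih =>
    rcases h2 with ⟨i, h1, h2, h3⟩ | ⟨o, a, b, c, d, f, h2, h3⟩
    · exact (h.tb.cyc i).1 _ (by rw [h3]; decide)
    · simp only [ES, mem_filter] at h3; exact h3.2.1

noncomputable def wt (F : ι → Ch V) (i : ι) : ℚ := if sz (F i) = 3 then 4 else if sz (F i) = 4 then 2 else if sz (F i) = 5 then 4/5 else 0
noncomputable def chg (F : ι → Ch V) (e : Sym2 V) : ℚ := 9 - ∑ i, if F i e = 1 then wt F i else 0
def sing (G : SimpleGraph V) (F : ι → Ch V) (e : Sym2 V) : Prop := cls G F e = {e}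
noncomputable def hh (G : SimpleGraph V) (F : ι → Ch V) (v : V) : ℚ :=
  ∑ e ∈ univ.filter (fun e => e ∈ G.edgeSet ∧ v ∈ e ∧ sing G F e), chg F e / 2
/-- the nonsingleton classes -/
noncomputable def Kn (G : SimpleGraph V) (F : ι → Ch V) : Finset (Finset (Sym2 V)) :=
  (univ.filter (fun e => e ∈ G.edgeSet ∧ ¬ sing G F e)).image (cls G F)
def tch (q : Finset (Sym2 V)) (v : V) : Prop := ∃ e ∈ q, v ∈ e
noncomputable def mm (G : SimpleGraph V) (F : ι → Ch V) (v : V) : ℕ := ((Kn G F).filter (fun q => tch q v)).card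
noncomputable def DD (G : SimpleGraph V) (F : ι → Ch V) (v : V) : ℚ := max 0 (6 - hh G F v) / (mm G F v : ℚ)

lemma wt_le (i : ι) : wt F i ≤ 4 := by unfold wt; split_ifs <;> norm_num
lemma wt_nonneg (i : ι) : 0 ≤ wt F i := by unfold wt; split_ifs <;> norm_num
lemma wt_le2 {i : ι} (h : sz (F i) ≠ 3) : wt F i ≤ 2 := by unfold wt; rw [if_neg h]; split_ifs <;> norm_num
lemma wt_le1 {i : ι} (h : sz (F i) ≠ 3) (h' : sz (F i) ≠ 4) : wt F i ≤ 4/5 := by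
  unfold wt; rw [if_neg h, if_neg h']; split_ifs <;> norm_num
lemma wt_zero {i : ι} (h : 6 ≤ sz (F i)) : wt F i = 0 := by
  unfold wt; rw [if_neg (by omega), if_neg (by omega), if_neg (by omega)]

lemma chg_eq (h : Cfg G F) {i j : ι} {e : Sym2 V} (hij : i ≠ j) (hi : F i e = 1) (hj : F j e = 1) : chg F e = 9 - wt F i - wt F j := by
  unfold chg
  have : (∑ k, if F k e = 1 then wt F k else 0) = ∑ k ∈ ({i, j} : Finset ι), wt F k := by
    rw [← Finset.sum_filter]
    apply Finset.sum_congr _ (fun _ _ => rfl)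
    ext k
    simp only [mem_filter, mem_univ, true_and, mem_insert, mem_singleton]
    constructor
    · intro hk; exact h.tb.third hij hi hj hk
    · rintro (rfl | rfl) <;> assumption
  rw [this, Finset.sum_pair hij]; ring

section D
variable (h : Cfg G F) (hA : ∀ e ∈ G.edgeSet, sing G F e → 31/5 ≤ chg F e)
include h hA

lemma hh_ge {v : V} (S : Finset (Sym2 V)) (hS : ∀ e ∈ S, e ∈ G.edgeSet ∧ v ∈ e ∧ sing G F e) :
    ∑ e ∈ S, chg F e / 2 ≤ hh G F v := by
  apply Finset.sum_le_sum_of_subset_of_nonneg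
  · intro e he; simp only [mem_filter, mem_univ, true_and]; exact hS e he
  · intro e he _
    simp only [mem_filter, mem_univ, true_and] at he
    have := hA e he.1 he.2.2
    linarith

lemma hh0 (v : V) : 0 ≤ hh G F v := by
  have := hh_ge h hA (v := v) ∅ (by simp)
  simpa using this

lemma hh1 {v x : V} (hx : G.Adj v x) (hs : sing G F s(v,x)) : chg F s(v,x) / 2 ≤ hh G F v := by
  have := hh_ge h hA (v := v) {s(v,x)} (by simp only [mem_singleton]; rintro e rfl; exact ⟨hx, by simp, hs⟩)
  simpa using this

lemma hh2 {v x y : V} (hxy : x ≠ y) (hx : G.Adj v x) (hs : sing G F s(v,x)) (hy : G.Adj v y) (hs' : sing G F s(v,y)) : 6 ≤ hh G F v := by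
  have := hh_ge h hA (v := v) {s(v,x), s(v,y)} (by
    simp only [mem_singleton, mem_insert]; rintro e (rfl | rfl); exacts [⟨hx, by simp, hs⟩, ⟨hy, by simp, hs'⟩])
  rw [Finset.sum_pair (by rw [Ne, Sym2.congr_right]; exact hxy)] at this
  have := hA _ hx hs
  have := hA _ hy hs'
  linarith

lemma DD0 (v : V) : 0 ≤ DD G F v := by unfold DD; positivity

lemma DD_of (v : V) {m : ℕ} {t : ℚ} (hm : 0 < m) (hm' : m ≤ mm G F v) (ht : 6 - hh G F v ≤ t * m) (ht0 : 0 ≤ t) : DD G F v ≤ t := by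
  unfold DD
  have h1 : (m : ℚ) ≤ mm G F v := by exact_mod_cast hm'
  have h2 : (0 : ℚ) < m := by exact_mod_cast hm
  rw [div_le_iff₀ (by linarith)]
  apply max_le
  · positivity
  · have := mul_le_mul_of_nonneg_left h1 ht0
    linarith

lemma DD6 (v : V) : DD G F v ≤ 6 := by
  by_cases hm : mm G F v = 0
  · unfold DD; rw [hm]; norm_num
  · apply DD_of h hA v (m := 1) (by norm_num) (by omega) _ (by norm_num)
    have := hh0 h hA v
    push_cast; linarith

lemma mem_Kn {e : Sym2 V} (he : e ∈ G.edgeSet) (hs : ¬ sing G F e) : cls G F e ∈ Kn G F := by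
  apply Finset.mem_image_of_mem
  simp [he, hs]

lemma mm1 {v x : V} (hx : G.Adj v x) (hs : ¬ sing G F s(v,x)) : 1 ≤ mm G F v := by
  apply Finset.card_pos.2
  refine ⟨cls G F s(v,x), ?_⟩
  rw [mem_filter]
  exact ⟨mem_Kn h hA hx hs, _, self_cls _, by simp⟩

lemma mm2 {v x y : V} (hx : G.Adj v x) (hs : ¬ sing G F s(v,x)) (hy : G.Adj v y) (hs' : ¬ sing G F s(v,y))
    (hn : s(v,y) ∉ cls G F s(v,x)) : 2 ≤ mm G F v := by
  have : ({cls G F s(v,x), cls G F s(v,y)} : Finset (Finset (Sym2 V))) ⊆ (Kn G F).filter (fun q => tch q v) := by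
    intro q hq
    rw [mem_filter]
    simp only [mem_insert, mem_singleton] at hq
    rcases hq with rfl | rfl
    · exact ⟨mem_Kn h hA hx hs, _, self_cls _, by simp⟩
    · exact ⟨mem_Kn h hA hy hs', _, self_cls _, by simp⟩
  have := Finset.card_le_card this
  rwa [Finset.card_pair] at this
  intro e
  apply hn
  rw [e]; exact self_cls _

lemma DD3 {v x y : V} (hx : G.Adj v x) (hs : ¬ sing G F s(v,x)) (hy : G.Adj v y) (hn : s(v,y) ∉ cls G F s(v,x)) : DD G F v ≤ 3 := by
  by_cases hs' : sing G F s(v,y)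
  · apply DD_of h hA v (by norm_num) (mm1 h hA hx hs) _ (by norm_num)
    have := hh1 h hA hy hs'
    have := hA _ hy hs'
    push_cast; linarith
  · apply DD_of h hA v (by norm_num) (mm2 h hA hx hs hy hs' hn) _ (by norm_num)
    have := hh0 h hA v
    push_cast; linarith

lemma DDz {v x y : V} (hxy : x ≠ y) (hx : G.Adj v x) (hs : sing G F s(v,x)) (hy : G.Adj v y) (hs' : sing G F s(v,y)) : DD G F v ≤ 0 := by
  have := hh2 h hA hxy hx hs hy hs'
  unfold DD
  rw [max_eq_left (by linarith)]; simp

lemma DD25 {v x y : V} (hx : G.Adj v x) (hs : ¬ sing G F s(v,x)) (hy : G.Adj v y) (hs' : sing G F s(v,y))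
    (hc : (∀ w, G.Adj v w → w = y ∨ s(v,w) ∈ cls G F s(v,x)) → 7 ≤ chg F s(v,y)) : DD G F v ≤ 5/2 := by
  have h1 := hh1 h hA hy hs'
  by_cases hall : ∀ w, G.Adj v w → w = y ∨ s(v,w) ∈ cls G F s(v,x)
  · have := hc hall
    apply DD_of h hA v (by norm_num) (mm1 h hA hx hs) _ (by norm_num)
    push_cast; linarith
  · push Not at hall
    obtain ⟨w, hw, hwy, hwn⟩ := hall
    by_cases hsw : sing G F s(v,w)
    · have := DDz h hA hwy hw hsw hy hs'; linarith
    · apply DD_of h hA v (by norm_num) (mm2 h hA hx hs hw hsw hwn) _ (by norm_num)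
      have := hA _ hy hs'
      push_cast; linarith

lemma vertex_ok (v : V) : 6 ≤ hh G F v + mm G F v * DD G F v := by
  by_cases hm : mm G F v = 0
  · have hs : ∀ x, G.Adj v x → sing G F s(v,x) := by
      intro x hx; by_contra hs
      have := mm1 h hA hx hs; omega
    obtain ⟨x, hx, _⟩ := h.deg v v v
    obtain ⟨y, hy, hxy, _⟩ := h.deg v x x
    have := hh2 h hA hxy hy (hs y hy) hx (hs x hx)
    rw [hm]; simpa using this
  · have hp : (0:ℚ) < mm G F v := by exact_mod_cast Nat.pos_of_ne_zero hm
    unfold DD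
    rw [mul_div_cancel₀ _ hp.ne']
    have := le_max_right 0 (6 - hh G F v)
    linarith

/-- the global count, with extra credit `x q` for classes -/
lemma global_count (x : Finset (Sym2 V) → ℚ)
    (hB : ∀ q ∈ Kn G F, ∑ v ∈ univ.filter (fun v => tch q v), DD G F v ≤ ∑ e ∈ q, chg F e + x q) :
    6 * (Fintype.card V : ℚ) ≤ ∑ e ∈ G.edgeFinset, chg F e + ∑ q ∈ Kn G F, x q := by
  have s1 : 6 * (Fintype.card V : ℚ) ≤ ∑ v : V, hh G F v + ∑ v : V, mm G F v * DD G F v := by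
    rw [← Finset.sum_add_distrib]
    have := Finset.sum_le_sum (fun v (_ : v ∈ (univ : Finset V)) => vertex_ok h hA v)
    simp only [Finset.sum_const, Finset.card_univ, nsmul_eq_mul] at this
    linarith
  have s2 : ∑ v : V, hh G F v = ∑ e ∈ univ.filter (fun e => e ∈ G.edgeSet ∧ sing G F e), chg F e := by
    have : ∀ v, hh G F v = ∑ e ∈ univ.filter (fun e => e ∈ G.edgeSet ∧ sing G F e), if v ∈ e then chg F e / 2 else 0 := by
      intro v
      unfold hh
      rw [← Finset.sum_filter, Finset.filter_filter]
      apply Finset.sum_congr _ (fun _ _ => rfl)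
      ext e; simp only [mem_filter, mem_univ, true_and]; tauto
    simp_rw [this]
    rw [Finset.sum_comm]
    apply Finset.sum_congr rfl
    intro e he
    simp only [mem_filter, mem_univ, true_and] at he
    induction e using Sym2.ind with
    | _ a b =>
    have hab : a ≠ b := G.ne_of_adj he.1
    rw [← Finset.sum_filter]
    have : univ.filter (fun v => v ∈ s(a,b)) = {a, b} := by ext v; simp
    rw [this, Finset.sum_pair hab]; ring
  have s3 : ∑ v : V, mm G F v * DD G F v = ∑ q ∈ Kn G F, ∑ v ∈ univ.filter (fun v => tch q v), DD G F v := by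
    have : ∀ v, (mm G F v : ℚ) * DD G F v = ∑ q ∈ Kn G F, if tch q v then DD G F v else 0 := by
      intro v
      rw [← Finset.sum_filter, Finset.sum_const, nsmul_eq_mul]; rfl
    simp_rw [this]
    rw [Finset.sum_comm]
    apply Finset.sum_congr rfl
    intro q _
    rw [Finset.sum_filter]
  have s4 : ∑ q ∈ Kn G F, ∑ e ∈ q, chg F e = ∑ e ∈ univ.filter (fun e => e ∈ G.edgeSet ∧ ¬ sing G F e), chg F e := by
    rw [← Finset.sum_fiberwise_of_maps_to (g := cls G F) (t := Kn G F) (fun e he => Finset.mem_image_of_mem _ he)]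
    apply Finset.sum_congr rfl
    intro q hq
    apply Finset.sum_congr _ (fun _ _ => rfl)
    obtain ⟨e0, he0, rfl⟩ := Finset.mem_image.1 hq
    simp only [mem_filter, mem_univ, true_and] at he0
    ext e
    simp only [mem_filter, mem_univ, true_and]
    constructor
    · intro he
      refine ⟨⟨cls_edge h he0.1 he, ?_⟩, cls_eq he⟩
      intro hs
      unfold sing at hs
      rw [cls_eq he] at hs
      have := self_cls (G := G) (F := F) e0
      rw [hs, mem_singleton] at this
      subst this
      exact he0.2 hs
    · rintro ⟨_, he⟩
      rw [← he]; exact self_cls _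
  have s5 : ∑ e ∈ G.edgeFinset, chg F e = ∑ e ∈ univ.filter (fun e => e ∈ G.edgeSet ∧ sing G F e), chg F e
      + ∑ e ∈ univ.filter (fun e => e ∈ G.edgeSet ∧ ¬ sing G F e), chg F e := by
    rw [← Finset.sum_filter_add_sum_filter_not G.edgeFinset (fun e => sing G F e)]
    congr 1 <;>
    · apply Finset.sum_congr _ (fun _ _ => rfl)
      ext e; simp
  have s6 := Finset.sum_le_sum hB
  rw [Finset.sum_add_distrib, s4] at s6
  rw [s2, s3] at s1
  rw [s5]; linarith

end D
end T6

end

section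
open SimpleGraph Finset
open scoped Classical
set_option linter.unusedSectionVars false
set_option linter.unusedVariables false
set_option linter.unusedSimpArgs false
set_option linter.unnecessarySeqFocus false

namespace T6
variable {V : Type*} [Fintype V] {G : SimpleGraph V} {ι : Type} [Fintype ι] {F : ι → Ch V}

section cfg
variable (h : Cfg G F)
include h

lemma Cfg.no44 {i j : ι} {u v : V} (hij : i ≠ j) (hi : F i s(u,v) = 1) (hj : F j s(u,v) = 1) (si : sz (F i) = 4) (sj : sz (F j) = 4) : False := by
  obtain ⟨w, x, h1⟩ := h.ex4 hi si
  obtain ⟨w', x', h2⟩ := h.ex4 hj sj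
  have e4 := h1.e4
  rw [Sym2.eq_swap] at e4
  have e4' := h2.e4
  rw [Sym2.eq_swap] at e4'
  have nx : x ≠ x' := by
    rintro rfl
    exact hij (h.s2 h1.1.2.2.2.2.1 h1.e1 e4 h2.e1 e4')
  have nw : w ≠ w' := by
    rintro rfl
    exact hij (h.s2 h1.1.2.1 (by rw [Sym2.eq_swap]; exact h1.e1) h1.e2 (by rw [Sym2.eq_swap]; exact h2.e1) h2.e2)
  have nxw : x ≠ w' := by
    rintro rfl
    have := h.sw j u v x x' h2 (h.adj e4) i e4
    omega
  have nwx : w ≠ x' := by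
    rintro rfl
    have := h.sw j v w' w u h2.rot (h.adj h1.e2) i h1.e2
    omega
  exact th_long h.th (h.adj e4) (h.adj h1.e3).symm (h.adj h1.e2).symm (h.adj h2.e2) (h.adj h2.e3) (h.adj h2.e4) (h.adj h1.e1)
    h1.1.2.1 h2.1.2.1 h1.1.2.2.2.2.1.symm nxw nx nw nwx h2.1.2.2.2.2.1

lemma Cfg.not_sing {i : ι} {e : Sym2 V} (h3 : sz (F i) = 3) (he : F i e = 1) : ¬ sing G F e := by
  induction e using Sym2.ind with
  | _ u v =>
  obtain ⟨w, hw⟩ := h.ex3 he h3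
  intro hs
  have : s(v,w) ∈ cls G F s(u,v) := R.mem (Or.inl ⟨i, h3, he, hw.e2⟩)
  rw [hs, mem_singleton, Sym2.eq_iff] at this
  have := hw.1
  grind

lemma Cfg.sing_ge {e : Sym2 V} (he : e ∈ G.edgeSet) (hs : sing G F e) : 31/5 ≤ chg F e := by
  obtain ⟨i, j, hij, hi, hj, _⟩ := h.tb.two e he
  have i3 : sz (F i) ≠ 3 := fun h3 => h.not_sing h3 hi hs
  have j3 : sz (F j) ≠ 3 := fun h3 => h.not_sing h3 hj hs
  rw [chg_eq h hij hi hj]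
  have := wt_le2 i3
  have := wt_le2 j3
  by_cases i4 : sz (F i) = 4
  · have j4 : sz (F j) ≠ 4 := by
      intro j4
      induction e using Sym2.ind with
      | _ u v => exact h.no44 hij hi hj i4 j4
    have := wt_le1 j3 j4
    linarith
  · have := wt_le1 i3 i4
    linarith

/-- three faces closing up around a vertex -/
lemma Cfg.sat3 {i j l : ι} {o a b c : V} (hij : i ≠ j) (hil : i ≠ l) (hjl : j ≠ l) (hab : a ≠ b) (hac : a ≠ c) (hbc : b ≠ c)
    (ia : F i s(o,a) = 1) (ib : F i s(o,b) = 1) (jb : F j s(o,b) = 1) (jc : F j s(o,c) = 1) (lc : F l s(o,c) = 1) (la : F l s(o,a) = 1) :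
    (∀ w, G.Adj o w → w = a ∨ w = b ∨ w = c) ∧ ∀ k w, F k s(o,w) = 1 → k = i ∨ k = j ∨ k = l := by
  have hk : ∀ k w, (w = a ∨ w = b ∨ w = c) → F k s(o,w) = 1 → k = i ∨ k = j ∨ k = l := by
    intro k w hw hk
    rcases hw with rfl | rfl | rfl
    · rcases h.tb.third hil ia la hk with e | e <;> simp [e]
    · rcases h.tb.third hij ib jb hk with e | e <;> simp [e]
    · rcases h.tb.third hjl jc lc hk with e | e <;> simp [e]
  have hS := h.tb.sat h.tc {w | w = a ∨ w = b ∨ w = c} (v := o) (a := a) (Or.inl rfl) (h.adj ia) (by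
    intro w hw k hkw w' hw'
    rcases hk k w hw hkw with rfl | rfl | rfl
    · rcases h.f2 hab ia ib hw' with e | e <;> simp [e]
    · rcases h.f2 hbc jb jc hw' with e | e <;> simp [e]
    · rcases h.f2 hac la lc hw' with e | e <;> simp [e])
  exact ⟨hS, fun k w hw => hk k w (hS w (h.adj hw)) hw⟩

/-- any vertex set of at most five vertices has a contact vertex besides a given one -/
lemma Cfg.contact {X : Finset V} (hX : X.card ≤ 5) {p q : V} (hq : q ∈ X) (hpq : q ≠ p) :
    ∃ v ∈ X, v ≠ p ∧ ∃ w, w ∉ X ∧ G.Adj v w := by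
  by_contra hh; push Not at hh
  have := h.tc.2.2 p ({v | v ∈ X ∧ v ≠ p}) (fun v hv => ⟨trivial, hv.2⟩) ⟨q, hq, hpq⟩ (by
    intro x hx y hy hxy
    refine ⟨?_, hy.2⟩
    by_contra hyX
    exact hh x hx.1 hx.2 y hyX hxy)
  have h2 : (univ : Finset V) ⊆ insert p X := by
    intro v _
    rw [mem_insert]
    by_cases hv : v = p
    · exact Or.inl hv
    · right
      have : v ∈ (Set.univ \ {p} : Set V) := ⟨trivial, hv⟩
      rw [← ‹_ = Set.univ \ {p}›] at this
      exact this.1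
  have h3 : univ ⊆ X ∨ univ = insert p X := by
    right; exact (Finset.eq_univ_iff_forall.2 (fun v => h2 (mem_univ v))).symm
  have h6 := h.n6
  have h4 := Finset.card_le_card h2
  rw [Finset.card_univ] at h4
  by_cases hp : p ∈ X
  · rw [Finset.insert_eq_of_mem hp] at h4; omega
  · -- then p is the only outside vertex and is isolated from X \ {p}
    have hd := h.deg p p p
    obtain ⟨w, hw, hwp, _⟩ := hd
    have hwX : w ∈ X := by
      have := h2 (mem_univ w)
      rw [mem_insert] at this
      exact this.resolve_left hwp
    exact hh w hwX hwp p hp hw.symm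

lemma cls_char {S : Finset (Sym2 V)} {e : Sym2 V} (he : e ∈ S)
    (nf : ∀ x ∈ cls G F e, ∀ o a b c d, Fan F o a b c d → x ∉ ES G (fs o a b c d))
    (h1 : ∀ x ∈ S, x ∈ cls G F e) (h2 : ∀ x ∈ S, ∀ k, sz (F k) = 3 → F k x = 1 → ∀ y, F k y = 1 → y ∈ S) : cls G F e = S := by
  apply Finset.Subset.antisymm
  · apply cls_sub _ he
    rintro x hx y (⟨k, h3, hk, hk'⟩ | ⟨o, a, b, c, d, f, m1, m2⟩)
    · exact h2 x hx k h3 hk y hk'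
    · exact absurd m1 (nf x (h1 x hx) _ _ _ _ _ f)
  · exact h1

lemma cls_tri {i : ι} (h3 : sz (F i) = 3) {e x y : Sym2 V} (hx : F i x = 1) (hy : F i y = 1) (he : x ∈ cls G F e) : y ∈ cls G F e := by
  rw [← cls_eq he]
  exact R.mem (Or.inl ⟨i, h3, hx, hy⟩)

lemma Fan.cls_eq {o a b c d : V} (f : Fan F o a b c d) {e : Sym2 V} (he : e ∈ ES G (fs o a b c d)) : cls G F e = ES G (fs o a b c d) := by
  apply Finset.Subset.antisymm
  · apply cls_sub _ he
    rintro x hx y (⟨k, h3, hk, hk'⟩ | ⟨o', a', b', c', d', f', m1, m2⟩)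
    · induction x using Sym2.ind with
      | _ u v =>
      induction y using Sym2.ind with
      | _ u' v' =>
      obtain ⟨w, hw⟩ := h.ex3 hk h3
      rw [mem_ES] at hx ⊢
      obtain ⟨huv, hu, hv⟩ := hx
      have hwX := f.closed h hu hv ⟨k, hw⟩
      refine ⟨h.adj hk', ?_⟩
      have := (hw.2 _).1 hk'
      simp only [Sym2.eq_iff] at this
      rcases this with (⟨rfl, rfl⟩ | ⟨rfl, rfl⟩) | (⟨rfl, rfl⟩ | ⟨rfl, rfl⟩) | (⟨rfl, rfl⟩ | ⟨rfl, rfl⟩) <;> constructor <;> assumption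
    · induction x using Sym2.ind with
      | _ u v =>
      have m1' := mem_ES.1 m1
      rw [mem_ES] at hx
      have := f.inter h f' hx.1.ne hx.2.1 hx.2.2 m1'.2.1 m1'.2.2
      rwa [this] at m2
  · intro y hy
    exact R.mem (Or.inr ⟨o, a, b, c, d, f, he, hy⟩)

end cfg

/-- classes without fans -/
def NF (G : SimpleGraph V) (F : ι → Ch V) (e : Sym2 V) : Prop :=
  ∀ x ∈ cls G F e, ∀ o a b c d, Fan F o a b c d → x ∉ ES G (fs o a b c d)

structure TK3 (G : SimpleGraph V) (F : ι → Ch V) (q : Finset (Sym2 V)) (i : ι) (a b c : V) : Prop where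
  hi : Is3 (F i) a b c
  q : q = {s(a,b), s(b,c), s(a,c)}
  n : ∀ k, k ≠ i → (F k s(a,b) = 1 ∨ F k s(b,c) = 1 ∨ F k s(a,c) = 1) → sz (F k) ≠ 3

structure TKm (G : SimpleGraph V) (F : ι → Ch V) (q : Finset (Sym2 V)) (i j : ι) (a b c d : V) : Prop where
  hi : Is3 (F i) a b c
  hj : Is3 (F j) a b d
  ncd : c ≠ d
  q : q = {s(a,b), s(a,c), s(b,c), s(a,d), s(b,d)}
  n : ∀ k, k ≠ i → k ≠ j → (F k s(a,c) = 1 ∨ F k s(b,c) = 1 ∨ F k s(a,d) = 1 ∨ F k s(b,d) = 1) → sz (F k) ≠ 3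

structure TK4 (G : SimpleGraph V) (F : ι → Ch V) (q : Finset (Sym2 V)) (i j l : ι) (o a b c : V) : Prop where
  hi : Is3 (F i) o a b
  hj : Is3 (F j) o b c
  hl : Is3 (F l) o c a
  q : q = {s(o,a), s(o,b), s(o,c), s(a,b), s(b,c), s(c,a)}
  n : ∀ k, k ≠ i → k ≠ j → k ≠ l → (F k s(a,b) = 1 ∨ F k s(b,c) = 1 ∨ F k s(c,a) = 1) → sz (F k) ≠ 3

section cl
variable (h : Cfg G F)
include h

/-- a facial triangle sharing two edges must coincide -/
lemma Cfg.ne_of_apex {i j : ι} {a b c d : V} (hi : Is3 (F i) a b c) (hj : Is3 (F j) a b d) (hcd : c ≠ d) : i ≠ j := by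
  rintro rfl
  rcases h.f2 hi.1.2.2 hi.e1 hi.e3 hj.e3 with e | e
  · exact hj.1.2.2 e.symm
  · exact hcd e.symm
lemma Cfg.apex_ne {i j : ι} {a b c d : V} (hi : Is3 (F i) a b c) (hj : Is3 (F j) a b d) (hij : i ≠ j) : c ≠ d := by
  rintro rfl
  exact hij (h.corner hj hi.e1 hi.e3)

lemma Cfg.k4_out {i j l k : ι} {o a b c : V} (hi : Is3 (F i) o a b) (hj : Is3 (F j) o b c) (hl : Is3 (F l) o c a)
    {e : Sym2 V} (he : s(o,a) ∈ cls G F e) (nf : NF G F e) (k1 : k ≠ i) (hk : F k s(a,b) = 1) : sz (F k) ≠ 3 := by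
  intro h3
  have nbc := hj.1.2.2
  have nca := hl.1.2.2
  have nab := hi.1.2.2
  obtain ⟨y, hy⟩ := h.ex3 hk h3
  have hyo : y ≠ o := by
    rintro rfl
    exact k1 (h.corner hi.rot hy.e1 hy.e3)
  by_cases hyc : y = c
  · subst hyc
    have hij : i ≠ j := h.ne_of_apex hi.rot.rot hj.rev nca.symm
    have hil : i ≠ l := h.ne_of_apex hi hl.rev.rot nbc
    have hjl : j ≠ l := h.ne_of_apex hj.rot.rot hl.rev nab.symm
    have hkj : k ≠ j := h.ne_of_apex hy.rot hj.rot hi.1.1.symm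
    have hkl : k ≠ l := h.ne_of_apex hy.rot.rot hl.rot hi.1.2.1.symm
    have so := (h.sat3 hij hil hjl nab nca.symm nbc hi.e1 hi.e3 hj.e1 hj.e3 hl.e1 hl.e3).1
    have sa := (h.sat3 k1.symm hil hkl hi.1.2.1 hj.1.2.1 nbc hi.rev.e1 hi.rev.e3 hy.e1 hy.e3 hl.rot.rot.e3 hl.rot.rot.e1).1
    have sb := (h.sat3 k1.symm hij hkj hi.1.1 hj.1.2.1 nca.symm hi.rot.rot.e1 hi.rot.rot.e3 hy.rev.e1 hy.rev.e3 hj.rev.e3 hj.rev.e1).1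
    have sc := (h.sat3 hkl.symm hjl.symm hkj hi.1.1 hi.1.2.1 nab hl.rev.e1 hl.rev.e3 hy.rot.rot.e1 hy.rot.rot.e3 hj.rot.rot.e3 hj.rot.rot.e1).1
    obtain ⟨v, hv, -, w, hw, hvw⟩ := h.contact (X := {o, a, b, y}) (p := a) (q := o) (card_le_four.trans (by norm_num)) (by simp) hi.1.1
    simp only [mem_insert, mem_singleton, not_or] at hv hw
    rcases hv with rfl | rfl | rfl | rfl
    · have := so w hvw; grind
    · have := sa w hvw; grind
    · have := sb w hvw; grind
    · have := sc w hvw; grind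
  · refine nf s(o,a) he a y b o c ⟨⟨k, hy.rot.rot.rev⟩, ⟨i, hi.rot⟩, ⟨l, hl.rot.rot⟩, hyo, hyc, nbc⟩ ?_
    · rw [mem_ES]; exact ⟨h.adj hi.e1, by simp [fs], by simp [fs]⟩

lemma cls_char' {S : Finset (Sym2 V)} {e x0 : Sym2 V} (h0 : x0 ∈ S) (h0' : x0 ∈ cls G F e) (nf : NF G F e)
    (h1 : ∀ x ∈ S, x ∈ cls G F e) (h2 : ∀ x ∈ S, ∀ k, sz (F k) = 3 → F k x = 1 → ∀ y, F k y = 1 → y ∈ S) : cls G F e = S := by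
  have hc := cls_eq h0'
  rw [← hc]
  apply cls_char h h0 _ _ h2
  · rw [hc]; exact nf
  · rw [hc]; exact h1

lemma cl_step3 {i j l : ι} {a b c d : V} {e : Sym2 V} (nf : NF G F e) (hi : Is3 (F i) a b c) (hj : Is3 (F j) a b d) (hcd : c ≠ d)
    (he : s(a,b) ∈ cls G F e) (hli : l ≠ i) (hl : F l s(a,c) = 1) (h3 : sz (F l) = 3) :
    ∃ i j l o a b c, TK4 G F (cls G F e) i j l o a b c := by
  obtain ⟨y, hy⟩ := h.ex3 hl h3
  have hyb : y ≠ b := by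
    rintro rfl
    exact hli (h.corner hi hy.e3 hy.e1)
  have hac := cls_tri h hi.sz hi.e1 hi.e3 he
  have hbc := cls_tri h hi.sz hi.e1 hi.e2 he
  have had := cls_tri h hj.sz hj.e1 hj.e3 he
  have hbd := cls_tri h hj.sz hj.e1 hj.e2 he
  by_cases hyd : y = d
  · subst hyd
    have hcy := cls_tri h hy.sz hy.e1 hy.e2 hac
    have t1 : Is3 (F i) a c b := hi.rot.rot.rev
    have t2 : Is3 (F j) a b y := hj
    have t3 : Is3 (F l) a y c := hy.rot.rot.rev
    have hij : i ≠ j := h.ne_of_apex hi hj hcd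
    have hlj : l ≠ j := h.ne_of_apex t3 hj.rot.rot.rev hi.1.2.2.symm
    have o1 : ∀ k, k ≠ i → F k s(c,b) = 1 → sz (F k) ≠ 3 := fun k k1 k2 => h.k4_out t1 t2 t3 hac nf k1 k2
    have o2 : ∀ k, k ≠ j → F k s(b,y) = 1 → sz (F k) ≠ 3 := fun k k1 k2 => h.k4_out t2 t3 t1 he nf k1 k2
    have o3 : ∀ k, k ≠ l → F k s(y,c) = 1 → sz (F k) ≠ 3 := fun k k1 k2 => h.k4_out t3 t1 t2 had nf k1 k2
    refine ⟨i, j, l, a, c, b, y, t1, t2, t3, ?_, ?_⟩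
    · apply cls_char' h (x0 := s(a,b)) (by simp) he nf
      · intro x hx
        simp only [mem_insert, mem_singleton] at hx
        rcases hx with rfl | rfl | rfl | rfl | rfl | rfl
        · exact hac
        · exact he
        · exact had
        · rw [Sym2.eq_swap]; exact hbc
        · exact hbd
        · rw [Sym2.eq_swap]; exact hcy
      · intro x hx k k3 hk z hz
        have hkk : k = i ∨ k = j ∨ k = l := by
          simp only [mem_insert, mem_singleton] at hx
          by_contra hne
          push Not at hne
          rcases hx with rfl | rfl | rfl | rfl | rfl | rfl
          · rcases h.tb.third hli hy.e1 hi.e3 hk with e | e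
            exacts [hne.2.2 e, hne.1 e]
          · rcases h.tb.third hij hi.e1 hj.e1 hk with e | e
            exacts [hne.1 e, hne.2.1 e]
          · rcases h.tb.third hlj t3.e1 hj.e3 hk with e | e
            exacts [hne.2.2 e, hne.2.1 e]
          · exact o1 k hne.1 hk k3
          · exact o2 k hne.2.1 hk k3
          · exact o3 k hne.2.2 hk k3
        simp only [mem_insert, mem_singleton]
        rcases hkk with rfl | rfl | rfl
        · rcases (t1.2 z).1 hz with e | e | e <;> simp [e]
        · rcases (t2.2 z).1 hz with e | e | e <;> simp [e]
        · rcases (t3.2 z).1 hz with e | e | e <;> simp [e, Sym2.eq_swap]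
    · intro k k1 k2 k3 hk
      rcases hk with hk | hk | hk
      exacts [o1 k k1 hk, o2 k k2 hk, o3 k k3 hk]
  · exfalso
    refine nf _ he a d b c y ⟨⟨j, hj.rev.rot⟩, ⟨i, hi⟩, ⟨l, hy⟩, hcd.symm, fun e => hyd e.symm, hyb.symm⟩ ?_
    rw [mem_ES]; exact ⟨h.adj hi.e1, by simp [fs], by simp [fs]⟩

lemma cl_step2 {i j : ι} {a b c : V} {e : Sym2 V} (nf : NF G F e) (hi : Is3 (F i) a b c)
    (he : s(a,b) ∈ cls G F e) (hji : j ≠ i) (hjab : F j s(a,b) = 1) (h3 : sz (F j) = 3) :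
    (∃ i j a b c d, TKm G F (cls G F e) i j a b c d) ∨ ∃ i j l o a b c, TK4 G F (cls G F e) i j l o a b c := by
  obtain ⟨d, hj⟩ := h.ex3 hjab h3
  have hcd : c ≠ d := h.apex_ne hi hj hji.symm
  have he' : s(b,a) ∈ cls G F e := by rw [Sym2.eq_swap]; exact he
  by_cases n : ∀ k, k ≠ i → k ≠ j → (F k s(a,c) = 1 ∨ F k s(b,c) = 1 ∨ F k s(a,d) = 1 ∨ F k s(b,d) = 1) → sz (F k) ≠ 3
  · left
    refine ⟨i, j, a, b, c, d, hi, hj, hcd, ?_, n⟩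
    apply cls_char' h (x0 := s(a,b)) (by simp) he nf
    · intro x hx
      simp only [mem_insert, mem_singleton] at hx
      rcases hx with rfl | rfl | rfl | rfl | rfl
      · exact he
      · exact cls_tri h hi.sz hi.e1 hi.e3 he
      · exact cls_tri h hi.sz hi.e1 hi.e2 he
      · exact cls_tri h hj.sz hj.e1 hj.e3 he
      · exact cls_tri h hj.sz hj.e1 hj.e2 he
    · intro x hx k k3 hk z hz
      have hkk : k = i ∨ k = j := by
        simp only [mem_insert, mem_singleton] at hx
        by_contra hne
        push Not at hne
        have := n k hne.1 hne.2
        rcases hx with rfl | rfl | rfl | rfl | rfl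
        · rcases h.tb.third hji.symm hi.e1 hj.e1 hk with e | e
          exacts [hne.1 e, hne.2 e]
        · exact this (Or.inl hk) k3
        · exact this (Or.inr (Or.inl hk)) k3
        · exact this (Or.inr (Or.inr (Or.inl hk))) k3
        · exact this (Or.inr (Or.inr (Or.inr hk))) k3
      simp only [mem_insert, mem_singleton]
      rcases hkk with rfl | rfl
      · rcases (hi.2 z).1 hz with e | e | e <;> simp [e]
      · rcases (hj.2 z).1 hz with e | e | e <;> simp [e]
  · right
    push Not at n
    obtain ⟨l, li, lj, hl, l3⟩ := n
    rcases hl with hl | hl | hl | hl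
    · exact cl_step3 h nf hi hj hcd he li hl l3
    · exact cl_step3 h nf hi.rev hj.rev hcd he' li hl l3
    · exact cl_step3 h nf hj hi hcd.symm he lj hl l3
    · exact cl_step3 h nf hj.rev hi.rev hcd.symm he' lj hl l3

lemma classify {e : Sym2 V} (he : e ∈ G.edgeSet) (hs : ¬ sing G F e) :
    (∃ o a b c d, Fan F o a b c d ∧ cls G F e = ES G (fs o a b c d)) ∨
    (NF G F e ∧ ((∃ i a b c, TK3 G F (cls G F e) i a b c) ∨ (∃ i j a b c d, TKm G F (cls G F e) i j a b c d) ∨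
      ∃ i j l o a b c, TK4 G F (cls G F e) i j l o a b c)) := by
  by_cases nf : NF G F e
  · right
    refine ⟨nf, ?_⟩
    have : ∃ i, sz (F i) = 3 ∧ F i e = 1 := by
      by_contra hno
      push Not at hno
      apply hs
      apply Finset.Subset.antisymm
      · apply cls_sub _ (mem_singleton_self e)
        intro x hx y hR
        rw [mem_singleton] at hx; subst hx
        rcases hR with ⟨i, h3, hi, _⟩ | ⟨o, a, b, c, d, f, hx, _⟩
        · exact absurd hi (hno i h3)
        · exact absurd hx (nf x (self_cls x) _ _ _ _ _ f)
      · intro x hx; rw [mem_singleton] at hx; subst hx; exact self_cls x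
    obtain ⟨i, h3, hi⟩ := this
    induction e using Sym2.ind with
    | _ a b =>
    obtain ⟨c, hc⟩ := h.ex3 hi h3
    have hab := self_cls (G := G) (F := F) s(a,b)
    have hac := cls_tri h hc.sz hc.e1 hc.e3 hab
    have hbc := cls_tri h hc.sz hc.e1 hc.e2 hab
    by_cases n : ∀ k, k ≠ i → (F k s(a,b) = 1 ∨ F k s(b,c) = 1 ∨ F k s(a,c) = 1) → sz (F k) ≠ 3
    · left
      refine ⟨i, a, b, c, hc, ?_, n⟩
      apply cls_char' h (x0 := s(a,b)) (by simp) hab nf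
      · intro x hx
        simp only [mem_insert, mem_singleton] at hx
        rcases hx with rfl | rfl | rfl
        exacts [hab, hbc, hac]
      · intro x hx k k3 hk z hz
        simp only [mem_insert, mem_singleton] at hx
        have hki : k = i := by
          by_contra hne
          rcases hx with rfl | rfl | rfl
          exacts [n k hne (Or.inl hk) k3, n k hne (Or.inr (Or.inl hk)) k3, n k hne (Or.inr (Or.inr hk)) k3]
        subst hki
        simp only [mem_insert, mem_singleton]
        rcases (hc.2 z).1 hz with e | e | e <;> simp [e, Sym2.eq_swap]
    · right
      push Not at n
      obtain ⟨k, ki, hk, k3⟩ := n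
      rcases hk with hk | hk | hk
      · exact cl_step2 h nf hc hab ki hk k3
      · exact cl_step2 h nf hc.rot hbc ki hk k3
      · exact cl_step2 h nf hc.rev.rot hac ki hk k3
  · left
    unfold NF at nf
    push Not at nf
    obtain ⟨x, hx, o, a, b, c, d, f, hm⟩ := nf
    refine ⟨o, a, b, c, d, f, ?_⟩
    rw [← cls_eq hx]
    exact f.cls_eq h hm

end cl
end T6

end

section
open SimpleGraph Finset
open scoped Classical
set_option linter.unusedSectionVars false
set_option linter.unusedVariables false
set_option linter.unusedSimpArgs false
set_option linter.unnecessarySeqFocus false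

namespace T6
variable {V : Type*} [Fintype V] {G : SimpleGraph V} {ι : Type} [Fintype ι] {F : ι → Ch V}

lemma fsw {k : ι} {x y : V} (hk : F k s(x,y) = 1) : F k s(y,x) = 1 := by rw [Sym2.eq_swap]; exact hk

section ch
variable (h : Cfg G F)
include h

lemma chg_ge {i : ι} {e : Sym2 V} (hi : F i e = 1) {t : ℚ} (ht : ∀ k, k ≠ i → F k e = 1 → wt F k ≤ t) : 5 - t ≤ chg F e := by
  obtain ⟨j, hj, hje⟩ := h.tb.other hi
  rw [chg_eq h hj.symm hi hje]
  have := ht j hj hje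
  have := wt_le (F := F) i
  linarith

lemma chg_ge1 {i j : ι} {e : Sym2 V} (hij : i ≠ j) (hi : F i e = 1) (hj : F j e = 1) : 1 ≤ chg F e := by
  rw [chg_eq h hij hi hj]
  have := wt_le (F := F) i
  have := wt_le (F := F) j
  linarith

lemma not_sing_of {e x : Sym2 V} (hs : ¬ sing G F e) (hx : x ∈ cls G F e) : ¬ sing G F x := by
  intro hsx
  unfold sing at hsx
  rw [cls_eq hx] at hsx
  have := self_cls (G := G) (F := F) e
  rw [hsx, mem_singleton] at this
  subst this
  exact hs hsx

/-- a vertex of the class with an edge outside the class -/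
lemma cont3 {e : Sym2 V} (he : e ∈ G.edgeSet) (hs : ¬ sing G F e) {v x y : V} (hx : s(v,x) ∈ cls G F e)
    (hy : G.Adj v y) (hn : s(v,y) ∉ cls G F e) : DD G F v ≤ 3 :=
  DD3 h (fun e he hs => h.sing_ge he hs) (cls_edge h he hx) (not_sing_of h hs hx) hy (by rw [cls_eq hx]; exact hn)

lemma sum_tch {q : Finset (Sym2 V)} {X : Finset V} (hq : ∀ e ∈ q, ∀ v ∈ e, v ∈ X) :
    ∑ v ∈ univ.filter (fun v => tch q v), DD G F v ≤ ∑ v ∈ X, DD G F v := by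
  apply Finset.sum_le_sum_of_subset_of_nonneg
  · intro v hv
    simp only [mem_filter, mem_univ, true_and] at hv
    obtain ⟨e, he, hve⟩ := hv
    exact hq e he v hve
  · intro v _ _
    exact DD0 h (fun e he hs => h.sing_ge he hs) v

lemma sum_con {X C : Finset V} (hC : C ⊆ X) (h3 : ∀ v ∈ C, DD G F v ≤ 3) : ∑ v ∈ X, DD G F v ≤ 6 * X.card - 3 * C.card := by
  have : ∀ v ∈ X, DD G F v ≤ 6 - if v ∈ C then 3 else 0 := by
    intro v hv
    split_ifs with hc
    · have := h3 v hc; linarith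
    · have := DD6 h (fun e he hs => h.sing_ge he hs) v; linarith
  have := Finset.sum_le_sum this
  rw [Finset.sum_sub_distrib, ← Finset.sum_filter, Finset.filter_mem_eq_inter, Finset.inter_eq_right.2 hC] at this
  simp only [Finset.sum_const, nsmul_eq_mul] at this
  linarith

/-- two contact vertices -/
lemma two_con {X : Finset V} (hX : X.card ≤ 5) (h2 : 2 ≤ X.card) : ∃ v ∈ X, ∃ v' ∈ X, v ≠ v' ∧ (∃ w, w ∉ X ∧ G.Adj v w) ∧ ∃ w, w ∉ X ∧ G.Adj v' w := by
  obtain ⟨p, hp, q, hq, hpq⟩ := Finset.one_lt_card.1 h2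
  obtain ⟨v, hv, -, hw⟩ := h.contact hX hq hpq.symm
  have : ∃ q' ∈ X, q' ≠ v := by
    by_cases e : p = v
    · exact ⟨q, hq, fun e' => hpq (e.trans e'.symm)⟩
    · exact ⟨p, hp, e⟩
  obtain ⟨q', hq', hne⟩ := this
  obtain ⟨v', hv', hne', hw'⟩ := h.contact hX hq' hne
  exact ⟨v, hv, v', hv', hne'.symm, hw, hw'⟩

lemma K3_ok {e : Sym2 V} (he : e ∈ G.edgeSet) (hs : ¬ sing G F e) {i : ι} {a b c : V} (T : TK3 G F (cls G F e) i a b c) :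
    ∑ v ∈ univ.filter (fun v => tch (cls G F e) v), DD G F v ≤ ∑ x ∈ cls G F e, chg F x := by
  obtain ⟨⟨nab, nac, nbc⟩, -⟩ := T.hi
  have hq : ∀ u v, s(u,v) ∈ cls G F e → u ∈ ({a,b,c} : Finset V) ∧ v ∈ ({a,b,c} : Finset V) := by
    intro u v huv
    rw [T.q] at huv
    simp only [mem_insert, mem_singleton, Sym2.eq_iff] at huv ⊢
    grind
  have hd : ∀ v ∈ ({a,b,c} : Finset V), DD G F v ≤ 3 := by
    have key : ∀ v x y : V, s(v,x) ∈ cls G F e → (∀ w, s(v,w) ∈ cls G F e → w = x ∨ w = y) → DD G F v ≤ 3 := by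
      intro v x y hx hw
      obtain ⟨w, hvw, hwx, hwy⟩ := h.deg v x y
      exact cont3 h he hs hx hvw (fun hm => (hw w hm).elim hwx hwy)
    intro v hv
    simp only [mem_insert, mem_singleton] at hv
    rcases hv with rfl | rfl | rfl
    · apply key v b c
      · rw [T.q]; simp
      · intro w hw; rw [T.q] at hw; simp only [mem_insert, mem_singleton, Sym2.eq_iff] at hw; grind
    · apply key v a c
      · rw [T.q]; simp [Sym2.eq_swap]
      · intro w hw; rw [T.q] at hw; simp only [mem_insert, mem_singleton, Sym2.eq_iff] at hw; grind
    · apply key v a b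
      · rw [T.q]; simp [Sym2.eq_swap]
      · intro w hw; rw [T.q] at hw; simp only [mem_insert, mem_singleton, Sym2.eq_iff] at hw; grind
  have s1 := sum_tch h (q := cls G F e) (X := {a,b,c}) (by
    intro x hx v hv
    induction x using Sym2.ind with
    | _ u w =>
    rw [Sym2.mem_iff] at hv
    rcases hv with rfl | rfl
    exacts [(hq _ _ hx).1, (hq _ _ hx).2])
  have s2 := sum_con h (Finset.Subset.refl _) hd
  have hc : ({a,b,c} : Finset V).card = 3 := Finset.card_eq_three.2 ⟨a, b, c, nab, nac, nbc, rfl⟩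
  rw [hc] at s2
  have c1 : 5 - 2 ≤ chg F s(a,b) := chg_ge h T.hi.e1 (fun k k1 k2 => wt_le2 (T.n k k1 (Or.inl k2)))
  have c2 : 5 - 2 ≤ chg F s(b,c) := chg_ge h T.hi.e2 (fun k k1 k2 => wt_le2 (T.n k k1 (Or.inr (Or.inl k2))))
  have c3 : 5 - 2 ≤ chg F s(a,c) := chg_ge h T.hi.e3 (fun k k1 k2 => wt_le2 (T.n k k1 (Or.inr (Or.inr k2))))
  have s3 : ∑ x ∈ cls G F e, chg F x = chg F s(a,b) + (chg F s(b,c) + chg F s(a,c)) := by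
    rw [T.q, Finset.sum_insert, Finset.sum_insert, Finset.sum_singleton]
    · simp only [mem_singleton, Sym2.eq_iff]; grind
    · simp only [mem_insert, mem_singleton, Sym2.eq_iff]; grind
  rw [s3]
  push_cast at s2
  linarith

lemma TK4.rot {q : Finset (Sym2 V)} {i j l : ι} {o a b c : V} (T : TK4 G F q i j l o a b c) : TK4 G F q j l i o b c a := by
  refine ⟨T.hj, T.hl, T.hi, ?_, ?_⟩
  · rw [T.q]; ext x; simp only [mem_insert, mem_singleton]; tauto
  · intro k k1 k2 k3 hk
    exact T.n k k3 k1 k2 (by tauto)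

lemma TK4.nn {q : Finset (Sym2 V)} {i j l : ι} {o a b c : V} (T : TK4 G F q i j l o a b c) {k : ι} (k1 : k ≠ i) (hk : F k s(a,b) = 1) :
    (k ≠ j ∧ k ≠ l) ∧ sz (F k) ≠ 3 := by
  have k2 : k ≠ j := by
    rintro rfl
    exact k1 (h.corner T.hi.rot.rot (fsw T.hj.e1) (fsw hk))
  have k3 : k ≠ l := by
    rintro rfl
    exact k1 (h.corner T.hi.rev (fsw T.hl.e3) hk)
  exact ⟨⟨k2, k3⟩, T.n k k1 k2 k3 (Or.inl hk)⟩

lemma TK4.ne {q : Finset (Sym2 V)} {i j l : ι} {o a b c : V} (T : TK4 G F q i j l o a b c) : i ≠ j := 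
  h.ne_of_apex T.hi.rot.rot T.hj.rev T.hl.1.2.2.symm

lemma TK4.out {q : Finset (Sym2 V)} {i j l : ι} {o a b c : V} (T : TK4 G F q i j l o a b c) {k : ι} (k1 : k ≠ i) (hk : F k s(a,b) = 1) :
    6 ≤ sz (F k) := by
  obtain ⟨⟨k2, k3⟩, h3⟩ := T.nn h k1 hk
  have hij := T.ne h
  have hjl := (T.rot h).ne h
  have hli := ((T.rot h).rot h).ne h
  have nbc := T.hj.1.2.2
  have nca := T.hl.1.2.2
  obtain ⟨noa, nob, nab⟩ := T.hi.1
  have noc := T.hj.1.2.1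
  have so := (h.sat3 hij hli.symm hjl nab nca.symm nbc T.hi.e1 T.hi.e3 T.hj.e1 T.hj.e3 T.hl.e1 T.hl.e3).2 k
  have no : ∀ w, F k s(o,w) ≠ 1 := by
    intro w hw
    rcases so w hw with e | e | e
    exacts [k1 e, k2 e, k3 e]
  have no' : ∀ w, F k s(w,o) ≠ 1 := fun w hw => no w (fsw hw)
  have h3' := h.tb.sz3 k
  have h4 : sz (F k) ≠ 4 := by
    intro h4
    obtain ⟨p, r, h4⟩ := h.ex4 hk h4
    have hpo : p ≠ o := by rintro rfl; exact no' _ h4.e2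
    have hro : r ≠ o := by rintro rfl; exact no _ h4.e4
    have hpc : p ≠ c := by
      rintro rfl
      obtain ⟨m, hm, hm'⟩ := h.tb.other T.hl.e2
      exact (((T.rot h).rot h).nn h hm hm').2 (h.sw k a b p r h4 (h.adj T.hl.e2).symm m (fsw hm'))
    have hrc : r ≠ c := by
      rintro rfl
      obtain ⟨m, hm, hm'⟩ := h.tb.other T.hj.e2
      exact ((T.rot h).nn h hm hm').2 (h.sw k b p r a h4.rot (h.adj T.hj.e2) m hm')
    exact th_long h.th (h.adj T.hi.e1).symm (h.adj T.hj.e3) (h.adj T.hj.e2).symm (h.adj h4.e2) (h.adj h4.e3) (h.adj h4.e4) (h.adj hk)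
      nca.symm h4.1.2.1 nob hpo.symm hro.symm hpc.symm hrc.symm h4.1.2.2.2.2.1
  have h5 : sz (F k) ≠ 5 := by
    intro h5
    obtain ⟨p, r, s, h5⟩ := h.ex5 hk h5
    have hpo : p ≠ o := by rintro rfl; exact no' _ h5.e2
    have hro : r ≠ o := by rintro rfl; exact no' _ h5.e3
    have hso : s ≠ o := by rintro rfl; exact no _ h5.e5
    obtain ⟨n1, n2, n3, n4, n5, n6, n7, n8, n9, n10⟩ := h5.1
    exact th_short h.th (h.adj T.hi.e1).symm (h.adj T.hi.e3) (h.adj h5.e2) (h.adj h5.e3) (h.adj h5.e4) (h.adj h5.e5) (h.adj hk)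
      n2 n3 hpo.symm hro.symm hso.symm n6 n7 n9
  omega

lemma K4_ok {e : Sym2 V} (he : e ∈ G.edgeSet) (hs : ¬ sing G F e) {i j l : ι} {o a b c : V} (T : TK4 G F (cls G F e) i j l o a b c) :
    ∑ v ∈ univ.filter (fun v => tch (cls G F e) v), DD G F v ≤ ∑ x ∈ cls G F e, chg F x := by
  have hij := T.ne h
  have hjl := (T.rot h).ne h
  have hli := ((T.rot h).rot h).ne h
  have nbc := T.hj.1.2.2
  have nca := T.hl.1.2.2
  obtain ⟨noa, nob, nab⟩ := T.hi.1
  have noc := T.hj.1.2.1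
  have c1 : 1 ≤ chg F s(o,a) := chg_ge1 h hli T.hl.e3 T.hi.e1
  have c2 : 1 ≤ chg F s(o,b) := chg_ge1 h hij T.hi.e3 T.hj.e1
  have c3 : 1 ≤ chg F s(o,c) := chg_ge1 h hjl T.hj.e3 T.hl.e1
  have c4 : 5 - 0 ≤ chg F s(a,b) := chg_ge h T.hi.e2 (fun k k1 k2 => (wt_zero (T.out h k1 k2)).le)
  have c5 : 5 - 0 ≤ chg F s(b,c) := chg_ge h T.hj.e2 (fun k k1 k2 => (wt_zero ((T.rot h).out h k1 k2)).le)
  have c6 : 5 - 0 ≤ chg F s(c,a) := chg_ge h T.hl.e2 (fun k k1 k2 => (wt_zero (((T.rot h).rot h).out h k1 k2)).le)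
  have s3 : ∑ x ∈ cls G F e, chg F x = chg F s(o,a) + (chg F s(o,b) + (chg F s(o,c) + (chg F s(a,b) + (chg F s(b,c) + chg F s(c,a))))) := by
    rw [T.q, Finset.sum_insert, Finset.sum_insert, Finset.sum_insert, Finset.sum_insert, Finset.sum_insert, Finset.sum_singleton]
    all_goals simp only [mem_insert, mem_singleton, Sym2.eq_iff]; grind
  have hq : ∀ u v, s(u,v) ∈ cls G F e → u ∈ ({o,a,b,c} : Finset V) ∧ v ∈ ({o,a,b,c} : Finset V) := by
    intro u v huv
    rw [T.q] at huv
    simp only [mem_insert, mem_singleton, Sym2.eq_iff] at huv ⊢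
    grind
  have s1 := sum_tch h (q := cls G F e) (X := {o,a,b,c}) (by
    intro x hx v hv
    induction x using Sym2.ind with
    | _ u w =>
    rw [Sym2.mem_iff] at hv
    rcases hv with rfl | rfl
    exacts [(hq _ _ hx).1, (hq _ _ hx).2])
  have hc : ({o,a,b,c} : Finset V).card = 4 := by
    rw [Finset.card_insert_of_notMem, Finset.card_insert_of_notMem, Finset.card_insert_of_notMem, Finset.card_singleton]
    all_goals simp only [mem_insert, mem_singleton]; grind
  have hd : ∀ v ∈ ({o,a,b,c} : Finset V), (∃ w, w ∉ ({o,a,b,c} : Finset V) ∧ G.Adj v w) → DD G F v ≤ 3 := by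
    rintro v hv ⟨w, hw, hvw⟩
    have : ∃ x, s(v,x) ∈ cls G F e := by
      simp only [mem_insert, mem_singleton] at hv
      rw [T.q]
      simp only [mem_insert, mem_singleton]
      rcases hv with rfl | rfl | rfl | rfl
      · exact ⟨a, by simp⟩
      · exact ⟨b, by simp⟩
      · exact ⟨c, by simp⟩
      · exact ⟨a, by simp⟩
    obtain ⟨x, hx⟩ := this
    exact cont3 h he hs hx hvw (fun hm => hw (hq _ _ hm).2)
  obtain ⟨v, hv, v', hv', hne, hw, hw'⟩ := two_con h (X := {o,a,b,c}) (by omega) (by omega)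
  have s2 := sum_con h (X := {o,a,b,c}) (C := {v,v'}) (by
    intro x hx
    rw [mem_insert, mem_singleton] at hx
    rcases hx with rfl | rfl <;> assumption) (by
    intro x hx
    rw [mem_insert, mem_singleton] at hx
    rcases hx with rfl | rfl
    exacts [hd _ hv hw, hd _ hv' hw'])
  rw [hc, Finset.card_pair hne] at s2
  rw [s3]
  push_cast at s2
  linarith

end ch
end T6

end

section
open SimpleGraph Finset
open scoped Classical
set_option linter.unusedSectionVars false
set_option linter.unusedVariables false
set_option linter.unusedSimpArgs false
set_option linter.unnecessarySeqFocus false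

namespace T6
variable {V : Type*} [Fintype V] {G : SimpleGraph V} {ι : Type} [Fintype ι] {F : ι → Ch V}

section km
variable (h : Cfg G F)
include h

lemma sing_of {e : Sym2 V} (h1 : ∀ k, F k e = 1 → sz (F k) ≠ 3)
    (h2 : ∀ o a b c d, Fan F o a b c d → e ∉ ES G (fs o a b c d)) : sing G F e := by
  apply Finset.Subset.antisymm
  · apply cls_sub _ (mem_singleton_self e)
    intro x hx y hR
    rw [mem_singleton] at hx; subst hx
    rcases hR with ⟨i, h3, hi, _⟩ | ⟨o, a, b, c, d, f, hx, _⟩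
    · exact absurd h3 (h1 i hi)
    · exact absurd hx (h2 _ _ _ _ _ f)
  · intro x hx; rw [mem_singleton] at hx; subst hx; exact self_cls x

variable {q : Finset (Sym2 V)} {i j : ι} {a b c d : V} 

lemma TKm.ab (T : TKm G F q i j a b c d) : TKm G F q i j b a c d := by
  refine ⟨T.hi.rev, T.hj.rev, T.ncd, ?_, ?_⟩
  · rw [T.q, Sym2.eq_swap (a := a) (b := b)]; ext x; simp only [mem_insert, mem_singleton]; tauto
  · intro k k1 k2 hk
    exact T.n k k1 k2 (by tauto)

lemma TKm.cd (T : TKm G F q i j a b c d) : TKm G F q j i a b d c := by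
  refine ⟨T.hj, T.hi, T.ncd.symm, ?_, ?_⟩
  · rw [T.q]; ext x; simp only [mem_insert, mem_singleton]; tauto
  · intro k k1 k2 hk
    exact T.n k k2 k1 (by tauto)

lemma TKm.ne (T : TKm G F q i j a b c d) : i ≠ j := h.ne_of_apex T.hi T.hj T.ncd

lemma TKm.nn (T : TKm G F q i j a b c d) {k : ι} (k1 : k ≠ i) (hk : F k s(a,c) = 1) : k ≠ j ∧ sz (F k) ≠ 3 := by
  have k2 : k ≠ j := by
    rintro rfl
    exact k1 (h.corner T.hi T.hj.e1 hk)
  exact ⟨k2, T.n k k1 k2 (Or.inl hk)⟩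

lemma TKm.four (T : TKm G F q i j a b c d) {k : ι} (k1 : k ≠ i) (hk : F k s(a,c) = 1) (h4 : sz (F k) = 4) :
    ∃ x, x ≠ b ∧ Is4 (F k) c a d x := by
  obtain ⟨k2, -⟩ := T.nn h k1 hk
  have hij := T.ne h
  obtain ⟨nab, nac, nbc⟩ := T.hi.1
  obtain ⟨-, nad, nbd⟩ := T.hj.1
  obtain ⟨p, r, h4⟩ := h.ex4 hk h4
  have hpb : p ≠ b := by
    rintro rfl
    exact k1 (h.corner T.hi.rot.rot (fsw hk) h4.e2)
  have hrb : r ≠ b := by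
    rintro rfl
    rcases h.tb.third hij T.hi.e1 T.hj.e1 (fsw h4.e4) with e | e
    exacts [k1 e, k2 e]
  have hpd : p ≠ d := by
    rintro rfl
    obtain ⟨m, hm, hm'⟩ := h.tb.other T.hj.e3
    exact ((T.cd h).nn h hm hm').2 (h.sw k a c p r h4 (h.adj T.hj.e3) m hm')
  by_cases hrd : r = d
  · subst hrd
    exact ⟨p, hpb, h4.rev⟩
  · exfalso
    exact th_short h.th (h.adj T.hj.e3) (h.adj T.hj.e2).symm (h.adj T.hi.e2) (h.adj h4.e2) (h.adj h4.e3) (h.adj h4.e4) (h.adj T.hi.e1)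
      nac h4.1.2.1 T.ncd.symm hpd.symm (fun e => hrd e.symm) hpb.symm hrb.symm h4.1.2.2.2.2.1

/-- a has another neighbor -/
lemma TKm.pa (T : TKm G F q i j a b c d) {w : V} (hw : G.Adj a w) (hb : w ≠ b) (hc : w ≠ c) (hd : w ≠ d) {k : ι} (k1 : k ≠ i)
    (hk : F k s(a,c) = 1) : wt F k ≤ 4/5 := by
  obtain ⟨k2, h3⟩ := T.nn h k1 hk
  apply wt_le1 h3
  intro h4
  obtain ⟨x, hxb, h4⟩ := T.four h k1 hk h4
  have := (h.sat3 (T.ne h) k1.symm k2.symm T.hi.1.2.2.symm T.ncd T.hj.1.2.2 T.hi.e3 T.hi.e1 T.hj.e1 T.hj.e3 h4.e2 (fsw h4.e1)).1 w hw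
  rcases this with e | e | e
  exacts [hc e, hb e, hd e]

/-- a has no further neighbor -/
lemma TKm.npa (T : TKm G F q i j a b c d) (hw : ∀ w, G.Adj a w → w = b ∨ w = c ∨ w = d) :
    (∀ k, k ≠ i → k ≠ j → (F k s(a,c) = 1 ∨ F k s(a,d) = 1) → wt F k = 0) ∨
    (∃ k x, k ≠ i ∧ k ≠ j ∧ x ≠ b ∧ Is4 (F k) c a d x) := by
  have hij := T.ne h
  obtain ⟨nab, nac, nbc⟩ := T.hi.1
  obtain ⟨-, nad, nbd⟩ := T.hj.1
  obtain ⟨k, k1, hk⟩ := h.tb.other T.hi.e3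
  obtain ⟨k2, h3⟩ := T.nn h k1 hk
  have hkd : F k s(a,d) = 1 := by
    obtain ⟨w, hwc, hkw⟩ := h.tb.face_ex2 hk
    rcases hw w (h.adj hkw) with e | e | e
    · subst e
      rcases h.tb.third hij T.hi.e1 T.hj.e1 hkw with e | e
      exacts [absurd e k1, absurd e k2]
    · exact absurd e hwc
    · rw [← e]; exact hkw
  by_cases h4 : sz (F k) = 4
  · right
    obtain ⟨x, hx⟩ := T.four h k1 hk h4
    exact ⟨k, x, k1, k2, hx⟩
  · left
    have h5 : sz (F k) ≠ 5 := by
      intro h5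
      obtain ⟨p, y, z, h5⟩ := h.ex5 (fsw hk) h5
      have hp : p = d := by
        rcases h.f2 T.ncd hk hkd h5.e2 with e | e
        · exact absurd e h5.1.2.1.symm
        · exact e
      subst hp
      have hyb : y ≠ b := by
        rintro rfl
        exact k2 (h.corner T.hj.rot.rot (fsw hkd) h5.e3)
      have hzb : z ≠ b := by
        rintro rfl
        exact k1 (h.corner T.hi.rot.rot (fsw hk) (fsw h5.e5))
      obtain ⟨n1, n2, n3, n4, n5, n6, n7, n8, n9, n10⟩ := h5.1
      exact th_short h.th (h.adj T.hi.e2).symm (h.adj T.hi.e1).symm (h.adj T.hj.e3) (h.adj h5.e3) (h.adj h5.e4) (h.adj h5.e5) (h.adj T.hi.e3).symm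
        n2 n3 nbd hyb.symm hzb.symm n6 n7 n9
    have hk0 : wt F k = 0 := by
      have := h.tb.sz3 k
      apply wt_zero; omega
    intro m m1 m2 hm
    have : m = k := by
      rcases hm with hm | hm
      · exact (h.tb.third k1 hk T.hi.e3 hm).resolve_right m1
      · exact (h.tb.third k2 hkd T.hj.e3 hm).resolve_right m2
    rw [this, hk0]

lemma TKm.sing {e : Sym2 V} (nf : NF G F e) (T : TKm G F (cls G F e) i j a b c d) {k : ι} {x : V} (k1 : k ≠ i) (hxb : x ≠ b)
    (h4 : Is4 (F k) c a d x) : sing G F s(c,x) := by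
  have hij := T.ne h
  obtain ⟨nab, nac, nbc⟩ := T.hi.1
  obtain ⟨-, nad, nbd⟩ := T.hj.1
  obtain ⟨k2, h3⟩ := T.nn h k1 (fsw h4.e1)
  obtain ⟨-, n2, n3, n4, n5, n6⟩ := h4.1
  apply sing_of h
  · intro m hm m3
    obtain ⟨y, hy⟩ := h.ex3 hm m3
    have hmk : m ≠ k := by
      rintro rfl
      rw [h4.sz] at m3; omega
    have hyd : y ≠ d := by
      rintro rfl
      exact hmk (h.s2 n2 (fsw hm) hy.e2 h4.e4 (fsw h4.e3))
    have hya : y ≠ a := by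
      rintro rfl
      exact hmk (h.s2 n5 hy.e3 hy.e1 h4.e1 (fsw h4.e4))
    have hyb : y ≠ b := by
      rintro rfl
      have mi : m ≠ i := by
        rintro rfl
        rcases h.f2 nab (fsw T.hi.e3) (fsw T.hi.e2) hm with e | e
        · exact n5 e.symm
        · exact hxb e
      exact ((T.ab h).nn h mi (fsw hy.e3)).2 m3
    exact th_short h.th (h.adj T.hj.e2).symm (h.adj T.hi.e1).symm (h.adj T.hi.e3) (h.adj hy.e3) (h.adj hy.e2).symm (h.adj h4.e3).symm (h.adj T.hj.e3).symm
      T.ncd.symm hyd.symm nbc hyb.symm hxb.symm hya.symm n5 n3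
  · intro o' a' b' c' d' f hm
    obtain ⟨hcx, hc, hx⟩ := mem_ES.1 hm
    have ha : a ∉ fs o' a' b' c' d' := by
      intro ha
      exact nf s(a,c) (by rw [T.q]; simp) _ _ _ _ _ f (mem_ES.2 ⟨h.adj T.hi.e3, ha, hc⟩)
    have hb : b ∉ fs o' a' b' c' d' := by
      intro hb
      exact nf s(b,c) (by rw [T.q]; simp) _ _ _ _ _ f (mem_ES.2 ⟨h.adj T.hi.e2, hb, hc⟩)
    by_cases hd : d ∈ fs o' a' b' c' d'
    · exact f.ear3 h hc hd T.ncd ha hb (h.adj T.hi.e3).symm (h.adj T.hi.e1) (h.adj T.hj.e2)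
    · exact f.ear3 h hx hc n3.symm hd hb (h.adj h4.e3).symm (h.adj T.hj.e2).symm (h.adj T.hi.e2)

lemma TKm.D25 {e : Sym2 V} (he : e ∈ G.edgeSet) (hs : ¬ T6.sing G F e) (nf : NF G F e) (T : TKm G F (cls G F e) i j a b c d) {k : ι} {x : V} (k1 : k ≠ i) (hxb : x ≠ b)
    (h4 : Is4 (F k) c a d x) (hB : ∀ k, k ≠ i → k ≠ j → (F k s(b,c) = 1 ∨ F k s(b,d) = 1) → wt F k = 0) : DD G F c ≤ 5/2 := by
  have hij := T.ne h
  obtain ⟨nab, nac, nbc⟩ := T.hi.1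
  obtain ⟨-, nad, nbd⟩ := T.hj.1
  obtain ⟨-, n2, n3, n4, n5, n6⟩ := h4.1
  have hca : s(c,a) ∈ cls G F e := by rw [T.q]; simp [Sym2.eq_swap]
  apply DD25 h (fun e he hs => h.sing_ge he hs) (h.adj h4.e1) (not_sing_of h hs hca) (h.adj h4.e4).symm (T.sing h nf k1 hxb h4)
  intro hall
  rw [cls_eq hca] at hall
  obtain ⟨m, hmk, hm⟩ := h.tb.other (fsw h4.e4)
  have mi : m ≠ i := by
    rintro rfl
    rcases h.f2 nab (fsw T.hi.e3) (fsw T.hi.e2) hm with e | e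
    · exact n5 e.symm
    · exact hxb e
  obtain ⟨w, hwx, hw⟩ := h.tb.face_ex2 hm
  have hwab : w = a ∨ w = b := by
    have := (hall w (h.adj hw)).resolve_left hwx
    rw [T.q] at this
    simp only [mem_insert, mem_singleton, Sym2.eq_iff] at this
    have := T.ncd
    grind
  have hm0 : wt F m = 0 := by
    rcases hwab with rfl | rfl
    · rcases h.tb.third k1 h4.e1 (fsw T.hi.e3) hw with e | e
      exacts [absurd e hmk, absurd e mi]
    · exact hB m mi ((T.ab h).nn h mi (fsw hw)).1 (Or.inl (fsw hw))
  rw [chg_eq h hmk.symm (fsw h4.e4) hm, hm0]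
  have := wt_le2 (T.nn h k1 (fsw h4.e1)).2
  linarith

lemma Km_ok {e : Sym2 V} (he : e ∈ G.edgeSet) (hs : ¬ T6.sing G F e) (nf : NF G F e) (T : TKm G F (cls G F e) i j a b c d) :
    ∑ v ∈ univ.filter (fun v => tch (cls G F e) v), DD G F v ≤ ∑ x ∈ cls G F e, chg F x := by
  have hA : ∀ e ∈ G.edgeSet, T6.sing G F e → 31/5 ≤ chg F e := fun e he hs => h.sing_ge he hs
  have hij := T.ne h
  have ncd := T.ncd
  obtain ⟨nab, nac, nbc⟩ := T.hi.1
  obtain ⟨-, nad, nbd⟩ := T.hj.1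
  have hq : ∀ u v, s(u,v) ∈ cls G F e → u ∈ ({a,b,c,d} : Finset V) ∧ v ∈ ({a,b,c,d} : Finset V) := by
    intro u v huv
    rw [T.q] at huv
    simp only [mem_insert, mem_singleton, Sym2.eq_iff] at huv ⊢
    grind
  have s1 := sum_tch h (q := cls G F e) (X := {a,b,c,d}) (by
    intro x hx v hv
    induction x using Sym2.ind with
    | _ u w =>
    rw [Sym2.mem_iff] at hv
    rcases hv with rfl | rfl
    exacts [(hq _ _ hx).1, (hq _ _ hx).2])
  have s2 : ∑ v ∈ {a,b,c,d}, DD G F v = DD G F a + (DD G F b + (DD G F c + DD G F d)) := by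
    rw [Finset.sum_insert, Finset.sum_insert, Finset.sum_insert, Finset.sum_singleton]
    all_goals simp only [mem_insert, mem_singleton]; grind
  have s3 : ∑ x ∈ cls G F e, chg F x = chg F s(a,b) + (chg F s(a,c) + (chg F s(b,c) + (chg F s(a,d) + chg F s(b,d)))) := by
    rw [T.q, Finset.sum_insert, Finset.sum_insert, Finset.sum_insert, Finset.sum_insert, Finset.sum_singleton]
    all_goals simp only [mem_insert, mem_singleton, Sym2.eq_iff]; grind
  have cab : 1 ≤ chg F s(a,b) := chg_ge1 h hij T.hi.e1 T.hj.e1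
  have Dc : DD G F c ≤ 3 := by
    obtain ⟨w, hvw, hwa, hwb⟩ := h.deg c a b
    refine cont3 h he hs (x := a) (by rw [T.q]; simp [Sym2.eq_swap]) hvw ?_
    rw [T.q]; simp only [mem_insert, mem_singleton, Sym2.eq_iff]; grind
  have Dd : DD G F d ≤ 3 := by
    obtain ⟨w, hvw, hwa, hwb⟩ := h.deg d a b
    refine cont3 h he hs (x := a) (by rw [T.q]; simp [Sym2.eq_swap]) hvw ?_
    rw [T.q]; simp only [mem_insert, mem_singleton, Sym2.eq_iff]; grind
  have Da6 := DD6 h hA a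
  have Db6 := DD6 h hA b
  -- analysis at a
  have key : ∀ {a b : V}, TKm G F (cls G F e) i j a b c d →
      (DD G F a ≤ 3 ∧ 21/5 ≤ chg F s(a,c) ∧ 21/5 ≤ chg F s(a,d)) ∨
      ((∀ k, k ≠ i → k ≠ j → (F k s(a,c) = 1 ∨ F k s(a,d) = 1) → wt F k = 0) ∧ 5 ≤ chg F s(a,c) ∧ 5 ≤ chg F s(a,d)) ∨
      ((∃ k x, k ≠ i ∧ k ≠ j ∧ x ≠ b ∧ Is4 (F k) c a d x) ∧ 3 ≤ chg F s(a,c) ∧ 3 ≤ chg F s(a,d)) := by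
    intro a b T
    by_cases hP : ∃ w, G.Adj a w ∧ w ≠ b ∧ w ≠ c ∧ w ≠ d
    · left
      obtain ⟨w, haw, wb, wc, wd⟩ := hP
      refine ⟨?_, ?_, ?_⟩
      · refine cont3 h he hs (x := b) (by rw [T.q]; simp) haw ?_
        have := haw.ne
        rw [T.q]; simp only [mem_insert, mem_singleton, Sym2.eq_iff]; grind
      · have := chg_ge h T.hi.e3 (fun k k1 k2 => T.pa h haw wb wc wd k1 k2)
        linarith
      · have := chg_ge h T.hj.e3 (fun k k1 k2 => (T.cd h).pa h haw wb wd wc k1 k2)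
        linarith
    · right
      push Not at hP
      have hP' : ∀ w, G.Adj a w → w = b ∨ w = c ∨ w = d := by
        intro w hw
        by_contra hne; push Not at hne
        exact hne.2.2 (hP w hw hne.1 hne.2.1)
      rcases T.npa h hP' with h0 | h1
      · left
        refine ⟨h0, ?_, ?_⟩
        · have := chg_ge h T.hi.e3 (fun k k1 k2 => (h0 k k1 (T.nn h k1 k2).1 (Or.inl k2)).le)
          linarith
        · have := chg_ge h T.hj.e3 (fun k k1 k2 => (h0 k ((T.cd h).nn h k1 k2).1 k1 (Or.inr k2)).le)
          linarith
      · right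
        refine ⟨h1, ?_, ?_⟩
        · have := chg_ge h T.hi.e3 (fun k k1 k2 => wt_le2 (T.nn h k1 k2).2)
          linarith
        · have := chg_ge h T.hj.e3 (fun k k1 k2 => wt_le2 ((T.cd h).nn h k1 k2).2)
          linarith
  have key2 : ∀ {a b : V}, TKm G F (cls G F e) i j a b c d → (∃ k x, k ≠ i ∧ k ≠ j ∧ x ≠ b ∧ Is4 (F k) c a d x) →
      (∀ k, k ≠ i → k ≠ j → (F k s(b,c) = 1 ∨ F k s(b,d) = 1) → wt F k = 0) → DD G F c ≤ 5/2 ∧ DD G F d ≤ 5/2 := by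
    rintro a b T ⟨k, x, k1, k2, hxb, h4⟩ hB
    exact ⟨T.D25 h he hs nf k1 hxb h4 hB,
      (T.cd h).D25 h he hs nf k2 hxb h4.rot.rot.rev.rot (fun k k1 k2 hk => hB k k2 k1 hk.symm)⟩
  rw [s3]
  rw [s2] at s1
  rcases key T with ⟨a1, a2, a3⟩ | ⟨a1, a2, a3⟩ | ⟨a1, a2, a3⟩ <;> rcases key (T.ab h) with ⟨b1, b2, b3⟩ | ⟨b1, b2, b3⟩ | ⟨b1, b2, b3⟩
  · linarith
  · linarith
  · linarith
  · linarith
  · linarith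
  · have := key2 (T.ab h) b1 a1
    linarith [this.1, this.2]
  · linarith
  · have := key2 T a1 b1
    linarith [this.1, this.2]
  · obtain ⟨k, x, k1, k2, hxb, h4⟩ := a1
    obtain ⟨k', x', k1', k2', hxa', h4'⟩ := b1
    have hxx : x ≠ x' := by
      rintro rfl
      have : k = k' := h.s2 ncd h4.e4 (fsw h4.e3) h4'.e4 (fsw h4'.e3)
      subst this
      exact k1 (h.corner T.hi.rot.rot h4.e1 h4'.e1)
    have r4 : Is4 (F k) d a c x := h4.rot.rot.rev.rot
    have r4' : Is4 (F k') d b c x' := h4'.rot.rot.rev.rot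
    have z1 := DDz h hA hxx (h.adj h4.e4).symm (T.sing h nf k1 hxb h4) (h.adj h4'.e4).symm ((T.ab h).sing h nf k1' hxa' h4')
    have z2 := DDz h hA hxx (h.adj r4.e4).symm ((T.cd h).sing h nf k2 hxb r4) (h.adj r4'.e4).symm (((T.cd h).ab h).sing h nf k2' hxa' r4')
    linarith

end km
end T6

end

section
open SimpleGraph Finset
open scoped Classical
set_option linter.unusedSectionVars false
set_option linter.unusedVariables false
set_option linter.unusedSimpArgs false
set_option linter.unnecessarySeqFocus false

namespace T6
variable {V : Type*} [Fintype V] {G : SimpleGraph V} {ι : Type} [Fintype ι] {F : ι → Ch V}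

noncomputable def cnt (F : ι → Ch V) (q : Finset (Sym2 V)) (i : ι) : ℕ := (q.filter (fun e => F i e = 1)).card
noncomputable def In (F : ι → Ch V) (q : Finset (Sym2 V)) : Finset ι := univ.filter (fun i => ∀ e, F i e = 1 → e ∈ q)

lemma mem_In {q : Finset (Sym2 V)} {i : ι} : i ∈ In F q ↔ ∀ e, F i e = 1 → e ∈ q := by simp [In]

lemma sum_chg (q : Finset (Sym2 V)) : ∑ e ∈ q, chg F e = 9 * q.card - ∑ i, wt F i * cnt F q i := by
  unfold chg
  rw [Finset.sum_sub_distrib, Finset.sum_comm]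
  congr 1
  · simp; ring
  · apply Finset.sum_congr rfl
    intro i _
    rw [← Finset.sum_filter, Finset.sum_const, nsmul_eq_mul, mul_comm]; rfl

lemma cnt_In {q : Finset (Sym2 V)} {i : ι} (hi : i ∈ In F q) : cnt F q i = sz (F i) := by
  unfold cnt sz
  congr 1
  ext e
  simp only [mem_filter, mem_univ, true_and, and_iff_right_iff_imp]
  exact mem_In.1 hi e

lemma wt_sz (h3 : ∀ i, 3 ≤ sz (F i)) (i : ι) : wt F i * sz (F i) ≤ 12 - if sz (F i) = 3 then 0 else 4 := by
  unfold wt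
  by_cases s3 : sz (F i) = 3
  · rw [if_pos s3, if_pos s3, s3]; norm_num
  by_cases s4 : sz (F i) = 4
  · rw [if_neg s3, if_pos s4, if_neg s3, s4]; norm_num
  by_cases s5 : sz (F i) = 5
  · rw [if_neg s3, if_neg s4, if_pos s5, if_neg s3, s5]; norm_num
  · rw [if_neg s3, if_neg s4, if_neg s5, if_neg s3]; norm_num

lemma sum_le_one {s : Finset ι} {g : ι → ℚ} {k : ι} {t : ℚ} (hk : g k ≤ t) (ht : 0 ≤ t) (hu : ∀ j ∈ s, g j ≠ 0 → j = k) : ∑ i ∈ s, g i ≤ t := by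
  by_cases hks : k ∈ s
  · rw [Finset.sum_eq_single_of_mem k hks]
    · exact hk
    · intro j hj hjk
      by_contra hne
      exact hjk (hu j hj hne)
  · rw [Finset.sum_eq_zero]
    · exact ht
    · intro j hj
      by_contra hne
      exact hks (hu j hj hne ▸ hj)

section fan
variable (h : Cfg G F) {o a b c d : V} (f : Fan F o a b c d)
include h f

lemma Fan.outface : ∃ i, i ∉ In F (ES G (fs o a b c d)) := by
  obtain ⟨v, hv, v', hv', hne, ⟨w, hw, hvw⟩, -⟩ := two_con h (X := fs o a b c d) (by rw [f.card h]) (by rw [f.card h]; norm_num)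
  obtain ⟨i, j, hij, hi, hj, -⟩ := h.tb.two s(v,w) hvw
  refine ⟨i, fun hin => ?_⟩
  have := mem_In.1 hin _ hi
  rw [mem_ES] at this
  exact hw this.2.2

lemma Fan.In_le : (In F (ES G (fs o a b c d))).card + 4 ≤ (ES G (fs o a b c d)).card := by
  set q := ES G (fs o a b c d) with hq
  set N := q.filter (fun e => o ∉ e) with hN
  have h4 : 4 ≤ (q.filter (fun e => ¬ o ∉ e)).card := by
    have hsub : ({s(o,a), s(o,b), s(o,c), s(o,d)} : Finset (Sym2 V)) ⊆ q.filter (fun e => ¬ o ∉ e) := by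
      intro e he
      simp only [mem_insert, mem_singleton] at he
      have g := f.g h
      rw [mem_filter, hq]
      rcases he with rfl | rfl | rfl | rfl
      · exact ⟨mem_ES.2 ⟨g.oa, by simp [fs], by simp [fs]⟩, by simp⟩
      · exact ⟨mem_ES.2 ⟨g.ob, by simp [fs], by simp [fs]⟩, by simp⟩
      · exact ⟨mem_ES.2 ⟨g.oc, by simp [fs], by simp [fs]⟩, by simp⟩
      · exact ⟨mem_ES.2 ⟨g.od, by simp [fs], by simp [fs]⟩, by simp⟩
    have hc : ({s(o,a), s(o,b), s(o,c), s(o,d)} : Finset (Sym2 V)).card = 4 := by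
      have g := f.g h
      have n1 := g.ab.ne
      have n2 := g.bc.ne
      have n3 := g.cd.ne
      have n4 := f.nac
      have n5 := f.nad
      have n6 := f.nbd
      rw [Finset.card_insert_of_notMem, Finset.card_insert_of_notMem, Finset.card_insert_of_notMem, Finset.card_singleton]
      all_goals simp only [mem_insert, mem_singleton, Sym2.congr_right]; grind
    rw [← hc]
    exact Finset.card_le_card hsub
  have hsum : N.card + (q.filter (fun e => ¬ o ∉ e)).card = q.card := by
    rw [hN]; convert Finset.card_filter_add_card_filter_not (s := q) (fun e => o ∉ e)
  have hle : (In F q).card ≤ N.card := by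
    let L : ((In F q) → ZMod 2) →ₗ[ZMod 2] (N → ZMod 2) :=
      { toFun := fun x e => ∑ i : In F q, x i * F i e.1
        map_add' := by intro x y; ext e; simp [add_mul, Finset.sum_add_distrib]
        map_smul' := by intro t x; ext e; simp [Finset.mul_sum, mul_assoc] }
    have hL : Function.Injective L := by
      rw [← LinearMap.ker_eq_bot, LinearMap.ker_eq_bot']
      intro x hx
      let x' : ι → ZMod 2 := fun i => if hi : i ∈ In F q then x ⟨i, hi⟩ else 0
      have hval : ∀ e, (∑ i, x' i • F i) e = ∑ i : In F q, x i * F i e := by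
        intro e
        rw [Finset.sum_apply]
        rw [← Finset.sum_subset (Finset.subset_univ (In F q))]
        · rw [← Finset.sum_coe_sort]
          apply Finset.sum_congr rfl
          intro i _
          simp only [Pi.smul_apply, smul_eq_mul]
          rw [show x' i.1 = x i by simp [x']]
        · intro i _ hi
          simp [x', hi]
      have hz0 : ∀ e, o ∉ e → (∑ i, x' i • F i) e = 0 := by
        intro e he
        rw [hval]
        by_cases heq : e ∈ q
        · have := congrFun hx ⟨e, by rw [hN, mem_filter]; exact ⟨heq, he⟩⟩
          exact this
        · apply Finset.sum_eq_zero
          intro i _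
          have : F i e = 0 := by
            rcases z2 (F i e) with h0 | h1
            · exact h0
            · exact absurd (mem_In.1 i.2 e h1) heq
          rw [this, mul_zero]
      have hb : bd (∑ i, x' i • F i) = 0 := by
        rw [map_sum]
        apply Finset.sum_eq_zero
        intro i _
        rw [map_smul, (h.tb.cyc i).2, smul_zero]
      have hz : ∑ i, x' i • F i = 0 := by
        ext e
        induction e using Sym2.ind with
        | _ u v =>
        have hv : ∀ v, (∑ i, x' i • F i) s(o,v) = 0 := by
          intro v
          by_cases hvo : v = o
          · subst hvo
            rw [Finset.sum_apply]
            apply Finset.sum_eq_zero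
            intro i _
            rw [Pi.smul_apply, h.loop, smul_zero]
          · have := congrFun hb v
            rw [bd_apply, Finset.sum_eq_single o] at this
            · rw [Sym2.eq_swap]; exact this
            · intro w _ hw
              apply hz0
              simp only [Sym2.mem_iff, not_or]
              exact ⟨fun e => hvo e.symm, fun e => hw e.symm⟩
            · simp
        by_cases hu : u = o
        · subst hu; exact hv v
        · by_cases hv' : v = o
          · subst hv'; rw [Sym2.eq_swap]; exact hv u
          · apply hz0
            simp only [Sym2.mem_iff, not_or]
            exact ⟨fun e => hu e.symm, fun e => hv' e.symm⟩
      obtain ⟨i0, hi0⟩ := f.outface h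
      have h0 : x' i0 = 0 := by simp only [x']; rw [dif_neg hi0]
      ext i
      have := h.tb.F3 h.tc x' hz i.1 i0
      rw [h0] at this
      rw [show x' i.1 = x i by simp [x']] at this
      exact this
    have := LinearMap.finrank_le_finrank_of_injective hL
    simpa using this
  omega

lemma Fan.ES_card : (ES G (fs o a b c d)).card ≤ 7 + (if G.Adj a c then 1 else 0) + (if G.Adj b d then 1 else 0) + (if G.Adj a d then 1 else 0) := by
  have hsub : ES G (fs o a b c d) ⊆ ((({s(o,a), s(o,b), s(o,c), s(o,d), s(a,b), s(b,c), s(c,d)} : Finset (Sym2 V)) ∪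
      (if G.Adj a c then {s(a,c)} else ∅)) ∪ (if G.Adj b d then {s(b,d)} else ∅)) ∪ (if G.Adj a d then {s(a,d)} else ∅) := by
    intro e he
    induction e using Sym2.ind with
    | _ u v =>
    obtain ⟨huv, hu, hv⟩ := mem_ES.1 he
    rw [mem_fs] at hu hv
    have hn := huv.ne
    rcases hu with rfl | rfl | rfl | rfl | rfl <;> rcases hv with rfl | rfl | rfl | rfl | rfl <;>
      first
      | exact absurd rfl hn
      | (simp only [mem_union, mem_insert, mem_singleton, true_or, or_true]; done)
      | (simp only [if_pos huv, mem_union, mem_insert, mem_singleton, true_or, or_true]; done)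
      | (rw [Sym2.eq_swap (a := u) (b := v)]; simp only [mem_union, mem_insert, mem_singleton, true_or, or_true]; done)
      | (rw [Sym2.eq_swap (a := u) (b := v)]; simp only [if_pos huv.symm, mem_union, mem_insert, mem_singleton, true_or, or_true]; done)
  refine (Finset.card_le_card hsub).trans ?_
  refine (Finset.card_union_le _ _).trans ?_
  refine Nat.add_le_add ((Finset.card_union_le _ _).trans (Nat.add_le_add ((Finset.card_union_le _ _).trans (Nat.add_le_add ?_ ?_)) ?_)) ?_
  · exact (Finset.card_insert_le _ _).trans (Nat.succ_le_succ Finset.card_le_six)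
  all_goals split_ifs <;> simp

lemma Fan.K5 : ¬ (G.Adj a c ∧ G.Adj b d ∧ G.Adj a d) := by
  rintro ⟨h1, h2, h3⟩
  apply h.k5
  have g := f.g h
  have n1 := g.oa
  have n2 := g.ob
  have n3 := g.oc
  have n4 := g.od
  have n5 := g.ab
  have n6 := g.bc
  have n7 := g.cd
  have key : ∀ w w' : Fin 5, w ≠ w' → G.Adj (![o,a,b,c,d] w) (![o,a,b,c,d] w') := by
    intro w w' hw
    fin_cases w <;> fin_cases w' <;> first | exact absurd rfl hw | assumption | (apply SimpleGraph.Adj.symm; assumption)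
  refine ⟨fun w => {![o,a,b,c,d] w}, fun w => Set.singleton_nonempty _, fun w => CC.singleton G _, ?_, ?_⟩
  · intro w w' hw x hx hx'
    rw [Set.mem_singleton_iff] at hx hx'
    exact (key w w' hw).ne (hx.symm.trans hx')
  · intro w w' hw
    exact ⟨_, rfl, _, rfl, key w w' hw.ne⟩

end fan
end T6

end

section
open SimpleGraph Finset
open scoped Classical
set_option linter.unusedSectionVars false
set_option linter.unusedVariables false
set_option linter.unusedSimpArgs false
set_option linter.unnecessarySeqFocus false

namespace T6
variable {V : Type*} [Fintype V] {G : SimpleGraph V} {ι : Type} [Fintype ι] {F : ι → Ch V}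

section fan
variable (h : Cfg G F) {o a b c d : V} (f : Fan F o a b c d)
include h f

lemma Fan.low {q : Finset (Sym2 V)} (hq : q = ES G (fs o a b c d)) {t : ℚ}
    (ht : ∑ i ∈ univ \ In F q, wt F i * cnt F q i ≤ t) :
    9 * (q.card : ℚ) - 12 * ((In F q).card : ℚ) + 4 * (((In F q).filter (fun i => sz (F i) ≠ 3)).card : ℚ) - t ≤ ∑ e ∈ q, chg F e := by
  rw [sum_chg, ← Finset.sum_sdiff (Finset.subset_univ (In F q))]
  have h1 : ∑ i ∈ In F q, wt F i * cnt F q i ≤ ∑ i ∈ In F q, ((12 : ℚ) - if sz (F i) ≠ 3 then 4 else 0) := by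
    apply Finset.sum_le_sum
    intro i hi
    rw [cnt_In hi]
    have := wt_sz (F := F) (fun i => h.tb.sz3 i) i
    by_cases s3 : sz (F i) = 3
    · rw [if_pos s3] at this; rw [if_neg (by simp [s3])]; exact this
    · rw [if_neg s3] at this; rw [if_pos s3]; exact this
  rw [Finset.sum_sub_distrib, ← Finset.sum_filter, Finset.sum_const, Finset.sum_const, nsmul_eq_mul, nsmul_eq_mul] at h1
  linarith

lemma Fan.nz {k : ι} (hk : k ∈ univ \ In F (ES G (fs o a b c d))) (hn : wt F k * cnt F (ES G (fs o a b c d)) k ≠ 0) :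
    (¬ G.Adj a c ∧ ¬ G.Adj b d ∧ ¬ G.Adj a d ∧ sz (F k) = 5 ∧ F k s(b,c) = 1 ∧
      ∀ e, F k e = 1 → e ∈ ES G (fs o a b c d) → e = s(b,c)) ∨
    (G.Adj b d ∧ ¬ G.Adj a c ∧ ¬ G.Adj a d ∧ ∃ z, z ∉ fs o a b c d ∧ Is4 (F k) o z b d) ∨
    (G.Adj a c ∧ ¬ G.Adj b d ∧ ¬ G.Adj a d ∧ ∃ z, z ∉ fs o a b c d ∧ Is4 (F k) o z c a) := by
  have h1 : ¬ ∀ e, F k e = 1 → e ∈ ES G (fs o a b c d) := fun hh => (Finset.mem_sdiff.1 hk).2 (mem_In.2 hh)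
  push Not at h1
  obtain ⟨e', he', hn'⟩ := h1
  have h2 : cnt F (ES G (fs o a b c d)) k ≠ 0 := by
    intro h0; apply hn; rw [h0]; simp
  obtain ⟨e, he⟩ := Finset.card_ne_zero.1 h2
  rw [mem_filter] at he
  refine f.out h ?_ he.2 he.1 he' hn'
  by_contra hlt
  apply hn
  rw [wt_zero (by omega), zero_mul]

lemma Fan.alt1 {k : ι} (n1 : ¬ G.Adj a c) (n2 : ¬ G.Adj b d) (n3 : ¬ G.Adj a d) (k5 : sz (F k) = 5) (hk : F k s(b,c) = 1)
    (hu : ∀ e, F k e = 1 → e ∈ ES G (fs o a b c d) → e = s(b,c)) :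
    ∑ i ∈ univ \ In F (ES G (fs o a b c d)), wt F i * cnt F (ES G (fs o a b c d)) i ≤ 4/5 := by
  apply sum_le_one (k := k) _ (by norm_num)
  · intro j hj hne
    have h1 := f.nz h hj hne
    rcases h1 with h1 | h1 | h1
    · obtain ⟨-, -, -, j5, hj1, -⟩ := h1
      obtain ⟨i, hi⟩ := f.t2
      have s3 := hi.sz
      have hik : i ≠ k := by rintro rfl; omega
      have hij : i ≠ j := by rintro rfl; omega
      exact (h.tb.third hik hi.e2 hk hj1).resolve_left hij.symm
    · exact absurd h1.1 n2
    · exact absurd h1.1 n1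
  · have w1 : wt F k ≤ 4/5 := wt_le1 (by omega) (by omega)
    have c1 : cnt F (ES G (fs o a b c d)) k ≤ 1 := by
      have : (ES G (fs o a b c d)).filter (fun e => F k e = 1) ⊆ {s(b,c)} := by
        intro e he
        rw [mem_filter] at he
        rw [mem_singleton]; exact hu e he.2 he.1
      exact Finset.card_le_card this
    have c2 : (cnt F (ES G (fs o a b c d)) k : ℚ) ≤ 1 := by exact_mod_cast c1
    have := wt_nonneg (F := F) k
    nlinarith

lemma Fan.uniq4 {k : ι} {z : V} (h1 : G.Adj b d) (n1 : ¬ G.Adj a c) (n3 : ¬ G.Adj a d) (h4 : Is4 (F k) o z b d)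
    {j : ι} {z' : V} (h4' : Is4 (F j) o z' b d) : j = k :=
  h.s2 h4.1.2.1 h4'.e4 (fsw h4'.e3) h4.e4 (fsw h4.e3)

lemma Fan.alt2 {k : ι} {z : V} (h1 : G.Adj b d) (n1 : ¬ G.Adj a c) (n3 : ¬ G.Adj a d) (hz : z ∉ fs o a b c d) (h4 : Is4 (F k) o z b d) :
    ∑ i ∈ univ \ In F (ES G (fs o a b c d)), wt F i * cnt F (ES G (fs o a b c d)) i ≤ 4 := by
  apply sum_le_one (k := k) _ (by norm_num)
  · intro j hj hne
    rcases f.nz h hj hne with h2 | h2 | h2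
    · exact absurd h1 h2.2.1
    · obtain ⟨-, -, -, z', -, h4'⟩ := h2
      exact f.uniq4 h h1 n1 n3 h4 h4'
    · exact absurd h2.1 n1
  · have s4 := h4.sz
    have w1 : wt F k ≤ 2 := wt_le2 (by omega)
    have c1 : cnt F (ES G (fs o a b c d)) k ≤ 2 := by
      have : (ES G (fs o a b c d)).filter (fun e => F k e = 1) ⊆ {s(d,o), s(b,d)} := by
        intro e he
        rw [mem_filter] at he
        obtain ⟨hE, hF⟩ := he
        have hF := (h4.2 e).1 hF
        simp only [mem_insert, mem_singleton]
        rcases hF with rfl | rfl | rfl | rfl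
        · exact absurd (mem_ES.1 hE).2.2 hz
        · exact absurd (mem_ES.1 hE).2.1 hz
        · right; rfl
        · left; rfl
      exact (Finset.card_le_card this).trans Finset.card_le_two
    have c2 : (cnt F (ES G (fs o a b c d)) k : ℚ) ≤ 2 := by exact_mod_cast c1
    have := wt_nonneg (F := F) k
    have : (0:ℚ) ≤ cnt F (ES G (fs o a b c d)) k := by positivity
    nlinarith

lemma Fan.con3 {e : Sym2 V} (he : e ∈ G.edgeSet) (hs : ¬ sing G F e) (hq : cls G F e = ES G (fs o a b c d))
    {v w : V} (hv : v ∈ fs o a b c d) (hw : w ∉ fs o a b c d) (hvw : G.Adj v w) : DD G F v ≤ 3 := by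
  have g := f.g h
  have : ∃ x, s(v,x) ∈ cls G F e := by
    rw [hq]
    by_cases hvo : v = o
    · subst hvo
      exact ⟨a, mem_ES.2 ⟨g.oa, hv, by simp [fs]⟩⟩
    · refine ⟨o, mem_ES.2 ⟨?_, hv, by simp [fs]⟩⟩
      rcases mem_fs.1 hv with rfl | rfl | rfl | rfl | rfl
      exacts [absurd rfl hvo, g.oa.symm, g.ob.symm, g.oc.symm, g.od.symm]
  obtain ⟨x, hx⟩ := this
  refine cont3 h he hs hx hvw ?_
  rw [hq, mem_ES]
  exact fun hh => hw hh.2.2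

lemma Fan.D25 {e : Sym2 V} (he : e ∈ G.edgeSet) (hs : ¬ sing G F e) (hq : cls G F e = ES G (fs o a b c d))
    {k : ι} {z : V} (h1 : G.Adj b d) (n1 : ¬ G.Adj a c) (n3 : ¬ G.Adj a d) (hz : z ∉ fs o a b c d) (h4 : Is4 (F k) o z b d)
    {v : V} (hv : s(v,a) ∈ ES G (fs o a b c d)) (hk : F k s(v,z) = 1) (hsz : sing G F s(v,z)) : DD G F v ≤ 5/2 := by
  rw [← hq] at hv
  apply DD25 h (fun e he hs => h.sing_ge he hs) (v := v) (x := a) (cls_edge h he hv) (not_sing_of h hs hv) (h.adj hk) hsz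
  intro hall
  rw [T6.cls_eq hv, hq] at hall
  obtain ⟨m, hmk, hm⟩ := h.tb.other hk
  obtain ⟨w, hwz, hw⟩ := h.tb.face_ex2 hm
  have hwq := (hall w (h.adj hw)).resolve_left hwz
  have m6 : 6 ≤ sz (F m) := by
    by_contra hlt
    rcases f.out h (by omega) hw hwq hm (fun hh => hz (mem_ES.1 hh).2.2) with h2 | h2 | h2
    · exact h2.2.1 h1
    · obtain ⟨-, -, -, z', -, h4'⟩ := h2
      exact hmk (f.uniq4 h h1 n1 n3 h4 h4')
    · exact n1 h2.1
  rw [chg_eq h hmk.symm hk hm, wt_zero m6]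
  have s4 := h4.sz
  have := wt_le2 (F := F) (i := k) (by omega)
  linarith

lemma Fan.sz_oz {k : ι} {z : V} (h1 : G.Adj b d) (hz : z ∉ fs o a b c d) (h4 : Is4 (F k) o z b d) : sing G F s(o,z) := by
  have g := f.g h
  have hz' := hz
  rw [mem_fs] at hz'
  push Not at hz'
  obtain ⟨zo, za, zb, zc, zd⟩ := hz'
  apply sing_of h
  · intro m hm m3
    obtain ⟨y, hy⟩ := h.ex3 hm m3
    have hyX : y ∉ fs o a b c d := by
      intro hyX
      exact hz (f.closed h hyX (by simp [fs]) ⟨m, hy.rot.rot⟩)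
    rw [mem_fs] at hyX
    push Not at hyX
    obtain ⟨yo, ya, yb, yc, yd⟩ := hyX
    exact th_short h.th (h.adj hy.e3) (h.adj hy.e2).symm (h.adj h4.e2) g.bc g.cd g.od.symm (h.adj hm)
      g.ob.ne g.oc.ne yb yc yd zc zd f.nbd
  · intro o' a' b' c' d' f' hm
    obtain ⟨-, ho, hz1⟩ := mem_ES.1 hm
    have ha : a ∉ fs o' a' b' c' d' := by
      intro ha
      rw [f.inter h f' g.oa.ne (by simp [fs]) (by simp [fs]) ho ha] at hz1
      exact hz hz1
    have hb : b ∉ fs o' a' b' c' d' := by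
      intro hb
      rw [f.inter h f' g.ob.ne (by simp [fs]) (by simp [fs]) ho hb] at hz1
      exact hz hz1
    exact f'.ear3 h hz1 ho zo hb ha (h.adj h4.e2) g.ab.symm g.oa.symm

lemma Fan.sz_bz {k : ι} {z : V} (h1 : G.Adj b d) (hz : z ∉ fs o a b c d) (h4 : Is4 (F k) o z b d) : sing G F s(b,z) := by
  have g := f.g h
  have hz' := hz
  rw [mem_fs] at hz'
  push Not at hz'
  obtain ⟨zo, za, zb, zc, zd⟩ := hz'
  apply sing_of h
  · intro m hm m3
    obtain ⟨y, hy⟩ := h.ex3 hm m3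
    have hyX : y ∉ fs o a b c d := by
      intro hyX
      exact hz (f.closed h hyX (by simp [fs]) ⟨m, hy.rot.rot⟩)
    rw [mem_fs] at hyX
    push Not at hyX
    obtain ⟨yo, ya, yb, yc, yd⟩ := hyX
    exact th_short h.th (h.adj hy.e3) (h.adj hy.e2).symm (h.adj h4.e1).symm g.oc g.cd h1.symm (h.adj hm)
      g.ob.ne.symm g.bc.ne yo yc yd zc zd g.od.ne
  · intro o' a' b' c' d' f' hm
    obtain ⟨-, hb, hz1⟩ := mem_ES.1 hm
    have ha : a ∉ fs o' a' b' c' d' := by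
      intro ha
      rw [f.inter h f' g.ab.ne (by simp [fs]) (by simp [fs]) ha hb] at hz1
      exact hz hz1
    have ho : o ∉ fs o' a' b' c' d' := by
      intro ho
      rw [f.inter h f' g.ob.ne (by simp [fs]) (by simp [fs]) ho hb] at hz1
      exact hz hz1
    exact f'.ear3 h hz1 hb zb ho ha (h.adj h4.e1).symm g.oa g.ab

lemma Fan.sum5 : ∑ v ∈ fs o a b c d, DD G F v = DD G F o + (DD G F a + (DD G F b + (DD G F c + DD G F d))) := by
  have g := f.g h
  have n0 := g.oa.ne
  have n1 := g.ab.ne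
  have n2 := g.bc.ne
  have n3 := g.cd.ne
  have n4 := f.nac
  have n5 := f.nad
  have n6 := f.nbd
  have n7 := g.ob.ne
  have n8 := g.oc.ne
  have n9 := g.od.ne
  unfold fs
  rw [Finset.sum_insert, Finset.sum_insert, Finset.sum_insert, Finset.sum_insert, Finset.sum_singleton]
  all_goals simp only [mem_insert, mem_singleton]; grind

lemma Fan.D2 {e : Sym2 V} (he : e ∈ G.edgeSet) (hs : ¬ sing G F e) (hq : cls G F e = ES G (fs o a b c d))
    {k : ι} {z : V} (h1 : G.Adj b d) (n1 : ¬ G.Adj a c) (n3 : ¬ G.Adj a d) (hz : z ∉ fs o a b c d) (h4 : Is4 (F k) o z b d) :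
    ∑ v ∈ fs o a b c d, DD G F v ≤ ∑ x ∈ cls G F e, chg F x := by
  have hA : ∀ e ∈ G.edgeSet, T6.sing G F e → 31/5 ≤ chg F e := fun e he hs => h.sing_ge he hs
  have g := f.g h
  have hlow := f.low h rfl (f.alt2 h h1 n1 n3 hz h4)
  have hI := f.In_le h
  have hE := f.ES_card h
  rw [if_neg n1, if_pos h1, if_neg n3] at hE
  have hI' : ((In F (ES G (fs o a b c d))).card : ℚ) + 4 ≤ (ES G (fs o a b c d)).card := by exact_mod_cast hI
  have hE' : ((ES G (fs o a b c d)).card : ℚ) ≤ 8 := by exact_mod_cast hE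
  have hp : (0:ℚ) ≤ (((In F (ES G (fs o a b c d))).filter (fun i => sz (F i) ≠ 3)).card : ℚ) := by positivity
  have Da : DD G F a ≤ 3 := by
    obtain ⟨w, hvw, hwo, hwb⟩ := h.deg a o b
    refine f.con3 h he hs hq (v := a) (w := w) (by simp [fs]) ?_ hvw
    intro hw
    rcases mem_fs.1 hw with rfl | rfl | rfl | rfl | rfl
    exacts [hwo rfl, hvw.ne rfl, hwb rfl, n1 hvw, n3 hvw]
  have Do : DD G F o ≤ 5/2 := f.D25 h he hs hq h1 n1 n3 hz h4 (mem_ES.2 ⟨g.oa, by simp [fs], by simp [fs]⟩) h4.e1 (f.sz_oz h h1 hz h4)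
  have Db : DD G F b ≤ 5/2 := f.D25 h he hs hq h1 n1 n3 hz h4 (mem_ES.2 ⟨g.ab.symm, by simp [fs], by simp [fs]⟩) (fsw h4.e2) (f.sz_bz h h1 hz h4)
  have Dc := DD6 h hA c
  have Dd := DD6 h hA d
  rw [f.sum5 h, hq]
  linarith

/-- the bad case data -/
lemma Fan.ok1 {e : Sym2 V} (he : e ∈ G.edgeSet) (hs : ¬ sing G F e) (hq : cls G F e = ES G (fs o a b c d)) :
    ∑ v ∈ fs o a b c d, DD G F v ≤ ∑ x ∈ cls G F e, chg F x ∨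
    (∑ v ∈ fs o a b c d, DD G F v ≤ ∑ x ∈ cls G F e, chg F x + 4 ∧ (cls G F e).card = 9 ∧ (In F (cls G F e)).card = 5 ∧
      (∀ i ∈ In F (cls G F e), sz (F i) = 3) ∧
      ((G.Adj a c ∧ G.Adj b d) ∨ (G.Adj a c ∧ G.Adj a d) ∨ (G.Adj b d ∧ G.Adj a d)) ∧
      ∃ C ⊆ fs o a b c d, C.card ≤ 2 ∧ ∀ v ∈ fs o a b c d, ∀ w, w ∉ fs o a b c d → G.Adj v w → v ∈ C) := by
  set C := (fs o a b c d).filter (fun v => ∃ w, w ∉ fs o a b c d ∧ G.Adj v w) with hC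
  have hCm : ∀ v ∈ fs o a b c d, ∀ w, w ∉ fs o a b c d → G.Adj v w → v ∈ C := by
    intro v hv w hw hvw
    rw [hC, mem_filter]; exact ⟨hv, w, hw, hvw⟩
  have hCs : C ⊆ fs o a b c d := Finset.filter_subset _ _
  have hD := sum_con h hCs (fun v hv => by
    rw [hC, mem_filter] at hv
    obtain ⟨hv, w, hw, hvw⟩ := hv
    exact f.con3 h he hs hq hv hw hvw)
  rw [f.card h] at hD
  have hC2 : 2 ≤ C.card := by
    obtain ⟨v, hv, v', hv', hne, ⟨w, hw, hvw⟩, ⟨w', hw', hvw'⟩⟩ := two_con h (X := fs o a b c d) (by rw [f.card h]) (by rw [f.card h]; norm_num)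
    exact Finset.one_lt_card.2 ⟨v, hCm v hv w hw hvw, v', hCm v' hv' w' hw' hvw', hne⟩
  have hC2' : (2:ℚ) ≤ C.card := by exact_mod_cast hC2
  have hI := f.In_le h
  have hI' : ((In F (ES G (fs o a b c d))).card : ℚ) + 4 ≤ (ES G (fs o a b c d)).card := by exact_mod_cast hI
  have hE := f.ES_card h
  have hp : (0:ℚ) ≤ (((In F (ES G (fs o a b c d))).filter (fun i => sz (F i) ≠ 3)).card : ℚ) := by positivity
  by_cases hz : ∀ k ∈ univ \ In F (ES G (fs o a b c d)), wt F k * cnt F (ES G (fs o a b c d)) k = 0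
  · have hlow := f.low h rfl (Finset.sum_eq_zero hz).le
    by_cases h8 : (ES G (fs o a b c d)).card ≤ 8
    · left
      have hE' : ((ES G (fs o a b c d)).card : ℚ) ≤ 8 := by exact_mod_cast h8
      rw [hq]
      push_cast at hD
      linarith
    · have hK := f.K5 h
      have hadj : (G.Adj a c ∧ G.Adj b d) ∨ (G.Adj a c ∧ G.Adj a d) ∨ (G.Adj b d ∧ G.Adj a d) := by
        by_cases x1 : G.Adj a c <;> by_cases x2 : G.Adj b d <;> by_cases x3 : G.Adj a d <;> simp [x1, x2, x3] at hE ⊢ <;> omega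
      have h9 : (ES G (fs o a b c d)).card = 9 := by
        have : (ES G (fs o a b c d)).card ≤ 9 := by
          by_cases x1 : G.Adj a c <;> by_cases x2 : G.Adj b d <;> by_cases x3 : G.Adj a d
          · exact absurd ⟨x1, x2, x3⟩ hK
          all_goals simp only [x1, x2, x3, if_true, if_false] at hE; omega
        omega
      have h9' : ((ES G (fs o a b c d)).card : ℚ) = 9 := by exact_mod_cast h9
      push_cast at hD
      by_cases h3 : 3 ≤ C.card
      · left
        have : (3:ℚ) ≤ C.card := by exact_mod_cast h3
        rw [hq]; linarith
      by_cases h5 : (In F (ES G (fs o a b c d))).card ≤ 4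
      · left
        have : ((In F (ES G (fs o a b c d))).card : ℚ) ≤ 4 := by exact_mod_cast h5
        rw [hq]; linarith
      by_cases h1 : 1 ≤ ((In F (ES G (fs o a b c d))).filter (fun i => sz (F i) ≠ 3)).card
      · left
        have : (1:ℚ) ≤ (((In F (ES G (fs o a b c d))).filter (fun i => sz (F i) ≠ 3)).card : ℚ) := by exact_mod_cast h1
        rw [hq]; linarith
      right
      rw [hq]
      refine ⟨by linarith, h9, by omega, ?_, hadj, C, hCs, by omega, hCm⟩
      intro i hi
      by_contra h3
      apply h1
      exact Finset.card_pos.2 ⟨i, mem_filter.2 ⟨hi, h3⟩⟩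
  · left
    push Not at hz
    obtain ⟨k, hk, hne⟩ := hz
    rcases f.nz h hk hne with h2 | h2 | h2
    · obtain ⟨n1, n2, n3, k5, hk1, hu⟩ := h2
      have hlow := f.low h rfl (f.alt1 h n1 n2 n3 k5 hk1 hu)
      rw [if_neg n1, if_neg n2, if_neg n3] at hE
      have hE' : ((ES G (fs o a b c d)).card : ℚ) ≤ 7 := by exact_mod_cast hE
      rw [hq]
      push_cast at hD
      linarith
    · obtain ⟨h1, n1, n3, z, hz, h4⟩ := h2
      exact f.D2 h he hs hq h1 n1 n3 hz h4
    · obtain ⟨h1, n1, n3, z, hz, h4⟩ := h2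
      rw [← fs_rev] at hq hz ⊢
      exact f.rev.D2 h he hs hq h1.symm (fun e => n1 e.symm) (fun e => n3 e.symm) hz h4

end fan
end T6

end

section
open SimpleGraph Finset
open scoped Classical
set_option linter.unusedSectionVars false
set_option linter.unusedVariables false
set_option linter.unusedSimpArgs false
set_option linter.unnecessarySeqFocus false

namespace T6
variable {V : Type*} [Fintype V] {G : SimpleGraph V} {ι : Type} [Fintype ι] {F : ι → Ch V}

def Rigid (G : SimpleGraph V) (Q : Finset (Sym2 V)) : Prop :=
  ∀ D, Cyc G.edgeSet D → sz D ≤ 5 → ∀ e ∈ Q, D e = 1 → ∀ e', D e' = 1 → e' ∈ Q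

/-- the face `i` runs along two sides of a triangle of the class `Q`, which is separated by this triangle -/
def BadAt (G : SimpleGraph V) (F : ι → Ch V) (Q : Finset (Sym2 V)) (i : ι) : Prop :=
  Rigid G Q ∧ (∃ e, F i e = 1 ∧ e ∉ Q) ∧ ∃ a p r, a ≠ p ∧ a ≠ r ∧ p ≠ r ∧ s(a,p) ∈ Q ∧ s(a,r) ∈ Q ∧ s(p,r) ∈ Q ∧
    F i s(a,p) = 1 ∧ F i s(a,r) = 1 ∧ F i s(p,r) = 0

lemma Cyc.lp {D : Ch V} (hD : Cyc G.edgeSet D) (v : V) : D s(v,v) = 0 := by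
  by_contra hne
  exact G.loopless.irrefl v (hD.1 _ hne)

lemma Cyc.ad {D : Ch V} (hD : Cyc G.edgeSet D) {u v : V} (huv : D s(u,v) = 1) : G.Adj u v :=
  hD.1 _ (by rw [huv]; decide)

lemma Cyc.ge3 {D : Ch V} (hD : Cyc G.edgeSet D) (h0 : D ≠ 0) : 3 ≤ sz D := by
  obtain ⟨k, c, hc, _, h2⟩ := even_ge3 hD.2 h0 hD.lp
  have := hc.k3
  omega

section fan
variable (h : Cfg G F) {o a b c d : V} (f : Fan F o a b c d)
include h f

lemma Fan.rigid (hadj : (G.Adj a c ∧ G.Adj b d) ∨ (G.Adj a c ∧ G.Adj a d) ∨ (G.Adj b d ∧ G.Adj a d)) : Rigid G (ES G (fs o a b c d)) := by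
  intro D hD h5 e he hDe e' hDe'
  have e2 : ∀ {p q z : V}, p ∈ fs o a b c d → q ∈ fs o a b c d → p ≠ q → z ∉ fs o a b c d → G.Adj p z → G.Adj z q → False := by
    intro p q z hp hq hpq hz h1 h2
    rcases f.ear2 h hp hq hpq hz h1 h2 with ⟨-, n1, n2⟩ | ⟨-, n1, n2⟩
    · rcases hadj with h3 | h3 | h3
      exacts [n1 h3.1, n1 h3.1, n2 h3.2]
    · rcases hadj with h3 | h3 | h3
      exacts [n1 h3.2, n2 h3.2, n1 h3.1]
  have hD0 : D ≠ 0 := by rintro rfl; simp at hDe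
  have h3 := hD.ge3 hD0
  induction e using Sym2.ind with
  | _ u v =>
  obtain ⟨-, hu, hv⟩ := mem_ES.1 he
  have hin : ∀ {x y : V}, D s(x,y) = 1 → x ∈ fs o a b c d → y ∈ fs o a b c d → s(x,y) ∈ ES G (fs o a b c d) :=
    fun h1 h2 h3 => mem_ES.2 ⟨hD.ad h1, h2, h3⟩
  by_cases s3 : sz D = 3
  · obtain ⟨_, _, _, h'⟩ := is3_ex hD.2 hD.lp s3
    obtain ⟨w, hI⟩ := h'.at hDe
    have hw : w ∈ fs o a b c d := by
      by_contra hw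
      exact e2 hu hv hI.1.1 hw (hD.ad hI.e3) (hD.ad hI.e2).symm
    have := (hI.2 e').1 hDe'
    rcases this with rfl | rfl | rfl
    exacts [he, hin hDe' hv hw, hin hDe' hw hu]
  by_cases s4 : sz D = 4
  · obtain ⟨_, _, _, _, h'⟩ := is4_ex hD.2 hD.lp s4
    obtain ⟨w, x, hI⟩ := h'.at hDe
    obtain ⟨n1, n2, n3, n4, n5, n6⟩ := hI.1
    have a2 := hD.ad hI.e2
    have a3 := hD.ad hI.e3
    have a4 := hD.ad hI.e4
    have hwx : w ∈ fs o a b c d ∧ x ∈ fs o a b c d := by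
      by_cases hw : w ∈ fs o a b c d <;> by_cases hx : x ∈ fs o a b c d
      · exact ⟨hw, hx⟩
      · exact (e2 hw hu n2.symm hx a3 a4).elim
      · exact (e2 hv hx n5 hw a2 a3).elim
      · exact (f.ear3 h hv hu n1.symm hw hx a2 a3 a4).elim
    obtain ⟨hw, hx⟩ := hwx
    have := (hI.2 e').1 hDe'
    rcases this with rfl | rfl | rfl | rfl
    exacts [he, hin hDe' hv hw, hin hDe' hw hx, hin hDe' hx hu]
  · obtain ⟨_, _, _, _, _, h'⟩ := is5_ex hD.2 hD.lp (by omega)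
    obtain ⟨w, x, y, hI⟩ := h'.at hDe
    obtain ⟨n1, n2, n3, n4, n5, n6, n7, n8, n9, n10⟩ := hI.1
    have a1 := hD.ad hI.e1
    have a2 := hD.ad hI.e2
    have a3 := hD.ad hI.e3
    have a4 := hD.ad hI.e4
    have a5 := hD.ad hI.e5
    have hwx : w ∈ fs o a b c d ∧ x ∈ fs o a b c d ∧ y ∈ fs o a b c d := by
      by_cases hw : w ∈ fs o a b c d <;> by_cases hx : x ∈ fs o a b c d <;> by_cases hy : y ∈ fs o a b c d
      · exact ⟨hw, hx, hy⟩
      · exact (e2 hx hu n3.symm hy a4 a5).elim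
      · exact (e2 hw hy n9 hx a3 a4).elim
      · exact (f.ear3 h hw hu n2.symm hx hy a3 a4 a5).elim
      · exact (e2 hv hx n6 hw a2 a3).elim
      · exact (e2 hv hx n6 hw a2 a3).elim
      · exact (f.ear3 h hv hy n7 hw hx a2 a3 a4).elim
      · exact (f.ear4 h hv hu a1.symm hw hx hy a2 a3 a4 a5 n9).elim
    obtain ⟨hw, hx, hy⟩ := hwx
    have := (hI.2 e').1 hDe'
    rcases this with rfl | rfl | rfl | rfl | rfl
    exacts [he, hin hDe' hv hw, hin hDe' hw hx, hin hDe' hx hy, hin hDe' hy hu]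

lemma Fan.bad (h9 : (ES G (fs o a b c d)).card = 9) (h5 : (In F (ES G (fs o a b c d))).card = 5)
    (ht : ∀ i ∈ In F (ES G (fs o a b c d)), sz (F i) = 3)
    (hadj : (G.Adj a c ∧ G.Adj b d) ∨ (G.Adj a c ∧ G.Adj a d) ∨ (G.Adj b d ∧ G.Adj a d))
    {C : Finset V} (hC2 : C.card ≤ 2)
    (hC : ∀ v ∈ fs o a b c d, ∀ w, w ∉ fs o a b c d → G.Adj v w → v ∈ C) : ∃ i, BadAt G F (ES G (fs o a b c d)) i := by
  have hrig := f.rigid h hadj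
  obtain ⟨i0, hi0⟩ := f.outface h
  have hmem : ∀ u v, s(u,v) ∈ ES G (fs o a b c d) ↔ G.Adj u v ∧ u ∈ fs o a b c d ∧ v ∈ fs o a b c d := fun u v => mem_ES
  have hedge : ∀ e ∈ ES G (fs o a b c d), e ∈ G.edgeSet := by
    intro e he
    induction e using Sym2.ind with
    | _ u v => exact (mem_ES.1 he).1
  set q := ES G (fs o a b c d) with hq
  set X := fs o a b c d with hX
  set Z : Ch V := ∑ i ∈ In F q, F i with hZ
  have hbZ : bd Z = 0 := by
    rw [hZ, map_sum]
    exact Finset.sum_eq_zero (fun i _ => (h.tb.cyc i).2)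
  have hZq : ∀ e, Z e = 1 → e ∈ q := by
    intro e he
    by_contra hne
    rw [hZ, Finset.sum_apply, Finset.sum_eq_zero] at he
    · exact absurd he (by decide)
    · intro i hi
      rcases z2 (F i e) with h0 | h1
      · exact h0
      · exact absurd (mem_In.1 hi e h1) hne
  have hZc : Cyc G.edgeSet Z := ⟨fun e he => hedge e (hZq e (z2_ne he)), hbZ⟩
  have hZ0 : Z ≠ 0 := by
    intro h0
    obtain ⟨j, hj⟩ : (In F q).Nonempty := Finset.card_pos.1 (by omega)
    have := h.tb.F3 h.tc (fun i => if i ∈ In F q then 1 else 0) (by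
      rw [← h0, hZ]
      rw [← Finset.sum_subset (Finset.subset_univ (In F q))]
      · apply Finset.sum_congr rfl
        intro i hi; simp [hi]
      · intro i _ hi; simp [hi]) j i0
    simp only [hj, hi0, if_true, if_false] at this
    exact absurd this (by decide)
  have hZ3 := hZc.ge3 hZ0
  -- counting
  set n : Sym2 V → ℕ := fun e => ((In F q).filter (fun i => F i e = 1)).card with hn
  have hnZ : ∀ e, Z e = (n e : ZMod 2) := by
    intro e
    rw [hZ, Finset.sum_apply, hn]
    simp only
    rw [Finset.card_filter, Nat.cast_sum]
    apply Finset.sum_congr rfl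
    intro i _
    rcases z2 (F i e) with h0 | h1
    · rw [h0]; simp
    · rw [h1]; simp
  have hn2 : ∀ e ∈ q, n e + (if Z e = 1 then 1 else 0) ≤ 2 := by
    intro e he
    obtain ⟨i, j, hij, hi, hj, hk⟩ := h.tb.two e (hedge e he)
    have hle : n e ≤ 2 := by
      have : (In F q).filter (fun i => F i e = 1) ⊆ {i, j} := by
        intro k hk
        rw [mem_filter] at hk
        simp only [mem_insert, mem_singleton]
        exact h.tb.third hij hi hj hk.2
      exact (Finset.card_le_card this).trans Finset.card_le_two
    split_ifs with h1
    · have : n e ≠ 2 := by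
        intro h2
        rw [hnZ, h2] at h1
        exact absurd h1 (by decide)
      omega
    · omega
  have hsn : ∑ e ∈ q, n e = 15 := by
    have h1 : ∑ e ∈ q, n e = ∑ i ∈ In F q, sz (F i) := by
      rw [hn]
      simp only [Finset.card_filter]
      rw [Finset.sum_comm]
      apply Finset.sum_congr rfl
      intro i hi
      rw [← Finset.card_filter]
      exact cnt_In hi
    rw [h1, Finset.sum_congr rfl ht, Finset.sum_const, h5]; rfl
  have hsZ : ∑ e ∈ q, (if Z e = 1 then 1 else 0) = sz Z := by
    rw [← Finset.card_filter]
    unfold sz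
    congr 1
    ext e
    simp only [mem_filter, mem_univ, true_and, and_iff_right_iff_imp]
    exact hZq e
  have hsum : ∑ e ∈ q, (n e + (if Z e = 1 then 1 else 0)) = 15 + sz Z := by
    rw [Finset.sum_add_distrib, hsn, hsZ]
  have hs18 : ∑ e ∈ q, 2 = 18 := by rw [Finset.sum_const, h9]; rfl
  have hle18 := Finset.sum_le_sum hn2
  have hsz3 : sz Z = 3 := by omega
  have heq : ∀ e ∈ q, n e + (if Z e = 1 then 1 else 0) = 2 := by
    apply (Finset.sum_eq_sum_iff_of_le hn2).1
    omega
  have hA : ∀ e ∈ q, Z e ≠ 1 → ∀ k, F k e = 1 → k ∈ In F q := by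
    intro e he h1 k hk
    have h2 := heq e he
    rw [if_neg h1] at h2
    obtain ⟨i, j, hij, hi, hj, -⟩ := h.tb.two e (hedge e he)
    obtain ⟨i', hi', j', hj', hij'⟩ := Finset.one_lt_card.1 (show 1 < ((In F q).filter (fun i => F i e = 1)).card by
      change n e + 0 = 2 at h2
      change 1 < n e
      omega)
    rw [mem_filter] at hi' hj'
    rcases h.tb.third hij' hi'.2 hj'.2 hk with rfl | rfl
    exacts [hi'.1, hj'.1]
  have hB : ∀ e ∈ q, Z e = 1 → ∃ k, F k e = 1 ∧ k ∉ In F q := by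
    intro e he h1
    by_contra hh; push Not at hh
    obtain ⟨i, j, hij, hi, hj, -⟩ := h.tb.two e (hedge e he)
    have h2 := heq e he
    rw [if_pos h1] at h2
    have : ({i, j} : Finset ι) ⊆ (In F q).filter (fun i => F i e = 1) := by
      intro k hk
      simp only [mem_insert, mem_singleton] at hk
      rw [mem_filter]
      rcases hk with rfl | rfl
      exacts [⟨hh _ hi, hi⟩, ⟨hh _ hj, hj⟩]
    have h3 := Finset.card_le_card this
    rw [Finset.card_pair hij] at h3
    change n e + 1 = 2 at h2
    change 2 ≤ n e at h3
    omega
  obtain ⟨p, r, t, hI⟩ := is3_ex hbZ hZc.lp hsz3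
  -- a non-contact vertex
  have hnc : ∃ a' p' r', Is3 Z a' p' r' ∧ ∀ w, G.Adj a' w → w ∈ X := by
    have hno : ∀ v ∈ X, v ∉ C → ∀ w, G.Adj v w → w ∈ X := by
      intro v hv hvC w hvw
      by_contra hw
      exact hvC (hC v hv w hw hvw)
    have m1 := (hmem _ _).1 (hZq _ hI.e1)
    have m2 := (hmem _ _).1 (hZq _ hI.e2)
    by_cases c1 : p ∈ C
    · by_cases c2 : r ∈ C
      · by_cases c3 : t ∈ C
        · exfalso
          have hsub : ({p, r, t} : Finset V) ⊆ C := by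
            intro x hx
            simp only [mem_insert, mem_singleton] at hx
            rcases hx with rfl | rfl | rfl
            exacts [c1, c2, c3]
          have h1 := Finset.card_le_card hsub
          rw [Finset.card_eq_three.2 ⟨p, r, t, hI.1.1, hI.1.2.1, hI.1.2.2, rfl⟩] at h1
          omega
        · exact ⟨t, p, r, hI.rot.rot, hno t m2.2.2 c3⟩
      · exact ⟨r, t, p, hI.rot, hno r m1.2.2 c2⟩
    · exact ⟨p, r, t, hI, hno p m1.2.1 c1⟩
  obtain ⟨a', p', r', hI, hnb⟩ := hnc
  obtain ⟨i, hi, hin⟩ := hB _ (hZq _ hI.e1) hI.e1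
  have hout : ∃ e, F i e = 1 ∧ e ∉ q := by
    by_contra hh; push Not at hh
    exact hin (mem_In.2 hh)
  obtain ⟨w, hwp, hw⟩ := h.tb.face_ex2 hi
  have hwr : w = r' := by
    have m := (hmem a' w).2 ⟨h.adj hw, ((hmem _ _).1 (hZq _ hI.e1)).2.1, hnb w (h.adj hw)⟩
    have hZw : Z s(a',w) = 1 := by
      by_contra hne
      exact hin (hA _ m hne i hw)
    have := (hI.2 _).1 hZw
    obtain ⟨n1, n2, n3⟩ := hI.1
    simp only [Sym2.eq_iff] at this
    grind
  subst hwr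
  refine ⟨i, hrig, hout, a', p', w, hI.1.1, hI.1.2.1, hI.1.2.2, hZq _ hI.e1, hZq _ hI.e3, hZq _ hI.e2, hi, hw, ?_⟩
  rcases z2 (F i s(p',w)) with h0 | h1
  · exact h0
  · exfalso
    have := h.tb.min h.tc i Z hbZ hZ0 (by
      intro e he
      rcases (hI.2 e).1 he with rfl | rfl | rfl
      exacts [hi, h1, fsw hw])
    obtain ⟨e, he, hne⟩ := hout
    rw [← this] at he
    exact hne (hZq e he)

end fan
end T6

end

section
open SimpleGraph Finset
open scoped Classical
set_option linter.unusedSectionVars false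
set_option linter.unusedVariables false
set_option linter.unusedSimpArgs false
set_option linter.unnecessarySeqFocus false

namespace T6
variable {V : Type*} [Fintype V] {G : SimpleGraph V} {ι : Type} [Fintype ι] {F : ι → Ch V}

lemma tri_flip {D : Ch V} (hD : Cyc G.edgeSet D) {a p r : V} (h1 : a ≠ p) (h2 : a ≠ r) (h3 : p ≠ r) (ap : D s(a,p) = 1) (ar : D s(a,r) = 1)
    (pr : D s(p,r) = 0) (hadj : G.Adj p r) :
    ∃ D', Cyc G.edgeSet D' ∧ sz D' + 1 ≤ sz D ∧ D' s(p,r) = 1 ∧ ∀ e, e ≠ s(a,p) → e ≠ s(a,r) → e ≠ s(p,r) → D' e = D e := by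
  have hI := is3_mk h1 h2 h3
  have hc := cyc_tri (hD.ad ap) (hD.ad ar) hadj
  set T : Ch V := dl s(a,p) + dl s(p,r) + dl s(r,a) with hT
  have hv : ∀ e, e ≠ s(a,p) → e ≠ s(a,r) → e ≠ s(p,r) → (D + T) e = D e := by
    intro e n1 n2 n3
    rw [Pi.add_apply]
    rcases z2 (T e) with h0 | h1
    · rw [h0, add_zero]
    · exfalso
      rcases (hI.2 e).1 h1 with e1 | e1 | e1
      exacts [n1 e1, n3 e1, n2 (e1.trans Sym2.eq_swap)]
  have v1 : (D + T) s(a,p) = 0 := by rw [Pi.add_apply, ap, hI.e1]; decide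
  have v2 : (D + T) s(a,r) = 0 := by rw [Pi.add_apply, ar, hI.e3]; decide
  refine ⟨D + T, hD.add hc, ?_, ?_, hv⟩
  · have hne : s(a,p) ≠ s(a,r) := by
      intro e; rw [Sym2.eq_iff] at e; grind
    have hsub : univ.filter (fun e => (D + T) e = 1) ⊆ insert s(p,r) (((univ.filter (fun e => D e = 1)).erase s(a,p)).erase s(a,r)) := by
      intro e he
      simp only [mem_filter, mem_univ, true_and] at he
      simp only [mem_insert, mem_erase, mem_filter, mem_univ, true_and]
      by_cases e3 : e = s(p,r)
      · left; exact e3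
      right
      have e1 : e ≠ s(a,p) := by rintro rfl; rw [v1] at he; exact absurd he (by decide)
      have e2 : e ≠ s(a,r) := by rintro rfl; rw [v2] at he; exact absurd he (by decide)
      refine ⟨e2, e1, ?_⟩
      rw [← hv e e1 e2 e3]; exact he
    have := (Finset.card_le_card hsub).trans (Finset.card_insert_le _ _)
    rw [Finset.card_erase_of_mem (by simp [hne.symm, ar]), Finset.card_erase_of_mem (by simp [ap])] at this
    have h2 : 2 ≤ sz D := by
      refine Finset.one_lt_card.2 ⟨s(a,p), by simp [ap], s(a,r), by simp [ar], hne⟩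
    unfold sz at *
    omega
  · rw [Pi.add_apply, pr, hI.e2]; decide

section fin
variable (h : Cfg G F)
include h

lemma Kn_disj {q q' : Finset (Sym2 V)} (hq : q ∈ Kn G F) (hq' : q' ∈ Kn G F) {e : Sym2 V} (he : e ∈ q) (he' : e ∈ q') : q = q' := by
  unfold Kn at hq hq'
  rw [Finset.mem_image] at hq hq'
  obtain ⟨x, -, rfl⟩ := hq
  obtain ⟨y, -, rfl⟩ := hq'
  rw [← cls_eq he, ← cls_eq he']

lemma Kn_edge {q : Finset (Sym2 V)} (hq : q ∈ Kn G F) {e : Sym2 V} (he : e ∈ q) : e ∈ G.edgeSet := by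
  unfold Kn at hq
  rw [Finset.mem_image] at hq
  obtain ⟨x, hx, rfl⟩ := hq
  simp only [mem_filter, mem_univ, true_and] at hx
  exact cls_edge h hx.1 he

lemma bad_flip (i : ι) (B : Finset (Finset (Sym2 V))) (hB : ∀ Q ∈ B, Q ∈ Kn G F ∧ BadAt G F Q i) :
    ∃ D, Cyc G.edgeSet D ∧ sz D + B.card ≤ sz (F i) ∧ (∀ e, (∀ Q ∈ B, e ∉ Q) → D e = F i e) ∧ ∀ Q ∈ B, ∃ e ∈ Q, D e = 1 := by
  induction B using Finset.induction_on with
  | empty => exact ⟨F i, h.tb.cyc i, by simp, by simp, by simp⟩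
  | insert Q B hQ ih =>
    obtain ⟨D, hD, hs, hv, hp⟩ := ih (fun Q hQ => hB Q (mem_insert_of_mem hQ))
    obtain ⟨hK, -, -, a, p, r, n1, n2, n3, m1, m2, m3, f1, f2, f3⟩ := hB Q (mem_insert_self _ _)
    have hdis : ∀ Q' ∈ B, ∀ e ∈ Q, e ∉ Q' := by
      intro Q' hQ' e he he'
      have := Kn_disj h hK (hB Q' (mem_insert_of_mem hQ')).1 he he'
      subst this
      exact hQ hQ'
    have hval : ∀ e ∈ Q, D e = F i e := fun e he => hv e (fun Q' hQ' => hdis Q' hQ' e he)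
    obtain ⟨D', hD', hs', hpr, hv'⟩ := tri_flip hD n1 n2 n3 (by rw [hval _ m1, f1]) (by rw [hval _ m2, f2]) (by rw [hval _ m3, f3])
      (Kn_edge h hK m3)
    have hoff : ∀ e, e ∉ Q → D' e = D e := by
      intro e he
      apply hv'
      · rintro rfl; exact he m1
      · rintro rfl; exact he m2
      · rintro rfl; exact he m3
    refine ⟨D', hD', ?_, ?_, ?_⟩
    · rw [Finset.card_insert_of_notMem hQ]; omega
    · intro e he
      rw [hoff e (he Q (mem_insert_self _ _))]
      exact hv e (fun Q' hQ' => he Q' (mem_insert_of_mem hQ'))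
    · intro Q' hQ'
      rcases mem_insert.1 hQ' with rfl | hQ'
      · exact ⟨_, m3, hpr⟩
      · obtain ⟨e, he, hDe⟩ := hp Q' hQ'
        refine ⟨e, he, ?_⟩
        rw [hoff e (fun hh => hdis Q' hQ' e hh he)]; exact hDe

noncomputable def bj (G : SimpleGraph V) (F : ι → Ch V) (i : ι) : ℕ := ((Kn G F).filter (fun Q => BadAt G F Q i)).card

lemma bad_size (i : ι) (hj : bj G F i ≠ 0) : 6 + bj G F i ≤ sz (F i) := by
  obtain ⟨D, hD, hs, hv, hp⟩ := bad_flip h i ((Kn G F).filter (fun Q => BadAt G F Q i)) (by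
    intro Q hQ; exact mem_filter.1 hQ)
  change sz D + bj G F i ≤ sz (F i) at hs
  obtain ⟨Q0, hQ0⟩ := Finset.card_ne_zero.1 hj
  by_contra hlt
  have h5 : sz D ≤ 5 := by omega
  obtain ⟨hK0, hR, ⟨e, he, heQ⟩, -⟩ := mem_filter.1 hQ0
  obtain ⟨e0, he0, hDe0⟩ := hp Q0 hQ0
  have hall := hR D hD h5 e0 he0 hDe0
  by_cases hex : ∃ Q1 ∈ (Kn G F).filter (fun Q => BadAt G F Q i), e ∈ Q1
  · obtain ⟨Q1, hQ1, he1⟩ := hex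
    obtain ⟨e1, he1', hDe1⟩ := hp Q1 hQ1
    have := Kn_disj h hK0 (mem_filter.1 hQ1).1 (hall e1 hDe1) he1'
    subst this
    exact heQ he1
  · push Not at hex
    exact heQ (hall e (by rw [hv e hex, he]))

lemma class_ok {q : Finset (Sym2 V)} (hq : q ∈ Kn G F) :
    ∑ v ∈ univ.filter (fun v => tch q v), DD G F v ≤ ∑ e ∈ q, chg F e + ∑ i, if BadAt G F q i then (4:ℚ) else 0 := by
  unfold Kn at hq
  rw [Finset.mem_image] at hq
  obtain ⟨e, hx, rfl⟩ := hq
  simp only [mem_filter, mem_univ, true_and] at hx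
  obtain ⟨he, hs⟩ := hx
  have hx0 : (0:ℚ) ≤ ∑ i, if BadAt G F (cls G F e) i then (4:ℚ) else 0 := by
    apply Finset.sum_nonneg
    intro i _
    split_ifs <;> norm_num
  rcases classify h he hs with ⟨o, a, b, c, d, f, hq⟩ | ⟨nf, ⟨i, a, b, c, T⟩ | ⟨i, j, a, b, c, d, T⟩ | ⟨i, j, l, o, a, b, c, T⟩⟩
  · have s1 := sum_tch h (q := cls G F e) (X := fs o a b c d) (by
      intro x hx v hv
      rw [hq] at hx
      induction x using Sym2.ind with
      | _ u w =>
      rw [Sym2.mem_iff] at hv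
      rcases hv with rfl | rfl
      exacts [(mem_ES.1 hx).2.1, (mem_ES.1 hx).2.2])
    rcases f.ok1 h he hs hq with h1 | ⟨h1, h9, h5, ht, hadj, C, hCs, hC2, hC⟩
    · linarith
    · rw [hq] at h9 h5 ht
      obtain ⟨i, hi⟩ := f.bad h h9 h5 ht hadj hC2 hC
      rw [← hq] at hi
      have : (4:ℚ) ≤ ∑ i, if BadAt G F (cls G F e) i then (4:ℚ) else 0 := by
        have h2 := Finset.single_le_sum (f := fun i => if BadAt G F (cls G F e) i then (4:ℚ) else 0) (s := univ)
          (fun i _ => by split_ifs <;> norm_num) (mem_univ i)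
        simp only [if_pos hi] at h2
        exact h2
      linarith
  · have := K3_ok h he hs T
    linarith
  · have := Km_ok h he hs nf T
    linarith
  · have := K4_ok h he hs T
    linarith

lemma face_ok (i : ι) : 4 * (6 - (sz (F i) : ℚ)) ≤ wt F i * sz (F i) - 4 * bj G F i := by
  have h3 := h.tb.sz3 i
  by_cases hj : bj G F i = 0
  · rw [hj]
    unfold wt
    by_cases s3 : sz (F i) = 3
    · rw [if_pos s3, s3]; norm_num
    by_cases s4 : sz (F i) = 4
    · rw [if_neg s3, if_pos s4, s4]; norm_num
    by_cases s5 : sz (F i) = 5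
    · rw [if_neg s3, if_neg s4, if_pos s5, s5]; norm_num
    · rw [if_neg s3, if_neg s4, if_neg s5]
      have : (6:ℚ) ≤ sz (F i) := by
        have : 6 ≤ sz (F i) := by omega
        exact_mod_cast this
      push_cast; linarith
  · have hb := bad_size h i hj
    rw [wt_zero (by omega)]
    have : (6:ℚ) + bj G F i ≤ sz (F i) := by exact_mod_cast hb
    linarith

lemma In_all (i : ι) : i ∈ In F G.edgeFinset := by
  rw [mem_In]
  intro e he
  rw [SimpleGraph.mem_edgeFinset]
  exact (h.tb.cyc i).1 e (by rw [he]; decide)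

lemma sum_sz : ∑ i, sz (F i) = 2 * G.edgeFinset.card := by
  have h1 : ∑ i, sz (F i) = ∑ i, ∑ e ∈ G.edgeFinset, if F i e = 1 then 1 else 0 := by
    apply Finset.sum_congr rfl
    intro i _
    rw [← Finset.card_filter, ← cnt_In (In_all h i)]
    rfl
  rw [h1, Finset.sum_comm]
  have : ∀ e ∈ G.edgeFinset, (∑ i, if F i e = 1 then 1 else 0) = 2 := by
    intro e he
    rw [SimpleGraph.mem_edgeFinset] at he
    obtain ⟨i, j, hij, hi, hj, hk⟩ := h.tb.two e he
    rw [← Finset.card_filter]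
    refine Eq.trans ?_ (Finset.card_pair hij)
    congr 1
    ext k
    simp only [mem_filter, mem_univ, true_and, mem_insert, mem_singleton]
    constructor
    · exact fun hk => h.tb.third hij hi hj hk
    · rintro (rfl | rfl)
      exacts [hi, hj]
  rw [Finset.sum_congr rfl this, Finset.sum_const, smul_eq_mul, mul_comm]

lemma final_bound : 7 * (G.edgeFinset.card : ℚ) ≤ 18 * Fintype.card V - 48 := by
  have hg := global_count h (fun e he hs => h.sing_ge he hs) (fun q => ∑ i, if BadAt G F q i then (4:ℚ) else 0) (fun q hq => class_ok h hq)
  have hx : ∑ q ∈ Kn G F, ∑ i, (if BadAt G F q i then (4:ℚ) else 0) = ∑ i, 4 * (bj G F i : ℚ) := by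
    rw [Finset.sum_comm]
    apply Finset.sum_congr rfl
    intro i _
    rw [← Finset.sum_filter, Finset.sum_const, nsmul_eq_mul, mul_comm]
    rfl
  rw [hx, sum_chg] at hg
  have hc : ∑ i, wt F i * (cnt F G.edgeFinset i : ℚ) = ∑ i, wt F i * (sz (F i) : ℚ) :=
    Finset.sum_congr rfl (fun i _ => by rw [cnt_In (In_all h i)])
  rw [hc] at hg
  have hf := Finset.sum_le_sum (fun i (_ : i ∈ (univ : Finset ι)) => face_ok h i)
  rw [Finset.sum_sub_distrib, ← Finset.mul_sum, Finset.sum_sub_distrib, Finset.sum_const, Finset.card_univ, nsmul_eq_mul] at hf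
  have hsz : ∑ i, (sz (F i) : ℚ) = 2 * G.edgeFinset.card := by exact_mod_cast sum_sz h
  rw [hsz] at hf
  have hi0 : ∃ i : ι, True := by
    have : 0 < Fintype.card V := by have := h.n6; omega
    obtain ⟨v⟩ := Fintype.card_pos_iff.1 this
    obtain ⟨w, hw, -, -⟩ := h.deg v v v
    obtain ⟨i, -⟩ := h.tb.two s(v,w) hw
    exact ⟨i, trivial⟩
  obtain ⟨i0, -⟩ := hi0
  have he := h.tb.euler i0
  have he' : (G.edgeFinset.card : ℚ) + 2 ≤ Fintype.card ι + Fintype.card V := by exact_mod_cast he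
  linarith

lemma final_bound' : 7 * (G.edgeSet.ncard : ℚ) ≤ 18 * Fintype.card V - 48 := by
  have hb := final_bound h
  have : G.edgeSet.ncard = G.edgeFinset.card := by
    rw [← SimpleGraph.coe_edgeFinset, Set.ncard_coe_finset]
  rw [this]
  exact hb

end fin

end T6

end

/-- Every `n`-vertex (`n ≥ 6`) planar, 2-connected graph with minimum degree at
least 3 containing no Theta graph on 6 vertices has at most `18n/7 - 48/7` edges. -/
theorem theta6_two_connected_bound {V : Type*} [Fintype V] (n : ℕ)
    (G : SimpleGraph V) (hcard : Fintype.card V = n) (hn : 6 ≤ n)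
    (hplanar : IsPlanar G) (h2conn : IsTwoConnected G)
    (hdeg : ∀ v : V, 3 ≤ (G.neighborSet v).ncard)
    (hfree : ¬ HasTheta6 G) :
    (G.edgeSet.ncard : ℚ) ≤ 18 / 7 * n - 48 / 7 := by
  subst hcard
  obtain ⟨ι, _, F, h⟩ := T6.cfg_exists hn hplanar h2conn hdeg hfree
  have hb := T6.final_bound' h
  linarith
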